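/- Let G = (V,E) be a finite simple graph with n = |V| ≥ 3 vertices admitting an IC-planar straight-line drawing. Then there exist an edge set E⁺ ⊇ E and an IC-planar straight-line drawing ρ of G⁺ = (V,E⁺) such that: (c1) for every pair of edges {a,d} and {b,c} that cross in ρ, all six edges on the four vertices {a,b,c,d} belong to E⁺, the four edges {a,b},{b,d},{d,c},{c,a} cross no edge of E⁺ in ρ, and {a,d},{b,c} cross only each other (the endpoints of each crossing pair induce a kite); (c2) the convex hull of {ρ(a),ρ(b),ρ(c),ρ(d)} contains the image of no vertex other than a,b,c,d (each kite is empty); (c3) there is a set C* ⊆ E⁺ containing exactly one edge from each crossing pair such that in ρ no two edges of E⁺ \ C* cross and |E⁺ \ C*| = 3n − 6 (so that E⁺ minus one edge per crossing is a triangulated planar graph); and (c4) there are three vertices forming a 3-cycle in G⁺ none of whose three edges is crossed in ρ, such that the triangle spanned by their images contains all vertex images. -/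

import Mathlib

/-- The open straight-line segment representing an edge (an unordered pair of
vertices) in a straight-line drawing `ρ`. -/
def edgeSeg {V : Type*} (ρ : V → ℝ × ℝ) : Sym2 V → Set (ℝ × ℝ) :=
  Sym2.lift ⟨fun u v => openSegment ℝ (ρ u) (ρ v),
    fun u v => openSegment_symm ℝ (ρ u) (ρ v)⟩

/-- Two edges *cross* in the drawing `ρ`: they share no endpoint and
their open segments meet. -/
def Crosses {V : Type*} (ρ : V → ℝ × ℝ) (e f : Sym2 V) : Prop :=
  (∀ v : V, v ∈ e → v ∉ f) ∧ (edgeSeg ρ e ∩ edgeSeg ρ f).Nonempty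

/-- `ρ` is a straight-line drawing of the simple graph `G`. -/
structure IsStraightLineDrawing {V : Type*} (G : SimpleGraph V) (ρ : V → ℝ × ℝ) : Prop where
  inj : Function.Injective ρ
  no_vertex_on_edge : ∀ e ∈ G.edgeSet, ∀ v : V, v ∉ e → ρ v ∉ edgeSeg ρ e
  meet_at_most_once : ∀ e ∈ G.edgeSet, ∀ f ∈ G.edgeSet, (∀ v : V, v ∈ e → v ∉ f) →
    (edgeSeg ρ e ∩ edgeSeg ρ f).Subsingleton

/-- `ρ` is an IC-planar straight-line drawing of `G`: it is a straight-line drawing,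
each edge crosses at most one other edge, and the crossed edges form a matching. -/
def IsICPlanarDrawing {V : Type*} (G : SimpleGraph V) (ρ : V → ℝ × ℝ) : Prop :=
  IsStraightLineDrawing G ρ ∧
  (∀ e ∈ G.edgeSet, ∀ f ∈ G.edgeSet, ∀ g ∈ G.edgeSet,
    Crosses ρ e f → Crosses ρ e g → f = g) ∧
  (∀ e ∈ G.edgeSet, ∀ f ∈ G.edgeSet,
    (∃ e' ∈ G.edgeSet, Crosses ρ e e') → (∃ f' ∈ G.edgeSet, Crosses ρ f f') →
    e ≠ f → ∀ v : V, v ∈ e → v ∉ f)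

/-- All vertices are placed at integer coordinates. -/
def IsGridDrawing {V : Type*} (ρ : V → ℝ × ℝ) : Prop :=
  ∀ v : V, ∃ a b : ℤ, ρ v = ((a : ℝ), (b : ℝ))

/-- `ρ` is a RAC drawing of `G`: any two crossing edges are perpendicular. -/
def IsRACDrawing {V : Type*} (G : SimpleGraph V) (ρ : V → ℝ × ℝ) : Prop :=
  ∀ e ∈ G.edgeSet, ∀ f ∈ G.edgeSet, Crosses ρ e f →
    ∀ a b c d : V, e = s(a, b) → f = s(c, d) →
      ((ρ b).1 - (ρ a).1) * ((ρ d).1 - (ρ c).1)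
        + ((ρ b).2 - (ρ a).2) * ((ρ d).2 - (ρ c).2) = 0


set_option linter.all false
noncomputable section
set_option maxHeartbeats 1000000
open Classical Filter Topology

namespace ICP

/-! ### Part 0: basic definitions -/

/-- cross product -/
def crs (u v : ℝ × ℝ) : ℝ := u.1 * v.2 - u.2 * v.1

/-- orientation of three points -/
def ori (p q r : ℝ × ℝ) : ℝ := (q.1 - p.1) * (r.2 - p.2) - (q.2 - p.2) * (r.1 - p.1)

theorem ori_rot (p q r : ℝ × ℝ) : ori q r p = ori p q r := by unfold ori; ring
theorem ori_rot' (p q r : ℝ × ℝ) : ori r p q = ori p q r := by unfold ori; ring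
theorem ori_swap (p q r : ℝ × ℝ) : ori q p r = - ori p q r := by unfold ori; ring
theorem ori_swap' (p q r : ℝ × ℝ) : ori p r q = - ori p q r := by unfold ori; ring
theorem ori_add (a b c p : ℝ × ℝ) : ori a b p + ori b c p + ori c a p = ori a b c := by
  unfold ori; ring
theorem ori_bary (a b c p : ℝ × ℝ) (f : ℝ × ℝ → ℝ) (hf : f = Prod.fst ∨ f = Prod.snd) :
    ori b c p * (f a - f p) + ori c a p * (f b - f p) + ori a b p * (f c - f p) = 0 := by
  rcases hf with rfl | rfl <;> (unfold ori; ring)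
theorem ori_self1 (a b : ℝ × ℝ) : ori a b a = 0 := by unfold ori; ring
theorem ori_self2 (a b : ℝ × ℝ) : ori a b b = 0 := by unfold ori; ring
theorem ori_self3 (a b : ℝ × ℝ) : ori a a b = 0 := by unfold ori; ring

/-- combinatorial closed surface made of oriented triangles -/
structure CS {W : Type} (S : Finset (W × W × W)) : Prop where
  rot : ∀ a b c, (a, b, c) ∈ S → (b, c, a) ∈ S
  uniq : ∀ a b c c', (a, b, c) ∈ S → (a, b, c') ∈ S → c = c'
  adj : ∀ a b c, (a, b, c) ∈ S → ∃ c', (b, a, c') ∈ S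

/-- realised combinatorial sphere with outer triangle `A B C` -/
structure RS {W : Type} (S : Finset (W × W × W)) (A B C : W) (P : W → ℝ × ℝ) : Prop extends CS S where
  out : (C, B, A) ∈ S
  pos : 0 < ori (P A) (P B) (P C)
  inn : ∀ a b c, (a, b, c) ∈ S → 0 < ori (P a) (P b) (P c) ∨ (a, b, c) = (C, B, A) ∨
    (a, b, c) = (B, A, C) ∨ (a, b, c) = (A, C, B)

/-- edge relation -/
def Ed {W : Type} (S : Finset (W × W × W)) (a b : W) : Prop := ∃ c, (a, b, c) ∈ S
/-- vertex relation -/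
def Sp {W : Type} (S : Finset (W × W × W)) (v : W) : Prop := ∃ b c, (v, b, c) ∈ S

section comb
variable {W : Type} {S : Finset (W × W × W)}

theorem anti {M : Type} [AddCommGroup M] (R : Finset (W × W × W))
    (hu : ∀ a b c c', (a, b, c) ∈ R → (a, b, c') ∈ R → c = c')
    (ha : ∀ a b c, (a, b, c) ∈ R → ∃ c', (b, a, c') ∈ R)
    (φ : W → W → M) (hφ : ∀ a b, φ a b + φ b a = 0) (hφ0 : ∀ a, φ a a = 0) :
    ∑ t ∈ R, φ t.1 t.2.1 = 0 := by
  have h1 : ∀ t ∈ R, ∃ c', (t.2.1, t.1, c') ∈ R := fun t ht => ha t.1 t.2.1 t.2.2 ht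
  choose g hg using h1
  refine Finset.sum_involution (fun t ht => (t.2.1, t.1, g t ht)) ?_ ?_ ?_ ?_
  · intro t ht; exact hφ _ _
  · intro t ht h h2
    apply h
    have : t.2.1 = t.1 := congrArg Prod.fst h2
    rw [this]; exact hφ0 _
  · intro t ht; exact hg t ht
  · intro t ht
    have := hg _ (hg t ht)
    have h3 := hu _ _ _ _ this (show (t.1, t.2.1, t.2.2) ∈ R from ht)
    show (t.1, t.2.1, _) = t
    rw [h3]

theorem sum_rot {M : Type} [AddCommGroup M] (R : Finset (W × W × W))
    (hr : ∀ a b c, (a, b, c) ∈ R → (b, c, a) ∈ R) (φ : W → W → W → M) :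
    ∑ t ∈ R, φ t.2.1 t.2.2 t.1 = ∑ t ∈ R, φ t.1 t.2.1 t.2.2 := by
  refine Finset.sum_nbij' (fun t => (t.2.1, t.2.2, t.1)) (fun t => (t.2.2, t.1, t.2.1))
    ?_ ?_ ?_ ?_ ?_
  · intro t ht; exact hr _ _ _ ht
  · intro t ht; exact hr _ _ _ (hr _ _ _ ht)
  · intro t ht; rfl
  · intro t ht; rfl
  · intro t ht; rfl

theorem anti_tri {M : Type} [AddCommGroup M] (hS : CS S)
    (φ : W → W → M) (hφ : ∀ a b, φ a b + φ b a = 0) (hφ0 : ∀ a, φ a a = 0) :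
    ∑ t ∈ S, (φ t.1 t.2.1 + φ t.2.1 t.2.2 + φ t.2.2 t.1) = 0 := by
  have h1 := anti S hS.uniq hS.adj φ hφ hφ0
  have h2 := sum_rot S hS.rot (fun a b c => φ a b)
  have h3 := sum_rot S hS.rot (fun a b c => φ b c)
  rw [Finset.sum_add_distrib, Finset.sum_add_distrib, h3, h2, h1]; simp

theorem CS.rot' (hS : CS S) {a b c : W} (h : (a, b, c) ∈ S) : (c, a, b) ∈ S :=
  hS.rot _ _ _ (hS.rot _ _ _ h)
theorem CS.ed_symm (hS : CS S) {a b : W} (h : Ed S a b) : Ed S b a := by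
  obtain ⟨c, hc⟩ := h; exact hS.adj _ _ _ hc
theorem CS.sp_l (hS : CS S) {a b : W} (h : Ed S a b) : Sp S a := by
  obtain ⟨c, hc⟩ := h; exact ⟨b, c, hc⟩
theorem CS.sp_r (hS : CS S) {a b : W} (h : Ed S a b) : Sp S b := hS.sp_l (hS.ed_symm h)

end comb

/-! ### crossing count -/

/-- the right-going edge `ab` is strictly above `p` -/
def gg (p a b : ℝ × ℝ) : ℤ := if a.1 < p.1 ∧ p.1 < b.1 ∧ ori a b p < 0 then 1 else 0
def cr (p a b : ℝ × ℝ) : ℤ := gg p b a - gg p a b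
def tr (p a b c : ℝ × ℝ) : ℤ := cr p a b + cr p b c + cr p c a

theorem tr_aux (p a b c : ℝ × ℝ) (h : 0 < ori a b c)
    (hs : (a.1 < p.1 ∧ p.1 < b.1 ∧ p.1 < c.1) ∨ (p.1 < a.1 ∧ b.1 < p.1 ∧ c.1 < p.1)) :
    (tr p a b c = 0 ∨ tr p a b c = 1) ∧ 
    (0 < ori a b p → 0 < ori b c p → 0 < ori c a p → tr p a b c = 1) ∧
    (tr p a b c = 1 → 0 ≤ ori a b p ∧ 0 ≤ ori b c p ∧ 0 ≤ ori c a p) := by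
  have e1 := ori_add a b c p
  have e2 := ori_bary a b c p Prod.fst (Or.inl rfl)
  have s1 := ori_swap a b p
  have s2 := ori_swap c a p
  simp only [tr, cr, gg]
  generalize ori a b p = γ at *
  generalize ori b c p = α at *
  generalize ori c a p = β at *
  rcases hs with ⟨h1, h2, h3⟩ | ⟨h1, h2, h3⟩
  · have n1 : ¬ (b.1 < p.1) := by linarith
    have n2 : ¬ (c.1 < p.1) := by linarith
    have n3 : ¬ (p.1 < a.1) := by linarith
    simp only [h1, h2, h3, n1, n2, n3, true_and, false_and, if_false, s2]
    have k1 : γ < 0 → 0 < β := by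
      intro hg; by_contra hb; push Not at hb
      have : 0 < α := by linarith
      nlinarith
    have k2 : 0 ≤ γ → 0 ≤ β → 0 ≤ α := by
      intro hg hb; by_contra ha; push Not at ha
      nlinarith
    clear s1 s2 e2 e1
    refine ⟨?_, ?_, ?_⟩
    · split_ifs <;> first | (exfalso; have := k1 (by assumption); linarith) | simp
    · intro q1 q2 q3
      split_ifs <;> first | (exfalso; linarith) | simp
    · intro q
      split_ifs at q <;> simp at q
      have hb : 0 ≤ β := by linarith
      have hg : 0 ≤ γ := by linarith
      exact ⟨hg, k2 hg hb, hb⟩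
  · have n1 : ¬ (p.1 < b.1) := by linarith
    have n2 : ¬ (p.1 < c.1) := by linarith
    have n3 : ¬ (a.1 < p.1) := by linarith
    simp only [h1, h2, h3, n1, n2, n3, true_and, false_and, and_false, if_false, s1]
    have k1 : β < 0 → 0 < γ := by
      intro hg; by_contra hb; push Not at hb
      have : 0 < α := by linarith
      nlinarith
    have k2 : 0 ≤ γ → 0 ≤ β → 0 ≤ α := by
      intro hg hb; by_contra ha; push Not at ha
      nlinarith
    clear s1 s2 e2 e1
    refine ⟨?_, ?_, ?_⟩
    · split_ifs <;> first | (exfalso; have := k1 (by assumption); linarith) | simp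
    · intro q1 q2 q3
      split_ifs <;> first | (exfalso; linarith) | simp
    · intro q
      split_ifs at q <;> simp at q
      have hb : 0 ≤ β := by linarith
      have hg : 0 ≤ γ := by linarith
      exact ⟨hg, k2 hg hb, hb⟩

theorem tr_rot (p a b c : ℝ × ℝ) : tr p b c a = tr p a b c := by unfold tr; ring

theorem tr_main (p a b c : ℝ × ℝ) (h : 0 < ori a b c) (ha : a.1 ≠ p.1) (hb : b.1 ≠ p.1)
    (hc : c.1 ≠ p.1) :
    (tr p a b c = 0 ∨ tr p a b c = 1) ∧ 
    (0 < ori a b p → 0 < ori b c p → 0 < ori c a p → tr p a b c = 1) ∧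
    (tr p a b c = 1 → 0 ≤ ori a b p ∧ 0 ≤ ori b c p ∧ 0 ≤ ori c a p) := by
  have A1 := tr_aux p a b c h
  have A2 := tr_aux p b c a (by rw [ori_rot]; exact h)
  have A3 := tr_aux p c a b (by rw [ori_rot']; exact h)
  rw [tr_rot] at A2
  rw [← tr_rot p c a b] at A3
  have e2 := ori_bary a b c p Prod.fst (Or.inl rfl)
  rcases lt_or_gt_of_ne ha with ha | ha <;> rcases lt_or_gt_of_ne hb with hb | hb <;>
    rcases lt_or_gt_of_ne hc with hc | hc
  · have n1 : ¬ (p.1 < a.1) := by linarith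
    have n2 : ¬ (p.1 < b.1) := by linarith
    have n3 : ¬ (p.1 < c.1) := by linarith
    simp [tr, cr, gg, n1, n2, n3]
    intro q1 q2; by_contra q3; push Not at q3; nlinarith [mul_pos q1 (sub_pos.2 hc), mul_pos q2 (sub_pos.2 ha), mul_pos q3 (sub_pos.2 hb)]
  · obtain ⟨x, y, z⟩ := A3 (Or.inr ⟨hc, ha, hb⟩)
    exact ⟨x, fun q1 q2 q3 => y q3 q1 q2, fun q => ⟨(z q).2.1, (z q).2.2, (z q).1⟩⟩
  · obtain ⟨x, y, z⟩ := A2 (Or.inr ⟨hb, hc, ha⟩)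
    exact ⟨x, fun q1 q2 q3 => y q2 q3 q1, fun q => ⟨(z q).2.2, (z q).1, (z q).2.1⟩⟩
  · exact A1 (Or.inl ⟨ha, hb, hc⟩)
  · exact A1 (Or.inr ⟨ha, hb, hc⟩)
  · obtain ⟨x, y, z⟩ := A2 (Or.inl ⟨hb, hc, ha⟩)
    exact ⟨x, fun q1 q2 q3 => y q2 q3 q1, fun q => ⟨(z q).2.2, (z q).1, (z q).2.1⟩⟩
  · obtain ⟨x, y, z⟩ := A3 (Or.inl ⟨hc, ha, hb⟩)
    exact ⟨x, fun q1 q2 q3 => y q3 q1 q2, fun q => ⟨(z q).2.1, (z q).2.2, (z q).1⟩⟩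
  · have n1 : ¬ (a.1 < p.1) := by linarith
    have n2 : ¬ (b.1 < p.1) := by linarith
    have n3 : ¬ (c.1 < p.1) := by linarith
    simp [tr, cr, gg, n1, n2, n3]
    intro q1 q2; by_contra q3; push Not at q3; nlinarith [mul_pos q1 (sub_pos.2 hc), mul_pos q2 (sub_pos.2 ha), mul_pos q3 (sub_pos.2 hb)]

end ICP

end

set_option linter.all false
noncomputable section
set_option maxHeartbeats 1000000
open Classical Filter Topology

namespace ICP

def inT (p a b c : ℝ × ℝ) : Prop := 0 < ori a b p ∧ 0 < ori b c p ∧ 0 < ori c a p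
def clT (p a b c : ℝ × ℝ) : Prop := 0 ≤ ori a b p ∧ 0 ≤ ori b c p ∧ 0 ≤ ori c a p

theorem clT_rot {p a b c : ℝ × ℝ} (h : clT p a b c) : clT p b c a := ⟨h.2.1, h.2.2, h.1⟩
theorem inT_rot {p a b c : ℝ × ℝ} (h : inT p a b c) : inT p b c a := ⟨h.2.1, h.2.2, h.1⟩
theorem inT.cl {p a b c : ℝ × ℝ} (h : inT p a b c) : clT p a b c := ⟨h.1.le, h.2.1.le, h.2.2.le⟩

/-- moving a point -/
def mv (p e : ℝ × ℝ) (ε : ℝ) : ℝ × ℝ := (p.1 + ε * e.1, p.2 + ε * e.2)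

theorem ori_mv (a b p e : ℝ × ℝ) (ε : ℝ) : ori a b (mv p e ε) = ori a b p + ε * crs (b - a) e := by
  simp only [ori, mv, crs, Prod.fst_sub, Prod.snd_sub]; ring

def Cnd (a b p e : ℝ × ℝ) : Prop := 0 < ori a b p ∨ (ori a b p = 0 ∧ 0 < crs (b - a) e)

theorem ev_small (c : ℝ) (hc : 0 < c) : ∀ᶠ ε in 𝓝[>] (0 : ℝ), 0 < ε ∧ ε < c := by
  filter_upwards [Ioo_mem_nhdsGT hc] with ε h using h

theorem ev_pos {x y : ℝ} (h : 0 < x) : ∀ᶠ ε in 𝓝[>] (0 : ℝ), 0 < x + ε * y := by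
  filter_upwards [ev_small (x / (|y| + 1)) (by positivity)] with ε hε
  have h1 : ε * (|y| + 1) < x := by
    have := hε.2; rwa [lt_div_iff₀ (by positivity)] at this
  have h2 : -|y| ≤ y := neg_abs_le y
  nlinarith [hε.1, abs_nonneg y]

theorem ev_Cnd {a b p e : ℝ × ℝ} (h : Cnd a b p e) :
    ∀ᶠ ε in 𝓝[>] (0 : ℝ), 0 < ori a b (mv p e ε) := by
  rcases h with h | ⟨h, h'⟩
  · filter_upwards [ev_pos (y := crs (b - a) e) h] with ε hε
    rw [ori_mv]; exact hε
  · filter_upwards [ev_small 1 one_pos] with ε hε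
    rw [ori_mv, h, zero_add]; exact mul_pos hε.1 h'

theorem ev_neg {a b p e : ℝ × ℝ} (h : ori a b p < 0 ∨ (ori a b p = 0 ∧ crs (b - a) e < 0)) :
    ∀ᶠ ε in 𝓝[>] (0 : ℝ), ori a b (mv p e ε) < 0 := by
  rcases h with h | ⟨h, h'⟩
  · filter_upwards [ev_pos (x := -ori a b p) (y := -crs (b - a) e) (by linarith)] with ε hε
    rw [ori_mv]; linarith
  · filter_upwards [ev_small 1 one_pos] with ε hε
    rw [ori_mv, h, zero_add]; nlinarith [hε.1]

theorem ev_ne (x y : ℝ) : ∀ᶠ ε in 𝓝[>] (0 : ℝ), x ≠ y + ε := by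
  rcases le_or_gt x y with h | h
  · filter_upwards [ev_small 1 one_pos] with ε hε he
    linarith [hε.1]
  · filter_upwards [ev_small (x - y) (by linarith)] with ε hε he
    linarith [hε.2]

variable {W : Type} {S : Finset (W × W × W)} {A B C : W} {P : W → ℝ × ℝ}

/-- all coordinates of the triangles differ from that of `p` -/
def Gen (S : Finset (W × W × W)) (P : W → ℝ × ℝ) (p : ℝ × ℝ) : Prop :=
  ∀ t ∈ S, (P t.1).1 ≠ p.1 ∧ (P t.2.1).1 ≠ p.1 ∧ (P t.2.2).1 ≠ p.1

theorem ev_gen (S : Finset (W × W × W)) (P : W → ℝ × ℝ) (p : ℝ × ℝ) :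
    ∀ᶠ ε in 𝓝[>] (0 : ℝ), Gen S P (mv p (1, 0) ε) := by
  unfold Gen
  rw [eventually_all_finset]
  intro t ht
  filter_upwards [ev_ne (P t.1).1 p.1, ev_ne (P t.2.1).1 p.1, ev_ne (P t.2.2).1 p.1] with ε h1 h2 h3
  simp only [mv, mul_one]; exact ⟨h1, h2, h3⟩

def innF (S : Finset (W × W × W)) (P : W → ℝ × ℝ) : Finset (W × W × W) :=
  S.filter (fun t => 0 < ori (P t.1) (P t.2.1) (P t.2.2))

theorem ori_ne {a b c : W} (h : 0 < ori (P a) (P b) (P c)) : a ≠ b ∧ b ≠ c ∧ a ≠ c := by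
  refine ⟨?_, ?_, ?_⟩ <;> (rintro rfl; simp [ori] at h; try linarith)

theorem RS.ne (h : RS S A B C P) : A ≠ B ∧ B ≠ C ∧ A ≠ C := ori_ne h.pos

theorem RS.rotO (h : RS S A B C P) : RS S B C A P :=
  { toCS := h.toCS
    out := h.rot _ _ _ (h.rot _ _ _ h.out)
    pos := by rw [ori_rot]; exact h.pos
    inn := fun a b c hm => by
      rcases h.inn a b c hm with h1 | h1 | h1 | h1
      · exact Or.inl h1
      · exact Or.inr (Or.inr (Or.inl h1))
      · exact Or.inr (Or.inr (Or.inr h1))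
      · exact Or.inr (Or.inl h1) }

theorem RS.sum_inn (h : RS S A B C P) (p : ℝ × ℝ) :
    ∑ t ∈ innF S P, tr p (P t.1) (P t.2.1) (P t.2.2) = 3 * tr p (P A) (P B) (P C) := by
  have h0 := anti_tri h.toCS (fun a b => cr p (P a) (P b))
    (by intro a b; simp [cr]) (by intro a; simp [cr])
  have h1 : ∑ t ∈ S, tr p (P t.1) (P t.2.1) (P t.2.2) = 0 := h0
  have h2 : S.filter (fun t => ¬ 0 < ori (P t.1) (P t.2.1) (P t.2.2)) =
      {(C, B, A), (B, A, C), (A, C, B)} := by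
    have hp := h.pos
    ext ⟨a, b, c⟩
    simp only [Finset.mem_filter, Finset.mem_insert, Finset.mem_singleton]
    constructor
    · rintro ⟨hm, hn⟩
      rcases h.inn a b c hm with h3 | h3
      · exact absurd h3 hn
      · exact h3
    · have e1 : ori (P C) (P B) (P A) = - ori (P A) (P B) (P C) := by unfold ori; ring
      have e2 : ori (P B) (P A) (P C) = - ori (P A) (P B) (P C) := by unfold ori; ring
      have e3 : ori (P A) (P C) (P B) = - ori (P A) (P B) (P C) := by unfold ori; ring
      have k1 := h.out
      have k2 := h.rot _ _ _ k1
      have k3 := h.rot _ _ _ k2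
      rintro (h3 | h3 | h3) <;> (injection h3 with x y; injection y with y z; subst x y z)
      · exact ⟨k1, by rw [e1]; linarith⟩
      · exact ⟨k2, by rw [e2]; linarith⟩
      · exact ⟨k3, by rw [e3]; linarith⟩
  have h3 := Finset.sum_filter_add_sum_filter_not S
    (fun t => 0 < ori (P t.1) (P t.2.1) (P t.2.2)) (fun t => tr p (P t.1) (P t.2.1) (P t.2.2))
  obtain ⟨n1, n2, n3⟩ := h.ne
  rw [h2, h1, Finset.sum_insert (by simp; tauto), Finset.sum_insert (by simp; tauto),
    Finset.sum_singleton] at h3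
  have : innF S P = S.filter (fun t => 0 < ori (P t.1) (P t.2.1) (P t.2.2)) := rfl
  rw [this]
  simp only [tr, cr] at *
  linarith

theorem RS.gen_main (h : RS S A B C P) {p : ℝ × ℝ} (hg : Gen S P p) {a b c : W}
    (hm : (a, b, c) ∈ innF S P) :
    (tr p (P a) (P b) (P c) = 0 ∨ tr p (P a) (P b) (P c) = 1) ∧ 
    (inT p (P a) (P b) (P c) → tr p (P a) (P b) (P c) = 1) ∧
    (tr p (P a) (P b) (P c) = 1 → clT p (P a) (P b) (P c)) := by
  simp only [innF, Finset.mem_filter] at hm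
  obtain ⟨g1, g2, g3⟩ := hg _ hm.1
  obtain ⟨x, y, z⟩ := tr_main p _ _ _ hm.2 g1 g2 g3
  exact ⟨x, fun q => y q.1 q.2.1 q.2.2, z⟩

theorem RS.gen_out (h : RS S A B C P) {p : ℝ × ℝ} (hg : Gen S P p) :
    (tr p (P A) (P B) (P C) = 0 ∨ tr p (P A) (P B) (P C) = 1) ∧ 
    (inT p (P A) (P B) (P C) → tr p (P A) (P B) (P C) = 1) ∧
    (tr p (P A) (P B) (P C) = 1 → clT p (P A) (P B) (P C)) := by
  obtain ⟨g1, g2, g3⟩ := hg _ h.out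
  obtain ⟨x, y, z⟩ := tr_main p _ _ _ h.pos g3 g2 g1
  exact ⟨x, fun q => y q.1 q.2.1 q.2.2, z⟩

theorem rot_innF (h : RS S A B C P) {a b c : W} (hm : (a, b, c) ∈ innF S P) :
    (b, c, a) ∈ innF S P := by
  simp only [innF, Finset.mem_filter] at *
  exact ⟨h.rot _ _ _ hm.1, by rw [ori_rot]; exact hm.2⟩

def Rot3 (a b c a' b' c' : W) : Prop :=
  (a', b', c') = (a, b, c) ∨ (a', b', c') = (b, c, a) ∨ (a', b', c') = (c, a, b)

theorem mem_innF {a b c : W} : (a, b, c) ∈ innF S P ↔ (a, b, c) ∈ S ∧ 0 < ori (P a) (P b) (P c) := by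
  simp [innF]

theorem RS.uniq_gen (h : RS S A B C P) {p : ℝ × ℝ} (hg : Gen S P p) {a b c a' b' c' : W}
    (hm : (a, b, c) ∈ innF S P) (hm' : (a', b', c') ∈ innF S P)
    (hp : inT p (P a) (P b) (P c)) (hp' : inT p (P a') (P b') (P c')) : Rot3 a b c a' b' c' := by
  by_contra hr
  unfold Rot3 at hr
  push Not at hr
  obtain ⟨r1, r2, r3⟩ := hr
  have hs := h.sum_inn p
  have m2 := rot_innF h hm
  have m3 := rot_innF h m2
  have m2' := rot_innF h hm'
  have m3' := rot_innF h m2'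
  have t1 := (h.gen_main hg hm).2.1 hp
  have t2 := (h.gen_main hg m2).2.1 (inT_rot hp)
  have t3 := (h.gen_main hg m3).2.1 (inT_rot (inT_rot hp))
  have t1' := (h.gen_main hg hm').2.1 hp'
  have t2' := (h.gen_main hg m2').2.1 (inT_rot hp')
  have t3' := (h.gen_main hg m3').2.1 (inT_rot (inT_rot hp'))
  have hsub : ({(a, b, c), (b, c, a), (c, a, b), (a', b', c'), (b', c', a'), (c', a', b')} :
      Finset (W × W × W)) ⊆ innF S P := by
    intro t ht
    simp only [Finset.mem_insert, Finset.mem_singleton] at ht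
    rcases ht with rfl | rfl | rfl | rfl | rfl | rfl <;> assumption
  have hle := Finset.sum_le_sum_of_subset_of_nonneg hsub
    (f := fun t => tr p (P t.1) (P t.2.1) (P t.2.2)) (by
      rintro ⟨x, y, z⟩ hx _
      rcases (h.gen_main hg hx).1 with q | q <;> (simp only [q]; norm_num))
  obtain ⟨n1, n2, n3⟩ := ori_ne (mem_innF.1 hm).2
  obtain ⟨n1', n2', n3'⟩ := ori_ne (mem_innF.1 hm').2
  simp only [ne_eq, Prod.mk.injEq, not_and] at r1 r2 r3
  rw [Finset.sum_insert (by simp; grind), Finset.sum_insert (by simp; grind),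
    Finset.sum_insert (by simp; grind),
    Finset.sum_insert (by simp; grind), Finset.sum_insert (by simp; grind),
    Finset.sum_singleton, hs] at hle
  simp only [t1, t2, t3, t1', t2', t3'] at hle
  rcases (h.gen_out hg).1 with q | q <;> rw [q] at hle <;> norm_num at hle

theorem RS.sub_gen (h : RS S A B C P) {p : ℝ × ℝ} (hg : Gen S P p) {a b c : W}
    (hm : (a, b, c) ∈ innF S P) (hp : inT p (P a) (P b) (P c)) : clT p (P A) (P B) (P C) := by
  apply (h.gen_out hg).2.2
  rcases (h.gen_out hg).1 with q | q
  · exfalso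
    have hs := h.sum_inn p
    rw [q, mul_zero] at hs
    have h1 := (Finset.sum_eq_zero_iff_of_nonneg (by
      rintro ⟨x, y, z⟩ hx
      rcases (h.gen_main hg hx).1 with q | q <;> (simp only [q]; norm_num))).1 hs _ hm
    simp only [(h.gen_main hg hm).2.1 hp] at h1
    norm_num at h1
  · exact q

theorem RS.cov_gen (h : RS S A B C P) {p : ℝ × ℝ} (hg : Gen S P p)
    (hp : inT p (P A) (P B) (P C)) : ∃ a b c, (a, b, c) ∈ innF S P ∧ clT p (P a) (P b) (P c) := by
  have hs := h.sum_inn p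
  rw [(h.gen_out hg).2.1 hp] at hs
  obtain ⟨⟨a, b, c⟩, hm, hne⟩ := Finset.exists_ne_zero_of_sum_ne_zero (by rw [hs]; norm_num)
  refine ⟨a, b, c, hm, (h.gen_main hg hm).2.2 ?_⟩
  rcases (h.gen_main hg hm).1 with q | q
  · exact absurd q hne
  · exact q

theorem ev_inT {p a b c e : ℝ × ℝ} (h1 : Cnd a b p e) (h2 : Cnd b c p e) (h3 : Cnd c a p e) :
    ∀ᶠ ε in 𝓝[>] (0 : ℝ), inT (mv p e ε) a b c := by
  filter_upwards [ev_Cnd h1, ev_Cnd h2, ev_Cnd h3] with ε x y z using ⟨x, y, z⟩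

theorem ev_inT' {p a b c : ℝ × ℝ} (e : ℝ × ℝ) (h : inT p a b c) :
    ∀ᶠ ε in 𝓝[>] (0 : ℝ), inT (mv p e ε) a b c :=
  ev_inT (Or.inl h.1) (Or.inl h.2.1) (Or.inl h.2.2)

theorem RS.uniqT (h : RS S A B C P) {p : ℝ × ℝ} {a b c a' b' c' : W}
    (hm : (a, b, c) ∈ innF S P) (hm' : (a', b', c') ∈ innF S P)
    (hp : inT p (P a) (P b) (P c)) (hp' : inT p (P a') (P b') (P c')) : Rot3 a b c a' b' c' := by
  obtain ⟨ε, h1, h2, h3⟩ := ((ev_gen S P p).and ((ev_inT' (1, 0) hp).and (ev_inT' (1,0) hp'))).exists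
  exact h.uniq_gen h1 hm hm' h2 h3

/-- OVERLAP -/
theorem RS.overlap (h : RS S A B C P) {p e : ℝ × ℝ} {a b c a' b' c' : W}
    (hm : (a, b, c) ∈ innF S P) (hm' : (a', b', c') ∈ innF S P)
    (h1 : Cnd (P a) (P b) p e) (h2 : Cnd (P b) (P c) p e) (h3 : Cnd (P c) (P a) p e)
    (h1' : Cnd (P a') (P b') p e) (h2' : Cnd (P b') (P c') p e) (h3' : Cnd (P c') (P a') p e) :
    Rot3 a b c a' b' c' := by
  obtain ⟨ε, q1, q2⟩ := ((ev_inT h1 h2 h3).and (ev_inT h1' h2' h3')).exists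
  exact h.uniqT hm hm' q1 q2

theorem RS.subT (h : RS S A B C P) {p : ℝ × ℝ} {a b c : W}
    (hm : (a, b, c) ∈ innF S P) (hp : inT p (P a) (P b) (P c)) : clT p (P A) (P B) (P C) := by
  by_contra hn
  have : ori (P A) (P B) p < 0 ∨ ori (P B) (P C) p < 0 ∨ ori (P C) (P A) p < 0 := by
    unfold clT at hn; by_contra hh; push Not at hh; exact hn hh
  have h2 : ∀ᶠ ε in 𝓝[>] (0 : ℝ), ¬ clT (mv p (1, 0) ε) (P A) (P B) (P C) := by
    rcases this with q | q | q <;>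
    · filter_upwards [ev_neg (e := (1,0)) (Or.inl q)] with ε hε hc
      rcases hc with ⟨x, y, z⟩; linarith
  obtain ⟨ε, q1, q2, q3⟩ := ((ev_gen S P p).and ((ev_inT' (1, 0) hp).and h2)).exists
  exact q3 (h.sub_gen q1 hm q2)

theorem ev_nclT {p a b c e : ℝ × ℝ} (hn : ¬ clT p a b c) :
    ∀ᶠ ε in 𝓝[>] (0 : ℝ), ¬ clT (mv p e ε) a b c := by
  have : ori a b p < 0 ∨ ori b c p < 0 ∨ ori c a p < 0 := by
    unfold clT at hn; by_contra hh; push Not at hh; exact hn hh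
  rcases this with q | q | q <;>
  · filter_upwards [ev_neg (e := e) (Or.inl q)] with ε hε hc
    rcases hc with ⟨x, y, z⟩; linarith

theorem RS.covT (h : RS S A B C P) {p : ℝ × ℝ}
    (hp : inT p (P A) (P B) (P C)) : ∃ a b c, (a, b, c) ∈ innF S P ∧ clT p (P a) (P b) (P c) := by
  by_contra hn
  push Not at hn
  have h1 : ∀ᶠ ε in 𝓝[>] (0 : ℝ), ∀ t ∈ innF S P, ¬ clT (mv p (1,0) ε) (P t.1) (P t.2.1) (P t.2.2) := by
    rw [eventually_all_finset]
    intro t ht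
    exact ev_nclT (hn _ _ _ ht)
  obtain ⟨ε, q1, q2, q3⟩ := ((ev_gen S P p).and ((ev_inT' (1, 0) hp).and h1)).exists
  obtain ⟨a, b, c, hm, hc⟩ := h.cov_gen q1 q2
  exact q3 _ hm hc

end ICP

end

set_option linter.all false
noncomputable section
set_option maxHeartbeats 1000000
open Classical Filter Topology

namespace ICP
variable {W : Type} {S : Finset (W × W × W)} {A B C : W} {P : W → ℝ × ℝ}

theorem ori_crs (a b c : ℝ × ℝ) : ori a b c = crs (b - a) (c - a) := by
  simp [ori, crs]

theorem corner_Cnd {v u w e : ℝ × ℝ} (h : 0 < ori v u w) (h1 : 0 < crs (u - v) e)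
    (h2 : 0 < crs e (w - v)) : Cnd v u v e ∧ Cnd u w v e ∧ Cnd w v v e := by
  refine ⟨Or.inr ⟨ori_self1 _ _, h1⟩, Or.inl (by rw [ori_rot]; exact h),
    Or.inr ⟨ori_self2 _ _, ?_⟩⟩
  have : crs (v - w) e = crs e (w - v) := by simp [crs]; ring
  rw [this]; exact h2

theorem RS.inn_or (h : RS S A B C P) {a b c : W} (hm : (a, b, c) ∈ S) :
    (a, b, c) ∈ innF S P ∨ (a, b, c) = (C, B, A) ∨ (a, b, c) = (B, A, C) ∨ (a, b, c) = (A, C, B) := by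
  rcases h.inn a b c hm with q | q
  · exact Or.inl (mem_innF.2 ⟨hm, q⟩)
  · exact Or.inr q

theorem RS.inn_ori (h : RS S A B C P) {a b c : W} (hm : (a, b, c) ∈ innF S P) :
    0 < ori (P a) (P b) (P c) := (mem_innF.1 hm).2

theorem RS.edAB (h : RS S A B C P) : ∃ z, (A, B, z) ∈ innF S P := by
  obtain ⟨z, hz⟩ := h.adj _ _ _ (h.rot _ _ _ h.out)
  refine ⟨z, ?_⟩
  obtain ⟨n1, n2, n3⟩ := h.ne
  rcases h.inn_or hz with q | q | q | q
  · exact q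
  all_goals (simp only [Prod.mk.injEq] at q; grind)

theorem RS.sp_inn (h : RS S A B C P) {v : W} (hv : Sp S v) : ∃ b c, (v, b, c) ∈ innF S P := by
  obtain ⟨b, c, hm⟩ := hv
  rcases h.inn_or hm with q | q | q | q
  · exact ⟨b, c, q⟩
  · simp only [Prod.mk.injEq] at q; rw [q.1]
    obtain ⟨z, hz⟩ := h.rotO.rotO.edAB; exact ⟨_, _, hz⟩
  · simp only [Prod.mk.injEq] at q; rw [q.1]
    obtain ⟨z, hz⟩ := h.rotO.edAB; exact ⟨_, _, hz⟩
  · simp only [Prod.mk.injEq] at q; rw [q.1]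
    obtain ⟨z, hz⟩ := h.edAB; exact ⟨_, _, hz⟩

theorem RS.int_inn (h : RS S A B C P) {v b c : W} (hA : v ≠ A) (hB : v ≠ B) (hC : v ≠ C)
    (hm : (v, b, c) ∈ S) : (v, b, c) ∈ innF S P := by
  rcases h.inn_or hm with q | q | q | q
  · exact q
  all_goals (simp only [Prod.mk.injEq] at q; grind)

/-- next neighbour around an interior vertex -/
theorem RS.next (h : RS S A B C P) {v u : W} (hA : v ≠ A) (hB : v ≠ B) (hC : v ≠ C)
    (hu : Ed S v u) : ∃ w, Ed S v w ∧ (v, u, w) ∈ S ∧ 0 < crs (P u - P v) (P w - P v) := by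
  obtain ⟨w, hw⟩ := hu
  refine ⟨w, ?_, hw, ?_⟩
  · exact h.ed_symm ⟨_, h.rot' hw⟩
  · rw [← ori_crs]; exact h.inn_ori (h.int_inn hA hB hC hw)

theorem crs3 (d u w : ℝ × ℝ) : crs u w * (d.1 ^ 2 + d.2 ^ 2) =
    (d.1 * u.1 + d.2 * u.2) * crs d w - crs d u * (d.1 * w.1 + d.2 * w.2) := by
  unfold crs; ring

theorem sq_pos_of_ne {d : ℝ × ℝ} (hd : d ≠ 0) : 0 < d.1 ^ 2 + d.2 ^ 2 := by
  by_contra hn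
  have h1 : d.1 = 0 := by nlinarith [sq_nonneg d.1, sq_nonneg d.2]
  have h2 : d.2 = 0 := by nlinarith [sq_nonneg d.1, sq_nonneg d.2]
  exact hd (Prod.ext h1 h2)

def vset (S : Finset (W × W × W)) : Finset W := S.image (fun t => t.1)
theorem mem_vset {v : W} : v ∈ vset S ↔ Sp S v := by
  simp only [vset, Finset.mem_image, Prod.exists, Sp]
  constructor
  · rintro ⟨a, b, c, hm, rfl⟩; exact ⟨b, c, hm⟩
  · rintro ⟨b, c, hm⟩; exact ⟨v, b, c, hm, rfl⟩
def nbrs (S : Finset (W × W × W)) (v : W) : Finset W := (vset S).filter (fun u => Ed S v u)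
theorem RS.mem_nbrs (h : RS S A B C P) {v u : W} : u ∈ nbrs S v ↔ Ed S v u := by
  simp only [nbrs, Finset.mem_filter, mem_vset]
  exact ⟨fun q => q.2, fun q => ⟨h.sp_r q, q⟩⟩

/-- LE: some neighbour is strictly on the right of direction `d` -/
theorem RS.le (h : RS S A B C P) {v : W} (hv : Sp S v) (hA : v ≠ A) (hB : v ≠ B) (hC : v ≠ C)
    {d : ℝ × ℝ} (hd : d ≠ 0) : ∃ u, Ed S v u ∧ crs d (P u - P v) < 0 := by
  by_contra hn
  push Not at hn
  have hd2 := sq_pos_of_ne hd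
  -- no neighbour at angle π
  have npi : ∀ u, Ed S v u → crs d (P u - P v) = 0 →
      0 ≤ (d.1 * (P u - P v).1 + d.2 * (P u - P v).2) := by
    intro u hu h0
    by_contra hlt; push Not at hlt
    obtain ⟨w, hw, hm, hc⟩ := h.next hA hB hC hu
    have e := crs3 d (P u - P v) (P w - P v)
    rw [h0] at e
    have := hn w hw
    nlinarith [mul_pos hc hd2]
  have step : ∀ u, Ed S v u → ∃ w, Ed S v w ∧ 0 < crs (P u - P v) (P w - P v) ∧
      0 < crs d (P w - P v) := by
    intro u hu
    obtain ⟨w, hw, hm, hc⟩ := h.next hA hB hC hu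
    refine ⟨w, hw, hc, ?_⟩
    rcases (hn w hw).lt_or_eq with q | q
    · exact q
    · exfalso
      have e := crs3 d (P u - P v) (P w - P v)
      have := npi w hw q.symm
      rw [← q] at e
      nlinarith [mul_pos hc hd2, hn u hu]
  obtain ⟨b, c, hm⟩ := hv
  obtain ⟨w0, hw0, _, hp0⟩ := step b ⟨c, hm⟩
  let F := (nbrs S v).filter (fun u => 0 < crs d (P u - P v))
  have hF : F.Nonempty := ⟨w0, by simp only [F, Finset.mem_filter, h.mem_nbrs]; exact ⟨hw0, hp0⟩⟩
  obtain ⟨u, hu, hmax⟩ := F.exists_max_image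
    (fun u => -(d.1 * (P u - P v).1 + d.2 * (P u - P v).2) / crs d (P u - P v)) hF
  simp only [F, Finset.mem_filter, h.mem_nbrs] at hu hmax
  obtain ⟨w, hw, hc, hp⟩ := step u hu.1
  have := hmax w ⟨hw, hp⟩
  rw [div_le_div_iff₀ hp hu.2] at this
  have e := crs3 d (P u - P v) (P w - P v)
  nlinarith [mul_pos hc hd2]

/-- SECTOR -/
theorem RS.sector (h : RS S A B C P) {v : W} (hv : Sp S v) (hA : v ≠ A) (hB : v ≠ B) (hC : v ≠ C)
    {d : ℝ × ℝ} (hd : d ≠ 0)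
    (hray : ∀ u, Ed S v u → crs d (P u - P v) = 0 → d.1 * (P u - P v).1 + d.2 * (P u - P v).2 ≤ 0) :
    ∃ u w, (v, u, w) ∈ S ∧ crs d (P u - P v) < 0 ∧ 0 < crs d (P w - P v) := by
  have hd2 := sq_pos_of_ne hd
  obtain ⟨u0, hu0, hn0⟩ := h.le hv hA hB hC hd
  let F := (nbrs S v).filter (fun u => crs d (P u - P v) < 0)
  have hF : F.Nonempty := ⟨u0, by simp only [F, Finset.mem_filter, h.mem_nbrs]; exact ⟨hu0, hn0⟩⟩
  obtain ⟨u, hu, hmax⟩ := F.exists_max_image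
    (fun u => (d.1 * (P u - P v).1 + d.2 * (P u - P v).2) / (-crs d (P u - P v))) hF
  simp only [F, Finset.mem_filter, h.mem_nbrs] at hu hmax
  obtain ⟨w, hw, hm, hc⟩ := h.next hA hB hC hu.1
  have e := crs3 d (P u - P v) (P w - P v)
  refine ⟨u, w, hm, hu.2, ?_⟩
  by_contra hneg; push Not at hneg
  rcases hneg.lt_or_eq with q | q
  · have := hmax w ⟨hw, q⟩
    rw [div_le_div_iff₀ (by linarith) (by linarith [hu.2])] at this
    nlinarith [mul_pos hc hd2]
  · have := hray w hw q
    rw [q] at e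
    nlinarith [mul_pos hc hd2, hu.2]

theorem ev_lin_ne {x y : ℝ} (h : ¬ (x = 0 ∧ y = 0)) : ∀ᶠ ε in 𝓝[>] (0 : ℝ), x + ε * y ≠ 0 := by
  rcases lt_trichotomy x 0 with q | q | q
  · filter_upwards [ev_pos (x := -x) (y := -y) (by linarith)] with ε hε; intro h; linarith
  · subst q
    filter_upwards [ev_small 1 one_pos] with ε hε
    simp only [true_and] at h
    rw [zero_add]; exact mul_ne_zero hε.1.ne' h
  · filter_upwards [ev_pos (x := x) (y := y) q] with ε hε; exact hε.ne'

theorem crs_indep {n x y : ℝ × ℝ} (h : 0 < crs x y) (hn : n ≠ 0) : ¬ (crs n x = 0 ∧ crs n y = 0) := by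
  rintro ⟨h1, h2⟩
  have hn2 := sq_pos_of_ne hn
  have := crs3 n x y
  rw [h1, h2] at this
  nlinarith [mul_pos h hn2]

theorem crs_mvr (n x y : ℝ × ℝ) (ε : ℝ) : crs n (mv x y ε) = crs n x + ε * crs n y := by
  simp [crs, mv]; ring
theorem crs_self (x : ℝ × ℝ) : crs x x = 0 := by simp [crs]; ring
theorem crs_comm (x y : ℝ × ℝ) : crs x y = - crs y x := by simp [crs]; ring

/-- direction generically chosen in a cone -/
theorem ev_cone {x y : ℝ × ℝ} (h : 0 < crs x y) : ∀ᶠ ε in 𝓝[>] (0 : ℝ),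
    0 < crs x (mv x y ε) ∧ 0 < crs (mv x y ε) y := by
  filter_upwards [ev_small 1 one_pos] with ε hε
  rw [crs_mvr, crs_self, crs_comm (mv x y ε), crs_mvr, crs_self, crs_comm y x]
  constructor
  · have := mul_pos hε.1 h; linarith
  · linarith

theorem Rot3.mem1 {a b c a' b' c' : W} (h : Rot3 a b c a' b' c') : a' = a ∨ a' = b ∨ a' = c := by
  simp only [Rot3, Prod.mk.injEq] at h; tauto

theorem Rot3.symm {a b c a' b' c' : W} (h : Rot3 a b c a' b' c') : Rot3 a' b' c' a b c := by
  simp only [Rot3, Prod.mk.injEq] at *; tauto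

theorem RS.inj_aux (h : RS S A B C P) {v a : W} (hv : Sp S v) (ha : Sp S a) (hA : a ≠ A)
    (hB : a ≠ B) (hC : a ≠ C) (hP : P v = P a) : v = a := by
  by_contra hne
  obtain ⟨x, y, hm⟩ := h.sp_inn hv
  have hxy := h.inn_ori hm
  rw [ori_crs] at hxy
  have h1 : ∀ᶠ ε in 𝓝[>] (0 : ℝ), ∀ n ∈ nbrs S a,
      crs (P n - P a) (mv (P x - P v) (P y - P v) ε) ≠ 0 := by
    rw [eventually_all_finset]
    intro n hn
    rw [h.mem_nbrs] at hn
    simp only [crs_mvr]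
    refine ev_lin_ne (crs_indep hxy ?_)
    intro h0
    obtain ⟨w, -, -, hw⟩ := h.next hA hB hC hn
    rw [h0] at hw; simp [crs] at hw
  obtain ⟨ε, q1, q2, q3⟩ := (h1.and (ev_cone hxy)).exists
  generalize mv (P x - P v) (P y - P v) ε = e at *
  have he : e ≠ 0 := by rintro rfl; simp [crs] at q2
  obtain ⟨u, w, hm', c1, c2⟩ := h.sector ha hA hB hC he (by
    intro u hu h0
    exact absurd (by rw [crs_comm, h0, neg_zero]) (q1 u (h.mem_nbrs.2 hu)))
  have hin := h.int_inn hA hB hC hm'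
  obtain ⟨k1, k2, k3⟩ := corner_Cnd (h.inn_ori hm) q2 q3
  obtain ⟨k1', k2', k3'⟩ := corner_Cnd (e := e) (h.inn_ori hin) (by rw [crs_comm]; linarith) c2
  rw [hP] at k1 k2 k3
  rw [← hP] at k1 k2 k3 k1' k2' k3'
  have hr := h.overlap hm hin k1 k2 k3 (by simpa only [hP] using k1') (by simpa only [hP] using k2') (by simpa only [hP] using k3')
  have pos := h.inn_ori hin
  rcases hr.symm.mem1 with q | q | q
  · exact hne q
  · rw [← q, hP, ori_self3] at pos; exact lt_irrefl _ pos
  · rw [← q, hP, ori_self1] at pos; exact lt_irrefl _ pos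

theorem RS.inj (h : RS S A B C P) {v a : W} (hv : Sp S v) (ha : Sp S a) (hP : P v = P a) : v = a := by
  by_cases h1 : a ≠ A ∧ a ≠ B ∧ a ≠ C
  · exact h.inj_aux hv ha h1.1 h1.2.1 h1.2.2 hP
  by_cases h2 : v ≠ A ∧ v ≠ B ∧ v ≠ C
  · exact (h.inj_aux ha hv h2.1 h2.2.1 h2.2.2 hP.symm).symm
  have h1' : a = A ∨ a = B ∨ a = C := by tauto
  have h2' : v = A ∨ v = B ∨ v = C := by tauto
  have pos := h.pos
  rcases h1' with rfl | rfl | rfl <;> rcases h2' with rfl | rfl | rfl <;> first | rfl | (exfalso; (first | rw [hP] at pos | rw [← hP] at pos); simp [ori] at pos; try linarith)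

end ICP

end

set_option linter.all false
noncomputable section
set_option maxHeartbeats 1000000
open Classical Filter Topology

namespace ICP
variable {W : Type} {S : Finset (W × W × W)} {A B C : W} {P : W → ℝ × ℝ}

theorem ori_comb (a b c p x y : ℝ × ℝ) : ori a b c * ori x y p =
    ori b c p * ori x y a + ori c a p * ori x y b + ori a b p * ori x y c := by
  unfold ori; ring

theorem sp2 (h : CS S) {a b c : W} (hm : (a, b, c) ∈ S) : Sp S a ∧ Sp S b ∧ Sp S c :=
  ⟨⟨_, _, hm⟩, ⟨_, _, h.rot _ _ _ hm⟩, ⟨_, _, h.rot' hm⟩⟩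

theorem innS {a b c : W} (hm : (a, b, c) ∈ innF S P) : (a, b, c) ∈ S := (mem_innF.1 hm).1

theorem RS.partner (h : RS S A B C P) {a b c : W} (hm : (a, b, c) ∈ S) :
    (∃ c', (b, a, c') ∈ innF S P) ∨ (a, b) = (A, B) ∨ (a, b) = (B, C) ∨ (a, b) = (C, A) := by
  obtain ⟨c', hc⟩ := h.adj _ _ _ hm
  rcases h.inn_or hc with q | q | q | q
  · exact Or.inl ⟨c', q⟩
  all_goals (simp only [Prod.mk.injEq] at q ⊢; tauto)

theorem RS.cone_gen (h : RS S A B C P) {v x y : W} (hm : (v, x, y) ∈ innF S P) {d : ℝ × ℝ}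
    (hd : d ≠ 0) : ∃ e, crs d e ≠ 0 ∧ 0 < crs (P x - P v) e ∧ 0 < crs e (P y - P v) := by
  have hxy := h.inn_ori hm
  rw [ori_crs] at hxy
  obtain ⟨ε, q1, q2, q3⟩ := ((ev_lin_ne (crs_indep hxy hd)).and (ev_cone hxy)).exists
  exact ⟨_, by rw [crs_mvr]; exact q1, q2, q3⟩

theorem eq_of_two_zero {a b c p : ℝ × ℝ} (h : 0 < ori a b c) (h1 : ori a b p = 0)
    (h2 : ori c a p = 0) : p = a := by
  have e0 := ori_add a b c p
  have e1 := ori_bary a b c p Prod.fst (Or.inl rfl)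
  have e2 := ori_bary a b c p Prod.snd (Or.inr rfl)
  rw [h1, h2] at e0 e1 e2
  have : ori b c p = ori a b c := by linarith
  rw [this] at e1 e2
  have h3 : p.1 = a.1 := by
    have : ori a b c * (a.1 - p.1) = 0 := by linarith
    rcases mul_eq_zero.1 this with q | q <;> linarith
  have h4 : p.2 = a.2 := by
    have : ori a b c * (a.2 - p.2) = 0 := by linarith
    rcases mul_eq_zero.1 this with q | q <;> linarith
  exact Prod.ext h3 h4

theorem ori_sub_ne {a b c : ℝ × ℝ} (h : 0 < ori a b c) : b - a ≠ 0 := by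
  intro h0; rw [ori_crs, h0] at h; simp [crs] at h

theorem RS.no_edge (h : RS S A B C P) {v a b c : W} (hv : Sp S v) (hm : (a, b, c) ∈ innF S P)
    (h1 : ori (P a) (P b) (P v) = 0) (h2 : 0 < ori (P b) (P c) (P v))
    (h3 : 0 < ori (P c) (P a) (P v)) : False := by
  obtain ⟨x, y, hx⟩ := h.sp_inn hv
  have pos := h.inn_ori hm
  obtain ⟨e, q1, q2, q3⟩ := h.cone_gen hx (ori_sub_ne pos)
  obtain ⟨k1, k2, k3⟩ := corner_Cnd (h.inn_ori hx) q2 q3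
  rcases lt_or_gt_of_ne q1 with q1 | q1
  · -- other side
    rcases h.partner (innS hm) with ⟨c', hc'⟩ | ho
    · have pos' := h.inn_ori hc'
      have r1 := ori_comb (P a) (P b) (P c) (P v) (P a) (P c')
      have r2 := ori_comb (P a) (P b) (P c) (P v) (P c') (P b)
      rw [h1, ori_self1] at r1
      rw [h1, ori_self2] at r2
      rw [ori_rot (P b) (P a) (P c')] at r1
      have s2 : ori (P c') (P b) (P a) = ori (P b) (P a) (P c') := by unfold ori; ring
      rw [s2] at r2
      have p1 : 0 < ori (P a) (P c') (P v) := by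
        by_contra hh; push Not at hh; nlinarith [mul_pos h3 pos']
      have p2 : 0 < ori (P c') (P b) (P v) := by
        by_contra hh; push Not at hh; nlinarith [mul_pos h2 pos']
      have hr := h.overlap hx hc' k1 k2 k3
        (Or.inr ⟨by rw [ori_swap, h1, neg_zero], by
          have : crs (P a - P b) e = - crs (P b - P a) e := by simp [crs]; ring
          rw [this]; linarith⟩) (Or.inl p1) (Or.inl p2)
      rcases hr.symm.mem1 with q | q | q
      · rw [q, ori_self1] at h2; exact lt_irrefl _ h2
      · rw [q, ori_self2] at h3; exact lt_irrefl _ h3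
      · rw [q, ori_self2] at p1; exact lt_irrefl _ p1
    · obtain ⟨ε, w1, w2⟩ := ((ev_inT k1 k2 k3).and (ev_neg (a := P a) (b := P b) (p := P v) (e := e) (Or.inr ⟨h1, q1⟩))).exists
      have := h.subT hx w1
      simp only [Prod.mk.injEq] at ho
      rcases ho with ⟨rfl, rfl⟩ | ⟨rfl, rfl⟩ | ⟨rfl, rfl⟩
      · linarith [this.1]
      · linarith [this.2.1]
      · linarith [this.2.2]
  · have hr := h.overlap hx hm k1 k2 k3 (Or.inr ⟨h1, q1⟩) (Or.inl h2) (Or.inl h3)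
    rcases hr.symm.mem1 with q | q | q
    · rw [q, ori_self2] at h3; exact lt_irrefl _ h3
    · rw [q, ori_self1] at h2; exact lt_irrefl _ h2
    · rw [q] at h1; linarith

/-- P2a -/
theorem RS.p2a (h : RS S A B C P) {v a b c : W} (hv : Sp S v) (hm : (a, b, c) ∈ innF S P)
    (hc : clT (P v) (P a) (P b) (P c)) : v = a ∨ v = b ∨ v = c := by
  have pos := h.inn_ori hm
  have m2 := rot_innF h hm
  have m3 := rot_innF h m2
  obtain ⟨sa, sb, sc⟩ := sp2 h.toCS (innS hm)
  obtain ⟨h1, h2, h3⟩ := hc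
  rcases h1.lt_or_eq with h1 | h1 <;> rcases h2.lt_or_eq with h2 | h2 <;>
    rcases h3.lt_or_eq with h3 | h3
  · obtain ⟨x, y, hx⟩ := h.sp_inn hv
    obtain ⟨e, q1, q2, q3⟩ := h.cone_gen hx (ori_sub_ne pos)
    obtain ⟨k1, k2, k3⟩ := corner_Cnd (h.inn_ori hx) q2 q3
    exact (h.overlap hx hm k1 k2 k3 (Or.inl h1) (Or.inl h2) (Or.inl h3)).symm.mem1
  · exact (h.no_edge hv m3 h3.symm h1 h2).elim
  · exact (h.no_edge hv m2 h2.symm h3 h1).elim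
  · right; right
    exact h.inj hv sc (eq_of_two_zero (by rw [ori_rot']; exact pos) h3.symm h2.symm)
  · exact (h.no_edge hv hm h1.symm h2 h3).elim
  · left
    exact h.inj hv sa (eq_of_two_zero pos h1.symm h3.symm)
  · right; left
    exact h.inj hv sb (eq_of_two_zero (by rw [ori_rot]; exact pos) h2.symm h1.symm)
  · have := ori_add (P a) (P b) (P c) (P v)
    linarith

theorem RS.hull_aux (h : RS S A B C P) {v : W} (hv : Sp S v) : 0 ≤ ori (P A) (P B) (P v) := by
  by_contra hn; push Not at hn
  obtain ⟨x, y, hx⟩ := h.sp_inn hv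
  obtain ⟨e, q1, q2, q3⟩ := h.cone_gen hx (d := (1, 0)) (by simp)
  obtain ⟨k1, k2, k3⟩ := corner_Cnd (h.inn_ori hx) q2 q3
  obtain ⟨ε, w1, w2⟩ := ((ev_inT k1 k2 k3).and (ev_neg (e := e) (Or.inl hn))).exists
  linarith [(h.subT hx w1).1]

theorem RS.hull (h : RS S A B C P) {v : W} (hv : Sp S v) : clT (P v) (P A) (P B) (P C) :=
  ⟨h.hull_aux hv, h.rotO.hull_aux hv, h.rotO.rotO.hull_aux hv⟩

theorem RS.hull_aux' (h : RS S A B C P) {v : W} (hv : Sp S v) (hA : v ≠ A) (hB : v ≠ B) :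
    0 < ori (P A) (P B) (P v) := by
  rcases (h.hull_aux hv).lt_or_eq with q | q
  · exact q
  exfalso
  obtain ⟨z, hz⟩ := h.edAB
  obtain ⟨h1, h2, h3⟩ := h.hull hv
  have pos := h.inn_ori hz
  have pos' := h.pos
  have r1 := ori_comb (P A) (P B) (P C) (P v) (P B) (P z)
  have r2 := ori_comb (P A) (P B) (P C) (P v) (P z) (P A)
  rw [← q, ori_self1, ori_rot (P A) (P B) (P z)] at r1
  rw [← q, ori_self2, ori_rot' (P A) (P B) (P z)] at r2
  have hc : clT (P v) (P A) (P B) (P z) := by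
    refine ⟨h1, ?_, ?_⟩
    · by_contra hh; push Not at hh; nlinarith [mul_nonneg h2 pos.le]
    · by_contra hh; push Not at hh; nlinarith [mul_nonneg h3 pos.le]
  rcases h.p2a hv hz hc with w | w | w
  · exact hA w
  · exact hB w
  · rw [w] at q; linarith

theorem RS.hull' (h : RS S A B C P) {v : W} (hv : Sp S v) (hA : v ≠ A) (hB : v ≠ B) (hC : v ≠ C) :
    inT (P v) (P A) (P B) (P C) :=
  ⟨h.hull_aux' hv hA hB, h.rotO.hull_aux' hv hB hC, h.rotO.rotO.hull_aux' hv hC hA⟩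

/-- point on an open segment -/
def lerp (a b : ℝ × ℝ) (s : ℝ) : ℝ × ℝ := (a.1 + s * (b.1 - a.1), a.2 + s * (b.2 - a.2))
def OnSeg (p a b : ℝ × ℝ) : Prop := ∃ s, 0 < s ∧ s < 1 ∧ p = lerp a b s

theorem OnSeg.symm {p a b : ℝ × ℝ} (h : OnSeg p a b) : OnSeg p b a := by
  obtain ⟨s, h0, h1, rfl⟩ := h
  refine ⟨1 - s, by linarith, by linarith, ?_⟩
  unfold lerp; ext <;> (simp only; ring)

theorem ori_lerp (x y a b : ℝ × ℝ) (s : ℝ) :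
    ori x y (lerp a b s) = (1 - s) * ori x y a + s * ori x y b := by
  unfold ori lerp; ring

theorem OnSeg.pos {p a b x y : ℝ × ℝ} (h : OnSeg p a b) (h1 : 0 < ori x y a) (h2 : 0 ≤ ori x y b) :
    0 < ori x y p := by
  obtain ⟨s, q0, q1, rfl⟩ := h
  rw [ori_lerp]
  have : 0 < (1 - s) * ori x y a := mul_pos (by linarith) h1
  have : 0 ≤ s * ori x y b := mul_nonneg q0.le h2
  linarith

theorem OnSeg.edge {p a b c : ℝ × ℝ} (h : OnSeg p a b) (h1 : 0 < ori a b c) :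
    ori a b p = 0 ∧ 0 < ori b c p ∧ 0 < ori c a p := by
  refine ⟨?_, ?_, ?_⟩
  · obtain ⟨s, q0, q1, rfl⟩ := h
    rw [ori_lerp, ori_self1, ori_self2]; ring
  · exact h.pos (by rw [ori_rot]; exact h1) (by rw [ori_self1])
  · exact h.symm.pos (by rw [ori_rot']; exact h1) (by rw [ori_self2])

theorem exists_dir {u w : ℝ × ℝ} (hu : u ≠ 0) (hw : w ≠ 0)
    (h : crs u w ≠ 0 ∨ 0 < u.1 * w.1 + u.2 * w.2) : ∃ e, 0 < crs u e ∧ 0 < crs w e := by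
  have hu2 := sq_pos_of_ne hu
  have hw2 := sq_pos_of_ne hw
  by_cases hc : crs u w = 0
  · have hd : 0 < u.1 * w.1 + u.2 * w.2 := by tauto
    refine ⟨(-u.2, u.1), ?_, ?_⟩
    · simp only [crs]; nlinarith
    · simp only [crs]; nlinarith
  · rcases lt_or_gt_of_ne hc with q | q
    · refine ⟨u - w, ?_, ?_⟩
      · have : crs u (u - w) = - crs u w := by simp [crs]; ring
        rw [this]; linarith
      · have : crs w (u - w) = - crs u w := by simp [crs]; ring
        rw [this]; linarith
    · refine ⟨w - u, ?_, ?_⟩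
      · have : crs u (w - u) = crs u w := by simp [crs]; ring
        rw [this]; linarith
      · have : crs w (w - u) = crs u w := by simp [crs]; ring
        rw [this]; linarith

theorem RS.p2b_aux (h : RS S A B C P) {a b z c d z' : W} (hm : (a, b, z) ∈ innF S P)
    (hm' : (c, d, z') ∈ innF S P) {p : ℝ × ℝ} (h1 : OnSeg p (P a) (P b)) (h2 : OnSeg p (P c) (P d))
    (hd : crs (P b - P a) (P d - P c) ≠ 0 ∨
      0 < (P b - P a).1 * (P d - P c).1 + (P b - P a).2 * (P d - P c).2) : a = c ∧ b = d := by
  obtain ⟨e, e1, e2⟩ := exists_dir (ori_sub_ne (h.inn_ori hm)) (ori_sub_ne (h.inn_ori hm')) hd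
  obtain ⟨k1, k2, k3⟩ := h1.edge (h.inn_ori hm)
  obtain ⟨l1, l2, l3⟩ := h2.edge (h.inn_ori hm')
  have hr := h.overlap hm hm' (Or.inr ⟨k1, e1⟩) (Or.inl k2) (Or.inl k3)
    (Or.inr ⟨l1, e2⟩) (Or.inl l2) (Or.inl l3)
  simp only [Rot3, Prod.mk.injEq] at hr
  rcases hr with ⟨rfl, rfl, rfl⟩ | ⟨rfl, rfl, rfl⟩ | ⟨rfl, rfl, rfl⟩
  · exact ⟨rfl, rfl⟩
  · linarith
  · linarith

theorem RS.ed_inn (h : RS S A B C P) {a b : W} (he : Ed S a b) :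
    ((∃ z, (a, b, z) ∈ innF S P) ∧ ((∃ z, (b, a, z) ∈ innF S P) ∨ (a, b) = (A, B) ∨ (a, b) = (B, C) ∨ (a, b) = (C, A))) ∨
    ((∃ z, (b, a, z) ∈ innF S P) ∧ ((∃ z, (a, b, z) ∈ innF S P) ∨ (b, a) = (A, B) ∨ (b, a) = (B, C) ∨ (b, a) = (C, A))) := by
  obtain ⟨c, hc⟩ := he
  obtain ⟨c', hc'⟩ := h.ed_symm ⟨c, hc⟩
  rcases h.partner hc' with q1 | q1
  · exact Or.inl ⟨q1, h.partner hc⟩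
  · rcases h.partner hc with q2 | q2
    · exact Or.inr ⟨q2, Or.inr q1⟩
    · exfalso
      obtain ⟨n1, n2, n3⟩ := h.ne
      simp only [Prod.mk.injEq] at q1 q2; grind

theorem RS.p2b_aux2 (h : RS S A B C P) {a b z c d z' : W} (hm : (a, b, z) ∈ innF S P)
    (hm' : (c, d, z') ∈ innF S P) {p : ℝ × ℝ} (h1 : OnSeg p (P a) (P b)) (h2 : OnSeg p (P c) (P d)) :
    (a = c ∧ b = d) ∨ (a = d ∧ b = c) := by
  by_cases hd : crs (P b - P a) (P d - P c) ≠ 0 ∨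
      0 < (P b - P a).1 * (P d - P c).1 + (P b - P a).2 * (P d - P c).2
  · exact Or.inl (h.p2b_aux hm hm' h1 h2 hd)
  push Not at hd
  obtain ⟨hd1, hd2⟩ := hd
  have hd2' : (P b - P a).1 * (P d - P c).1 + (P b - P a).2 * (P d - P c).2 < 0 := by
    rcases hd2.lt_or_eq with q | q
    · exact q
    · exfalso
      have u2 := sq_pos_of_ne (ori_sub_ne (h.inn_ori hm))
      have w2 := sq_pos_of_ne (ori_sub_ne (h.inn_ori hm'))
      have : ((P b - P a).1 ^ 2 + (P b - P a).2 ^ 2) * ((P d - P c).1 ^ 2 + (P d - P c).2 ^ 2) =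
        (crs (P b - P a) (P d - P c)) ^ 2 + ((P b - P a).1 * (P d - P c).1 + (P b - P a).2 * (P d - P c).2) ^ 2 := by
        unfold crs; ring
      rw [hd1, q] at this
      nlinarith [mul_pos u2 w2]
  rcases h.partner (innS hm') with ⟨y, hy⟩ | ho
  · right
    refine h.p2b_aux hm hy h1 h2.symm (Or.inr ?_)
    simp only [Prod.fst_sub, Prod.snd_sub] at *; nlinarith
  rcases h.partner (innS hm) with ⟨y, hy⟩ | ho'
  · right
    refine (h.p2b_aux hy hm' h1.symm h2 (Or.inr ?_)).symm
    simp only [Prod.fst_sub, Prod.snd_sub] at *; nlinarith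
  exfalso
  have pos := h.pos
  simp only [Prod.mk.injEq] at ho ho'
  simp only [crs, Prod.fst_sub, Prod.snd_sub] at hd1 hd2'
  simp only [ori] at pos
  rcases ho with ⟨rfl, rfl⟩ | ⟨rfl, rfl⟩ | ⟨rfl, rfl⟩ <;> rcases ho' with ⟨rfl, rfl⟩ | ⟨rfl, rfl⟩ | ⟨rfl, rfl⟩ <;>
    nlinarith

/-- P2b: two edges whose open segments meet coincide -/
theorem RS.p2b (h : RS S A B C P) {a b c d : W} (he : Ed S a b) (hf : Ed S c d)
    {p : ℝ × ℝ} (h1 : OnSeg p (P a) (P b)) (h2 : OnSeg p (P c) (P d)) :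
    (a = c ∧ b = d) ∨ (a = d ∧ b = c) := by
  rcases h.ed_inn he with ⟨⟨z, hz⟩, -⟩ | ⟨⟨z, hz⟩, -⟩ <;>
    rcases h.ed_inn hf with ⟨⟨y, hy⟩, -⟩ | ⟨⟨y, hy⟩, -⟩
  · exact h.p2b_aux2 hz hy h1 h2
  · have := h.p2b_aux2 hz hy h1 h2.symm; tauto
  · have := h.p2b_aux2 hz hy h1.symm h2; tauto
  · have := h.p2b_aux2 hz hy h1.symm h2.symm; tauto

theorem RS.p2c_aux (h : RS S A B C P) {a b c u w y : W} (hm : (a, b, c) ∈ innF S P)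
    (hy : (u, w, y) ∈ innF S P)
    {p : ℝ × ℝ} (h1 : inT p (P a) (P b) (P c)) (h2 : OnSeg p (P u) (P w)) : False := by
  obtain ⟨l1, l2, l3⟩ := h2.edge (h.inn_ori hy)
  have hn := ori_sub_ne (h.inn_ori hy)
  have hr := h.overlap hm hy (e := (-(P w - P u).2, (P w - P u).1)) (Or.inl h1.1) (Or.inl h1.2.1) (Or.inl h1.2.2)
    (Or.inr ⟨l1, by have := sq_pos_of_ne hn; simp only [crs]; nlinarith⟩) (Or.inl l2) (Or.inl l3)
  simp only [Rot3, Prod.mk.injEq] at hr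
  obtain ⟨q1, q2, q3⟩ := h1
  rcases hr with ⟨rfl, rfl, rfl⟩ | ⟨rfl, rfl, rfl⟩ | ⟨rfl, rfl, rfl⟩ <;> linarith

/-- P2c: no edge enters an open inner triangle -/
theorem RS.p2c (h : RS S A B C P) {a b c u w : W} (hm : (a, b, c) ∈ innF S P) (he : Ed S u w)
    {p : ℝ × ℝ} (h1 : inT p (P a) (P b) (P c)) (h2 : OnSeg p (P u) (P w)) : False := by
  rcases h.ed_inn he with ⟨⟨y, hy⟩, -⟩ | ⟨⟨y, hy⟩, -⟩
  · exact h.p2c_aux hm hy h1 h2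
  · exact h.p2c_aux hm hy h1 h2.symm

theorem lerp_mv (a b : ℝ × ℝ) (s : ℝ) : lerp a b s = mv a (b - a) s := by
  simp [lerp, mv]

/-- CONE -/
theorem RS.cone (h : RS S A B C P) {x u w n : W} (hm : (x, u, w) ∈ innF S P) (he : Ed S x n)
    (h1 : 0 < ori (P x) (P u) (P n)) (h2 : 0 < ori (P x) (P n) (P w)) : False := by
  rw [ori_crs] at h1 h2
  obtain ⟨k1, k2, k3⟩ := corner_Cnd (h.inn_ori hm) h1 h2
  obtain ⟨ε, w1, w2⟩ := ((ev_inT k1 k2 k3).and (ev_small 1 one_pos)).exists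
  rw [← lerp_mv] at w1
  exact h.p2c hm he w1 ⟨ε, w2.1, w2.2, rfl⟩

theorem RS.ed_ne (h : RS S A B C P) {a b : W} (he : Ed S a b) : a ≠ b := by
  rcases h.ed_inn he with ⟨⟨y, hy⟩, -⟩ | ⟨⟨y, hy⟩, -⟩
  · exact (ori_ne (h.inn_ori hy)).1
  · exact (ori_ne (h.inn_ori hy)).1.symm

/-- no vertex on an open edge -/
theorem RS.no_vertex (h : RS S A B C P) {v a b : W} (hv : Sp S v) (he : Ed S a b)
    (h1 : OnSeg (P v) (P a) (P b)) : False := by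
  rcases h.ed_inn he with ⟨⟨y, hy⟩, -⟩ | ⟨⟨y, hy⟩, -⟩
  · obtain ⟨l1, l2, l3⟩ := h1.edge (h.inn_ori hy); exact h.no_edge hv hy l1 l2 l3
  · obtain ⟨l1, l2, l3⟩ := h1.symm.edge (h.inn_ori hy); exact h.no_edge hv hy l1 l2 l3

end ICP

end

set_option linter.all false
noncomputable section
set_option maxHeartbeats 1000000
open Classical Filter Topology

namespace ICP
variable {W : Type} {S : Finset (W × W × W)} {A B C : W} {P : W → ℝ × ℝ}

theorem onSeg_of_zero {a b c p : ℝ × ℝ} (h : 0 < ori a b c) (h1 : ori a b p = 0)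
    (h2 : 0 < ori b c p) (h3 : 0 < ori c a p) : OnSeg p a b := by
  have e0 := ori_add a b c p
  have e1 := ori_bary a b c p Prod.fst (Or.inl rfl)
  have e2 := ori_bary a b c p Prod.snd (Or.inr rfl)
  rw [h1] at e0 e1 e2
  refine ⟨ori c a p / ori a b c, by positivity, by rw [div_lt_one h]; linarith, ?_⟩
  unfold lerp
  ext
  · simp only; field_simp; rw [← e0]; linarith
  · simp only; field_simp; rw [← e0]; linarith

theorem closed_side {a b c p : ℝ × ℝ} (h : 0 < ori a b c) (h1 : ori a b p = 0)
    (h2 : 0 ≤ ori b c p) (h3 : 0 ≤ ori c a p) : p = a ∨ p = b ∨ OnSeg p a b := by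
  rcases h3.lt_or_eq with q3 | q3
  · rcases h2.lt_or_eq with q2 | q2
    · exact Or.inr (Or.inr (onSeg_of_zero h h1 q2 q3))
    · exact Or.inr (Or.inl (eq_of_two_zero (by rw [ori_rot]; exact h) q2.symm h1))
  · exact Or.inl (eq_of_two_zero h h1 q3.symm)

/-- two segments cross -/
theorem seg_cross {a b c d : ℝ × ℝ} (h1 : 0 < ori a b c) (h2 : ori a b d < 0)
    (h3 : 0 < ori c d b) (h4 : ori c d a < 0) : ∃ p, OnSeg p a b ∧ OnSeg p c d := by
  have hD : ori a b c - ori a b d = ori c d b - ori c d a := by unfold ori; ring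
  have hpos : 0 < ori a b c - ori a b d := by linarith
  have hpos2 : 0 < ori c d b - ori c d a := by linarith
  refine ⟨lerp a b (-ori c d a / (ori c d b - ori c d a)),
    ⟨_, by apply div_pos <;> linarith, by rw [div_lt_one hpos2]; linarith, rfl⟩,
    ⟨ori a b c / (ori a b c - ori a b d), by positivity, by rw [div_lt_one hpos]; linarith, ?_⟩⟩
  unfold lerp
  rw [← hD]
  ext
  · simp only; field_simp; unfold ori; ring
  · simp only; field_simp; unfold ori; ring

def exS (a b : ℝ) : ℝ := if b < 0 then a / (a - b) else 1

theorem exS_lin {a b s : ℝ} (ha : 0 < a) (hs : 0 ≤ s) (hs1 : s ≤ exS a b) : 0 ≤ (1 - s) * a + s * b := by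
  unfold exS at hs1
  split_ifs at hs1 with h
  · rw [le_div_iff₀ (by linarith)] at hs1; linarith
  · nlinarith
theorem exS_prop {a b : ℝ} (ha : 0 < a) : 0 < exS a b ∧ (exS a b < 1 → b < 0 ∧ (1 - exS a b) * a + exS a b * b = 0) := by
  unfold exS
  split_ifs with h
  · have : 0 < a - b := by linarith
    refine ⟨by positivity, fun _ => ⟨h, ?_⟩⟩
    field_simp; ring
  · exact ⟨one_pos, fun q => absurd q (lt_irrefl _)⟩
theorem exS_lt {a b : ℝ} (ha : 0 < a) (hb : b < 0) : exS a b < 1 := by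
  unfold exS; rw [if_pos hb, div_lt_one (by linarith)]; linarith

theorem exit_aux {x y z i o : ℝ × ℝ} (h : 0 < ori x y z) (hi : inT i x y z)
    (h1 : exS (ori x y i) (ori x y o) < 1)
    (h2 : exS (ori x y i) (ori x y o) ≤ exS (ori y z i) (ori y z o))
    (h3 : exS (ori x y i) (ori x y o) ≤ exS (ori z x i) (ori z x o)) :
    ∃ p, OnSeg p i o ∧ (p = x ∨ p = y ∨ OnSeg p x y) := by
  obtain ⟨q0, q1⟩ := exS_prop (b := ori x y o) hi.1
  obtain ⟨q2, q3⟩ := q1 h1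
  refine ⟨lerp i o (exS (ori x y i) (ori x y o)), ⟨_, q0, h1, rfl⟩, closed_side h ?_ ?_ ?_⟩
  · rw [ori_lerp]; exact q3
  · rw [ori_lerp]; exact exS_lin hi.2.1 q0.le h2
  · rw [ori_lerp]; exact exS_lin hi.2.2 q0.le h3

theorem exit_tri {x y z i o : ℝ × ℝ} (h : 0 < ori x y z) (hi : inT i x y z) (ho : ¬ clT o x y z) :
    ∃ p, OnSeg p i o ∧ (p = x ∨ p = y ∨ p = z ∨ OnSeg p x y ∨ OnSeg p y z ∨ OnSeg p z x) := by
  have key : exS (ori x y i) (ori x y o) < 1 ∨ exS (ori y z i) (ori y z o) < 1 ∨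
      exS (ori z x i) (ori z x o) < 1 := by
    by_contra hn; push Not at hn
    apply ho
    refine ⟨?_, ?_, ?_⟩
    · by_contra q; push Not at q; linarith [exS_lt hi.1 q, hn.1]
    · by_contra q; push Not at q; linarith [exS_lt hi.2.1 q, hn.2.1]
    · by_contra q; push Not at q; linarith [exS_lt hi.2.2 q, hn.2.2]
  have hmin : ∀ a b c : ℝ, (a < 1 ∨ b < 1 ∨ c < 1) → (a < 1 ∧ a ≤ b ∧ a ≤ c) ∨ (b < 1 ∧ b ≤ c ∧ b ≤ a) ∨
      (c < 1 ∧ c ≤ a ∧ c ≤ b) := by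
    intro a b c hk
    rcases le_total a b with a1 | a1 <;> rcases le_total b c with a2 | a2 <;>
      rcases le_total a c with a3 | a3 <;> grind
  rcases hmin _ _ _ key with ⟨k1, k2, k3⟩ | ⟨k1, k2, k3⟩ | ⟨k1, k2, k3⟩
  · obtain ⟨p, h1, h2⟩ := exit_aux h hi k1 k2 k3
    exact ⟨p, h1, by tauto⟩
  · obtain ⟨p, h1, h2⟩ := exit_aux (by rw [ori_rot]; exact h) (inT_rot hi) k1 k2 k3
    exact ⟨p, h1, by tauto⟩
  · obtain ⟨p, h1, h2⟩ := exit_aux (by rw [ori_rot']; exact h) (inT_rot (inT_rot hi)) k1 k2 k3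
    exact ⟨p, h1, by tauto⟩

/-- CROSS3 in a realised sphere -/
theorem RS.cross3 (h : RS S A B C P) {x y z i o : W} (hT : 0 < ori (P x) (P y) (P z))
    (e1 : Ed S x y) (e2 : Ed S y z) (e3 : Ed S z x) (hi : inT (P i) (P x) (P y) (P z))
    (ho : ¬ clT (P o) (P x) (P y) (P z)) (he : Ed S i o) : False := by
  obtain ⟨i1, i2, i3⟩ := hi
  have nx : i ≠ x := by rintro rfl; rw [ori_self1] at i1; exact lt_irrefl _ i1
  have ny : i ≠ y := by rintro rfl; rw [ori_self2] at i1; exact lt_irrefl _ i1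
  have nz : i ≠ z := by rintro rfl; rw [ori_self2] at i2; exact lt_irrefl _ i2
  obtain ⟨p, hp, q | q | q | q | q | q⟩ := exit_tri hT ⟨i1, i2, i3⟩ ho
  · subst q; exact h.no_vertex (h.sp_l e1) he hp
  · subst q; exact h.no_vertex (h.sp_l e2) he hp
  · subst q; exact h.no_vertex (h.sp_l e3) he hp
  · have := h.p2b he e1 hp q; tauto
  · have := h.p2b he e2 hp q; tauto
  · have := h.p2b he e3 hp q; tauto

theorem RS.ray (h : RS S A B C P) {v a d : W} (ha : Ed S v a) (hd : Ed S v d)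
    (h0 : crs (P a - P v) (P d - P v) = 0)
    (hpos : 0 < (P a - P v).1 * (P d - P v).1 + (P a - P v).2 * (P d - P v).2) : a = d := by
  have hd0 : P d - P v ≠ 0 := by
    intro q; rw [q] at hpos; simp at hpos
  have hd2 := sq_pos_of_ne hd0
  set μ := ((P a - P v).1 * (P d - P v).1 + (P a - P v).2 * (P d - P v).2) /
    ((P d - P v).1 ^ 2 + (P d - P v).2 ^ 2) with hμ
  have hμ0 : 0 < μ := by positivity
  have e : P a - P v = (μ * (P d - P v).1, μ * (P d - P v).2) := by
    simp only [crs] at h0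
    ext
    · simp only [hμ]; field_simp; linear_combination (P d - P v).2 * h0
    · simp only [hμ]; field_simp; linear_combination (-(P d - P v).1) * h0
  have e1 := congrArg Prod.fst e
  have e2 := congrArg Prod.snd e
  simp only [Prod.fst_sub, Prod.snd_sub] at e1 e2
  have k1 : OnSeg (lerp (P v) (P a) (1 / (1 + μ))) (P v) (P a) :=
    ⟨_, by positivity, by rw [div_lt_one (by positivity)]; linarith, rfl⟩
  have k2 : OnSeg (lerp (P v) (P a) (1 / (1 + μ))) (P v) (P d) :=
    ⟨μ / (1 + μ), by positivity, by rw [div_lt_one (by positivity)]; linarith, by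
      unfold lerp; ext
      · simp only; rw [e1]; ring
      · simp only; rw [e2]; ring⟩
  have := h.p2b ha hd k1 k2
  have n1 := h.ed_ne ha
  tauto

theorem crs_cyc (a b c d : ℝ × ℝ) : crs b c * crs a d + crs c a * crs b d + crs a b * crs c d = 0 := by
  unfold crs; ring

theorem dot_pos_of {a b d : ℝ × ℝ} (h0 : crs b d = 0) (h1 : 0 < crs a b) (h2 : 0 < crs a d) :
    0 < b.1 * d.1 + b.2 * d.2 := by
  have e := crs3 b a d
  have hb : b ≠ 0 := by rintro rfl; simp [crs] at h1
  have := sq_pos_of_ne hb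
  rw [h0, crs_comm b a] at e
  by_contra hh; push Not at hh
  nlinarith [mul_pos h2 this]

theorem dot_pos_of' {a b d : ℝ × ℝ} (h0 : crs b d = 0) (h1 : crs a b < 0) (h2 : crs a d < 0) :
    0 < b.1 * d.1 + b.2 * d.2 := by
  have e := crs3 b a d
  have hb : b ≠ 0 := by rintro rfl; simp [crs] at h1
  have := sq_pos_of_ne hb
  rw [h0, crs_comm b a] at e
  by_contra hh; push Not at hh
  nlinarith [mul_pos (neg_pos.2 h2) this]

/-- a neighbour lying strictly in the cone of two others, joined by an edge, is inside the triangle -/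
theorem RS.in_tri (h : RS S A B C P) {v a b c : W} (ha : Ed S v a) (hb : Ed S v b) (hc : Ed S v c)
    (hac : Ed S a c) (h1 : 0 < ori (P v) (P a) (P b)) (h2 : 0 < ori (P v) (P b) (P c))
    (h3 : 0 < ori (P v) (P a) (P c)) : inT (P b) (P v) (P a) (P c) := by
  have h2' : 0 < ori (P c) (P v) (P b) := by rw [ori_rot']; exact h2
  have nb1 : b ≠ a := by rintro rfl; rw [ori_self2] at h1; exact lt_irrefl _ h1
  have nb2 : b ≠ c := by rintro rfl; rw [ori_self2] at h2; exact lt_irrefl _ h2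
  refine ⟨h1, ?_, h2'⟩
  by_contra hn; push Not at hn
  rcases hn.lt_or_eq with q | q
  · obtain ⟨p, k1, k2⟩ := seg_cross (a := P v) (b := P b) (c := P c) (d := P a) h2 (by rw [ori_swap']; linarith)
      (by rw [ori_swap]; linarith) (by rw [ori_rot, ori_swap']; linarith)
    have := h.p2b hb hac k1 k2.symm
    have := h.ed_ne ha; have := h.ed_ne hc
    tauto
  · exact h.no_vertex (h.sp_r hb) hac (onSeg_of_zero (c := P v) (by rw [ori_rot]; exact h3) q h2' h1)

/-- N1 prime -/
theorem RS.n1 (h : RS S A B C P) {v a b c d : W} (m1 : (v, a, b) ∈ innF S P) (m2 : (v, b, c) ∈ innF S P)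
    (hd : Ed S v d) (da : d ≠ a) (db : d ≠ b) (dc : d ≠ c) (hac : Ed S a c) (hbd : Ed S b d) : False := by
  have ha : Ed S v a := ⟨_, innS m1⟩
  have hb : Ed S v b := ⟨_, innS m2⟩
  have hc : Ed S v c := h.ed_symm ⟨_, h.rot' (innS m2)⟩
  have p1 := h.inn_ori m1
  have p2 := h.inn_ori m2
  have nva := h.ed_ne ha
  have nvb := h.ed_ne hb
  have nvc := h.ed_ne hc
  have nvd := h.ed_ne hd
  have f1 : ¬ (0 < crs (P a - P v) (P d - P v) ∧ crs (P b - P v) (P d - P v) < 0) := by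
    rintro ⟨x, y⟩
    exact h.cone m1 hd (by rw [ori_crs]; exact x) (by rw [ori_crs, crs_comm]; linarith)
  have f2 : ¬ (0 < crs (P b - P v) (P d - P v) ∧ crs (P c - P v) (P d - P v) < 0) := by
    rintro ⟨x, y⟩
    exact h.cone m2 hd (by rw [ori_crs]; exact x) (by rw [ori_crs, crs_comm]; linarith)
  have r1 : ¬ (crs (P a - P v) (P d - P v) = 0 ∧ _) := fun q => da (h.ray ha hd q.1 q.2).symm
  have r2 : ¬ (crs (P b - P v) (P d - P v) = 0 ∧ _) := fun q => db (h.ray hb hd q.1 q.2).symm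
  have r3 : ¬ (crs (P c - P v) (P d - P v) = 0 ∧ _) := fun q => dc (h.ray hc hd q.1 q.2).symm
  rcases lt_trichotomy (ori (P v) (P a) (P c)) 0 with q | q | q
  · -- triangle v c a
    have q' : 0 < ori (P v) (P c) (P a) := by rw [ori_swap']; linarith
    have pd : 0 < crs (P c - P v) (P d - P v) ∧ crs (P a - P v) (P d - P v) < 0 := by
      have cyc := crs_cyc (P a - P v) (P b - P v) (P c - P v) (P d - P v)
      have cca := q'
      rw [ori_crs] at p1 p2 cca
      have hd0 : P d - P v ≠ 0 := by
        intro h0; exact nvd (h.inj (h.sp_l hd) (h.sp_r hd) (sub_eq_zero.1 h0).symm)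
      rcases lt_trichotomy (crs (P a - P v) (P d - P v)) 0 with x | x | x
      · refine ⟨?_, x⟩
        by_contra hh; push Not at hh
        rcases lt_or_ge 0 (crs (P b - P v) (P d - P v)) with y | y
        · rcases hh.lt_or_eq with z | z
          · exact f2 ⟨y, z⟩
          · refine r3 ⟨z, dot_pos_of (a := P b - P v) z p2 y⟩
        · nlinarith [mul_pos p2 (neg_pos.2 x), mul_nonneg cca.le (neg_nonneg.2 y), mul_nonneg p1.le (neg_nonneg.2 hh)]
      · exfalso
        rcases lt_trichotomy (crs (P b - P v) (P d - P v)) 0 with y | y | y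
        · exact r1 ⟨x, dot_pos_of' (a := P b - P v) x (by rw [crs_comm]; linarith) y⟩
        · have := crs_indep p1 hd0
          exact this ⟨by rw [crs_comm, x, neg_zero], by rw [crs_comm, y, neg_zero]⟩
        · apply f2 ⟨y, ?_⟩
          by_contra hh; push Not at hh
          rw [x] at cyc
          nlinarith [mul_pos cca y, mul_nonneg p1.le hh]
      · exfalso
        have y : 0 ≤ crs (P b - P v) (P d - P v) := by
          by_contra hh; push Not at hh; exact f1 ⟨x, hh⟩
        have z : crs (P c - P v) (P d - P v) < 0 := by
          by_contra hh; push Not at hh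
          nlinarith [mul_pos p2 x, mul_nonneg cca.le y, mul_nonneg p1.le hh]
        rcases y.lt_or_eq with y | y
        · exact f2 ⟨y, z⟩
        · exact r2 ⟨y.symm, dot_pos_of (a := P a - P v) y.symm p1 x⟩
    have hin : inT (P d) (P v) (P c) (P a) := h.in_tri hc hd ha (h.ed_symm hac)
      (by rw [ori_crs]; exact pd.1) (by rw [ori_crs, crs_comm]; linarith [pd.2]) q'
    refine h.cross3 q' hc (h.ed_symm hac) (h.ed_symm ha) hin ?_ (h.ed_symm hbd)
    intro hcl
    have := hcl.1
    rw [ori_swap'] at this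
    linarith
  · -- collinear: v on ac
    have hz : OnSeg (P v) (P a) (P c) := by
      rw [ori_crs] at q p1 p2
      set a' := P a - P v with ha'
      set b' := P b - P v
      set c' := P c - P v with hc'
      have hb0 : b' ≠ 0 := by intro h0; rw [h0] at p1; simp [crs] at p1
      have e1 : crs b' c' * a'.1 + crs a' b' * c'.1 = 0 := by
        have : crs b' c' * a'.1 + crs a' b' * c'.1 = crs a' c' * b'.1 := by unfold crs; ring
        rw [this, q, zero_mul]
      have e2 : crs b' c' * a'.2 + crs a' b' * c'.2 = 0 := by
        have : crs b' c' * a'.2 + crs a' b' * c'.2 = crs a' c' * b'.2 := by unfold crs; ring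
        rw [this, q, zero_mul]
      refine ⟨crs a' b' / (crs a' b' + crs b' c'), by positivity, by
        rw [div_lt_one (by positivity)]; linarith, ?_⟩
      have s1 : (P a).1 = a'.1 + (P v).1 := by simp [ha']
      have s2 : (P a).2 = a'.2 + (P v).2 := by simp [ha']
      have s3 : (P c).1 = c'.1 + (P v).1 := by simp [hc']
      have s4 : (P c).2 = c'.2 + (P v).2 := by simp [hc']
      unfold lerp
      ext
      · simp only [s1, s3]; field_simp; linear_combination -e1
      · simp only [s2, s4]; field_simp; linear_combination -e2
    exact h.no_vertex (h.sp_l ha) hac hz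
  · have hin := h.in_tri ha hb hc hac p1 p2 q
    refine h.cross3 q ha hac (h.ed_symm hc) hin ?_ hbd
    intro hcl
    have y1 : 0 ≤ crs (P a - P v) (P d - P v) := by rw [← ori_crs]; exact hcl.1
    have y3 : crs (P c - P v) (P d - P v) ≤ 0 := by
      have := hcl.2.2
      rw [ori_swap, ori_crs] at this; linarith
    rw [ori_crs] at p1 p2 q
    -- rule out boundary
    have nd : d ≠ v := nvd.symm
    have y1' : 0 < crs (P a - P v) (P d - P v) := by
      rcases y1.lt_or_eq with w | w
      · exact w
      · exfalso
        have := crs_cyc (P a - P v) (P b - P v) (P c - P v) (P d - P v)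
        rcases y3.lt_or_eq with w3 | w3
        · exact r1 ⟨w.symm, dot_pos_of' (a := P c - P v) w.symm (by rw [crs_comm]; linarith) w3⟩
        · have hd0 : P d - P v ≠ 0 := by
            intro h0; exact nvd (h.inj (h.sp_l hd) (h.sp_r hd) (sub_eq_zero.1 h0).symm)
          exact crs_indep q hd0 ⟨by rw [crs_comm, ← w, neg_zero], by rw [crs_comm, w3, neg_zero]⟩
    have y3' : crs (P c - P v) (P d - P v) < 0 := by
      rcases y3.lt_or_eq with w | w
      · exact w
      · exact absurd ⟨w, dot_pos_of (a := P a - P v) w q y1'⟩ r3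
    rcases lt_trichotomy (crs (P b - P v) (P d - P v)) 0 with z | z | z
    · exact f1 ⟨y1', z⟩
    · exact r2 ⟨z, dot_pos_of (a := P a - P v) z p1 y1'⟩
    · exact f2 ⟨z, y3'⟩

end ICP

end

set_option linter.all false
noncomputable section
set_option maxHeartbeats 1000000
open Classical Filter Topology
namespace ICP

/-- two drawings with the same abscissae and compatible vertical order -/
structure Ord2 {W : Type} (E : W → W → Prop) (N : W → Prop) (P R : W → ℝ × ℝ) : Prop where
  sym : ∀ a b, E a b → E b a
  mem : ∀ a b, E a b → N b
  hx : ∀ v, (R v).1 = (P v).1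
  inj : ∀ a b, N a → N b → (P a).1 = (P b).1 → a = b
  nv : ∀ a b p, E a b → N p → (P a).1 < (P p).1 → (P p).1 < (P b).1 → ori (P a) (P b) (P p) ≠ 0
  nc : ∀ a b c d, E a b → E c d → ori (P a) (P b) (P c) * ori (P a) (P b) (P d) < 0 →
    ori (P c) (P d) (P a) * ori (P c) (P d) (P b) < 0 → False
  per : ∀ a b p, E a b → N p → (P a).1 < (P p).1 → (P p).1 < (P b).1 →
    (ori (P a) (P b) (P p) < 0 → ori (R a) (R b) (R p) ≤ 0) ∧
    (0 < ori (P a) (P b) (P p) → 0 ≤ ori (R a) (R b) (R p))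

def fx (p : ℝ × ℝ) : ℝ × ℝ := (-p.1, p.2)
def fy (p : ℝ × ℝ) : ℝ × ℝ := (p.1, -p.2)
theorem ori_fx (a b c : ℝ × ℝ) : ori (fx a) (fx b) (fx c) = - ori a b c := by
  simp [ori, fx]; ring
theorem ori_fy (a b c : ℝ × ℝ) : ori (fy a) (fy b) (fy c) = - ori a b c := by
  simp [ori, fy]; ring

section
variable {W : Type} {E : W → W → Prop} {N : W → Prop} {P R : W → ℝ × ℝ}

theorem Ord2.fx (h : Ord2 E N P R) : Ord2 E N (fun v => fx (P v)) (fun v => fx (R v)) where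
  sym := h.sym
  mem := h.mem
  hx v := by simp [ICP.fx, h.hx]
  inj a b ha hb e := h.inj a b ha hb (by simpa [ICP.fx] using e)
  nv a b p he hp h1 h2 := by
    simp only [ori_fx]
    simp only [ICP.fx] at h1 h2
    have := h.nv b a p (h.sym _ _ he) hp (by linarith) (by linarith)
    rw [ori_swap] at this
    exact this
  nc a b c d h1 h2 h3 h4 := by
    simp only [ori_fx] at h3 h4
    exact h.nc a b c d h1 h2 (by linarith) (by linarith)
  per a b p he hp h1 h2 := by
    simp only [ori_fx]
    simp only [ICP.fx] at h1 h2
    have := h.per b a p (h.sym _ _ he) hp (by linarith) (by linarith)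
    rw [ori_swap, ori_swap (R a)] at this
    exact this

theorem Ord2.fy (h : Ord2 E N P R) : Ord2 E N (fun v => fy (P v)) (fun v => fy (R v)) where
  sym := h.sym
  mem := h.mem
  hx v := by simp [ICP.fy, h.hx]
  inj a b ha hb e := h.inj a b ha hb (by simpa [ICP.fy] using e)
  nv a b p he hp h1 h2 := by
    simp only [ori_fy]
    simp only [ICP.fy] at h1 h2
    have := h.nv a b p he hp h1 h2
    simpa using this
  nc a b c d h1 h2 h3 h4 := by
    simp only [ori_fy] at h3 h4
    exact h.nc a b c d h1 h2 (by linarith) (by linarith)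
  per a b p he hp h1 h2 := by
    simp only [ori_fy]
    simp only [ICP.fy] at h1 h2
    have := h.per a b p he hp h1 h2
    constructor
    · intro h3; have := this.2 (by linarith); linarith
    · intro h3; have := this.1 (by linarith); linarith

theorem ori_x1 (a b v r : ℝ × ℝ) : ori v r a * (b.1 - a.1) =
    (v.1 - a.1) * ori a b r - (r.1 - a.1) * ori a b v := by unfold ori; ring
theorem ori_x2 (a b v r : ℝ × ℝ) : ori v r b * (b.1 - a.1) =
    (v.1 - b.1) * ori a b r - (r.1 - b.1) * ori a b v := by unfold ori; ring

theorem Ord2.fl (h : Ord2 E N P R) {a b v r : W} (he : E a b) (h1 : (P a).1 < (P v).1)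
    (h2 : (P v).1 < (P b).1) (h3 : ori (P a) (P b) (P v) < 0) (h4 : ori (R a) (R b) (R v) = 0)
    (hr : E v r) (h5 : (P v).1 < (P r).1) : ori (R a) (R b) (R r) ≤ 0 := by
  have k1 := ori_x1 (P a) (P b) (P v) (P r)
  have k2 := ori_x2 (P a) (P b) (P v) (P r)
  have k3 := ori_x2 (R a) (R b) (R v) (R r)
  have hba : 0 < (P b).1 - (P a).1 := by linarith
  have key : 0 < ori (P a) (P b) (P r) → ori (P v) (P r) (P b) < 0 → False := by
    intro g1 g2
    have g3 : 0 < ori (P v) (P r) (P a) * ((P b).1 - (P a).1) := by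
      rw [k1]
      have := mul_pos (sub_pos.2 h1) g1
      have := mul_pos (show 0 < (P r).1 - (P a).1 by linarith) (neg_pos.2 h3)
      linarith
    have g4 : 0 < ori (P v) (P r) (P a) := (mul_pos_iff_of_pos_right hba).1 g3
    exact h.nc a b v r he hr (mul_neg_of_neg_of_pos h3 g1) (mul_neg_of_pos_of_neg g4 g2)
  rcases lt_trichotomy (P r).1 (P b).1 with c | c | c
  · have hn := h.nv a b r he (h.mem _ _ hr) (by linarith) c
    have hp := h.per a b r he (h.mem _ _ hr) (by linarith) c
    rcases lt_or_gt_of_ne hn with g | g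
    · exact hp.1 g
    · exfalso
      refine key g ?_
      have : ori (P v) (P r) (P b) * ((P b).1 - (P a).1) < 0 := by
        rw [k2]
        have := mul_pos (sub_pos.2 h2) g
        have := mul_pos (sub_pos.2 c) (neg_pos.2 h3)
        linarith
      by_contra hc
      push Not at hc
      have := mul_nonneg hc hba.le
      linarith
  · have := h.inj r b (h.mem _ _ hr) (h.mem _ _ he) c
    rw [this, ori_self2]
  · have hn := h.nv v r b hr (h.mem _ _ he) h2 c
    have hp := h.per v r b hr (h.mem _ _ he) h2 c
    rcases lt_or_gt_of_ne hn with g | g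
    · exfalso
      refine key ?_ g
      have e1 := mul_pos (neg_pos.2 g) hba
      have e2 := mul_pos (sub_pos.2 c) (neg_pos.2 h3)
      by_contra hc
      push Not at hc
      have := mul_nonneg (sub_pos.2 h2).le (neg_nonneg.2 hc)
      linarith
    · have g1 := hp.2 g
      rw [h4, h.hx, h.hx, h.hx] at k3
      have g2 := mul_nonneg g1 hba.le
      by_contra hc
      push Not at hc
      have := mul_pos (sub_pos.2 h2) hc
      linarith

theorem Ord2.fl2 (h : Ord2 E N P R) {a b v r : W} (hv : N v) (he : E a b) (h1 : (P a).1 < (P v).1)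
    (h2 : (P v).1 < (P b).1) (h3 : ori (P a) (P b) (P v) < 0) (h4 : ori (R a) (R b) (R v) = 0)
    (hr : E v r) (hvr : v ≠ r) : ori (R a) (R b) (R r) ≤ 0 := by
  rcases lt_trichotomy (P v).1 (P r).1 with c | c | c
  · exact h.fl he h1 h2 h3 h4 hr c
  · exact absurd (h.inj _ _ hv (h.mem _ _ hr) c) hvr
  · have := h.fx.fl (a := b) (b := a) (v := v) (r := r) (h.sym _ _ he) (by simp [ICP.fx, h2])
      (by simp [ICP.fx, h1]) (by rw [ori_fx, ori_swap]; simpa using h3)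
      (by rw [ori_fx, ori_swap]; simpa using h4) hr (by simp [ICP.fx, c])
    rw [ori_fx, ori_swap] at this
    simpa using this

/-- all neighbours lie on one closed side -/
theorem Ord2.flat (h : Ord2 E N P R) {a b v : W} (hv : N v) (hne : ∀ r, E v r → v ≠ r) (he : E a b)
    (h1 : (P a).1 < (P v).1)
    (h2 : (P v).1 < (P b).1) (h4 : ori (R a) (R b) (R v) = 0) :
    (∀ r, E v r → ori (R a) (R b) (R r) ≤ 0) ∨ (∀ r, E v r → 0 ≤ ori (R a) (R b) (R r)) := by
  rcases lt_or_gt_of_ne (h.nv a b v he hv h1 h2) with g | g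
  · left; intro r hr; exact h.fl2 hv he h1 h2 g h4 hr (hne r hr)
  · right; intro r hr
    have := h.fy.fl2 (a := a) (b := b) (v := v) (r := r) hv he h1 h2 (by rw [ori_fy]; linarith)
      (by rw [ori_fy, h4]; simp) hr (hne r hr)
    rw [ori_fy] at this
    linarith

end

/-- family of quadrilaterals -/
structure QOK {W : Type} (S : Finset (W × W × W)) (P : W → ℝ × ℝ) (Q : W → W → W → W → Prop) : Prop where
  sym : ∀ a b c d, Q a b c d → Q c d a b
  t1 : ∀ a b c d, Q a b c d → (a, b, c) ∈ innF S P
  t2 : ∀ a b c d, Q a b c d → (a, c, d) ∈ innF S P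
  nd : ∀ a b c d, Q a b c d → ¬ Ed S b d
  dis : ∀ a b c d a' b' c' d' x, Q a b c d → Q a' b' c' d' → (x = a ∨ x = b ∨ x = c ∨ x = d) →
    (x = a' ∨ x = b' ∨ x = c' ∨ x = d') → (a' = a ∧ b' = b ∧ c' = c ∧ d' = d) ∨
      (a' = c ∧ b' = d ∧ c' = a ∧ d' = b)

/-- edges that are not diagonals -/
def Es {W : Type} (S : Finset (W × W × W)) (Q : W → W → W → W → Prop) (u v : W) : Prop :=
  Ed S u v ∧ ¬ ∃ b d, Q u b v d

section
variable {W : Type} {S : Finset (W × W × W)} {A B C : W} {P R : W → ℝ × ℝ} {Q : W → W → W → W → Prop}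

theorem QOK.es_symm (hq : QOK S P Q) (h : CS S) {u v : W} (he : Es S Q u v) : Es S Q v u :=
  ⟨h.ed_symm he.1, fun ⟨b, d, hh⟩ => he.2 ⟨d, b, hq.sym _ _ _ _ hh⟩⟩

theorem QOK.ne (hq : QOK S P Q) {a b c d : W} (h : Q a b c d) :
    a ≠ b ∧ b ≠ c ∧ a ≠ c ∧ c ≠ d ∧ a ≠ d ∧ b ≠ d := by
  obtain ⟨h1, h2, h3⟩ := ori_ne (mem_innF.1 (hq.t1 _ _ _ _ h)).2
  obtain ⟨h4, h5, h6⟩ := ori_ne (mem_innF.1 (hq.t2 _ _ _ _ h)).2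
  refine ⟨h1, h2, h3, h5, h6, ?_⟩
  rintro rfl
  have e1 := (mem_innF.1 (hq.t1 _ _ _ _ h)).2
  have e2 := (mem_innF.1 (hq.t2 _ _ _ _ h)).2
  rw [ori_swap'] at e2
  linarith

theorem QOK.es (hq : QOK S P Q) (hS : CS S) {a b c d : W} (h : Q a b c d) :
    Es S Q a b ∧ Es S Q b c ∧ Es S Q c d ∧ Es S Q d a := by
  have h1 := innS (hq.t1 _ _ _ _ h)
  have h2 := innS (hq.t2 _ _ _ _ h)
  obtain ⟨n1, n2, n3, n4, n5, n6⟩ := hq.ne h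
  refine ⟨⟨⟨_, h1⟩, ?_⟩, ⟨⟨_, hS.rot _ _ _ h1⟩, ?_⟩, ⟨⟨_, hS.rot _ _ _ h2⟩, ?_⟩, ⟨⟨_, hS.rot' h2⟩, ?_⟩⟩
  all_goals
    rintro ⟨x, y, hh⟩
    rcases hq.dis _ _ _ _ _ _ _ _ _ h hh (by first | exact Or.inl rfl | exact Or.inr (Or.inl rfl) | exact Or.inr (Or.inr (Or.inl rfl)) | exact Or.inr (Or.inr (Or.inr rfl))) (Or.inl rfl) with ⟨e1, e2, e3, e4⟩ | ⟨e1, e2, e3, e4⟩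
    all_goals first | exact n1 (by simp_all) | exact n2 (by simp_all) | exact n3 (by simp_all) | exact n4 (by simp_all) | exact n5 (by simp_all) | exact n6 (by simp_all) | simp_all

end
end ICP

end

set_option linter.all false
noncomputable section
set_option maxHeartbeats 1000000
open Classical Filter Topology
namespace ICP
section
variable {W : Type} {S : Finset (W × W × W)} {A B C : W} {P R : W → ℝ × ℝ} {Q : W → W → W → W → Prop}

/-- link identity -/
theorem link_sum (hS : CS S) (Z : W → Prop) (φ : W → W → ℝ) (hφ : ∀ a b, φ a b + φ b a = 0) :
    ∑ t ∈ S.filter (fun t => Z t.2.2 ∧ ¬ Z t.1 ∧ ¬ Z t.2.1), φ t.1 t.2.1 =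
    ∑ t ∈ S.filter (fun t => Z t.1 ∨ Z t.2.1 ∨ Z t.2.2), φ t.1 t.2.1 := by
  have h0 : ∀ a, φ a a = 0 := fun a => by have := hφ a a; linarith
  have h1 := anti (S.filter (fun t => Z t.1 ∨ Z t.2.1)) ?_ ?_ φ hφ h0
  · have h2 : S.filter (fun t => Z t.1 ∨ Z t.2.1 ∨ Z t.2.2) =
        S.filter (fun t => Z t.1 ∨ Z t.2.1) ∪ S.filter (fun t => Z t.2.2 ∧ ¬ Z t.1 ∧ ¬ Z t.2.1) := by
      ext t; simp only [Finset.mem_filter, Finset.mem_union]; tauto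
    rw [h2, Finset.sum_union, h1, zero_add]
    rw [Finset.disjoint_left]
    intro t ht ht'
    simp only [Finset.mem_filter] at ht ht'
    tauto
  · intro a b c c' h h'
    simp only [Finset.mem_filter] at h h'
    exact hS.uniq _ _ _ _ h.1 h'.1
  · intro a b c h
    simp only [Finset.mem_filter] at h
    obtain ⟨c', hc'⟩ := hS.adj _ _ _ h.1
    exact ⟨c', by simp only [Finset.mem_filter]; exact ⟨hc', h.2.symm⟩⟩

theorem star_sum (hS : CS S) (Z : W → Prop) (φ : W → W → ℝ) :
    3 * ∑ t ∈ S.filter (fun t => Z t.1 ∨ Z t.2.1 ∨ Z t.2.2), φ t.1 t.2.1 =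
    ∑ t ∈ S.filter (fun t => Z t.1 ∨ Z t.2.1 ∨ Z t.2.2), (φ t.1 t.2.1 + φ t.2.1 t.2.2 + φ t.2.2 t.1) := by
  have hr : ∀ a b c, (a, b, c) ∈ S.filter (fun t => Z t.1 ∨ Z t.2.1 ∨ Z t.2.2) →
      (b, c, a) ∈ S.filter (fun t => Z t.1 ∨ Z t.2.1 ∨ Z t.2.2) := by
    intro a b c h
    simp only [Finset.mem_filter] at h ⊢
    exact ⟨hS.rot _ _ _ h.1, by tauto⟩
  have h1 := sum_rot _ hr (fun a b c => φ a b)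
  have h2 := sum_rot _ hr (fun a b c => φ b c)
  simp only [Finset.sum_add_distrib]
  linarith

/-- combinatorial core of the strictness argument: an edge-closed set with only two outer
neighbours cannot exist. -/
theorem link_false (h : RS S A B C P) (hq : QOK S P Q) (Z : W → Prop) (z0 : W) (hz0 : Z z0)
    (hsp : ∀ z, Z z → Sp S z)
    (hIntr : ∀ z, Z z → z ≠ A ∧ z ≠ B ∧ z ≠ C) (u w : W) (hx : (P u).1 ≠ (P w).1)
    (hN : ∀ z p, Z z → Es S Q z p → ¬ Z p → p = u ∨ p = w) : False := by
  set Lk := S.filter (fun t => Z t.2.2 ∧ ¬ Z t.1 ∧ ¬ Z t.2.1) with hLk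
  have sx : ∑ t ∈ Lk, ((P t.2.1).1 - (P t.1).1) = 0 := by
    have e1 := link_sum h.toCS Z (fun a b => (P b).1 - (P a).1) (by intros; ring)
    have e2 := star_sum h.toCS Z (fun a b => (P b).1 - (P a).1)
    rw [hLk, e1]
    have : ∑ t ∈ S.filter (fun t => Z t.1 ∨ Z t.2.1 ∨ Z t.2.2), (((P t.2.1).1 - (P t.1).1)
      + ((P t.2.2).1 - (P t.2.1).1) + ((P t.1).1 - (P t.2.2).1)) = 0 :=
      Finset.sum_eq_zero (fun t _ => by ring)
    linarith
  have sc : 0 < ∑ t ∈ Lk, crs (P t.1) (P t.2.1) := by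
    have e1 := link_sum h.toCS Z (fun a b => crs (P a) (P b)) (by intros; simp [crs]; ring)
    have e2 := star_sum h.toCS Z (fun a b => crs (P a) (P b))
    rw [hLk, e1]
    have : 0 < ∑ t ∈ S.filter (fun t => Z t.1 ∨ Z t.2.1 ∨ Z t.2.2), (crs (P t.1) (P t.2.1)
      + crs (P t.2.1) (P t.2.2) + crs (P t.2.2) (P t.1)) := by
      apply Finset.sum_pos
      · rintro ⟨a, b, c⟩ ht
        simp only [Finset.mem_filter] at ht
        have : (a, b, c) ∈ innF S P := by
          rcases ht.2 with g | g | g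
          · exact h.int_inn (hIntr _ g).1 (hIntr _ g).2.1 (hIntr _ g).2.2 ht.1
          · exact rot_innF h (rot_innF h (h.int_inn (hIntr _ g).1 (hIntr _ g).2.1 (hIntr _ g).2.2 (h.rot _ _ _ ht.1)))
          · exact rot_innF h (h.int_inn (hIntr _ g).1 (hIntr _ g).2.1 (hIntr _ g).2.2 (h.rot' ht.1))
        have := (mem_innF.1 this).2
        have e : crs (P a) (P b) + crs (P b) (P c) + crs (P c) (P a) = ori (P a) (P b) (P c) := by
          simp [crs, ori]; ring
        simp only []
        rw [e]; exact this
      · obtain ⟨b, c, hh⟩ := hsp _ hz0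
        exact ⟨(z0, b, c), by simp [hh, hz0]⟩
    linarith
  -- classification
  have cl : ∀ t ∈ Lk, (Ed S u w ∧ ((t.1 = u ∧ t.2.1 = w) ∨ (t.1 = w ∧ t.2.1 = u))) ∨
      (¬ Ed S u w ∧ ∃ a b c d, Q a b c d ∧ ((b = u ∧ d = w) ∨ (b = w ∧ d = u)) ∧ Z a ∧ ¬ Z b ∧ ¬ Z c ∧ ¬ Z d ∧
        (t = (b, c, a) ∨ t = (c, d, a))) := by
    rintro ⟨p, q, z⟩ ht
    simp only [hLk, Finset.mem_filter] at ht
    obtain ⟨hm, hz, hp, hq'⟩ := ht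
    have hpq : p ≠ q := h.ed_ne ⟨_, hm⟩
    have fin : (p = u ∨ p = w) → (q = u ∨ q = w) → (Ed S u w ∧ ((p = u ∧ q = w) ∨ (p = w ∧ q = u))) := by
      have e1 : Ed S p q := ⟨_, hm⟩
      have e2 := h.ed_symm e1
      rintro (rfl | rfl) (rfl | rfl)
      · exact absurd rfl hpq
      · exact ⟨e1, Or.inl ⟨rfl, rfl⟩⟩
      · exact ⟨e2, Or.inr ⟨rfl, rfl⟩⟩
      · exact absurd rfl hpq
    have quad : ∀ b d, ((b = u ∨ b = w) → (d = u ∨ d = w) → b ≠ d → ¬ Ed S b d →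
        ((b = u ∧ d = w) ∨ (b = w ∧ d = u)) ∧ ¬ Ed S u w) := by
      intro b d
      rintro (rfl | rfl) (rfl | rfl) h1 h2
      · exact absurd rfl h1
      · exact ⟨Or.inl ⟨rfl, rfl⟩, h2⟩
      · exact ⟨Or.inr ⟨rfl, rfl⟩, fun g => h2 (h.ed_symm g)⟩
      · exact absurd rfl h1
    by_cases d1 : ∃ b d, Q z b p d
    · obtain ⟨b, d, hQ⟩ := d1
      have hd : q = d := h.uniq _ _ _ _ (h.rot' hm) (innS (hq.t2 _ _ _ _ hQ))
      subst hd
      obtain ⟨s1, s2, s3, s4⟩ := hq.es h.toCS hQ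
      have hqq := hN z q hz (hq.es_symm h.toCS s4) hq'
      by_cases hb : Z b
      · exact Or.inl (fin (hN b p hb s2 hp) hqq)
      · have hbb := hN z b hz s1 hb
        obtain ⟨k1, k2⟩ := quad b q hbb hqq (hq.ne hQ).2.2.2.2.2 (hq.nd _ _ _ _ hQ)
        exact Or.inr ⟨k2, z, b, p, q, hQ, k1, hz, hb, hp, hq', Or.inr rfl⟩
    · by_cases d2 : ∃ b d, Q z b q d
      · obtain ⟨b, d, hQ⟩ := d2
        have hd : p = b := h.uniq _ _ _ _ (h.rot _ _ _ hm) (h.rot' (innS (hq.t1 _ _ _ _ hQ)))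
        subst hd
        obtain ⟨s1, s2, s3, s4⟩ := hq.es h.toCS hQ
        have hpp := hN z p hz s1 hp
        by_cases hb : Z d
        · exact Or.inl (fin hpp (hN d q hb (hq.es_symm h.toCS s3) hq'))
        · have hbb := hN z d hz (hq.es_symm h.toCS s4) hb
          obtain ⟨k1, k2⟩ := quad p d hpp hbb (hq.ne hQ).2.2.2.2.2 (hq.nd _ _ _ _ hQ)
          exact Or.inr ⟨k2, z, p, q, d, hQ, k1, hz, hp, hq', hb, Or.inl rfl⟩
      · refine Or.inl (fin (hN z p hz ⟨⟨_, h.rot' hm⟩, d1⟩ hp) (hN z q hz ⟨h.ed_symm ⟨_, h.rot _ _ _ hm⟩, d2⟩ hq'))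
  by_cases hE : Ed S u w
  · have key : ∀ φ : W → W → ℝ, (∀ a b, φ a b + φ b a = 0) → ∑ t ∈ Lk, φ t.1 t.2.1 =
        (∑ t ∈ Lk, (if t.1 = u ∧ t.2.1 = w then (1:ℝ) else -1)) * φ u w := by
      intro φ hφ
      rw [Finset.sum_mul]
      refine Finset.sum_congr rfl (fun t ht => ?_)
      rcases cl t ht with ⟨_, h1 | h1⟩ | h1
      · rw [if_pos h1, h1.1, h1.2]; ring
      · rw [if_neg, h1.1, h1.2]
        · have := hφ u w; linarith
        · rintro ⟨e1, e2⟩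
          apply hx
          rw [← e1, h1.1]
      · exact absurd hE h1.1
    have k1 := key (fun a b => (P b).1 - (P a).1) (by intros; ring)
    have k2 := key (fun a b => crs (P a) (P b)) (by intros; simp [crs]; ring)
    rw [sx] at k1
    rcases mul_eq_zero.1 k1.symm with k | k
    · rw [k, zero_mul] at k2; linarith
    · apply hx; linarith
  · have hne : Lk.Nonempty := by
      rw [Finset.nonempty_iff_ne_empty]; intro e; rw [e] at sc; simp at sc
    obtain ⟨t, ht⟩ := hne
    rcases cl t ht with h1 | ⟨_, a, b, c, d, hQ, hbd, za, zb, zc, zd, htt⟩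
    · exact hE h1.1
    · have hL : Lk = {(b, c, a), (c, d, a)} := by
        ext t'
        simp only [Finset.mem_insert, Finset.mem_singleton]
        constructor
        · intro ht'
          rcases cl t' ht' with h1 | ⟨_, a', b', c', d', hQ', hbd', za', zb', zc', zd', htt'⟩
          · exact absurd h1.1 hE
          · have : (a' = a ∧ b' = b ∧ c' = c ∧ d' = d) ∨
              (a' = c ∧ b' = d ∧ c' = a ∧ d' = b) :=
              hq.dis _ _ _ _ _ _ _ _ u hQ hQ' (by rcases hbd with g | g <;> simp [g])
                (by rcases hbd' with g | g <;> simp [g])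
            rcases this with ⟨rfl, rfl, rfl, rfl⟩ | ⟨rfl, rfl, rfl, rfl⟩
            · exact htt'
            · exact absurd za' zc
        · rintro (rfl | rfl)
          · simp only [hLk, Finset.mem_filter]
            exact ⟨h.rot _ _ _ (innS (hq.t1 _ _ _ _ hQ)), za, zb, zc⟩
          · simp only [hLk, Finset.mem_filter]
            exact ⟨h.rot _ _ _ (innS (hq.t2 _ _ _ _ hQ)), za, zc, zd⟩
      rw [hL, Finset.sum_pair] at sx
      · simp only [] at sx
        apply hx
        rcases hbd with ⟨rfl, rfl⟩ | ⟨rfl, rfl⟩ <;> linarith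
      · intro e
        exact (hq.ne hQ).2.1 (Prod.mk.inj e).1

end
end ICP

end

set_option linter.all false
noncomputable section
set_option maxHeartbeats 1000000
open Classical Filter Topology
namespace ICP
section
variable {W : Type} {S : Finset (W × W × W)} {A B C : W} {P R : W → ℝ × ℝ} {Q : W → W → W → W → Prop}

theorem RS.ord2_nc (h : RS S A B C P) (a b c d : W) (h1 : Ed S a b) (h2 : Ed S c d)
    (h3 : ori (P a) (P b) (P c) * ori (P a) (P b) (P d) < 0)
    (h4 : ori (P c) (P d) (P a) * ori (P c) (P d) (P b) < 0) : False := by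
  have aux : ∀ a b c d : W, Ed S a b → Ed S c d → 0 < ori (P a) (P b) (P c) → 
      ori (P a) (P b) (P d) < 0 → 0 < ori (P c) (P d) (P b) → ori (P c) (P d) (P a) < 0 → False := by
    intro a b c d e1 e2 g1 g2 g3 g4
    obtain ⟨p, hp1, hp2⟩ := seg_cross g1 g2 g3 g4
    rcases h.p2b e1 e2 hp1 hp2 with ⟨rfl, rfl⟩ | ⟨rfl, rfl⟩
    · rw [ori_self1] at g1; exact lt_irrefl _ g1
    · rw [ori_self2] at g1; exact lt_irrefl _ g1
  have k : ori (P a) (P b) (P c) - ori (P a) (P b) (P d) = ori (P c) (P d) (P b) - ori (P c) (P d) (P a) := by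
    unfold ori; ring
  rcases mul_neg_iff.1 h3 with ⟨g1, g2⟩ | ⟨g1, g2⟩ <;> rcases mul_neg_iff.1 h4 with ⟨g3, g4⟩ | ⟨g3, g4⟩
  · linarith
  · exact aux a b c d h1 h2 g1 g2 g4 g3
  · exact aux a b d c h1 (h.ed_symm h2) g2 g1 (by rw [ori_swap]; linarith) (by rw [ori_swap]; linarith)
  · linarith

theorem onSeg_x {a b p : ℝ × ℝ} (h1 : a.1 < p.1) (h2 : p.1 < b.1) (h : ori a b p = 0) : OnSeg p a b := by
  have hb : 0 < b.1 - a.1 := by linarith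
  refine ⟨(p.1 - a.1) / (b.1 - a.1), div_pos (by linarith) hb, by rw [div_lt_one hb]; linarith, ?_⟩
  apply Prod.ext
  · simp only [lerp]; field_simp; ring
  · simp only [lerp]; unfold ori at h; field_simp; linarith

theorem clT_corner {a b c p q r : ℝ × ℝ} (h : 0 < ori a b c) (hp : clT p a b c) (hq : clT q a b c)
    (hs : OnSeg a p q) : p = a := by
  obtain ⟨s, s0, s1, e⟩ := hs
  have e1 := ori_lerp a b p q s
  have e2 := ori_lerp c a p q s
  rw [← e] at e1 e2
  rw [ori_self1] at e1
  rw [ori_self2] at e2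
  have hs1 : 0 < 1 - s := by linarith
  have k1 : ori a b p = 0 := by
    have := mul_nonneg hs1.le hp.1
    have := mul_nonneg s0.le hq.1
    have : (1 - s) * ori a b p = 0 := by linarith
    rcases mul_eq_zero.1 this with g | g
    · linarith
    · exact g
  have k2 : ori c a p = 0 := by
    have := mul_nonneg hs1.le hp.2.2
    have := mul_nonneg s0.le hq.2.2
    have : (1 - s) * ori c a p = 0 := by linarith
    rcases mul_eq_zero.1 this with g | g
    · linarith
    · exact g
  exact eq_of_two_zero h k1 k2

/-- weighted equilibrium (in both coordinates) -/
def Equil (S : Finset (W × W × W)) (w : W → W → ℝ) (R : W → ℝ × ℝ) (v : W) : Prop :=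
  ∑ u ∈ nbrs S v, w v u * ((R u).1 - (R v).1) = 0 ∧ ∑ u ∈ nbrs S v, w v u * ((R u).2 - (R v).2) = 0

theorem Equil.lin {w : W → W → ℝ} {v : W} (h : Equil S w R v) (α β : ℝ) :
    ∑ u ∈ nbrs S v, w v u * (α * ((R u).1 - (R v).1) + β * ((R u).2 - (R v).2)) = 0 := by
  have : ∑ u ∈ nbrs S v, w v u * (α * ((R u).1 - (R v).1) + β * ((R u).2 - (R v).2)) =
    α * ∑ u ∈ nbrs S v, w v u * ((R u).1 - (R v).1) + β * ∑ u ∈ nbrs S v, w v u * ((R u).2 - (R v).2) := by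
    rw [Finset.mul_sum, Finset.mul_sum, ← Finset.sum_add_distrib]
    exact Finset.sum_congr rfl (fun u _ => by ring)
  rw [this, h.1, h.2]; ring

theorem Equil.ori {w : W → W → ℝ} {v : W} (h : Equil S w R v) (a b : ℝ × ℝ) :
    ∑ u ∈ nbrs S v, w v u * (ori a b (R u) - ori a b (R v)) = 0 := by
  rw [← h.lin (-(b.2 - a.2)) (b.1 - a.1)]
  exact Finset.sum_congr rfl (fun u _ => by unfold ICP.ori; ring)

theorem collin {a b p q r : ℝ × ℝ} (hab : a.1 ≠ b.1) (h1 : ori a b p = 0) (h2 : ori a b q = 0)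
    (h3 : ori a b r = 0) : ori p q r = 0 := by
  have hb : b.1 - a.1 ≠ 0 := sub_ne_zero.2 hab.symm
  have : ori p q r * (b.1 - a.1) = 0 := by
    have : ori p q r * (b.1 - a.1) = (q.1 - p.1) * (ori a b r - ori a b p) - (r.1 - p.1) * (ori a b q - ori a b p) := by
      unfold ori; ring
    rw [this, h1, h2, h3]; ring
  exact (mul_eq_zero.1 this).resolve_right hb

theorem collin' {p q r a b : ℝ × ℝ} (hpq : p.1 ≠ q.1) (h1 : ori a b p = 0) (h2 : ori a b q = 0)
    (h3 : ori p q r = 0) : ori a b r = 0 := by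
  have hb : q.1 - p.1 ≠ 0 := sub_ne_zero.2 hpq.symm
  have : ori a b r * (q.1 - p.1) = 0 := by
    have : ori a b r * (q.1 - p.1) = (b.1 - a.1) * ori p q r + (r.1 - p.1) * (ori a b q - ori a b p) + 
      (q.1 - p.1) * ori a b p := by
      unfold ori; ring
    rw [this, h1, h2, h3]; ring
  exact (mul_eq_zero.1 this).resolve_right hb

theorem RS.strict (h : RS S A B C P) (hq : QOK S P Q) (ho : Ord2 (Ed S) (Sp S) P R)
    (hpos : 0 < ori (R A) (R B) (R C)) (hull : ∀ v, Sp S v → clT (R v) (R A) (R B) (R C))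
    (hLR : ∀ v, Sp S v → v ≠ A → v ≠ B → v ≠ C → (∃ u, Es S Q v u ∧ (P u).1 < (P v).1) ∧
      ∃ u, Es S Q v u ∧ (P v).1 < (P u).1)
    (w : W → W → ℝ) (w0 : ∀ v u, 0 ≤ w v u) (w1 : ∀ v u, Es S Q v u → 0 < w v u)
    (hm : ∀ v, Sp S v → v ≠ A → v ≠ B → v ≠ C → Equil S w R v) :
    ∀ a b c, (a, b, c) ∈ innF S P → 0 < ori (R a) (R b) (R c) := by
  -- interior
  have hin : ∀ a b p, Ed S a b → Sp S p → (P a).1 < (P p).1 → (P p).1 < (P b).1 →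
      ori (R a) (R b) (R p) = 0 → p ≠ A ∧ p ≠ B ∧ p ≠ C := by
    intro a b p he hp h1 h2 h3
    have hs : OnSeg (R p) (R a) (R b) := onSeg_x (by rw [ho.hx, ho.hx]; exact h1) (by rw [ho.hx, ho.hx]; exact h2) h3
    have hne : R a ≠ R p := by
      intro e; have := congrArg Prod.fst e; rw [ho.hx, ho.hx] at this; linarith
    have ka := hull a (h.sp_l he)
    have kb := hull b (h.sp_r he)
    refine ⟨?_, ?_, ?_⟩ <;> rintro rfl
    · exact hne (clT_corner (r := 0) hpos ka kb hs)
    · exact hne (clT_corner (r := 0) (by rw [ori_rot]; exact hpos) (clT_rot ka) (clT_rot kb) hs)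
    · exact hne (clT_corner (r := 0) (by rw [ori_rot']; exact hpos) (clT_rot (clT_rot ka)) (clT_rot (clT_rot kb)) hs)
  -- flatness
  have hfl : ∀ a b p, Ed S a b → Sp S p → (P a).1 < (P p).1 → (P p).1 < (P b).1 →
      ori (R a) (R b) (R p) = 0 → ∀ r, Es S Q p r → ori (R a) (R b) (R r) = 0 := by
    intro a b p he hp h1 h2 h3 r hr
    obtain ⟨iA, iB, iC⟩ := hin a b p he hp h1 h2 h3
    have hs := (hm p hp iA iB iC).ori (R a) (R b)
    simp only [h3, sub_zero] at hs
    have hrm : r ∈ nbrs S p := h.mem_nbrs.2 hr.1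
    rcases ho.flat hp (fun r hr => h.ed_ne hr) he h1 h2 h3 with g | g
    · have := (Finset.sum_eq_zero_iff_of_nonpos (fun u hu => mul_nonpos_of_nonneg_of_nonpos (w0 p u) (g u (h.mem_nbrs.1 hu)))).1 hs r hrm
      exact (mul_eq_zero.1 this).resolve_left (w1 p r hr).ne'
    · have := (Finset.sum_eq_zero_iff_of_nonneg (fun u hu => mul_nonneg (w0 p u) (g u (h.mem_nbrs.1 hu)))).1 hs r hrm
      exact (mul_eq_zero.1 this).resolve_left (w1 p r hr).ne'
  have main : ∀ a b p, Ed S a b → Sp S p → (P a).1 < (P p).1 → (P p).1 < (P b).1 →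
      ori (R a) (R b) (R p) ≠ 0 := by
    intro a b v he hv h1 h2 h3
    have hab : (R a).1 ≠ (R b).1 := by rw [ho.hx, ho.hx]; linarith
    set Z : W → Prop := fun z => Sp S z ∧ z ≠ A ∧ z ≠ B ∧ z ≠ C ∧ ori (R a) (R b) (R z) = 0 ∧
      ∀ r, Es S Q z r → ori (R a) (R b) (R r) = 0 with hZ
    have vZ : Z v := ⟨hv, (hin a b v he hv h1 h2 h3).1, (hin a b v he hv h1 h2 h3).2.1,
      (hin a b v he hv h1 h2 h3).2.2, h3, hfl a b v he hv h1 h2 h3⟩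
    set Z0 : W → Prop := fun z => Z z ∧ Relation.ReflTransGen (fun p q => Es S Q p q ∧ Z q) v z with hZ0
    have vZ0 : Z0 v := ⟨vZ, Relation.ReflTransGen.refl⟩
    have step : ∀ z p, Z0 z → Es S Q z p → Z p → Z0 p := fun z p hz hzp hp => ⟨hp, hz.2.tail ⟨hzp, hp⟩⟩
    set N := (vset S).filter (fun p => Z0 p ∨ ∃ z, Z0 z ∧ Es S Q z p) with hN
    have hvN : v ∈ N := by simp only [hN, Finset.mem_filter, mem_vset]; exact ⟨hv, Or.inl vZ0⟩
    have hNs : ∀ p, p ∈ N → Sp S p := by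
      intro p hp; simp only [hN, Finset.mem_filter, mem_vset] at hp; exact hp.1
    have hNn : ∀ z p, Z0 z → Es S Q z p → p ∈ N := by
      intro z p hz hp; simp only [hN, Finset.mem_filter, mem_vset]
      exact ⟨h.sp_r hp.1, Or.inr ⟨z, hz, hp⟩⟩
    have hNl : ∀ p, p ∈ N → ori (R a) (R b) (R p) = 0 := by
      intro p hp; simp only [hN, Finset.mem_filter, mem_vset] at hp
      rcases hp.2 with g | ⟨z, hz, g⟩
      · exact g.1.2.2.2.2.1
      · exact hz.1.2.2.2.2.2 p g
    obtain ⟨u, huN, hu⟩ := Finset.exists_min_image N (fun p => (P p).1) ⟨v, hvN⟩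
    obtain ⟨t, htN, ht⟩ := Finset.exists_max_image N (fun p => (P p).1) ⟨v, hvN⟩
    have huZ : ¬ Z0 u := by
      intro hz
      obtain ⟨⟨p, hp, hlt⟩, _⟩ := hLR u hz.1.1 hz.1.2.1 hz.1.2.2.1 hz.1.2.2.2.1
      exact absurd (hu p (hNn u p hz hp)) (by simpa using hlt)
    have htZ : ¬ Z0 t := by
      intro hz
      obtain ⟨_, ⟨p, hp, hlt⟩⟩ := hLR t hz.1.1 hz.1.2.1 hz.1.2.2.1 hz.1.2.2.2.1
      exact absurd (ht p (hNn t p hz hp)) (by simpa using hlt)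
    have huv : (P u).1 < (P v).1 := lt_of_le_of_ne (hu v hvN) (fun e => huZ (by
      rw [ho.inj u v (hNs u huN) hv e]; exact vZ0))
    have hvt : (P v).1 < (P t).1 := lt_of_le_of_ne (ht v hvN) (fun e => htZ (by
      rw [← ho.inj v t hv (hNs t htN) e]; exact vZ0))
    have hnb : ∀ p, p ∈ N → ¬ Z0 p → ∃ z, Z0 z ∧ Es S Q z p := by
      intro p hp hz; simp only [hN, Finset.mem_filter, mem_vset] at hp
      exact hp.2.resolve_left hz
    refine link_false h hq Z0 v vZ0 (fun z hz => hz.1.1) (fun z hz => ⟨hz.1.2.1, hz.1.2.2.1, hz.1.2.2.2.1⟩)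
      u t (by linarith) ?_
    intro z p hz hzp hpZ
    by_contra hcon
    push Not at hcon
    have hpN := hNn z p hz hzp
    have hps := hNs p hpN
    have hup : (P u).1 < (P p).1 := lt_of_le_of_ne (hu p hpN) (fun e => hcon.1 (ho.inj u p (hNs u huN) hps e).symm)
    have hpt : (P p).1 < (P t).1 := lt_of_le_of_ne (ht p hpN) (fun e => hcon.2 (ho.inj p t hps (hNs t htN) e))
    -- spanning edge
    have span : ∃ c d, Es S Q c d ∧ c ∈ N ∧ d ∈ N ∧ (P c).1 < (P p).1 ∧ (P p).1 < (P d).1 := by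
      by_contra hno
      push Not at hno
      have hside : ∀ q r, Z0 q → Es S Q q r → r ≠ p → ((P q).1 < (P p).1 ↔ (P r).1 < (P p).1) := by
        intro q r hq' hqr hrp
        have hqN : q ∈ N := by simp only [hN, Finset.mem_filter, mem_vset]; exact ⟨hq'.1.1, Or.inl hq'⟩
        have hrN := hNn q r hq' hqr
        constructor
        · intro g
          exact lt_of_le_of_ne (hno q r hqr hqN hrN g) (fun e => hrp (ho.inj r p (hNs r hrN) hps e))
        · intro g
          exact lt_of_le_of_ne (hno r q (hq.es_symm h.toCS hqr) hrN hqN g) (fun e => hpZ (by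
            rw [← ho.inj q p hq'.1.1 hps e]; exact hq'))
      have hall : ∀ q, Relation.ReflTransGen (fun p q => Es S Q p q ∧ Z q) v q → ((P v).1 < (P p).1 ↔ (P q).1 < (P p).1) := by
        intro q hq'
        induction hq' with
        | refl => exact Iff.rfl
        | tail g1 g2 ih =>
          rename_i q1 q2
          have hz1 : Z0 q1 := by
            refine ⟨?_, g1⟩
            rcases Relation.ReflTransGen.cases_tail g1 with e | ⟨_, _, e⟩
            · rw [e]; exact vZ
            · exact e.2
          have hz2 : Z0 q2 := step q1 q2 hz1 g2.1 g2.2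
          rw [ih]
          exact hside q1 q2 hz1 g2.1 (fun e => hpZ (e ▸ hz2))
      obtain ⟨zu, hzu, hzu'⟩ := hnb u huN huZ
      obtain ⟨zt, hzt, hzt'⟩ := hnb t htN htZ
      have e1 := hall zu hzu.2
      have e2 := hside zu u hzu hzu' (fun e => hcon.1 e.symm)
      have e3 := hall zt hzt.2
      have e4 := hside zt t hzt hzt' (fun e => hcon.2 e.symm)
      have : (P t).1 < (P p).1 := e4.1 (e3.1 (e1.2 (e2.2 hup)))
      linarith
    obtain ⟨c, d, hcd, hcN, hdN, hc, hd⟩ := span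
    have hcd0 : ori (R c) (R d) (R p) = 0 := collin hab (hNl c hcN) (hNl d hdN) (hNl p hpN)
    obtain ⟨iA, iB, iC⟩ := hin c d p hcd.1 hps hc hd hcd0
    have hne : (R c).1 ≠ (R d).1 := by rw [ho.hx, ho.hx]; linarith
    have hpZ' : Z p := ⟨hps, iA, iB, iC, hNl p hpN, fun r hr =>
      collin' hne (hNl c hcN) (hNl d hdN) (hfl c d p hcd.1 hps hc hd hcd0 r hr)⟩
    exact hpZ (step z p hz hzp hpZ')
  have mid : ∀ a b c, (a, b, c) ∈ innF S P → ((P b).1 < (P a).1 ∧ (P a).1 < (P c).1 ∨ (P c).1 < (P a).1 ∧ (P a).1 < (P b).1) →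
      0 < ori (R a) (R b) (R c) := by
    intro a b c hh hx
    have sp := sp2 h.toCS (innS hh)
    have e1 : Ed S b c := ⟨_, h.rot _ _ _ (innS hh)⟩
    have hp := h.inn_ori hh
    rcases hx with ⟨g1, g2⟩ | ⟨g1, g2⟩
    · have k1 := main b c a e1 sp.1 g1 g2
      have k2 := (ho.per b c a e1 sp.1 g1 g2).2 (by rw [ori_rot]; exact hp)
      rw [ori_rot] at k1 k2
      exact lt_of_le_of_ne k2 k1.symm
    · have k1 := main c b a (h.ed_symm e1) sp.1 g1 g2
      have k2 := (ho.per c b a (h.ed_symm e1) sp.1 g1 g2).1 (by rw [ori_swap, ori_rot]; linarith)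
      rw [ori_swap, ori_rot] at k1 k2
      exact lt_of_le_of_ne (by linarith) (fun e => k1 (by rw [← e]; simp))
  intro a b c hh
  have sp := sp2 h.toCS (innS hh)
  obtain ⟨n1, n2, n3⟩ := ori_ne (h.inn_ori hh)
  have x1 : (P a).1 ≠ (P b).1 := fun e => n1 (ho.inj _ _ sp.1 sp.2.1 e)
  have x2 : (P b).1 ≠ (P c).1 := fun e => n2 (ho.inj _ _ sp.2.1 sp.2.2 e)
  have x3 : (P a).1 ≠ (P c).1 := fun e => n3 (ho.inj _ _ sp.1 sp.2.2 e)
  have r1 := rot_innF h hh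
  have r2 := rot_innF h r1
  have m1 := mid a b c hh
  have m2 := mid b c a r1
  have m3 := mid c a b r2
  rw [ori_rot] at m2
  rw [ori_rot'] at m3
  rcases lt_or_gt_of_ne x1 with g1 | g1 <;> rcases lt_or_gt_of_ne x2 with g2 | g2 <;>
    rcases lt_or_gt_of_ne x3 with g3 | g3
  · exact m2 (Or.inr ⟨g1, g2⟩)
  · linarith
  · exact m3 (Or.inl ⟨g3, g2⟩)
  · exact m1 (Or.inr ⟨g3, g1⟩)
  · exact m1 (Or.inl ⟨g1, g3⟩)
  · exact m3 (Or.inr ⟨g2, g3⟩)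
  · linarith
  · exact m2 (Or.inl ⟨g2, g1⟩)

end
end ICP

end

set_option linter.all false
noncomputable section
set_option maxHeartbeats 1000000
open Classical Filter Topology
namespace ICP
section
variable {W : Type}

theorem max_pr (I : Finset W) (nb : W → Finset W) (x : W → ℝ) (w : W → W → ℝ) (w0 : ∀ v u, 0 ≤ w v u)
    (hl : ∀ v ∈ I, ∃ u ∈ nb v, 0 < w v u ∧ x u < x v) (f : W → ℝ) (f0 : ∀ v, v ∉ I → f v = 0)
    (hf : ∀ v ∈ I, ∑ u ∈ nb v, w v u * (f u - f v) = 0) : ∀ v, f v ≤ 0 := by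
  by_contra hc
  push Not at hc
  obtain ⟨v, hv⟩ := hc
  have vI : v ∈ I := by by_contra g; rw [f0 v g] at hv; exact lt_irrefl _ hv
  obtain ⟨m, hm, hmax⟩ := Finset.exists_max_image I f ⟨v, vI⟩
  have m0 : 0 < f m := lt_of_lt_of_le hv (hmax v vI)
  have hall : ∀ u, f u ≤ f m := by
    intro u
    by_cases hu : u ∈ I
    · exact hmax u hu
    · rw [f0 u hu]; exact m0.le
  obtain ⟨k, hk, hmin⟩ := Finset.exists_min_image (I.filter (fun u => f u = f m)) x ⟨m, by simp [hm]⟩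
  rw [Finset.mem_filter] at hk
  obtain ⟨u, hu, hw, hx⟩ := hl k hk.1
  have hz := hf k hk.1
  have := (Finset.sum_eq_zero_iff_of_nonpos (fun u _ => mul_nonpos_of_nonneg_of_nonpos (w0 k u)
    (by have := hall u; rw [hk.2]; linarith))).1 hz u hu
  have e : f u = f m := by
    have := (mul_eq_zero.1 this).resolve_left hw.ne'
    rw [← hk.2]; linarith
  have uI : u ∈ I := by by_contra g; rw [f0 u g] at e; linarith
  have := hmin u (by simp [uI, e])
  linarith

theorem harm_uniq (I : Finset W) (nb : W → Finset W) (x : W → ℝ) (w : W → W → ℝ) (w0 : ∀ v u, 0 ≤ w v u)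
    (hl : ∀ v ∈ I, ∃ u ∈ nb v, 0 < w v u ∧ x u < x v) (f : W → ℝ) (f0 : ∀ v, v ∉ I → f v = 0)
    (hf : ∀ v ∈ I, ∑ u ∈ nb v, w v u * (f u - f v) = 0) : ∀ v, f v = 0 := by
  intro v
  refine le_antisymm (max_pr I nb x w w0 hl f f0 hf v) ?_
  have := max_pr I nb x w w0 hl (fun v => - f v) (fun v hv => by simp [f0 v hv]) (fun v hv => by
    have := hf v hv
    rw [← neg_eq_zero, ← Finset.sum_neg_distrib] at this
    rw [← this]
    exact Finset.sum_congr rfl (fun u _ => by ring)) v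
  linarith

def hMat (I : Finset W) (nb : W → Finset W) (w : W → W → ℝ) : Matrix I I ℝ :=
  fun v u => (if (u : W) ∈ nb v then w v u else 0) - (if u = v then ∑ u' ∈ nb v, w v u' else 0)

def ext0 (I : Finset W) (y : I → ℝ) (y0 : W → ℝ) (v : W) : ℝ := if h : v ∈ I then y ⟨v, h⟩ else y0 v

theorem hMat_mul (I : Finset W) (nb : W → Finset W) (w : W → W → ℝ) (y : I → ℝ) (y0 : W → ℝ) (v : I) :
    ∑ u ∈ nb v, w v u * (ext0 I y y0 u - ext0 I y y0 v) =
      (hMat I nb w).mulVec y v + ∑ u ∈ nb v, (if u ∈ I then 0 else w v u * y0 u) := by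
  have e1 : (hMat I nb w).mulVec y v = ∑ u : I, (if (u : W) ∈ nb v then w v u * y u else 0) -
      (∑ u' ∈ nb v, w v u') * y v := by
    simp only [Matrix.mulVec, dotProduct, hMat, sub_mul, Finset.sum_sub_distrib, ite_mul, zero_mul]
    congr 1
    rw [Finset.sum_ite_eq' Finset.univ v]
    simp
  have e2 : ∑ u : I, (if (u : W) ∈ nb v then w v u * y u else 0) =
      ∑ u ∈ nb v, (if u ∈ I then w v u * ext0 I y y0 u else 0) := by
    have h1 : ∀ u : I, (if (u : W) ∈ nb v then w v u * y u else 0) =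
        (fun u : W => if u ∈ nb v then w v u * ext0 I y y0 u else 0) u := by
      intro u; simp [ext0]
    rw [Finset.sum_congr rfl (fun u _ => h1 u)]
    rw [Finset.sum_coe_sort I (fun u : W => if u ∈ nb v then w v u * ext0 I y y0 u else 0)]
    rw [← Finset.sum_filter, ← Finset.sum_filter]
    refine Finset.sum_congr ?_ (fun _ _ => rfl)
    ext; simp [and_comm]
  have e3 : ext0 I y y0 v = y v := by simp [ext0]
  rw [e1, e2, Finset.sum_mul, e3]
  rw [sub_add_eq_add_sub, ← Finset.sum_add_distrib, ← Finset.sum_sub_distrib]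
  refine Finset.sum_congr rfl (fun u _ => ?_)
  by_cases hu : u ∈ I
  · simp [hu]; ring
  · simp [hu, ext0]; ring

theorem hMat_unit (I : Finset W) (nb : W → Finset W) (x : W → ℝ) (w : W → W → ℝ) (w0 : ∀ v u, 0 ≤ w v u)
    (hl : ∀ v ∈ I, ∃ u ∈ nb v, 0 < w v u ∧ x u < x v) : IsUnit (hMat I nb w).det := by
  rw [← Matrix.isUnit_iff_isUnit_det]
  rw [← Matrix.mulVec_injective_iff_isUnit]
  have key : ∀ y, (hMat I nb w).mulVec y = 0 → y = 0 := by
    intro y hy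
    have := harm_uniq I nb x w w0 hl (ext0 I y 0) (fun v hv => by simp [ext0, hv]) (fun v hv => by
      have := hMat_mul I nb w y 0 ⟨v, hv⟩
      simp only [] at this
      rw [this, hy]; simp)
    funext v
    have := this v
    simpa [ext0] using this
  intro y y' e
  have := key (y - y') (by rw [Matrix.mulVec_sub, e, sub_self])
  exact sub_eq_zero.1 this

theorem harm_solve (I : Finset W) (nb : W → Finset W) (x : W → ℝ) (w : ℝ → W → W → ℝ)
    (w0 : ∀ t ∈ Set.Icc (0:ℝ) 1, ∀ v u, 0 ≤ w t v u)
    (wc : ∀ v u, Continuous (fun t => w t v u))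
    (hl : ∀ t ∈ Set.Icc (0:ℝ) 1, ∀ v ∈ I, ∃ u ∈ nb v, 0 < w t v u ∧ x u < x v) (y0 : W → ℝ) :
    ∃ Y : ℝ → W → ℝ, (∀ u, ContinuousOn (fun t => Y t u) (Set.Icc 0 1)) ∧ (∀ t, ∀ v, v ∉ I → Y t v = y0 v) ∧
      ∀ t ∈ Set.Icc (0:ℝ) 1, ∀ v ∈ I, ∑ u ∈ nb v, w t v u * (Y t u - Y t v) = 0 := by
  set b : ℝ → I → ℝ := fun t v => - ∑ u ∈ nb v, (if u ∈ I then 0 else w t v u * y0 u) with hb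
  set y : ℝ → I → ℝ := fun t => ((hMat I nb (w t))⁻¹).mulVec (b t) with hy
  have hM : Continuous (fun t => hMat I nb (w t)) := by
    refine continuous_matrix (fun v u => ?_)
    unfold hMat
    refine Continuous.sub ?_ ?_
    · split_ifs
      · exact wc _ _
      · exact continuous_const
    · split_ifs
      · exact continuous_finset_sum _ (fun u _ => wc _ _)
      · exact continuous_const
  have hbc : Continuous b := by
    refine continuous_pi (fun v => ?_)
    refine Continuous.neg (continuous_finset_sum _ (fun u _ => ?_))
    split_ifs
    · exact continuous_const
    · exact (wc _ _).mul continuous_const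
  have hyc : ContinuousOn y (Set.Icc 0 1) := by
    have e : ∀ t, y t = (Ring.inverse (hMat I nb (w t)).det) • ((hMat I nb (w t)).adjugate.mulVec (b t)) := by
      intro t
      simp only [hy, Matrix.inv_def, Matrix.smul_mulVec]
    have : y = fun t => (Ring.inverse (hMat I nb (w t)).det) • ((hMat I nb (w t)).adjugate.mulVec (b t)) := funext e
    rw [this]
    have h1 : ContinuousOn (fun t => Ring.inverse (hMat I nb (w t)).det) (Set.Icc 0 1) := by
      simp only [Ring.inverse_eq_inv']
      refine ContinuousOn.inv₀ hM.matrix_det.continuousOn ?_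
      intro t ht
      exact (hMat_unit I nb x (w t) (w0 t ht) (hl t ht)).ne_zero
    have h2 : ContinuousOn (fun t => (hMat I nb (w t)).adjugate.mulVec (b t)) (Set.Icc 0 1) :=
      (hM.matrix_adjugate.matrix_mulVec hbc).continuousOn
    exact h1.smul h2
  refine ⟨fun t => ext0 I (y t) y0, ?_, ?_, ?_⟩
  · intro u
    by_cases hu : u ∈ I
    · simp only [ext0, hu, dif_pos]
      exact (continuous_apply (⟨u, hu⟩ : I)).comp_continuousOn hyc
    · simp only [ext0, hu, dif_neg, not_false_eq_true]
      exact continuousOn_const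
  · intro t v hv; simp [ext0, hv]
  · intro t ht v hv
    have := hMat_mul I nb (w t) (y t) y0 ⟨v, hv⟩
    simp only [] at this
    rw [this, hy]
    simp only []
    rw [Matrix.mulVec_mulVec, Matrix.mul_nonsing_inv _ (hMat_unit I nb x (w t) (w0 t ht) (hl t ht)), Matrix.one_mulVec]
    simp [hb]

end
end ICP

end

set_option linter.all false
noncomputable section
set_option maxHeartbeats 1000000
open Classical Filter Topology
namespace ICP
section
variable {W : Type} {S : Finset (W × W × W)} {A B C : W} {P R : W → ℝ × ℝ} {Q : W → W → W → W → Prop}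

theorem sum_one {N : Finset W} {u : W} (hu : u ∈ N) (α : ℝ) (f : W → ℝ) :
    ∑ z ∈ N, (if z = u then α else 0) * f z = α * f u := by
  simp only [ite_mul, zero_mul]
  rw [Finset.sum_ite_eq' N u]; simp [hu]

theorem RS.lam (h : RS S A B C P) (xinj : ∀ a b, Sp S a → Sp S b → (P a).1 = (P b).1 → a = b) {v : W}
    (hv : Sp S v) (hA : v ≠ A) (hB : v ≠ B) (hC : v ≠ C) :
    ∃ l : W → ℝ, (∀ u, 0 ≤ l u) ∧ (∑ u ∈ nbrs S v, l u * ((P u).1 - (P v).1) = 0) ∧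
      (∑ u ∈ nbrs S v, l u * ((P u).2 - (P v).2) = 0) ∧ ∃ u ∈ nbrs S v, 0 < l u ∧ (P u).1 < (P v).1 := by
  obtain ⟨u0, c0, hm0⟩ := hv
  have e0 : Ed S v u0 := ⟨_, hm0⟩
  have xne : ∀ u, Ed S v u → (P u).1 - (P v).1 ≠ 0 := by
    intro u hu e
    exact h.ed_ne hu (xinj _ _ (h.sp_l hu) (h.sp_r hu) (by linarith))
  suffices hs : ∃ l : W → ℝ, (∀ u, 0 ≤ l u) ∧ (∑ u ∈ nbrs S v, l u * ((P u).1 - (P v).1) = 0) ∧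
      (∑ u ∈ nbrs S v, l u * ((P u).2 - (P v).2) = 0) ∧ 0 < l u0 by
    obtain ⟨l, l0, l1, l2, l3⟩ := hs
    refine ⟨l, l0, l1, l2, ?_⟩
    by_contra hc
    push Not at hc
    have := (Finset.sum_eq_zero_iff_of_nonneg (s := nbrs S v) (f := fun u => l u * ((P u).1 - (P v).1)) (by
      intro u hu
      rcases (l0 u).eq_or_lt with g | g
      · simp [← g]
      · exact mul_nonneg g.le (by have := hc u hu g; linarith))).1 l1 u0 (h.mem_nbrs.2 e0)
    rcases mul_eq_zero.1 this with g | g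
    · linarith
    · exact xne u0 e0 g
  set d : ℝ × ℝ := -(P u0 - P v) with hd
  have dne : d ≠ 0 := by
    intro e
    apply xne u0 e0
    have := congrArg Prod.fst e
    simp [hd] at this
    linarith
  by_cases hray : ∀ u, Ed S v u → crs d (P u - P v) = 0 → d.1 * (P u - P v).1 + d.2 * (P u - P v).2 ≤ 0
  · obtain ⟨u, w, hm, g1, g2⟩ := h.sector ⟨u0, c0, hm0⟩ hA hB hC dne hray
    have hin := h.inn_ori (h.int_inn hA hB hC hm)
    rw [ori_crs] at hin
    set X := P u0 - P v with hX
    set Y := P u - P v with hY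
    set Z := P w - P v with hZ
    have k1 : 0 < crs X Y := by simp only [hd, crs, Prod.fst_neg, Prod.snd_neg] at g1 ⊢; linarith
    have k2 : 0 < crs Z X := by simp only [hd, crs, Prod.fst_neg, Prod.snd_neg] at g2 ⊢; linarith
    have m0 := h.mem_nbrs.2 e0
    have m1 : u ∈ nbrs S v := h.mem_nbrs.2 ⟨_, hm⟩
    have m2 : w ∈ nbrs S v := h.mem_nbrs.2 (h.ed_symm ⟨_, h.rot' hm⟩)
    have id1 : crs Y Z * X.1 + crs Z X * Y.1 + crs X Y * Z.1 = 0 := by simp only [crs]; ring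
    have id2 : crs Y Z * X.2 + crs Z X * Y.2 + crs X Y * Z.2 = 0 := by simp only [crs]; ring
    refine ⟨fun z => (if z = u0 then crs Y Z else 0) + (if z = u then crs Z X else 0) + (if z = w then crs X Y else 0),
      ?_, ?_, ?_, ?_⟩
    · intro z
      have : ∀ (p : Prop) [Decidable p] (r : ℝ), 0 < r → 0 ≤ (if p then r else 0) := by
        intro p _ r hr; split_ifs <;> linarith
      have := this (z = u0) _ hin
      have := ‹∀ (p : Prop) [Decidable p] (r : ℝ), 0 < r → 0 ≤ (if p then r else 0)› (z = u) _ k2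
      have := ‹∀ (p : Prop) [Decidable p] (r : ℝ), 0 < r → 0 ≤ (if p then r else 0)› (z = w) _ k1
      positivity
    · simp only [add_mul, Finset.sum_add_distrib]
      rw [sum_one m0, sum_one m1, sum_one m2]
      exact id1
    · simp only [add_mul, Finset.sum_add_distrib]
      rw [sum_one m0 _ (fun u => (P u).2 - (P v).2), sum_one m1 _ (fun u => (P u).2 - (P v).2), sum_one m2 _ (fun u => (P u).2 - (P v).2)]
      exact id2
    · have a1 : (0:ℝ) ≤ (if u0 = u then crs Z X else 0) := by split_ifs <;> linarith
      have a2 : (0:ℝ) ≤ (if u0 = w then crs X Y else 0) := by split_ifs <;> linarith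
      simp only [if_true]
      linarith
  · push Not at hray
    obtain ⟨u, hu, g1, g2⟩ := hray
    set X := P u0 - P v with hX
    set Y := P u - P v with hY
    have m0 := h.mem_nbrs.2 e0
    have m1 : u ∈ nbrs S v := h.mem_nbrs.2 hu
    have k1 : X.1 * Y.2 = X.2 * Y.1 := by simp only [hd, crs, Prod.fst_neg, Prod.snd_neg] at g1; linarith
    have k2 : X.1 * Y.1 + X.2 * Y.2 < 0 := by simp only [hd, Prod.fst_neg, Prod.snd_neg] at g2; linarith
    have hXX : 0 < X.1 ^ 2 + X.2 ^ 2 := by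
      have := sq_pos_of_ne dne
      simpa [hd] using this
    -- |X|^2 Y = (X.Y) X
    refine ⟨fun z => (if z = u0 then -(X.1 * Y.1 + X.2 * Y.2) else 0) + (if z = u then X.1 ^ 2 + X.2 ^ 2 else 0),
      ?_, ?_, ?_, ?_⟩
    · intro z
      simp only []
      split_ifs <;> linarith
    · simp only [add_mul, Finset.sum_add_distrib]
      rw [sum_one m0, sum_one m1]
      show -(X.1 * Y.1 + X.2 * Y.2) * X.1 + (X.1 ^ 2 + X.2 ^ 2) * Y.1 = 0
      linear_combination (-X.2) * k1
    · simp only [add_mul, Finset.sum_add_distrib]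
      rw [sum_one m0 _ (fun u => (P u).2 - (P v).2), sum_one m1 _ (fun u => (P u).2 - (P v).2)]
      show -(X.1 * Y.1 + X.2 * Y.2) * X.2 + (X.1 ^ 2 + X.2 ^ 2) * Y.2 = 0
      linear_combination (X.1) * k1
    · simp only [if_true]
      split_ifs <;> linarith

/-- horizontal balancing weights -/
theorem mu_exists (E : W → Prop) (N : Finset W) (x : W → ℝ) (c : ℝ) (hE : ∀ u, E u → u ∈ N)
    (hne : ∀ u, E u → x u ≠ c)
    (hl : ∃ u, E u ∧ x u < c) (hr : ∃ u, E u ∧ c < x u) :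
    ∃ m : W → ℝ, (∀ u, 0 ≤ m u) ∧ (∀ u, E u → 0 < m u) ∧ (∀ u, ¬ E u → m u = 0) ∧
      ∑ u ∈ N, m u * (x u - c) = 0 := by
  set Lf := ∑ u ∈ N.filter (fun u => E u ∧ x u < c), (c - x u) with hL
  set Rt := ∑ u ∈ N.filter (fun u => E u ∧ c < x u), (x u - c) with hR
  have Lp : 0 < Lf := by
    refine Finset.sum_pos (fun u hu => by have := (Finset.mem_filter.1 hu).2.2; linarith) ?_
    obtain ⟨u, h1, h2⟩ := hl
    exact ⟨u, by simp [hE u h1, h1, h2]⟩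
  have Rp : 0 < Rt := by
    refine Finset.sum_pos (fun u hu => by have := (Finset.mem_filter.1 hu).2.2; linarith) ?_
    obtain ⟨u, h1, h2⟩ := hr
    exact ⟨u, by simp [hE u h1, h1, h2]⟩
  refine ⟨fun u => (if E u ∧ x u < c then Rt else 0) + (if E u ∧ c < x u then Lf else 0), ?_, ?_, ?_, ?_⟩
  · intro u; simp only []; split_ifs <;> linarith
  · intro u hu
    simp only []
    rcases lt_or_gt_of_ne (hne u hu) with g | g
    · rw [if_pos ⟨hu, g⟩]; split_ifs <;> linarith
    · rw [if_pos (show E u ∧ c < x u from ⟨hu, g⟩)]; split_ifs <;> linarith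
  · intro u hu; simp [hu]
  · simp only [add_mul, Finset.sum_add_distrib, ite_mul, zero_mul]
    rw [← Finset.sum_filter, ← Finset.sum_filter, ← Finset.mul_sum, ← Finset.mul_sum, ← hR]
    have : ∑ u ∈ N.filter (fun u => E u ∧ x u < c), (x u - c) = - Lf := by
      rw [hL, ← Finset.sum_neg_distrib]; exact Finset.sum_congr rfl (fun u _ => by ring)
    rw [this]; ring

theorem ivt_nonneg {f : ℝ → ℝ} {t : ℝ} (ht : 0 < t) (hf : ContinuousOn f (Set.Icc 0 t))
    (h : ∀ s, 0 ≤ s → s < t → 0 ≤ f s) : 0 ≤ f t := by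
  by_contra hc
  push Not at hc
  have := intermediate_value_Icc' ht.le hf
  have h0 := h 0 le_rfl ht
  obtain ⟨c, hc1, hc2⟩ := this (show f t / 2 ∈ Set.Icc (f t) (f 0) from ⟨by linarith, by linarith⟩)
  have : c ≠ t := by rintro rfl; linarith
  have := h c hc1.1 (lt_of_le_of_ne hc1.2 this)
  linarith

theorem ivt_pos {f : ℝ → ℝ} {t : ℝ} (ht : 0 < t) (hf : ContinuousOn f (Set.Icc 0 t))
    (h0 : 0 < f 0) (h : ∀ s, 0 ≤ s → s < t → f s ≠ 0) : 0 ≤ f t := by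
  by_contra hc
  push Not at hc
  have := intermediate_value_Icc' ht.le hf
  obtain ⟨c, hc1, hc2⟩ := this (show (0:ℝ) ∈ Set.Icc (f t) (f 0) from ⟨by linarith, by linarith⟩)
  have : c ≠ t := by rintro rfl; linarith
  exact h c hc1.1 (lt_of_le_of_ne hc1.2 this) hc2

end
end ICP

end

set_option linter.all false
noncomputable section
set_option maxHeartbeats 1000000
open Classical Filter Topology
namespace ICP
variable {W : Type} {S : Finset (W × W × W)} {A B C : W} {P R : W → ℝ × ℝ} {Q : W → W → W → W → Prop}

theorem RS.inn_iff (h : RS S A B C P) {a b c : W} (hm : (a, b, c) ∈ S) :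
    (a, b, c) ∈ innF S P ↔ ¬ ((a, b, c) = (C, B, A) ∨ (a, b, c) = (B, A, C) ∨ (a, b, c) = (A, C, B)) := by
  constructor
  · intro h1 h2
    have h3 := h.inn_ori h1
    have h4 := h.pos
    rcases h2 with h2 | h2 | h2 <;> simp only [Prod.mk.injEq] at h2 <;> obtain ⟨rfl, rfl, rfl⟩ := h2
    · have e : ori (P a) (P b) (P c) = - ori (P c) (P b) (P a) := by unfold ori; ring
      linarith
    · rw [ori_swap] at h3; linarith
    · rw [ori_swap'] at h3; linarith
  · intro h1
    rcases h.inn_or hm with h2 | h2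
    · exact h2
    · exact absurd h2 h1

theorem RS.innF_eq (h : RS S A B C P) (h' : RS S A B C R) : innF S P = innF S R := by
  ext ⟨a, b, c⟩
  constructor
  · intro hm
    exact (h'.inn_iff (innS hm)).2 ((h.inn_iff (innS hm)).1 hm)
  · intro hm
    exact (h.inn_iff (innS hm)).2 ((h'.inn_iff (innS hm)).1 hm)

theorem RS.of_inn (h : RS S A B C P) (hpos : 0 < ori (R A) (R B) (R C))
    (hi : ∀ a b c, (a, b, c) ∈ innF S P → 0 < ori (R a) (R b) (R c)) : RS S A B C R where
  toCS := h.toCS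
  out := h.out
  pos := hpos
  inn a b c hm := by
    rcases h.inn_or hm with h2 | h2
    · exact Or.inl (hi _ _ _ h2)
    · exact Or.inr h2

theorem RS.mono (h : RS S A B C P) (hq : QOK S P Q)
    (xinj : ∀ a b, Sp S a → Sp S b → (P a).1 = (P b).1 → a = b)
    (hLR : ∀ v, Sp S v → v ≠ A → v ≠ B → v ≠ C → (∃ u, Es S Q v u ∧ (P u).1 < (P v).1) ∧
      ∃ u, Es S Q v u ∧ (P v).1 < (P u).1) :
    ∃ R, RS S A B C R ∧ ∃ m : W → W → ℝ, (∀ v u, 0 ≤ m v u) ∧ (∀ v u, Es S Q v u → 0 < m v u) ∧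
      ∀ v, Sp S v → v ≠ A → v ≠ B → v ≠ C → (∀ u, ¬ Es S Q v u → m v u = 0) ∧ Equil S m R v := by
  set I : Finset W := (vset S).filter (fun v => v ≠ A ∧ v ≠ B ∧ v ≠ C) with hI
  have memI : ∀ v, v ∈ I ↔ Sp S v ∧ v ≠ A ∧ v ≠ B ∧ v ≠ C := by
    intro v; rw [hI, Finset.mem_filter, mem_vset]
  have hl : ∀ v, ∃ l : W → ℝ, (∀ u, 0 ≤ l u) ∧ (v ∈ I → (∑ u ∈ nbrs S v, l u * ((P u).1 - (P v).1) = 0) ∧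
      (∑ u ∈ nbrs S v, l u * ((P u).2 - (P v).2) = 0) ∧ ∃ u ∈ nbrs S v, 0 < l u ∧ (P u).1 < (P v).1) := by
    intro v
    by_cases hv : v ∈ I
    · obtain ⟨h1, h2, h3, h4⟩ := (memI v).1 hv
      obtain ⟨l, l0, l1⟩ := h.lam xinj h1 h2 h3 h4
      exact ⟨l, l0, fun _ => l1⟩
    · exact ⟨fun _ => 0, fun _ => le_rfl, fun h => absurd h hv⟩
  choose l l0 l1 using hl
  have hmu : ∀ v, ∃ m : W → ℝ, (∀ u, 0 ≤ m u) ∧ (∀ u, Es S Q v u → 0 < m u) ∧ (v ∈ I →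
      (∀ u, ¬ Es S Q v u → m u = 0) ∧ ∑ u ∈ nbrs S v, m u * ((P u).1 - (P v).1) = 0) := by
    intro v
    by_cases hv : v ∈ I
    · obtain ⟨h1, h2, h3, h4⟩ := (memI v).1 hv
      obtain ⟨m, m0, m1, m2, m3⟩ := mu_exists (Es S Q v) (nbrs S v) (fun u => (P u).1) (P v).1
        (fun u hu => h.mem_nbrs.2 hu.1)
        (fun u hu he => h.ed_ne hu.1 (xinj _ _ (h.sp_l hu.1) (h.sp_r hu.1) he.symm))
        (hLR v h1 h2 h3 h4).1 (hLR v h1 h2 h3 h4).2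
      exact ⟨m, m0, m1, fun _ => ⟨m2, m3⟩⟩
    · exact ⟨fun _ => 1, fun _ => zero_le_one, fun _ _ => zero_lt_one, fun h => absurd h hv⟩
  choose m m0 m1 m2 using hmu
  have w0 : ∀ t ∈ Set.Icc (0:ℝ) 1, ∀ v u, 0 ≤ (1 - t) * l v u + t * m v u := by
    intro t ht v u
    have := mul_nonneg (sub_nonneg.2 ht.2) (l0 v u)
    have := mul_nonneg ht.1 (m0 v u)
    linarith
  have wl : ∀ t ∈ Set.Icc (0:ℝ) 1, ∀ v ∈ I, ∃ u ∈ nbrs S v,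
      0 < (1 - t) * l v u + t * m v u ∧ (P u).1 < (P v).1 := by
    intro t ht v hv
    obtain ⟨h1, h2, h3, h4⟩ := (memI v).1 hv
    rcases eq_or_lt_of_le ht.1 with h0 | h0
    · subst h0
      obtain ⟨u, hu, hp, hx⟩ := (l1 v hv).2.2
      exact ⟨u, hu, by linarith, hx⟩
    · obtain ⟨u, hu, hx⟩ := (hLR v h1 h2 h3 h4).1
      refine ⟨u, h.mem_nbrs.2 hu.1, ?_, hx⟩
      have := mul_nonneg (sub_nonneg.2 ht.2) (l0 v u)
      have := mul_pos h0 (m1 v u hu)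
      linarith
  obtain ⟨Y, Yc, Yb, Ye⟩ := harm_solve I (nbrs S) (fun v => (P v).1)
    (fun t v u => (1 - t) * l v u + t * m v u) w0 (fun v u => by fun_prop) wl (fun v => (P v).2)
  have Y0 : ∀ v, Y 0 v = (P v).2 := by
    have z0 : (0:ℝ) ∈ Set.Icc (0:ℝ) 1 := ⟨le_rfl, zero_le_one⟩
    have := harm_uniq I (nbrs S) (fun v => (P v).1) _ (w0 0 z0) (wl 0 z0) (fun v => Y 0 v - (P v).2)
      (fun v hv => by simp [Yb 0 v hv])
      (fun v hv => by
        have e1 := Ye 0 z0 v hv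
        have e2 := (l1 v hv).2.1
        simp only [sub_zero, one_mul, zero_mul, add_zero] at e1 ⊢
        have e3 : ∑ u ∈ nbrs S v, l v u * (Y 0 u - (P u).2 - (Y 0 v - (P v).2)) =
          ∑ u ∈ nbrs S v, l v u * (Y 0 u - Y 0 v) - ∑ u ∈ nbrs S v, l v u * ((P u).2 - (P v).2) := by
          rw [← Finset.sum_sub_distrib]; exact Finset.sum_congr rfl (fun u _ => by ring)
        rw [e3, e1, e2, sub_zero])
    intro v; have := this v; linarith
  set Rt : ℝ → W → ℝ × ℝ := fun t v => ((P v).1, Y t v) with hRt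
  have R0 : Rt 0 = P := by funext v; simp [hRt, Y0]
  have oc : ∀ a b c, ContinuousOn (fun t => ori (Rt t a) (Rt t b) (Rt t c)) (Set.Icc 0 1) := by
    intro a b c
    have ha := Yc a
    have hb := Yc b
    have hc := Yc c
    simp only [ori, hRt]
    fun_prop
  have ob : ∀ t, Rt t A = P A ∧ Rt t B = P B ∧ Rt t C = P C := by
    intro t
    refine ⟨?_, ?_, ?_⟩ <;> simp only [hRt] <;> rw [Yb t] <;> simp [memI]
  have opos : ∀ t, 0 < ori (Rt t A) (Rt t B) (Rt t C) := by
    intro t; obtain ⟨e1, e2, e3⟩ := ob t; rw [e1, e2, e3]; exact h.pos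
  have eq : ∀ t ∈ Set.Icc (0:ℝ) 1, ∀ v ∈ I, Equil S (fun v u => (1 - t) * l v u + t * m v u) (Rt t) v := by
    intro t ht v hv
    refine ⟨?_, Ye t ht v hv⟩
    have e1 := (l1 v hv).1
    have e2 := (m2 v hv).2
    have e3 : ∑ u ∈ nbrs S v, ((1 - t) * l v u + t * m v u) * ((P u).1 - (P v).1) =
      (1 - t) * ∑ u ∈ nbrs S v, l v u * ((P u).1 - (P v).1) + t * ∑ u ∈ nbrs S v, m v u * ((P u).1 - (P v).1) := by
      rw [Finset.mul_sum, Finset.mul_sum, ← Finset.sum_add_distrib]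
      exact Finset.sum_congr rfl (fun u _ => by ring)
    simp only [hRt]
    rw [e3, e1, e2]; ring
  have key : ∀ t ∈ Set.Icc (0:ℝ) 1, 0 < t → (∀ s, 0 ≤ s → s < t → RS S A B C (Rt s)) → RS S A B C (Rt t) := by
    intro t ht tpos hs
    have sub : Set.Icc (0:ℝ) t ⊆ Set.Icc 0 1 := Set.Icc_subset_Icc le_rfl ht.2
    have per : ∀ a b p, Ed S a b → Sp S p → (P a).1 < (P p).1 → (P p).1 < (P b).1 → ∀ s, 0 ≤ s → s < t →
        ori (Rt s a) (Rt s b) (Rt s p) ≠ 0 := by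
      intro a b p he hp h1 h2 s s0 s1 hz
      exact (hs s s0 s1).no_vertex hp he (onSeg_x h1 h2 hz)
    refine h.of_inn (opos t) (h.strict hq ⟨fun a b => h.ed_symm, fun a b => h.sp_r, fun v => rfl, xinj,
      ?_, h.ord2_nc, ?_⟩ (opos t) ?_ hLR _ (w0 t ht) ?_ ?_)
    · intro a b p he hp h1 h2 hz
      exact h.no_vertex hp he (onSeg_x h1 h2 hz)
    · intro a b p he hp h1 h2
      constructor
      · intro h3
        have := ivt_pos (f := fun s => - ori (Rt s a) (Rt s b) (Rt s p)) tpos ((oc a b p).mono sub).neg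
          (by simp only [R0]; linarith) (fun s s0 s1 hz => per a b p he hp h1 h2 s s0 s1 (by linarith))
        linarith
      · intro h3
        exact ivt_pos (f := fun s => ori (Rt s a) (Rt s b) (Rt s p)) tpos ((oc a b p).mono sub)
          (by simp only [R0]; linarith) (fun s s0 s1 hz => per a b p he hp h1 h2 s s0 s1 (by linarith))
    · intro v hv
      refine ⟨?_, ?_, ?_⟩
      · exact ivt_nonneg (f := fun s => ori (Rt s A) (Rt s B) (Rt s v)) tpos ((oc _ _ _).mono sub)
          (fun s s0 s1 => ((hs s s0 s1).hull hv).1)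
      · exact ivt_nonneg (f := fun s => ori (Rt s B) (Rt s C) (Rt s v)) tpos ((oc _ _ _).mono sub)
          (fun s s0 s1 => ((hs s s0 s1).hull hv).2.1)
      · exact ivt_nonneg (f := fun s => ori (Rt s C) (Rt s A) (Rt s v)) tpos ((oc _ _ _).mono sub)
          (fun s s0 s1 => ((hs s s0 s1).hull hv).2.2)
    · intro v u hu
      have := mul_nonneg (sub_nonneg.2 ht.2) (l0 v u)
      have := mul_pos tpos (m1 v u hu)
      linarith
    · intro v hv hA hB hC
      exact eq t ht v ((memI v).2 ⟨hv, hA, hB, hC⟩)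
  have all : ∀ t ∈ Set.Icc (0:ℝ) 1, RS S A B C (Rt t) := by
    by_contra hcon
    push Not at hcon
    set Bd : Set ℝ := ⋃ q ∈ innF S P, Set.Icc (0:ℝ) 1 ∩ (fun t => ori (Rt t q.1) (Rt t q.2.1) (Rt t q.2.2)) ⁻¹' Set.Iic 0 with hBd
    have Bc : IsClosed Bd := by
      refine (innF S P).finite_toSet.isClosed_biUnion ?_
      intro q _
      exact (oc _ _ _).preimage_isClosed_of_isClosed isClosed_Icc isClosed_Iic
    have Bsub : Bd ⊆ Set.Icc 0 1 := by
      intro t ht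
      simp only [hBd, Set.mem_iUnion] at ht
      obtain ⟨q, _, h1, _⟩ := ht
      exact h1
    have Bn : ∀ t ∈ Set.Icc (0:ℝ) 1, t ∉ Bd → RS S A B C (Rt t) := by
      intro t ht hn
      refine h.of_inn (opos t) ?_
      intro a b c hm
      by_contra hle
      apply hn
      simp only [hBd, Set.mem_iUnion]
      exact ⟨(a, b, c), hm, ht, not_lt.1 hle⟩
    have By : ∀ t ∈ Bd, ¬ RS S A B C (Rt t) := by
      intro t ht hr
      simp only [hBd, Set.mem_iUnion] at ht
      obtain ⟨⟨a, b, c⟩, hm, _, h2⟩ := ht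
      rw [h.innF_eq hr] at hm
      have := hr.inn_ori hm
      exact absurd this (not_lt.2 h2)
    obtain ⟨t1, ht1, hn1⟩ := hcon
    have Bne : Bd.Nonempty := ⟨t1, by by_contra hc; exact hn1 (Bn t1 ht1 hc)⟩
    have Bbd : BddBelow Bd := ⟨0, fun t ht => (Bsub ht).1⟩
    have hmin := Bc.csInf_mem Bne Bbd
    have h01 := Bsub hmin
    have hp : 0 < sInf Bd := by
      rcases eq_or_lt_of_le h01.1 with h0 | h0
      · exfalso
        apply By _ hmin
        rw [← h0, R0]; exact h
      · exact h0
    refine By _ hmin (key _ h01 hp ?_)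
    intro s s0 s1
    refine Bn s ⟨s0, s1.le.trans h01.2⟩ (fun hc => ?_)
    exact absurd (csInf_le Bbd hc) (not_le.2 s1)
  have o1 : (1:ℝ) ∈ Set.Icc (0:ℝ) 1 := ⟨zero_le_one, le_rfl⟩
  refine ⟨Rt 1, all 1 o1, m, m0, m1, ?_⟩
  intro v hv hA hB hC
  have hv' := (memI v).2 ⟨hv, hA, hB, hC⟩
  refine ⟨(m2 v hv').1, ?_⟩
  have := eq 1 o1 v hv'
  simpa [Equil] using this

end ICP

end

set_option linter.all false
noncomputable section
set_option maxHeartbeats 1000000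
open Classical Filter Topology
namespace ICP
variable {W : Type} {S : Finset (W × W × W)} {A B C : W} {P R : W → ℝ × ℝ} {Q : W → W → W → W → Prop}

theorem crs_lin (n b c d : ℝ × ℝ) : crs b d * crs n c = crs b c * crs n d + crs c d * crs n b := by
  unfold crs; ring

theorem QOK.not_es (hq : QOK S R Q) {a b c d e : W} (h : Q a b c d) (he : Ed S a e) (hn : ¬ Es S Q a e) :
    e = c := by
  have : ∃ b d, Q a b e d := by
    by_contra hc
    exact hn ⟨he, hc⟩
  obtain ⟨b', d', h'⟩ := this
  rcases hq.dis _ _ _ _ _ _ _ _ a h h' (Or.inl rfl) (Or.inl rfl) with ⟨_, _, h3, _⟩ | ⟨h1, _, h3, _⟩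
  · exact h3
  · exact absurd h1 (hq.ne h).2.2.1

theorem RS.cvx_int (h : RS S A B C R) (hq : QOK S R Q) {a b c d : W} (hQ : Q a b c d)
    (m : W → W → ℝ) (m0 : ∀ u, 0 ≤ m a u) (m1 : ∀ u, Es S Q a u → 0 < m a u)
    (m2 : ∀ u, ¬ Es S Q a u → m a u = 0) (heq : Equil S m R a)
    (hA : a ≠ A) (hB : a ≠ B) (hC : a ≠ C) : 0 < ori (R a) (R b) (R d) := by
  by_contra hle
  rw [not_lt, ori_crs] at hle
  have i1 := hq.t1 _ _ _ _ hQ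
  have i2 := hq.t2 _ _ _ _ hQ
  have o1 := h.inn_ori i1
  have o2 := h.inn_ori i2
  rw [ori_crs] at o1 o2
  obtain ⟨eab, -, -, eda⟩ := hq.es h.toCS hQ
  have ead := hq.es_symm h.toCS eda
  have edac : Ed S a c := ⟨d, innS i2⟩
  have cl : ∀ e, Es S Q a e → crs (R b - R a) (R e - R a) ≤ 0 := by
    intro e he
    by_contra hp
    rw [not_le] at hp
    have hec : e ≠ c := by
      rintro rfl
      exact he.2 ⟨b, d, hQ⟩
    have h1 : 0 < crs (R c - R a) (R e - R a) := by
      rcases lt_trichotomy (crs (R c - R a) (R e - R a)) 0 with g | g | g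
      · exfalso
        refine h.cone i1 he.1 (by rw [ori_crs]; exact hp) (by rw [ori_crs, crs_comm]; linarith)
      · exfalso
        exact hec (h.ray edac he.1 g (dot_pos_of g o1 hp)).symm
      · exact g
    have h2 : 0 < crs (R d - R a) (R e - R a) := by
      rcases lt_trichotomy (crs (R d - R a) (R e - R a)) 0 with g | g | g
      · exfalso
        refine h.cone i2 he.1 (by rw [ori_crs]; exact h1) (by rw [ori_crs, crs_comm]; linarith)
      · exfalso
        have := h.ray ead.1 he.1 g (dot_pos_of g o2 h1)
        subst this
        linarith
      · exact g
    have k := crs_lin (R e - R a) (R b - R a) (R c - R a) (R d - R a)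
    rw [crs_comm (R e - R a) (R c - R a), crs_comm (R e - R a) (R b - R a), crs_comm (R e - R a) (R d - R a)] at k
    nlinarith [mul_pos o1 h2, mul_pos o2 hp]
  have hs : ∑ u ∈ nbrs S a, m a u * crs (R b - R a) (R u - R a) = 0 := by
    have := heq.ori (R a) (R b)
    rw [← this]
    refine Finset.sum_congr rfl (fun u _ => ?_)
    rw [ori_self1, ori_crs, sub_zero]
  have hz : ∀ e, Es S Q a e → crs (R b - R a) (R e - R a) = 0 := by
    intro e he
    have := (Finset.sum_eq_zero_iff_of_nonpos (fun u hu => ?_)).1 hs e (h.mem_nbrs.2 he.1)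
    · rcases mul_eq_zero.1 this with g | g
      · exact absurd g (m1 e he).ne'
      · exact g
    · by_cases hu : Es S Q a u
      · exact mul_nonpos_of_nonneg_of_nonpos (m0 u) (cl u hu)
      · rw [m2 u hu, zero_mul]
  obtain ⟨e, he1, he2, he3⟩ := h.next hA hB hC ead.1
  by_cases hee : Es S Q a e
  · exact crs_indep he3 (ori_sub_ne (h.inn_ori i1)) ⟨hz d ead, hz e hee⟩
  · have := hq.not_es hQ he1 hee
    subst this
    rw [crs_comm] at he3
    linarith

theorem RS.cvx_out (h : RS S A B C R) {b c d : W} (hb : (A, b, c) ∈ innF S R) (hd : (A, c, d) ∈ innF S R) :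
    0 < ori (R A) (R b) (R d) := by
  have o1 := h.inn_ori hb
  have o2 := h.inn_ori hd
  have f : ∀ v, Sp S v → v ≠ A → 0 < crs (R B - R C) (R v - R A) := by
    intro v hv hne
    obtain ⟨g1, _, g3⟩ := h.hull hv
    have e : crs (R B - R C) (R v - R A) = ori (R A) (R B) (R v) + ori (R C) (R A) (R v) := by
      simp only [crs, ori, Prod.fst_sub, Prod.snd_sub]; ring
    rw [e]
    rcases eq_or_lt_of_le g1 with k | k
    · rcases eq_or_lt_of_le g3 with k' | k'
      · exact absurd (h.inj hv (h.rot' h.out |> fun q => ⟨_, _, q⟩) (eq_of_two_zero h.pos k.symm k'.symm)) hne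
      · linarith
    · linarith
  obtain ⟨_, s1, s2⟩ := sp2 h.toCS (innS hb)
  obtain ⟨_, _, s3⟩ := sp2 h.toCS (innS hd)
  have f1 := f b s1 (ori_ne o1).1.symm
  have f2 := f c s2 (ori_ne o1).2.2.symm
  have f3 := f d s3 (ori_ne o2).2.2.symm
  rw [ori_crs] at o1 o2 ⊢
  have k := crs_lin (R B - R C) (R b - R A) (R c - R A) (R d - R A)
  have : 0 < crs (R b - R A) (R d - R A) * crs (R B - R C) (R c - R A) := by
    rw [k]; have := mul_pos o1 f3; have := mul_pos o2 f1; linarith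
  exact pos_of_mul_pos_left this f2.le

theorem QOK.of_innF (hq : QOK S P Q) (he : innF S P = innF S R) : QOK S R Q where
  sym := hq.sym
  t1 := by rw [← he]; exact hq.t1
  t2 := by rw [← he]; exact hq.t2
  nd := hq.nd
  dis := hq.dis

/-- linear change of coordinates -/
def Tn (n p : ℝ × ℝ) : ℝ × ℝ := (crs n p, -(n.1 * p.1 + n.2 * p.2))

theorem ori_Tn (n a b c : ℝ × ℝ) : ori (Tn n a) (Tn n b) (Tn n c) = (n.1 ^ 2 + n.2 ^ 2) * ori a b c := by
  simp only [ori, Tn, crs]; ring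

theorem RS.convex1 (h : RS S A B C P) (hq : QOK S P Q) {a b c d : W} (hQ : Q a b c d)
    (hcv : ∀ a' b' c' d', Q a' b' c' d' → a' ≠ a → a' ≠ c → 0 < ori (P a') (P b') (P d')) :
    ∃ R, RS S A B C R ∧ ∀ a' b' c' d', Q a' b' c' d' → 0 < ori (R a') (R b') (R d') := by
  have i1 := hq.t1 _ _ _ _ hQ
  have i2 := hq.t2 _ _ _ _ hQ
  have o1 := h.inn_ori i1
  have o2 := h.inn_ori i2
  have hx : ∃ e, crs (P c - P a) e ≠ 0 := ⟨P b - P a, by rw [crs_comm, ← ori_crs]; linarith⟩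
  obtain ⟨e, he⟩ := hx
  have ev1 : ∀ᶠ ε in 𝓝[>] (0:ℝ), ∀ u ∈ vset S, ∀ v ∈ vset S, u ≠ v →
      crs (mv (P c - P a) e ε) (P u - P v) ≠ 0 := by
    rw [Finset.eventually_all]
    intro u hu
    rw [Finset.eventually_all]
    intro v hv
    by_cases huv : u = v
    · simp [huv]
    have hne : P u - P v ≠ 0 := fun hz => huv (h.inj (mem_vset.1 hu) (mem_vset.1 hv) (sub_eq_zero.1 hz))
    have := ev_lin_ne (x := crs (P c - P a) (P u - P v)) (y := crs e (P u - P v)) (fun hz => by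
      have k := crs_lin (P u - P v) (P c - P a) (P u - P v) e
      rw [crs_self, crs_comm (P u - P v) e, hz.1, hz.2] at k
      -- (c-a) and e both parallel to u-v
      apply hne
      have k1 := hz.1
      have k2 := hz.2
      simp only [crs] at k1 k2 he
      have e1 : ((P c - P a).1 * e.2 - (P c - P a).2 * e.1) * (P u - P v).1 = 0 := by
        linear_combination e.1 * k1 - (P c - P a).1 * k2
      have e2 : ((P c - P a).1 * e.2 - (P c - P a).2 * e.1) * (P u - P v).2 = 0 := by
        linear_combination e.2 * k1 - (P c - P a).2 * k2
      have e1' := (mul_eq_zero.1 e1).resolve_left he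
      have e2' := (mul_eq_zero.1 e2).resolve_left he
      exact Prod.ext e1' e2')
    filter_upwards [this] with ε hε _
    have e3 : crs (mv (P c - P a) e ε) (P u - P v) = crs (P c - P a) (P u - P v) + ε * crs e (P u - P v) := by
      simp only [crs, mv]; ring
    rw [e3]; exact hε
  have ev2 : ∀ x : ℝ × ℝ, 0 < crs (P c - P a) x → ∀ᶠ ε in 𝓝[>] (0:ℝ), 0 < crs (mv (P c - P a) e ε) x := by
    intro x hx
    filter_upwards [ev_pos (y := crs e x) hx] with ε hε
    have e3 : crs (mv (P c - P a) e ε) x = crs (P c - P a) x + ε * crs e x := by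
      simp only [crs, mv]; ring
    rw [e3]; exact hε
  obtain ⟨ε, hgen, g1, g2, g3, g4⟩ := (ev1.and ((ev2 (P a - P b) (by
    have : crs (P c - P a) (P a - P b) = ori (P a) (P b) (P c) := by simp only [crs, ori, Prod.fst_sub, Prod.snd_sub]; ring
    linarith)).and ((ev2 (P c - P b) (by
    have : crs (P c - P a) (P c - P b) = ori (P a) (P b) (P c) := by simp only [crs, ori, Prod.fst_sub, Prod.snd_sub]; ring
    linarith)).and ((ev2 (P d - P a) (by rw [← ori_crs]; exact o2)).and (ev2 (P d - P c) (by
    have : crs (P c - P a) (P d - P c) = ori (P a) (P c) (P d) := by simp only [crs, ori, Prod.fst_sub, Prod.snd_sub]; ring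
    linarith)))))).exists
  set n := mv (P c - P a) e ε with hn
  have n0 : n ≠ 0 := by
    intro hz; rw [hz] at g1; simp [crs] at g1
  have npos := sq_pos_of_ne n0
  have xd : ∀ u v, (Tn n (P u)).1 - (Tn n (P v)).1 = crs n (P u - P v) := by
    intro u v; simp only [Tn, crs, Prod.fst_sub, Prod.snd_sub]; ring
  have cneg : ∀ u v : ℝ × ℝ, crs n (u - v) = - crs n (v - u) := by
    intro u v; simp only [crs, Prod.fst_sub, Prod.snd_sub]; ring
  have h' : RS S A B C (fun v => Tn n (P v)) := h.of_inn (by rw [ori_Tn]; exact mul_pos npos h.pos)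
    (fun x y z hm => by rw [ori_Tn]; exact mul_pos npos (h.inn_ori hm))
  have hq' := hq.of_innF (h.innF_eq h')
  obtain ⟨R, hR, m, m0, m1, m2⟩ := h'.mono hq' (by
    intro u v hu hv he
    by_contra hne
    refine hgen u (mem_vset.2 hu) v (mem_vset.2 hv) hne ?_
    rw [← xd]
    rw [he, sub_self]) (by
    intro v hv hA hB hC
    suffices hh : (∃ u, Es S Q v u ∧ crs n (P u - P v) < 0) ∧ (∃ u, Es S Q v u ∧ 0 < crs n (P u - P v)) by
      obtain ⟨⟨u, hu, hu'⟩, w, hw, hw'⟩ := hh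
      refine ⟨⟨u, hu, ?_⟩, w, hw, ?_⟩
      · have := xd u v; linarith
      · have := xd w v; linarith
    have aux : ∀ b' c' d', Q v b' c' d' → v ≠ a → v ≠ c → ∀ n' : ℝ × ℝ, n' ≠ 0 →
        ∃ u, Es S Q v u ∧ crs n' (P u - P v) < 0 := by
      intro b' c' d' hQ' va vc n' hn'
      obtain ⟨u, hu, hu'⟩ := h.le hv hA hB hC hn'
      by_cases hes : Es S Q v u
      · exact ⟨u, hes, hu'⟩
      · have := hq.not_es hQ' hu hes
        subst this
        obtain ⟨e1, _, _, e4⟩ := hq.es h.toCS hQ'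
        by_contra hcon
        push Not at hcon
        have p1 := hcon _ e1
        have p2 := hcon _ (hq.es_symm h.toCS e4)
        have q1 := h.inn_ori (hq.t1 _ _ _ _ hQ')
        have q2 := h.inn_ori (hq.t2 _ _ _ _ hQ')
        have q3 := hcv _ _ _ _ hQ' va vc
        rw [ori_crs] at q1 q2 q3
        have k := crs_lin n' (P b' - P v) (P u - P v) (P d' - P v)
        nlinarith [mul_nonneg q1.le p2, mul_nonneg q2.le p1]
    have neg : ∀ x, crs (-n) x = - crs n x := by intro x; simp [crs]; ring
    have nn0 : -n ≠ 0 := neg_ne_zero.2 n0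
    by_cases hqv : ∃ b' c' d', Q v b' c' d'
    · obtain ⟨b', c', d', hQ'⟩ := hqv
      by_cases va : v = a
      · subst va
        obtain ⟨e1, _, _, e4⟩ := hq.es h.toCS hQ
        exact ⟨⟨b, e1, by rw [cneg]; linarith⟩, d, hq.es_symm h.toCS e4, g3⟩
      by_cases vc : v = c
      · subst vc
        obtain ⟨_, e2, e3, _⟩ := hq.es h.toCS hQ
        exact ⟨⟨b, hq.es_symm h.toCS e2, by rw [cneg]; linarith⟩, d, e3, g4⟩
      refine ⟨aux _ _ _ hQ' va vc n n0, ?_⟩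
      obtain ⟨u, hu, hu'⟩ := aux _ _ _ hQ' va vc (-n) nn0
      exact ⟨u, hu, by rw [neg] at hu'; linarith⟩
    · have es : ∀ u, Ed S v u → Es S Q v u := fun u hu => ⟨hu, fun ⟨b', d', hQ'⟩ => hqv ⟨b', u, d', hQ'⟩⟩
      obtain ⟨u, hu, hu'⟩ := h.le hv hA hB hC n0
      obtain ⟨w, hw, hw'⟩ := h.le hv hA hB hC nn0
      exact ⟨⟨u, es u hu, hu'⟩, w, es w hw, by rw [neg] at hw'; linarith⟩)
  have hqR := hq'.of_innF (h'.innF_eq hR)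
  refine ⟨R, hR, ?_⟩
  intro a' b' c' d' hQ'
  have j1 := hqR.t1 _ _ _ _ hQ'
  have j2 := hqR.t2 _ _ _ _ hQ'
  by_cases hA : a' = A
  · subst hA; exact hR.cvx_out j1 j2
  by_cases hB : a' = B
  · subst hB; exact hR.rotO.cvx_out j1 j2
  by_cases hC : a' = C
  · subst hC; exact hR.rotO.rotO.cvx_out j1 j2
  have sp := (sp2 h.toCS (innS j1)).1
  obtain ⟨k1, k2⟩ := m2 a' sp hA hB hC
  exact hR.cvx_int hqR hQ' m (m0 a') (m1 a') k1 k2 hA hB hC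

theorem RS.convexify (h : RS S A B C P) (hq : QOK S P Q) :
    ∃ R, RS S A B C R ∧ ∀ a b c d, Q a b c d → 0 < ori (R a) (R b) (R d) := by
  have main : ∀ F : Finset (W × W × W × W), ∃ R, RS S A B C R ∧
      ∀ a b c d, Q a b c d → ((a, b, c, d) ∈ F ∨ (c, d, a, b) ∈ F) → 0 < ori (R a) (R b) (R d) := by
    intro F
    induction F using Finset.induction_on with
    | empty => exact ⟨P, h, by simp⟩
    | insert q F hqF ih =>
      obtain ⟨a, b, c, d⟩ := q
      obtain ⟨R, hR, hcv⟩ := ih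
      by_cases hQ : Q a b c d
      swap
      · refine ⟨R, hR, fun a' b' c' d' hQ' hm => hcv _ _ _ _ hQ' ?_⟩
        rcases hm with hm | hm
        · rcases Finset.mem_insert.1 hm with he | he
          · simp only [Prod.mk.injEq] at he
            obtain ⟨rfl, rfl, rfl, rfl⟩ := he
            exact absurd hQ' hQ
          · exact Or.inl he
        · rcases Finset.mem_insert.1 hm with he | he
          · simp only [Prod.mk.injEq] at he
            obtain ⟨rfl, rfl, rfl, rfl⟩ := he
            exact absurd (hq.sym _ _ _ _ hQ') hQ
          · exact Or.inr he
      have hq2 := hq.of_innF (h.innF_eq hR)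
      set Q' : W → W → W → W → Prop := fun a' b' c' d' => Q a' b' c' d' ∧
        ((a', b', c', d') ∈ insert (a, b, c, d) F ∨ (c', d', a', b') ∈ insert (a, b, c, d) F) with hQ'
      have hq3 : QOK S R Q' := {
        sym := fun a b c d h => ⟨hq.sym _ _ _ _ h.1, h.2.symm⟩
        t1 := fun a b c d h => hq2.t1 _ _ _ _ h.1
        t2 := fun a b c d h => hq2.t2 _ _ _ _ h.1
        nd := fun a b c d h => hq2.nd _ _ _ _ h.1
        dis := fun a b c d a' b' c' d' x h h' => hq2.dis _ _ _ _ _ _ _ _ x h.1 h'.1 }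
      obtain ⟨R', hR', hcv'⟩ := hR.convex1 hq3 (a := a) (b := b) (c := c) (d := d)
        ⟨hQ, Or.inl (Finset.mem_insert_self _ _)⟩ (by
          rintro a' b' c' d' ⟨hQ1, hm⟩ n1 n2
          refine hcv _ _ _ _ hQ1 ?_
          rcases hm with hm | hm
          · rcases Finset.mem_insert.1 hm with he | he
            · simp only [Prod.mk.injEq] at he
              exact absurd he.1 n1
            · exact Or.inl he
          · rcases Finset.mem_insert.1 hm with he | he
            · simp only [Prod.mk.injEq] at he
              exact absurd he.2.2.1 n2
            · exact Or.inr he)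
      exact ⟨R', hR', fun a' b' c' d' h1 h2 => hcv' _ _ _ _ ⟨h1, h2⟩⟩
  obtain ⟨R, hR, hcv⟩ := main (((vset S) ×ˢ (vset S) ×ˢ (vset S) ×ˢ (vset S)))
  refine ⟨R, hR, fun a b c d hQ => hcv _ _ _ _ hQ (Or.inl ?_)⟩
  obtain ⟨s1, s2, s3⟩ := sp2 h.toCS (innS (hq.t1 _ _ _ _ hQ))
  obtain ⟨_, _, s4⟩ := sp2 h.toCS (innS (hq.t2 _ _ _ _ hQ))
  simp only [Finset.mem_product, mem_vset]
  exact ⟨s1, s2, s3, s4⟩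

end ICP

end

set_option linter.all false
noncomputable section
set_option maxHeartbeats 1000000
open Classical Filter Topology
namespace ICP
variable {W : Type} {S : Finset (W × W × W)} {A B C : W} {P R : W → ℝ × ℝ} {Q : W → W → W → W → Prop}

/-- the three rotations of a triple -/
def rt (a b c : W) : Finset (W × W × W) := {(a, b, c), (b, c, a), (c, a, b)}

theorem mem_rt {a b c p q r : W} : (p, q, r) ∈ rt a b c ↔ (p = a ∧ q = b ∧ r = c) ∨
    (p = b ∧ q = c ∧ r = a) ∨ (p = c ∧ q = a ∧ r = b) := by
  simp [rt]

theorem rt_rot {a b c p q r : W} (h : (p, q, r) ∈ rt a b c) : (q, r, p) ∈ rt a b c := by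
  rw [mem_rt] at h ⊢
  rcases h with ⟨rfl, rfl, rfl⟩ | ⟨rfl, rfl, rfl⟩ | ⟨rfl, rfl, rfl⟩ <;> simp

theorem CS.surg (h : CS S) (D N : Finset (W × W × W)) (hD : D ⊆ S)
    (rotD : ∀ a b c, (a, b, c) ∈ D → (b, c, a) ∈ D) (rotN : ∀ a b c, (a, b, c) ∈ N → (b, c, a) ∈ N)
    (uN : ∀ a b c c', (a, b, c) ∈ N → (a, b, c') ∈ N → c = c')
    (c1 : ∀ a b c, (a, b, c) ∈ N → (∃ c', (a, b, c') ∈ D) ∨ ¬ Ed S a b)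
    (c2 : ∀ a b c, (a, b, c) ∈ D → (∃ c', (a, b, c') ∈ N) ∨ ∃ c', (b, a, c') ∈ D)
    (c3 : ∀ a b c, (a, b, c) ∈ N → (∃ c', (b, a, c') ∈ N) ∨ ∃ c', (b, a, c') ∈ S ∧ (b, a, c') ∉ D) :
    CS ((S \ D) ∪ N) := by
  have m : ∀ t, t ∈ (S \ D) ∪ N ↔ (t ∈ S ∧ t ∉ D) ∨ t ∈ N := by intro t; simp
  have xx : ∀ a b c c', (a, b, c) ∈ N → (a, b, c') ∈ S → (a, b, c') ∉ D → False := by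
    intro a b c c' h1 h2 h3
    rcases c1 _ _ _ h1 with ⟨d, hd⟩ | hd
    · have := h.uniq _ _ _ _ h2 (hD hd)
      subst this; exact h3 hd
    · exact hd ⟨c', h2⟩
  constructor
  · intro a b c
    rw [m, m]
    rintro (⟨h1, h2⟩ | h1)
    · exact Or.inl ⟨h.rot _ _ _ h1, fun h3 => h2 (rotD _ _ _ (rotD _ _ _ h3))⟩
    · exact Or.inr (rotN _ _ _ h1)
  · intro a b c c'
    rw [m, m]
    rintro (⟨h1, h2⟩ | h1) (⟨h3, h4⟩ | h3)
    · exact h.uniq _ _ _ _ h1 h3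
    · exact (xx _ _ _ _ h3 h1 h2).elim
    · exact (xx _ _ _ _ h1 h3 h4).elim
    · exact uN _ _ _ _ h1 h3
  · intro a b c
    rw [m]
    rintro (⟨h1, h2⟩ | h1)
    · obtain ⟨c', h3⟩ := h.adj _ _ _ h1
      by_cases h4 : (b, a, c') ∈ D
      · rcases c2 _ _ _ h4 with ⟨d, hd⟩ | ⟨d, hd⟩
        · exact ⟨d, (m _).2 (Or.inr hd)⟩
        · have := h.uniq _ _ _ _ h1 (hD hd)
          subst this; exact absurd hd h2
      · exact ⟨c', (m _).2 (Or.inl ⟨h3, h4⟩)⟩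
    · rcases c3 _ _ _ h1 with ⟨d, hd⟩ | ⟨d, hd⟩
      · exact ⟨d, (m _).2 (Or.inr hd)⟩
      · exact ⟨d, (m _).2 (Or.inl hd)⟩

/-- flip of the edge `uv` with faces `(u,v,w)`, `(v,u,z)` -/
def flipS (S : Finset (W × W × W)) (u v w z : W) : Finset (W × W × W) :=
  (S \ (rt u v w ∪ rt v u z)) ∪ (rt u z w ∪ rt v w z)

/-- deletion of a vertex of degree three with link `a b c` -/
def delS (S : Finset (W × W × W)) (x a b c : W) : Finset (W × W × W) :=
  (S \ (rt x a b ∪ rt x b c ∪ rt x c a)) ∪ rt a b c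

theorem CS.flip (h : CS S) {u v w z : W} (h1 : (u, v, w) ∈ S) (h2 : (v, u, z) ∈ S)
    (uv : u ≠ v) (uw : u ≠ w) (vw : v ≠ w) (uz : u ≠ z) (vz : v ≠ z) (wz : w ≠ z)
    (hne : ¬ Ed S z w) : CS (flipS S u v w z) := by
  have hne' : ¬ Ed S w z := fun hh => hne (h.ed_symm hh)
  have k1 := h.rot _ _ _ h1
  have k2 := h.rot' h1
  have k3 := h.rot _ _ _ h2
  have k4 := h.rot' h2
  refine h.surg _ _ ?_ ?_ ?_ ?_ ?_ ?_ ?_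
  · rintro ⟨p, q, r⟩ hm
    simp only [Finset.mem_union, mem_rt] at hm
    rcases hm with (⟨rfl, rfl, rfl⟩ | ⟨rfl, rfl, rfl⟩ | ⟨rfl, rfl, rfl⟩) | (⟨rfl, rfl, rfl⟩ | ⟨rfl, rfl, rfl⟩ | ⟨rfl, rfl, rfl⟩) <;> assumption
  · intro a b c hm
    rcases Finset.mem_union.1 hm with hm | hm
    · exact Finset.mem_union_left _ (rt_rot hm)
    · exact Finset.mem_union_right _ (rt_rot hm)
  · intro a b c hm
    rcases Finset.mem_union.1 hm with hm | hm
    · exact Finset.mem_union_left _ (rt_rot hm)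
    · exact Finset.mem_union_right _ (rt_rot hm)
  · intro a b c c'
    simp only [Finset.mem_union, mem_rt]; grind
  · intro a b c hm
    simp only [Finset.mem_union, mem_rt] at hm
    rcases hm with (⟨e1, e2, -⟩ | ⟨e1, e2, -⟩ | ⟨e1, e2, -⟩) | (⟨e1, e2, -⟩ | ⟨e1, e2, -⟩ | ⟨e1, e2, -⟩) <;> rw [e1, e2]
    · exact Or.inl ⟨v, by simp [mem_rt]⟩
    · exact Or.inr hne
    · exact Or.inl ⟨v, by simp [mem_rt]⟩
    · exact Or.inl ⟨u, by simp [mem_rt]⟩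
    · exact Or.inr hne'
    · exact Or.inl ⟨u, by simp [mem_rt]⟩
  · intro a b c hm
    simp only [Finset.mem_union, mem_rt] at hm
    rcases hm with (⟨e1, e2, -⟩ | ⟨e1, e2, -⟩ | ⟨e1, e2, -⟩) | (⟨e1, e2, -⟩ | ⟨e1, e2, -⟩ | ⟨e1, e2, -⟩) <;> rw [e1, e2]
    · exact Or.inr ⟨z, by simp [mem_rt]⟩
    · exact Or.inl ⟨z, by simp [mem_rt]⟩
    · exact Or.inl ⟨z, by simp [mem_rt]⟩
    · exact Or.inr ⟨w, by simp [mem_rt]⟩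
    · exact Or.inl ⟨w, by simp [mem_rt]⟩
    · exact Or.inl ⟨w, by simp [mem_rt]⟩
  · intro a b c hm
    simp only [Finset.mem_union, mem_rt] at hm
    rcases hm with (⟨e1, e2, -⟩ | ⟨e1, e2, -⟩ | ⟨e1, e2, -⟩) | (⟨e1, e2, -⟩ | ⟨e1, e2, -⟩ | ⟨e1, e2, -⟩) <;> rw [e1, e2]
    · right; obtain ⟨d, hd⟩ := h.adj _ _ _ k3; exact ⟨d, hd, by simp only [Finset.mem_union, mem_rt]; grind⟩
    · exact Or.inl ⟨v, by simp [mem_rt]⟩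
    · right; obtain ⟨d, hd⟩ := h.adj _ _ _ k2; exact ⟨d, hd, by simp only [Finset.mem_union, mem_rt]; grind⟩
    · right; obtain ⟨d, hd⟩ := h.adj _ _ _ k1; exact ⟨d, hd, by simp only [Finset.mem_union, mem_rt]; grind⟩
    · exact Or.inl ⟨u, by simp [mem_rt]⟩
    · right; obtain ⟨d, hd⟩ := h.adj _ _ _ k4; exact ⟨d, hd, by simp only [Finset.mem_union, mem_rt]; grind⟩

theorem mem_flipS {u v w z p q r : W} : (p, q, r) ∈ flipS S u v w z ↔
    ((p, q, r) ∈ S ∧ (p, q, r) ∉ rt u v w ∧ (p, q, r) ∉ rt v u z) ∨ (p, q, r) ∈ rt u z w ∨ (p, q, r) ∈ rt v w z := by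
  simp [flipS]

theorem mem_delS {x a b c p q r : W} : (p, q, r) ∈ delS S x a b c ↔
    ((p, q, r) ∈ S ∧ (p, q, r) ∉ rt x a b ∧ (p, q, r) ∉ rt x b c ∧ (p, q, r) ∉ rt x c a) ∨ (p, q, r) ∈ rt a b c := by
  simp [delS]

theorem CS.ed_flip (h : CS S) {u v w z : W} (h1 : (u, v, w) ∈ S) (h2 : (v, u, z) ∈ S)
    (uv : u ≠ v) (uw : u ≠ w) (vw : v ≠ w) (uz : u ≠ z) (vz : v ≠ z) {p q : W} :
    Ed (flipS S u v w z) p q ↔ (Ed S p q ∧ ¬ (p = u ∧ q = v) ∧ ¬ (p = v ∧ q = u)) ∨ (p = z ∧ q = w) ∨ (p = w ∧ q = z) := by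
  have k1 := h.rot _ _ _ h1
  have k2 := h.rot' h1
  have k3 := h.rot _ _ _ h2
  have k4 := h.rot' h2
  constructor
  · rintro ⟨r, hr⟩
    rw [mem_flipS] at hr
    rcases hr with ⟨m1, m2, m3⟩ | hr
    · left
      refine ⟨⟨r, m1⟩, ?_, ?_⟩
      · rintro ⟨rfl, rfl⟩
        have := h.uniq _ _ _ _ m1 h1
        subst this; simp [rt] at m2
      · rintro ⟨rfl, rfl⟩
        have := h.uniq _ _ _ _ m1 h2
        subst this; simp [rt] at m3
    · simp only [mem_rt] at hr
      rcases hr with (⟨rfl, rfl, rfl⟩ | ⟨rfl, rfl, rfl⟩ | ⟨rfl, rfl, rfl⟩) | (⟨rfl, rfl, rfl⟩ | ⟨rfl, rfl, rfl⟩ | ⟨rfl, rfl, rfl⟩)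
      · exact Or.inl ⟨⟨_, k3⟩, fun g => vz g.2.symm, fun g => uv g.1⟩
      · exact Or.inr (Or.inl ⟨rfl, rfl⟩)
      · exact Or.inl ⟨⟨_, k2⟩, fun g => uw g.1.symm, fun g => vw g.1.symm⟩
      · exact Or.inl ⟨⟨_, k1⟩, fun g => uv g.1.symm, fun g => uw g.2.symm⟩
      · exact Or.inr (Or.inr ⟨rfl, rfl⟩)
      · exact Or.inl ⟨⟨_, k4⟩, fun g => uz g.1.symm, fun g => vz g.1.symm⟩
  · rintro (⟨⟨r, m1⟩, m2, m3⟩ | ⟨rfl, rfl⟩ | ⟨rfl, rfl⟩)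
    · by_cases hr : (p, q, r) ∈ rt u v w
      · rw [mem_rt] at hr
        rcases hr with ⟨rfl, rfl, rfl⟩ | ⟨rfl, rfl, rfl⟩ | ⟨rfl, rfl, rfl⟩
        · simp at m2
        · exact ⟨z, by simp [mem_flipS, mem_rt]⟩
        · exact ⟨z, by simp [mem_flipS, mem_rt]⟩
      · by_cases hr' : (p, q, r) ∈ rt v u z
        · rw [mem_rt] at hr'
          rcases hr' with ⟨rfl, rfl, rfl⟩ | ⟨rfl, rfl, rfl⟩ | ⟨rfl, rfl, rfl⟩
          · simp at m3
          · exact ⟨w, by simp [mem_flipS, mem_rt]⟩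
          · exact ⟨w, by simp [mem_flipS, mem_rt]⟩
        · exact ⟨r, mem_flipS.2 (Or.inl ⟨m1, hr, hr'⟩)⟩
    · exact ⟨u, by simp [mem_flipS, mem_rt]⟩
    · exact ⟨v, by simp [mem_flipS, mem_rt]⟩

theorem CS.del (h : CS S) {x a b c : W} (h1 : (x, a, b) ∈ S) (h2 : (x, b, c) ∈ S) (h3 : (x, c, a) ∈ S)
    (xa : x ≠ a) (xb : x ≠ b) (xc : x ≠ c) (ab : a ≠ b) (bc : b ≠ c) (ac : a ≠ c) : CS (delS S x a b c) := by
  have k1 := h.rot _ _ _ h1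
  have k2 := h.rot _ _ _ h2
  have k3 := h.rot _ _ _ h3
  have k1' := h.rot' h1
  have k2' := h.rot' h2
  have k3' := h.rot' h3
  refine h.surg _ _ ?_ ?_ ?_ ?_ ?_ ?_ ?_
  · rintro ⟨p, q, r⟩ hm
    simp only [Finset.mem_union, mem_rt] at hm
    rcases hm with ((⟨rfl, rfl, rfl⟩ | ⟨rfl, rfl, rfl⟩ | ⟨rfl, rfl, rfl⟩) | (⟨rfl, rfl, rfl⟩ | ⟨rfl, rfl, rfl⟩ | ⟨rfl, rfl, rfl⟩)) | (⟨rfl, rfl, rfl⟩ | ⟨rfl, rfl, rfl⟩ | ⟨rfl, rfl, rfl⟩) <;> assumption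
  · intro p q r hm
    rcases Finset.mem_union.1 hm with hm | hm
    · rcases Finset.mem_union.1 hm with hm | hm
      · exact Finset.mem_union_left _ (Finset.mem_union_left _ (rt_rot hm))
      · exact Finset.mem_union_left _ (Finset.mem_union_right _ (rt_rot hm))
    · exact Finset.mem_union_right _ (rt_rot hm)
  · intro p q r hm
    exact rt_rot hm
  · intro p q r r'
    simp only [mem_rt]; grind
  · intro p q r hm
    simp only [mem_rt] at hm
    rcases hm with ⟨e1, e2, -⟩ | ⟨e1, e2, -⟩ | ⟨e1, e2, -⟩ <;> rw [e1, e2] <;>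
      exact Or.inl ⟨x, by simp [mem_rt]⟩
  · intro p q r hm
    simp only [Finset.mem_union, mem_rt] at hm
    rcases hm with ((⟨e1, e2, -⟩ | ⟨e1, e2, -⟩ | ⟨e1, e2, -⟩) | (⟨e1, e2, -⟩ | ⟨e1, e2, -⟩ | ⟨e1, e2, -⟩)) | (⟨e1, e2, -⟩ | ⟨e1, e2, -⟩ | ⟨e1, e2, -⟩) <;> rw [e1, e2]
    · exact Or.inr ⟨c, by simp [mem_rt]⟩
    · exact Or.inl ⟨c, by simp [mem_rt]⟩
    · exact Or.inr ⟨c, by simp [mem_rt]⟩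
    · exact Or.inr ⟨a, by simp [mem_rt]⟩
    · exact Or.inl ⟨a, by simp [mem_rt]⟩
    · exact Or.inr ⟨a, by simp [mem_rt]⟩
    · exact Or.inr ⟨b, by simp [mem_rt]⟩
    · exact Or.inl ⟨b, by simp [mem_rt]⟩
    · exact Or.inr ⟨b, by simp [mem_rt]⟩
  · intro p q r hm
    simp only [mem_rt] at hm
    rcases hm with ⟨e1, e2, -⟩ | ⟨e1, e2, -⟩ | ⟨e1, e2, -⟩ <;> rw [e1, e2]
    · right; obtain ⟨d, hd⟩ := h.adj _ _ _ k1; exact ⟨d, hd, by simp only [Finset.mem_union, mem_rt]; grind⟩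
    · right; obtain ⟨d, hd⟩ := h.adj _ _ _ k2; exact ⟨d, hd, by simp only [Finset.mem_union, mem_rt]; grind⟩
    · right; obtain ⟨d, hd⟩ := h.adj _ _ _ k3; exact ⟨d, hd, by simp only [Finset.mem_union, mem_rt]; grind⟩

theorem CS.ed_del (h : CS S) {x a b c : W} (h1 : (x, a, b) ∈ S) (h2 : (x, b, c) ∈ S) (h3 : (x, c, a) ∈ S)
    (xa : x ≠ a) (xb : x ≠ b) (xc : x ≠ c) (hall : ∀ n, Ed S x n → n = a ∨ n = b ∨ n = c) {p q : W} :
    Ed (delS S x a b c) p q ↔ Ed S p q ∧ p ≠ x ∧ q ≠ x := by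
  have k1 := h.rot _ _ _ h1
  have k2 := h.rot _ _ _ h2
  have k3 := h.rot _ _ _ h3
  have key : ∀ q r, (x, q, r) ∈ S → (x, q, r) ∈ rt x a b ∨ (x, q, r) ∈ rt x b c ∨ (x, q, r) ∈ rt x c a := by
    intro q r hm
    rcases hall q ⟨r, hm⟩ with rfl | rfl | rfl
    · have := h.uniq _ _ _ _ hm h1; subst this; left; simp [rt]
    · have := h.uniq _ _ _ _ hm h2; subst this; right; left; simp [rt]
    · have := h.uniq _ _ _ _ hm h3; subst this; right; right; simp [rt]
  constructor
  · rintro ⟨r, hr⟩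
    rw [mem_delS] at hr
    rcases hr with ⟨m1, m2, m3, m4⟩ | hr
    · refine ⟨⟨r, m1⟩, ?_, ?_⟩
      · rintro rfl
        rcases key _ _ m1 with g | g | g
        · exact m2 g
        · exact m3 g
        · exact m4 g
      · rintro rfl
        rcases key _ _ (h.rot _ _ _ m1) with g | g | g
        · exact m2 (rt_rot (rt_rot g))
        · exact m3 (rt_rot (rt_rot g))
        · exact m4 (rt_rot (rt_rot g))
    · simp only [mem_rt] at hr
      rcases hr with ⟨rfl, rfl, rfl⟩ | ⟨rfl, rfl, rfl⟩ | ⟨rfl, rfl, rfl⟩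
      · exact ⟨⟨_, k1⟩, xa.symm, xb.symm⟩
      · exact ⟨⟨_, k2⟩, xb.symm, xc.symm⟩
      · exact ⟨⟨_, k3⟩, xc.symm, xa.symm⟩
  · rintro ⟨⟨r, m1⟩, px, qx⟩
    by_cases g1 : (p, q, r) ∈ rt x a b
    · rw [mem_rt] at g1
      rcases g1 with ⟨rfl, rfl, rfl⟩ | ⟨rfl, rfl, rfl⟩ | ⟨rfl, rfl, rfl⟩
      · exact absurd rfl px
      · exact ⟨c, by simp [mem_delS, mem_rt]⟩
      · exact absurd rfl qx
    by_cases g2 : (p, q, r) ∈ rt x b c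
    · rw [mem_rt] at g2
      rcases g2 with ⟨rfl, rfl, rfl⟩ | ⟨rfl, rfl, rfl⟩ | ⟨rfl, rfl, rfl⟩
      · exact absurd rfl px
      · exact ⟨a, by simp [mem_delS, mem_rt]⟩
      · exact absurd rfl qx
    by_cases g3 : (p, q, r) ∈ rt x c a
    · rw [mem_rt] at g3
      rcases g3 with ⟨rfl, rfl, rfl⟩ | ⟨rfl, rfl, rfl⟩ | ⟨rfl, rfl, rfl⟩
      · exact absurd rfl px
      · exact ⟨b, by simp [mem_delS, mem_rt]⟩
      · exact absurd rfl qx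
    exact ⟨r, mem_delS.2 (Or.inl ⟨m1, g1, g2, g3⟩)⟩

theorem sp_iff_ed {v : W} : Sp S v ↔ ∃ u, Ed S v u := Iff.rfl

end ICP

end

set_option linter.all false
noncomputable section
set_option maxHeartbeats 1000000
open Classical Filter Topology
namespace ICP
variable {W : Type} {S : Finset (W × W × W)} {A B C : W} {P R : W → ℝ × ℝ} {Q : W → W → W → W → Prop}

theorem RS.flip (h : RS S A B C P) {u v w z : W} (h1 : (u, v, w) ∈ innF S P) (h2 : (v, u, z) ∈ innF S P)
    (wz : w ≠ z) (hne : ¬ Ed S z w) : ∃ R, RS (flipS S u v w z) A B C R := by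
  have hq : QOK S P (fun a b c d => (a = u ∧ b = z ∧ c = v ∧ d = w) ∨ (a = v ∧ b = w ∧ c = u ∧ d = z)) := by
    refine ⟨?_, ?_, ?_, ?_, ?_⟩
    · rintro a b c d (⟨rfl, rfl, rfl, rfl⟩ | ⟨rfl, rfl, rfl, rfl⟩) <;> simp
    · rintro a b c d (⟨rfl, rfl, rfl, rfl⟩ | ⟨rfl, rfl, rfl, rfl⟩)
      · exact rot_innF h h2
      · exact rot_innF h h1
    · rintro a b c d (⟨rfl, rfl, rfl, rfl⟩ | ⟨rfl, rfl, rfl, rfl⟩)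
      · exact h1
      · exact h2
    · rintro a b c d (⟨rfl, rfl, rfl, rfl⟩ | ⟨rfl, rfl, rfl, rfl⟩)
      · exact hne
      · exact fun q => hne (h.ed_symm q)
    · rintro a b c d a' b' c' d' x (⟨rfl, rfl, rfl, rfl⟩ | ⟨rfl, rfl, rfl, rfl⟩) (⟨rfl, rfl, rfl, rfl⟩ | ⟨rfl, rfl, rfl, rfl⟩) _ _ <;> simp
  obtain ⟨R, hR, hc⟩ := h.convexify hq
  refine ⟨R, ?_⟩
  have c1 := hc u z v w (Or.inl ⟨rfl, rfl, rfl, rfl⟩)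
  have c2 := hc v w u z (Or.inr ⟨rfl, rfl, rfl, rfl⟩)
  have n1 := ori_ne (h.inn_ori h1)
  have n2 := ori_ne (h.inn_ori h2)
  have he := h.innF_eq hR
  rw [he] at h1 h2
  refine { toCS := h.toCS.flip (innS h1) (innS h2) n1.1 n1.2.2 n1.2.1 n2.2.1 n2.2.2 wz hne, out := ?_, pos := hR.pos, inn := ?_ }
  · refine mem_flipS.2 (Or.inl ⟨h.out, ?_, ?_⟩)
    · intro q
      have p1 := hR.inn_ori h1
      have p2 := hR.pos
      rcases mem_rt.1 q with ⟨rfl, rfl, rfl⟩ | ⟨rfl, rfl, rfl⟩ | ⟨rfl, rfl, rfl⟩ <;> unfold ori at p1 p2 <;> linarith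
    · intro q
      have p1 := hR.inn_ori h2
      have p2 := hR.pos
      rcases mem_rt.1 q with ⟨rfl, rfl, rfl⟩ | ⟨rfl, rfl, rfl⟩ | ⟨rfl, rfl, rfl⟩ <;> unfold ori at p1 p2 <;> linarith
  · intro a b c hm
    rcases mem_flipS.1 hm with hm | hm | hm
    · exact hR.inn a b c hm.1
    · left
      rcases mem_rt.1 hm with ⟨rfl, rfl, rfl⟩ | ⟨rfl, rfl, rfl⟩ | ⟨rfl, rfl, rfl⟩ <;> unfold ori at c1 ⊢ <;> linarith
    · left
      rcases mem_rt.1 hm with ⟨rfl, rfl, rfl⟩ | ⟨rfl, rfl, rfl⟩ | ⟨rfl, rfl, rfl⟩ <;> unfold ori at c2 ⊢ <;> linarith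

theorem RS.closed_nbrs (h : RS S A B C P) {x n : W} (hA : x ≠ A) (hB : x ≠ B) (hC : x ≠ C)
    (Z : Finset W) (hZ : Z.Nonempty) (hcl : ∀ z ∈ Z, ∃ z' ∈ Z, (x, z, z') ∈ S) (hn : Ed S x n) : n ∈ Z := by
  by_contra hnZ
  have hcl : ∀ z ∈ Z, ∃ z' ∈ Z, (x, z, z') ∈ innF S P := fun z hz => by
    obtain ⟨z', h1, h2⟩ := hcl z hz
    exact ⟨z', h1, h.int_inn hA hB hC h2⟩
  have hed : ∀ z ∈ Z, Ed S x z := fun z hz => by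
    obtain ⟨z', h1, h2⟩ := hcl z hz
    exact ⟨z', innS h2⟩
  set d := P n - P x with hd
  have hd0 : d ≠ 0 := by
    intro q
    exact h.ed_ne hn (h.inj (h.sp_l hn) (h.sp_r hn) (sub_eq_zero.1 q).symm)
  have hsq := sq_pos_of_ne hd0
  have key : ∀ Y : Finset W, Y.Nonempty → (∀ z ∈ Y, ∃ z' ∈ Y, (x, z, z') ∈ innF S P ∧
      0 < crs d (P z - P x) * crs d (P z' - P x)) → False := by
    intro Y hY hc
    obtain ⟨z, hz, hmin⟩ := Y.exists_min_image (fun z => (d.1 * (P z - P x).1 + d.2 * (P z - P x).2) / crs d (P z - P x)) hY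
    obtain ⟨z', hz', hm, hp⟩ := hc z hz
    have h1 := hmin z' hz'
    have h2 := h.inn_ori hm
    rw [ori_crs] at h2
    have h3 := crs3 d (P z - P x) (P z' - P x)
    have n1 : crs d (P z - P x) ≠ 0 := fun q => by rw [q] at hp; simp at hp
    have n2 : crs d (P z' - P x) ≠ 0 := fun q => by rw [q] at hp; simp at hp
    have h4 : (d.1 * (P z - P x).1 + d.2 * (P z - P x).2) / crs d (P z - P x) - (d.1 * (P z' - P x).1 + d.2 * (P z' - P x).2) / crs d (P z' - P x)
      = (crs (P z - P x) (P z' - P x) * (d.1 ^ 2 + d.2 ^ 2)) / (crs d (P z - P x) * crs d (P z' - P x)) := by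
      rw [h3]; field_simp
    have h5 := div_pos (mul_pos h2 hsq) hp
    linarith
  have hopp : ∀ z ∈ Z, crs d (P z - P x) = 0 → d.1 * (P z - P x).1 + d.2 * (P z - P x).2 < 0 := by
    intro z hz h0
    by_contra hcon
    rcases lt_or_eq_of_le (not_lt.1 hcon) with h1 | h1
    · exact hnZ (h.ray hn (hed z hz) h0 h1 ▸ hz)
    · have h2 := h.ed_ne (hed z hz)
      apply h2
      apply h.inj (h.sp_l hn) (h.sp_r (hed z hz))
      unfold crs at h0
      have e1 : (d.1 ^ 2 + d.2 ^ 2) * (P z - P x).1 = 0 := by linear_combination (-d.2) * h0 - d.1 * h1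
      have e2 : (d.1 ^ 2 + d.2 ^ 2) * (P z - P x).2 = 0 := by linear_combination (d.1) * h0 - d.2 * h1
      have e1 := (mul_eq_zero.1 e1).resolve_left hsq.ne'
      have e2 := (mul_eq_zero.1 e2).resolve_left hsq.ne'
      simp only [Prod.fst_sub, Prod.snd_sub] at e1 e2
      apply Prod.ext <;> linarith
  -- negative part
  have hneg : ∀ z ∈ Z, ¬ crs d (P z - P x) < 0 := by
    intro z0 hz0 hz0'
    apply key (Z.filter (fun z => crs d (P z - P x) < 0)) ⟨z0, by simp [hz0, hz0']⟩
    intro z hz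
    simp only [Finset.mem_filter] at hz
    obtain ⟨z', hz', hm⟩ := hcl z hz.1
    have ho := h.inn_ori hm
    have hlt : crs d (P z' - P x) < 0 := by
      rcases lt_trichotomy (crs d (P z' - P x)) 0 with h1 | h1 | h1
      · exact h1
      · exfalso
        have h2 := hopp z' hz' h1
        rw [ori_crs] at ho
        have h3 := crs3 d (P z - P x) (P z' - P x)
        rw [h1] at h3
        nlinarith [mul_pos ho hsq, mul_pos_of_neg_of_neg hz.2 h2]
      · exfalso
        refine h.cone hm hn ?_ ?_
        · rw [ori_crs, crs_comm]; exact neg_pos.2 hz.2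
        · rw [ori_crs]; exact h1
    exact ⟨z', by simp [hz', hlt], hm, mul_pos_of_neg_of_neg hz.2 hlt⟩
  have hz0 : ∀ z ∈ Z, crs d (P z - P x) ≠ 0 := by
    intro z hz h0
    obtain ⟨z', hz', hm⟩ := hcl z hz
    have ho := h.inn_ori hm
    rw [ori_crs] at ho
    have h3 := crs3 d (P z - P x) (P z' - P x)
    rw [h0] at h3
    have h2 := hopp z hz h0
    have := hneg z' hz'
    nlinarith [mul_pos ho hsq]
  apply key Z hZ
  intro z hz
  obtain ⟨z', hz', hm⟩ := hcl z hz
  have p1 := lt_of_le_of_ne (not_lt.1 (hneg z hz)) (hz0 z hz).symm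
  have p2 := lt_of_le_of_ne (not_lt.1 (hneg z' hz')) (hz0 z' hz').symm
  exact ⟨z', hz', hm, mul_pos p1 p2⟩

theorem RS.del3 (h : RS S A B C P) {x a b c : W} (hA : x ≠ A) (hB : x ≠ B) (hC : x ≠ C)
    (h1 : (x, a, b) ∈ S) (h2 : (x, b, c) ∈ S) (h3 : (x, c, a) ∈ S) :
    RS (delS S x a b c) A B C P := by
  have i1 := h.inn_ori (h.int_inn hA hB hC h1)
  have i2 := h.inn_ori (h.int_inn hA hB hC h2)
  have i3 := h.inn_ori (h.int_inn hA hB hC h3)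
  have n1 := ori_ne i1
  have n2 := ori_ne i2
  have n3 := ori_ne i3
  refine { toCS := h.toCS.del h1 h2 h3 n1.1 n2.1 n3.1 n1.2.1 n2.2.1 n3.2.1.symm, out := ?_, pos := h.pos, inn := ?_ }
  · refine mem_delS.2 (Or.inl ⟨h.out, ?_, ?_, ?_⟩) <;> rw [mem_rt] <;> tauto
  · intro p q r hm
    rcases mem_delS.1 hm with hm | hm
    · exact h.inn _ _ _ hm.1
    · left
      rcases mem_rt.1 hm with ⟨rfl, rfl, rfl⟩ | ⟨rfl, rfl, rfl⟩ | ⟨rfl, rfl, rfl⟩ <;> unfold ori at i1 i2 i3 ⊢ <;> linarith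

theorem RS.delOut (h : RS S A B C P) {u : W} (h1 : (A, B, u) ∈ innF S P) (h2 : (A, u, C) ∈ innF S P) :
    RS (delS S A B u C) u B C P := by
  have i1 := h.inn_ori h1
  have i2 := h.inn_ori h2
  have n1 := ori_ne i1
  have n2 := ori_ne i2
  have n3 := h.ne
  have h3 : (A, C, B) ∈ S := h.rot' h.out
  have hu : 0 < ori (P B) (P C) (P u) := h.rotO.hull_aux' (h.sp_r ⟨C, innS h2⟩ |> fun q => q) n1.2.1.symm n2.2.1
  refine { toCS := h.toCS.del (innS h1) (innS h2) h3 n1.1 n2.1 n3.2.2 n1.2.1 n2.2.1 n3.2.1, out := ?_, pos := ?_, inn := ?_ }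
  · exact mem_delS.2 (Or.inr (mem_rt.2 (by simp)))
  · unfold ori at hu ⊢; linarith
  · intro p q r hm
    rcases mem_delS.1 hm with ⟨hm, r1, r2, r3⟩ | hm
    · left
      rcases h.inn _ _ _ hm with q | q | q | q
      · exact q
      · exfalso; apply r3; rw [q]; simp [rt]
      · exfalso; apply r3; rw [q]; simp [rt]
      · exfalso; apply r3; rw [q]; simp [rt]
    · right
      rcases mem_rt.1 hm with ⟨rfl, rfl, rfl⟩ | ⟨rfl, rfl, rfl⟩ | ⟨rfl, rfl, rfl⟩ <;> simp
end ICP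

end

set_option linter.all false
noncomputable section
set_option maxHeartbeats 1000000
open Classical Filter Topology
namespace ICP
variable {W : Type} {S : Finset (W × W × W)} {A B C : W} {P R : W → ℝ × ℝ} {Q : W → W → W → W → Prop}

/-- invariant of the surgeries -/
structure INV {W : Type} (S : Finset (W × W × W)) (A B C : W) (T X : Finset W) (K : W → Finset W) (E0 : W → W → Prop) : Prop where
  real : ∃ P, RS S A B C P
  sp : ∀ v, Sp S v ↔ v ∈ T
  xk : ∀ x ∈ X, ∀ k ∈ K x, Ed S x k
  g0 : ∀ u v, E0 u v → Ed S u v ∨ ∃ x ∈ X, u ∈ K x ∧ v ∈ K x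

/-- static data -/
structure DAT {W : Type} (X : Finset W) (K : W → Finset W) (E0 : W → W → Prop) : Prop where
  kx : ∀ x ∈ X, ∀ k ∈ K x, k ∉ X
  kd : ∀ x ∈ X, ∀ y ∈ X, ∀ k, k ∈ K x → k ∈ K y → x = y
  kc : ∀ x ∈ X, (K x).card = 4
  ex : ∀ u v, E0 u v → u ∉ X ∧ v ∉ X

variable {T X : Finset W} {K : W → Finset W} {E0 : W → W → Prop}

theorem RS.swap_ne (h : RS S A B C P) {a b c d : W} (h1 : (a, b, c) ∈ innF S P) (h2 : (b, a, d) ∈ innF S P) : c ≠ d := by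
  rintro rfl
  have := h.inn_ori h1
  have h4 := h.inn_ori h2
  rw [ori_swap] at h4
  linarith

theorem CS.prev (h : CS S) {x u : W} (hu : Ed S x u) : ∃ w, (x, w, u) ∈ S := by
  obtain ⟨c, hc⟩ := hu
  obtain ⟨w, hw⟩ := h.adj _ _ _ hc
  exact ⟨w, h.rot _ _ _ hw⟩

theorem INV.flip (I : INV S A B C T X K E0) {u v w z : W} (hP : RS S A B C P) (h1 : (u, v, w) ∈ innF S P) (h2 : (v, u, z) ∈ innF S P)
    (hne : ¬ Ed S z w) (p1 : ∀ y ∈ X, ¬ (y = u ∧ v ∈ K y) ∧ ¬ (y = v ∧ u ∈ K y))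
    (p2 : E0 u v ∨ E0 v u → ∃ x ∈ X, u ∈ K x ∧ v ∈ K x) :
    INV (flipS S u v w z) A B C T X K E0 ∧ ∀ p q, (Ed (flipS S u v w z) p q ↔ (Ed S p q ∧ ¬ (p = u ∧ q = v) ∧ ¬ (p = v ∧ q = u)) ∨ (p = z ∧ q = w) ∨ (p = w ∧ q = z)) := by
  have n1 := ori_ne (hP.inn_ori h1)
  have n2 := ori_ne (hP.inn_ori h2)
  have he : ∀ p q, (Ed (flipS S u v w z) p q ↔ (Ed S p q ∧ ¬ (p = u ∧ q = v) ∧ ¬ (p = v ∧ q = u)) ∨ (p = z ∧ q = w) ∨ (p = w ∧ q = z)) :=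
    fun p q => hP.toCS.ed_flip (innS h1) (innS h2) n1.1 n1.2.2 n1.2.1 n2.2.1 n2.2.2
  refine ⟨⟨hP.flip h1 h2 (hP.swap_ne h1 h2) hne, ?_, ?_, ?_⟩, he⟩
  · intro p
    rw [← I.sp p, sp_iff_ed, sp_iff_ed]
    constructor
    · rintro ⟨q, hq⟩
      rcases (he _ _).1 hq with hq | hq | hq
      · exact ⟨q, hq.1⟩
      · rw [hq.1]; exact ⟨v, u, hP.rot' (innS h2)⟩
      · rw [hq.1]; exact ⟨u, v, hP.rot' (innS h1)⟩
    · rintro ⟨q, hq⟩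
      by_cases c1 : p = u ∧ q = v
      · refine ⟨w, (he _ _).2 (Or.inl ⟨?_, ?_, ?_⟩)⟩
        · rw [c1.1]; exact hP.ed_symm ⟨v, hP.rot' (innS h1)⟩
        · exact fun q => n1.2.1 q.2.symm
        · exact fun q => n1.1 (c1.1.symm.trans q.1)
      · by_cases c2 : p = v ∧ q = u
        · refine ⟨w, (he _ _).2 (Or.inl ⟨?_, ?_, ?_⟩)⟩
          · rw [c2.1]; exact ⟨u, hP.rot _ _ _ (innS h1)⟩
          · exact fun q => n1.2.1 q.2.symm
          · exact fun q => n1.2.2 q.2.symm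
        · exact ⟨q, (he _ _).2 (Or.inl ⟨hq, c1, c2⟩)⟩
  · intro x hx k hk
    refine (he _ _).2 (Or.inl ⟨I.xk x hx k hk, ?_, ?_⟩)
    · rintro ⟨rfl, rfl⟩; exact (p1 x hx).1 ⟨rfl, hk⟩
    · rintro ⟨rfl, rfl⟩; exact (p1 x hx).2 ⟨rfl, hk⟩
  · intro p q hpq
    rcases I.g0 p q hpq with hq | hq
    · by_cases c1 : p = u ∧ q = v
      · right; rw [c1.1, c1.2] at hpq ⊢; exact p2 (Or.inl hpq)
      · by_cases c2 : p = v ∧ q = u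
        · right; rw [c2.1, c2.2] at hpq ⊢
          obtain ⟨x, q1, q2, q3⟩ := p2 (Or.inr hpq)
          exact ⟨x, q1, q3, q2⟩
        · left; exact (he _ _).2 (Or.inl ⟨hq, c1, c2⟩)
    · exact Or.inr hq

def Dn {W : Type} (S : Finset (W × W × W)) (K : W → Finset W) (x : W) : Prop := ∀ n, Ed S x n → n ∈ K x

/-- conclusion of a step at `x` -/
def Stp {W : Type} (S : Finset (W × W × W)) (A B C : W) (T X : Finset W) (K : W → Finset W) (E0 : W → W → Prop) (x : W) : Prop :=
  ∃ S', INV S' A B C T X K E0 ∧ (∀ y ∈ X, y ≠ x → Dn S K y → Dn S' K y) ∧ nbrs S' x ⊂ nbrs S x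

theorem INV.stp (I : INV S A B C T X K E0) (D : DAT X K E0) {x v w z : W} (hP : RS S A B C P) (hx : x ∈ X)
    (h1 : (x, v, w) ∈ innF S P) (h2 : (v, x, z) ∈ innF S P)
    (hne : ¬ Ed S z w) (hv : v ∉ K x) : Stp S A B C T X K E0 x := by
  have n1 := ori_ne (hP.inn_ori h1)
  have n2 := ori_ne (hP.inn_ori h2)
  obtain ⟨I', he⟩ := I.flip hP h1 h2 hne (by
    intro y hy
    constructor
    · rintro ⟨rfl, q⟩; exact hv q
    · rintro ⟨rfl, q⟩; exact D.kx _ hy _ q hx) (by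
    rintro (q | q)
    · exact absurd hx (D.ex _ _ q).1
    · exact absurd hx (D.ex _ _ q).2)
  obtain ⟨R, hR⟩ := I'.real
  refine ⟨_, I', ?_, ?_⟩
  · intro y hy hyx hD n hn
    rcases (he _ _).1 hn with q | q | q
    · exact hD n q.1
    · exfalso
      have : Ed S z x := hP.ed_symm ⟨v, hP.rot _ _ _ (innS h2)⟩
      rw [← q.1] at this
      exact D.kx _ hy _ (hD x this) hx
    · exfalso
      have : Ed S w x := ⟨v, hP.rot' (innS h1)⟩
      rw [← q.1] at this
      exact D.kx _ hy _ (hD x this) hx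
  · rw [Finset.ssubset_iff_of_subset]
    · refine ⟨v, hP.mem_nbrs.2 ⟨w, innS h1⟩, fun q => ?_⟩
      rcases (he _ _).1 (hR.mem_nbrs.1 q) with q | q | q
      · exact q.2.1 ⟨rfl, rfl⟩
      · exact n2.2.1 q.1
      · exact n1.2.2 q.1
    · intro n hn
      rcases (he _ _).1 (hR.mem_nbrs.1 hn) with q | q | q
      · exact hP.mem_nbrs.2 q.1
      · exact absurd q.1 n2.2.1
      · exact absurd q.1 n1.2.2

theorem INV.step (I : INV S A B C T X K E0) (D : DAT X K E0) {x u : W} (hx : x ∈ X)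
    (xo : x ≠ A ∧ x ≠ B ∧ x ≠ C) (ko : ∀ k ∈ K x, k ≠ A ∧ k ≠ B ∧ k ≠ C)
    (hu : Ed S x u) (huK : u ∉ K x) : Stp S A B C T X K E0 x := by
  obtain ⟨P, hP⟩ := I.real
  obtain ⟨oA, oB, oC⟩ := xo
  obtain ⟨c, hc⟩ := hu
  obtain ⟨a, ha⟩ := hP.prev ⟨c, hc⟩
  have hc' := hP.int_inn oA oB oC hc
  have ha' := hP.int_inn oA oB oC ha
  have nc := ori_ne (hP.inn_ori hc')
  have na := ori_ne (hP.inn_ori ha')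
  have ha2 := rot_innF hP (rot_innF hP ha')
  have hc2 := rot_innF hP (rot_innF hP hc')
  have ac : c ≠ a := hP.swap_ne hc' ha2
  -- not a closed triangle
  have h4 : (x, c, a) ∉ S := by
    intro q
    have hsub : K x ⊆ {a, u, c} := by
      intro k hk
      refine hP.closed_nbrs oA oB oC {a, u, c} ⟨a, by simp⟩ ?_ (I.xk x hx k hk)
      intro y hy
      simp only [Finset.mem_insert, Finset.mem_singleton] at hy
      rcases hy with rfl | rfl | rfl
      · exact ⟨u, by simp, ha⟩
      · exact ⟨c, by simp, hc⟩
      · exact ⟨a, by simp, q⟩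
    have := Finset.card_le_card hsub
    rw [D.kc x hx] at this
    have := Finset.card_le_three (a := a) (b := u) (c := c)
    omega
  by_cases e : Ed S a c
  swap
  · exact I.stp D hP hx hc' ha2 e huK
  by_cases kc : c ∈ K x
  swap
  · obtain ⟨w, hw⟩ := hP.ed_symm (show Ed S c x from ⟨u, innS hc2⟩)
    have hxc : Ed S x c := ⟨w, hw⟩
    have hw' := hP.int_inn oA oB oC hw
    have nw := ori_ne (hP.inn_ori hw')
    refine I.stp D hP hx hw' hc2 ?_ kc
    intro q
    refine hP.n1 ha' hc' (d := w) ⟨_, hP.rot' (innS (rot_innF hP (rot_innF hP hw'))) |> fun _ => (hP.adj _ _ _ (hP.rot' hw)).choose_spec⟩ ?_ ?_ nw.2.1.symm e q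
    · rintro rfl; exact h4 hw
    · exact hP.swap_ne hw' hc2
  by_cases ka : a ∈ K x
  swap
  · have hxa : Ed S x a := ⟨u, ha⟩
    obtain ⟨w, hw⟩ := hP.prev hxa
    have hw' := hP.int_inn oA oB oC hw
    have nw := ori_ne (hP.inn_ori hw')
    have hw2 := rot_innF hP (rot_innF hP hw')
    refine I.stp D hP hx ha' hw2 ?_ ka
    intro q
    refine hP.n1 hw' ha' (d := c) ⟨_, (hP.adj _ _ _ (innS hc2)).choose_spec⟩ ?_ ac nc.2.1.symm q e
    rintro rfl; exact h4 hw
  -- stuck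
  obtain ⟨w, hw⟩ := e
  obtain ⟨w', hw'⟩ := hP.ed_symm ⟨w, hw⟩
  have oa := ko a ka
  have oc := ko c kc
  have iw := hP.int_inn oa.1 oa.2.1 oa.2.2 hw
  have iw' := hP.int_inn oc.1 oc.2.1 oc.2.2 hw'
  have nw := ori_ne (hP.inn_ori iw)
  have nw' := ori_ne (hP.inn_ori iw')
  have xw : x ≠ w := by
    rintro rfl
    exact nc.2.1 (hP.uniq _ _ _ _ ha (hP.rot' hw))
  have xw' : x ≠ w' := by
    rintro rfl
    exact h4 (hP.rot' hw')
  have hax : Ed S a x := hP.ed_symm ⟨_, ha⟩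
  have hcx : Ed S c x := ⟨_, innS hc2⟩
  obtain ⟨I', he⟩ := I.flip hP iw iw' (by
    intro q
    exact hP.n1 (rot_innF hP iw') iw hax xw' nc.2.2 xw q hcx) (by
    intro y hy
    constructor
    · rintro ⟨rfl, q⟩; exact D.kx _ hx _ ka hy
    · rintro ⟨rfl, q⟩; exact D.kx _ hx _ kc hy) (fun _ => ⟨x, hx, ka, kc⟩)
  obtain ⟨R, hR⟩ := I'.real
  have f1 : (x, u, c) ∈ flipS S a c w w' := by
    refine mem_flipS.2 (Or.inl ⟨hc, ?_, ?_⟩) <;> rw [mem_rt] <;> tauto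
  have f2 : (x, a, u) ∈ flipS S a c w w' := by
    refine mem_flipS.2 (Or.inl ⟨ha, ?_, ?_⟩) <;> rw [mem_rt] <;> tauto
  have hE : ¬ Ed (flipS S a c w w') a c := by
    rw [he]; tauto
  obtain ⟨S', J1, J2, J3⟩ := I'.stp D hR hx (hR.int_inn oA oB oC f1) (rot_innF hR (rot_innF hR (hR.int_inn oA oB oC f2))) hE huK
  refine ⟨S', J1, ?_, ?_⟩
  · intro y hy yx hD
    refine J2 y hy yx ?_
    intro n hn
    rcases (he _ _).1 hn with q | q | q
    · exact hD n q.1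
    · exfalso
      have : Ed S w' a := hP.ed_symm ⟨_, hP.rot _ _ _ hw'⟩
      rw [← q.1] at this
      exact yx (D.kd _ hy _ hx a (hD a this) ka)
    · exfalso
      have : Ed S w a := ⟨_, hP.rot' hw⟩
      rw [← q.1] at this
      exact yx (D.kd _ hy _ hx a (hD a this) ka)
  · convert J3 using 1
    ext n
    rw [hP.mem_nbrs, hR.mem_nbrs, he]
    have := nc.2.2
    have := na.1
    tauto

theorem INV.link1 (D : DAT X K E0) {x : W} (hx : x ∈ X)
    (xo : x ≠ A ∧ x ≠ B ∧ x ≠ C) (ko : ∀ k ∈ K x, k ≠ A ∧ k ≠ B ∧ k ≠ C) : ∀ (m : ℕ) (S : Finset (W × W × W)), (nbrs S x).card = m →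
     INV S A B C T X K E0 → ∃ S', INV S' A B C T X K E0 ∧ (∀ y ∈ X, y ≠ x → Dn S K y → Dn S' K y) ∧ Dn S' K x := by
  intro m
  induction m using Nat.strong_induction_on with
  | _ m ih =>
    intro S hm I
    by_cases hd : Dn S K x
    · exact ⟨S, I, fun _ _ _ q => q, hd⟩
    · unfold Dn at hd
      push Not at hd
      obtain ⟨u, h1, h2⟩ := hd
      obtain ⟨S1, I1, D1, s1⟩ := I.step D hx xo ko h1 h2
      obtain ⟨S2, I2, D2, e2⟩ := ih _ (hm ▸ Finset.card_lt_card s1) S1 rfl I1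
      exact ⟨S2, I2, fun y hy yx q => D2 y hy yx (D1 y hy yx q), e2⟩

theorem INV.link (D : DAT X K E0) (xo : ∀ x ∈ X, x ≠ A ∧ x ≠ B ∧ x ≠ C) (ko : ∀ x ∈ X, ∀ k ∈ K x, k ≠ A ∧ k ≠ B ∧ k ≠ C)
   (I : INV S A B C T X K E0) : ∃ S', INV S' A B C T X K E0 ∧ ∀ y ∈ X, Dn S' K y := by
  have : ∀ Y : Finset W, Y ⊆ X → ∃ S', INV S' A B C T X K E0 ∧ ∀ y ∈ Y, Dn S' K y := by
    intro Y
    induction Y using Finset.induction_on with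
    | empty => exact fun _ => ⟨S, I, by simp⟩
    | insert x Y hx ih =>
      intro hY
      obtain ⟨S1, I1, h1⟩ := ih (fun y hy => hY (Finset.mem_insert_of_mem hy))
      have hxX := hY (Finset.mem_insert_self x Y)
      obtain ⟨S2, I2, h2, h3⟩ := INV.link1 D hxX (xo x hxX) (ko x hxX) _ S1 rfl I1
      refine ⟨S2, I2, ?_⟩
      intro y hy
      by_cases q : y = x
      · rw [q]; exact h3
      · have hyY := Finset.mem_of_mem_insert_of_ne hy q
        exact h2 y (hY hy) q (h1 y hyY)
  exact this X (fun _ q => q)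
end ICP

end

set_option linter.all false
noncomputable section
set_option maxHeartbeats 1000000
open Classical Filter Topology
namespace ICP
variable {W : Type} {S : Finset (W × W × W)} {A B C : W} {P R : W → ℝ × ℝ} {Q : W → W → W → W → Prop}
variable {T X : Finset W} {K : W → Finset W} {E0 : W → W → Prop}

/-- directed edges -/
def edS {W : Type} (S : Finset (W × W × W)) : Finset (W × W) := S.image (fun t => (t.1, t.2.1))

theorem mem_edS {a b : W} : (a, b) ∈ edS S ↔ Ed S a b := by
  unfold edS Ed
  simp

theorem card_edS_flip {S S' : Finset (W × W × W)} {u v z w : W} (h : CS S) (uv : u ≠ v) (zw : z ≠ w) (h1 : Ed S u v) (h2 : ¬ Ed S z w)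
    (he : ∀ p q, (Ed S' p q ↔ (Ed S p q ∧ ¬ (p = u ∧ q = v) ∧ ¬ (p = v ∧ q = u)) ∨ (p = z ∧ q = w) ∨ (p = w ∧ q = z))) :
    (edS S').card = (edS S).card := by
  have e : edS S' = (edS S \ {(u, v), (v, u)}) ∪ {(z, w), (w, z)} := by
    ext ⟨p, q⟩
    simp only [Finset.mem_union, Finset.mem_sdiff, Finset.mem_insert, Finset.mem_singleton, Prod.mk.injEq, mem_edS, he]
    tauto
  have hsub : ({(u, v), (v, u)} : Finset (W × W)) ⊆ edS S := by
    intro p hp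
    simp only [Finset.mem_insert, Finset.mem_singleton] at hp
    rcases hp with rfl | rfl
    · exact mem_edS.2 h1
    · exact mem_edS.2 (h.ed_symm h1)
  have hd : Disjoint (edS S \ {(u, v), (v, u)}) {(z, w), (w, z)} := by
    rw [Finset.disjoint_right]
    intro p hp hq
    simp only [Finset.mem_insert, Finset.mem_singleton] at hp
    rw [Finset.mem_sdiff] at hq
    rcases hp with rfl | rfl
    · exact h2 (mem_edS.1 hq.1)
    · exact h2 (h.ed_symm (mem_edS.1 hq.1))
  have c1 : ({(u, v), (v, u)} : Finset (W × W)).card = 2 := Finset.card_pair (by simp; tauto)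
  have c2 : ({(z, w), (w, z)} : Finset (W × W)).card = 2 := Finset.card_pair (by simp; tauto)
  have := Finset.card_le_card hsub
  rw [e, Finset.card_union_of_disjoint hd, Finset.card_sdiff_of_subset hsub, c1, c2]
  omega

theorem card_edS_del {S S' : Finset (W × W × W)} {x a b c : W} (h : CS S) (xa : x ≠ a) (xb : x ≠ b) (xc : x ≠ c) (ab : a ≠ b) (ac : a ≠ c) (bc : b ≠ c)
    (h1 : Ed S x a) (h2 : Ed S x b) (h3 : Ed S x c) (hall : ∀ n, Ed S x n → n = a ∨ n = b ∨ n = c)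
    (he : ∀ p q, (Ed S' p q ↔ Ed S p q ∧ p ≠ x ∧ q ≠ x)) :
    (edS S').card + 6 = (edS S).card := by
  have e : edS S' = (edS S \ {(x, a), (x, b), (x, c), (a, x), (b, x), (c, x)}) := by
    ext ⟨p, q⟩
    simp only [Finset.mem_sdiff, Finset.mem_insert, Finset.mem_singleton, Prod.mk.injEq, mem_edS, he]
    constructor
    · tauto
    · rintro ⟨r1, r2⟩
      refine ⟨r1, ?_, ?_⟩
      · rintro rfl
        rcases hall _ r1 with r | r | r <;> tauto
      · rintro rfl
        rcases hall _ (h.ed_symm r1) with r | r | r <;> tauto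
  have hsub : ({(x, a), (x, b), (x, c), (a, x), (b, x), (c, x)} : Finset (W × W)) ⊆ edS S := by
    intro p hp
    simp only [Finset.mem_insert, Finset.mem_singleton] at hp
    rcases hp with rfl | rfl | rfl | rfl | rfl | rfl <;> rw [mem_edS]
    · exact h1
    · exact h2
    · exact h3
    · exact h.ed_symm h1
    · exact h.ed_symm h2
    · exact h.ed_symm h3
  have c1 : ({(x, a), (x, b), (x, c), (a, x), (b, x), (c, x)} : Finset (W × W)).card = 6 := by
    rw [Finset.card_insert_of_notMem, Finset.card_insert_of_notMem, Finset.card_insert_of_notMem, Finset.card_insert_of_notMem, Finset.card_pair]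
    all_goals simp only [Finset.mem_insert, Finset.mem_singleton, Prod.mk.injEq, ne_eq]
    all_goals tauto
  have := Finset.card_le_card hsub
  rw [e, Finset.card_sdiff_of_subset hsub, c1]
  omega

theorem INV.rotO (I : INV S A B C T X K E0) : INV S B C A T X K E0 := by
  obtain ⟨P, hP⟩ := I.real
  exact ⟨⟨P, hP.rotO⟩, I.sp, I.xk, I.g0⟩

theorem INV.outFlip (I : INV S A B C T X K E0) (hAK : ∀ x ∈ X, A ∉ K x)
    (hAE : ∀ u v, E0 u v → u ≠ A ∧ v ≠ A) (hX : ∀ x ∈ X, x ≠ A) (hD : ∀ x ∈ X, Dn S K x)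
    {v w z : W} (hP : RS S A B C P) 
    (h1 : (A, v, w) ∈ innF S P) (h2 : (v, A, z) ∈ innF S P) (hne : ¬ Ed S z w) :
    ∃ S', INV S' A B C T X K E0 ∧ (∀ x ∈ X, Dn S' K x) ∧ nbrs S' A ⊂ nbrs S A ∧ (edS S').card = (edS S).card := by
  have n1 := ori_ne (hP.inn_ori h1)
  have n2 := ori_ne (hP.inn_ori h2)
  obtain ⟨I', he⟩ := I.flip hP h1 h2 hne (by
    intro y hy
    constructor
    · rintro ⟨rfl, q⟩; exact hX _ hy rfl
    · rintro ⟨rfl, q⟩; exact hAK _ hy q) (by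
    rintro (q | q)
    · exact absurd rfl (hAE _ _ q).1
    · exact absurd rfl (hAE _ _ q).2)
  obtain ⟨R, hR⟩ := I'.real
  refine ⟨_, I', ?_, ?_, card_edS_flip hP.toCS n1.1 (hP.swap_ne h1 h2).symm ⟨_, innS h1⟩ hne he⟩
  · intro y hy n hn
    rcases (he _ _).1 hn with q | q | q
    · exact hD y hy n q.1
    · exfalso
      have : Ed S z A := hP.ed_symm ⟨v, hP.rot _ _ _ (innS h2)⟩
      rw [← q.1] at this
      exact hAK _ hy (hD y hy _ this)
    · exfalso
      have : Ed S w A := ⟨v, hP.rot' (innS h1)⟩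
      rw [← q.1] at this
      exact hAK _ hy (hD y hy _ this)
  · rw [Finset.ssubset_iff_of_subset]
    · refine ⟨v, hP.mem_nbrs.2 ⟨w, innS h1⟩, fun q => ?_⟩
      rcases (he _ _).1 (hR.mem_nbrs.1 q) with q | q | q
      · exact q.2.1 ⟨rfl, rfl⟩
      · exact n2.2.1 q.1
      · exact n1.2.2 q.1
    · intro n hn
      rcases (he _ _).1 (hR.mem_nbrs.1 hn) with q | q | q
      · exact hP.mem_nbrs.2 q.1
      · exact absurd q.1 n2.2.1
      · exact absurd q.1 n1.2.2

theorem RS.outNbrs (h : RS S A B C P) {u n : W} (h1 : (A, B, u) ∈ innF S P) (h2 : (A, u, C) ∈ innF S P)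
    (hn : Ed S A n) : n = B ∨ n = u ∨ n = C := by
  by_contra hc
  push Not at hc
  have p1 := h.hull_aux' (h.sp_r hn) (h.ed_ne hn).symm hc.1
  have p2 := h.rotO.rotO.hull_aux' (h.sp_r hn) hc.2.2 (h.ed_ne hn).symm
  rcases lt_trichotomy (ori (P A) (P u) (P n)) 0 with q | q | q
  · refine h.cone h1 hn p1 ?_
    rw [ori_swap']; linarith
  · refine hc.2.1 (h.ray (v := A) hn ⟨_, innS h2⟩ ?_ ?_)
    · rw [ori_crs] at q; rw [crs_comm]; linarith
    · rw [ori_crs] at q p1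
      have p3 := h.inn_ori h1
      rw [ori_crs] at p3
      exact dot_pos_of (by rw [crs_comm]; linarith) p1 p3
  · refine h.cone h2 hn q ?_
    unfold ori at p2 ⊢; linarith

theorem INV.out1 (hAK : ∀ x ∈ X, A ∉ K x)
    (hAE : ∀ u v, E0 u v → u ≠ A ∧ v ≠ A) (hX : ∀ x ∈ X, x ≠ A ∧ x ≠ B ∧ x ≠ C) (hT : 4 ≤ T.card) :
    ∀ (m : ℕ) (S : Finset (W × W × W)), (nbrs S A).card = m →
     INV S A B C T X K E0 → (∀ x ∈ X, Dn S K x) → ∃ S' u, INV S' u B C (T.erase A) X K E0 ∧ (∀ x ∈ X, Dn S' K x) ∧ u ∉ X ∧ (edS S').card + 6 = (edS S).card := by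
  intro m
  induction m using Nat.strong_induction_on with
  | _ m ih =>
    intro S hm I hD
    obtain ⟨P, hP⟩ := I.real
    obtain ⟨n1, h1⟩ := hP.edAB
    have hne := hP.ne
    have o1 := ori_ne (hP.inn_ori h1)
    have n1C : n1 ≠ C := by
      rintro rfl
      have hsub : T ⊆ {A, B, n1} := by
        intro v hv
        have hv := (I.sp v).2 hv
        simpa using hP.p2a hv h1 (hP.hull hv)
      have := Finset.card_le_card hsub
      have := Finset.card_le_three (a := A) (b := B) (c := n1)
      omega
    have h1' := rot_innF hP (rot_innF hP h1)
    obtain ⟨n2, h2⟩ := hP.adj _ _ _ (innS h1')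
    have h2 : (A, n1, n2) ∈ innF S P := by
      rcases hP.inn_or h2 with q | q | q | q
      · exact q
      · simp only [Prod.mk.injEq] at q; exact absurd q.1 hne.2.2
      · simp only [Prod.mk.injEq] at q; exact absurd q.1 hne.1
      · simp only [Prod.mk.injEq] at q; exact absurd q.2.1 n1C
    have o2 := ori_ne (hP.inn_ori h2)
    by_cases e2 : n2 = C
    · subst e2
      have hE : ∀ p q, Ed (delS S A B n1 n2) p q ↔ Ed S p q ∧ p ≠ A ∧ q ≠ A := fun p q =>
        hP.toCS.ed_del (innS h1) (innS h2) (hP.rot' hP.out) hne.1 o2.1 hne.2.2 (fun n hn => hP.outNbrs h1 h2 hn)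
      have hxn : ∀ x ∈ X, ∀ n, Ed S x n → n ≠ A := by
        rintro x hx n q rfl
        exact hAK x hx (hD x hx _ q)
      refine ⟨_, n1, ⟨⟨P, hP.delOut h1 h2⟩, ?_, ?_, ?_⟩, ?_, ?_, card_edS_del hP.toCS hne.1 o2.1 hne.2.2 o1.2.1 hne.2.1 o2.2.1 ⟨_, innS h1⟩ ⟨_, innS h2⟩ ⟨_, hP.rot' hP.out⟩ (fun n hn => hP.outNbrs h1 h2 hn) hE⟩
      · intro v
        rw [Finset.mem_erase, ← I.sp, sp_iff_ed]
        constructor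
        · rintro ⟨q, hq⟩
          have := (hE _ _).1 hq
          exact ⟨this.2.1, q, this.1⟩
        · rintro ⟨hv, ⟨q, hq⟩⟩
          by_cases qA : q = A
          · subst qA
            rcases hP.outNbrs h1 h2 (hP.ed_symm hq) with rfl | rfl | rfl
            · exact ⟨n1, (hE _ _).2 ⟨⟨_, hP.rot _ _ _ (innS h1)⟩, hne.1.symm, o1.2.2.symm⟩⟩
            · exact ⟨n2, (hE _ _).2 ⟨⟨_, hP.rot _ _ _ (innS h2)⟩, o2.1.symm, o2.2.2.symm⟩⟩
            · exact ⟨B, (hE _ _).2 ⟨⟨_, hP.out⟩, hne.2.2.symm, hne.1.symm⟩⟩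
          · exact ⟨q, (hE _ _).2 ⟨hq, hv, qA⟩⟩
      · intro x hx k hk
        have := I.xk x hx k hk
        exact (hE _ _).2 ⟨this, (hX x hx).1, hxn x hx _ this⟩
      · intro p q hpq
        rcases I.g0 p q hpq with r | r
        · exact Or.inl ((hE _ _).2 ⟨r, hAE _ _ hpq⟩)
        · exact Or.inr r
      · intro x hx n hn
        exact hD x hx n ((hE _ _).1 hn).1
      · intro q
        exact hxn n1 q A (hP.ed_symm ⟨_, innS h2⟩) rfl
    · have h2' := rot_innF hP (rot_innF hP h2)
      obtain ⟨n3, h3⟩ := hP.adj _ _ _ (innS h2')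
      have h3 : (A, n2, n3) ∈ innF S P := by
        rcases hP.inn_or h3 with q | q | q | q
        · exact q
        · simp only [Prod.mk.injEq] at q; exact absurd q.1 hne.2.2
        · simp only [Prod.mk.injEq] at q; exact absurd q.1 hne.1
        · simp only [Prod.mk.injEq] at q; exact absurd q.2.1 e2
      have o3 := ori_ne (hP.inn_ori h3)
      have hf : ∃ S', INV S' A B C T X K E0 ∧ (∀ x ∈ X, Dn S' K x) ∧ nbrs S' A ⊂ nbrs S A ∧ (edS S').card = (edS S).card := by
        by_cases e : Ed S B n2
        · refine I.outFlip hAK hAE (fun x hx => (hX x hx).1) hD hP h3 h2' ?_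
          intro q
          have hAn : Ed S A n3 := hP.ed_symm ⟨_, hP.rot' (innS h3)⟩
          refine hP.n1 h1 h2 (d := n3) hAn ?_ ?_ o3.2.1.symm e q
          · rintro rfl
            have := hP.rot' (innS h3)
            have h5 := hP.rot _ _ _ hP.out
            exact e2 (hP.uniq _ _ _ _ this h5)
          · exact hP.swap_ne h3 h2'
        · exact I.outFlip hAK hAE (fun x hx => (hX x hx).1) hD hP h2 h1' e
      obtain ⟨S1, I1, D1, s1, s2⟩ := hf
      rw [← s2]
      exact ih _ (hm ▸ Finset.card_lt_card s1) S1 rfl I1 D1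

/-- delete all artificial outer vertices -/
theorem INV.outAll (D : DAT X K E0) {V : Finset W} (hV : 3 ≤ V.card) (hKV : ∀ x ∈ X, K x ⊆ V)
   (hEV : ∀ u v, E0 u v → u ∈ V ∧ v ∈ V) : ∀ (m : ℕ) (T : Finset W), (T \ (V ∪ X)).card = m → ∀ (S : Finset (W × W × W)) (A B C : W),
    V ∪ X ⊆ T → (∀ t ∈ T, t ∈ V ∪ X ∨ t = A ∨ t = B ∨ t = C) → (∀ x ∈ X, x ≠ A ∧ x ≠ B ∧ x ≠ C ∧ x ∉ V) →
     INV S A B C T X K E0 → (∀ x ∈ X, Dn S K x) → ∃ S' A' B' C', INV S' A' B' C' (V ∪ X) X K E0 ∧ (∀ x ∈ X, Dn S' K x) ∧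
      (∀ x ∈ X, x ≠ A' ∧ x ≠ B' ∧ x ≠ C' ∧ x ∉ V) := by
  intro m
  induction m with
  | zero =>
    intro T hm S A B C h1 h2 h3 I hD
    have : T = V ∪ X := by
      apply Finset.Subset.antisymm _ h1
      rw [← Finset.sdiff_eq_empty_iff_subset]
      exact Finset.card_eq_zero.1 hm
    subst this
    exact ⟨S, A, B, C, I, hD, h3⟩
  | succ m ih =>
    intro T hm S A B C h1 h2 h3 I hD
    obtain ⟨t, ht⟩ := Finset.card_pos.1 (by rw [hm]; omega : 0 < (T \ (V ∪ X)).card)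
    rw [Finset.mem_sdiff] at ht
    have key : ∀ (A B C : W), INV S A B C T X K E0 → (∀ t ∈ T, t ∈ V ∪ X ∨ t = A ∨ t = B ∨ t = C) → 
      (∀ x ∈ X, x ≠ A ∧ x ≠ B ∧ x ≠ C ∧ x ∉ V) → t = A → ∃ S' A' B' C', INV S' A' B' C' (V ∪ X) X K E0 ∧ (∀ x ∈ X, Dn S' K x) ∧
      (∀ x ∈ X, x ≠ A' ∧ x ≠ B' ∧ x ≠ C' ∧ x ∉ V) := by
      rintro A B C I h2 h3 rfl
      have htV : t ∉ V := fun q => ht.2 (Finset.mem_union_left _ q)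
      have hT : 4 ≤ T.card := by
        have : insert t V ⊆ T := by
          intro v hv
          rcases Finset.mem_insert.1 hv with rfl | hv
          · exact ht.1
          · exact h1 (Finset.mem_union_left _ hv)
        have := Finset.card_le_card this
        rw [Finset.card_insert_of_notMem htV] at this
        omega
      obtain ⟨S1, u, I1, D1, hu, -⟩ := INV.out1 (K := K) (E0 := E0) (T := T) (X := X) (A := t) (B := B) (C := C) (fun x hx q => htV (hKV x hx q))
        (fun u v q => ⟨fun r => htV (r ▸ (hEV u v q).1), fun r => htV (r ▸ (hEV u v q).2)⟩)
        (fun x hx => ⟨(h3 x hx).1, (h3 x hx).2.1, (h3 x hx).2.2.1⟩) hT _ S rfl I hD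
      refine ih (T.erase t) ?_ S1 u B C ?_ ?_ ?_ I1 D1
      · have : (T.erase t) \ (V ∪ X) = (T \ (V ∪ X)).erase t := by
          ext v; simp only [Finset.mem_sdiff, Finset.mem_erase]; tauto
        rw [this, Finset.card_erase_of_mem (Finset.mem_sdiff.2 ht), hm]; rfl
      · intro v hv
        refine Finset.mem_erase.2 ⟨?_, h1 hv⟩
        rintro rfl; exact ht.2 hv
      · intro v hv
        rw [Finset.mem_erase] at hv
        rcases h2 v hv.2 with q | q | q | q
        · exact Or.inl q
        · exact absurd q hv.1
        · tauto
        · tauto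
      · intro x hx
        refine ⟨?_, (h3 x hx).2⟩
        rintro rfl; exact hu hx
    rcases h2 t ht.1 with q | q | q | q
    · exact absurd q ht.2
    · exact key A B C I h2 h3 q
    · exact key B C A I.rotO (fun t ht => by rcases h2 t ht with q | q | q | q <;> tauto) (fun x hx => by have := h3 x hx; tauto) q
    · exact key C A B I.rotO.rotO (fun t ht => by rcases h2 t ht with q | q | q | q <;> tauto) (fun x hx => by have := h3 x hx; tauto) q

theorem RS.count_aux : ∀ (m : ℕ) (T : Finset W), T.card = m + 3 → ∀ (S : Finset (W × W × W)) (A B C : W) (P : W → ℝ × ℝ),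
    RS S A B C P → (∀ v, Sp S v ↔ v ∈ T) → (edS S).card = 6 * m + 6 := by
  intro m
  induction m with
  | zero =>
    intro T hT S A B C P h hs
    have hne := h.ne
    have hsp := sp2 h.toCS h.out
    have hTe : T = {A, B, C} := by
      symm
      apply Finset.eq_of_subset_of_card_le
      · intro v hv
        simp only [Finset.mem_insert, Finset.mem_singleton] at hv
        rw [← hs]
        rcases hv with rfl | rfl | rfl <;> tauto
      · rw [hT, Finset.card_insert_of_notMem, Finset.card_pair hne.2.1]
        simp only [Finset.mem_insert, Finset.mem_singleton]; tauto
    have o2 := h.rot _ _ _ h.out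
    have o3 := h.rot' h.out
    have e1 : Ed S A B := h.ed_symm ⟨_, o2⟩
    have e2 : Ed S B C := h.ed_symm ⟨_, h.out⟩
    have e3 : Ed S A C := ⟨_, o3⟩
    have : edS S = T.offDiag := by
      ext ⟨p, q⟩
      rw [mem_edS, Finset.mem_offDiag]
      constructor
      · intro r
        exact ⟨(hs _).1 (h.sp_l r), (hs _).1 (h.sp_r r), h.ed_ne r⟩
      · rintro ⟨r1, r2, r3⟩
        rw [hTe] at r1 r2
        simp only [Finset.mem_insert, Finset.mem_singleton] at r1 r2
        rcases r1 with rfl | rfl | rfl <;> rcases r2 with rfl | rfl | rfl <;> first | exact absurd rfl r3 | assumption | exact h.ed_symm e1 | exact h.ed_symm e2 | exact h.ed_symm e3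
    rw [this, Finset.offDiag_card, hT]
  | succ m ih =>
    intro T hT S A B C P h hs
    have I : INV S A B C T ∅ (fun _ => ∅) (fun _ _ => False) := ⟨⟨P, h⟩, hs, by simp, by simp⟩
    obtain ⟨S', u, I', -, -, hc⟩ := INV.out1 (by simp) (by simp) (by simp) (by omega) _ S rfl I (by simp)
    obtain ⟨P', h'⟩ := I'.real
    have hA : A ∈ T := (hs A).1 (sp2 h.toCS h.out).2.2
    have := ih (T.erase A) (by rw [Finset.card_erase_of_mem hA, hT]; omega) S' u B C P' h' I'.sp
    omega

theorem RS.count (h : RS S A B C P) {T : Finset W} (hT : 3 ≤ T.card) (hs : ∀ v, Sp S v ↔ v ∈ T) :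
    (edS S).card + 12 = 6 * T.card := by
  have := RS.count_aux (T.card - 3) T (by omega) S A B C P h hs
  omega
end ICP

end

set_option linter.all false
noncomputable section
set_option maxHeartbeats 1000000
open Classical Filter Topology
namespace ICP
variable {W : Type} {S : Finset (W × W × W)} {A B C : W} {P R : W → ℝ × ℝ} {Q : W → W → W → W → Prop}
variable {T X : Finset W} {K : W → Finset W} {E0 : W → W → Prop}

theorem RS.out_ed (h : RS S A B C P) {a b c : W} (hm : (a, b, c) = (C, B, A) ∨ (a, b, c) = (B, A, C) ∨ (a, b, c) = (A, C, B)) :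
    (a, b, c) ∈ S := by
  rcases hm with q | q | q <;> rw [q]
  · exact h.out
  · exact h.rot _ _ _ h.out
  · exact h.rot' h.out

theorem RS.red (h : RS S A B C P) {x p1 p2 p3 p4 : W} (hA : x ≠ A) (hB : x ≠ B) (hC : x ≠ C)
    (h1 : (x, p1, p2) ∈ S) (h2 : (x, p2, p3) ∈ S) (h3 : (x, p3, p4) ∈ S) (h4 : (x, p4, p1) ∈ S)
    (hall : ∀ n, Ed S x n → n = p1 ∨ n = p2 ∨ n = p3 ∨ n = p4) (hne : ¬ Ed S p1 p3) (d24 : p2 ≠ p4) :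
    ∃ S' R, RS S' A B C R ∧ (∀ p q, Ed S' p q ↔ p ≠ x ∧ q ≠ x ∧ (Ed S p q ∨ (p = p1 ∧ q = p3) ∨ (p = p3 ∧ q = p1))) ∧
      (∀ a b c, (a, b, c) ∈ innF S P → a ≠ x → b ≠ x → c ≠ x → (a, b, c) ∈ innF S' R) ∧
      (p1, p2, p3) ∈ innF S' R ∧ (p1, p3, p4) ∈ innF S' R := by
  have i1 := h.int_inn hA hB hC h1
  have i2 := h.int_inn hA hB hC h2
  have i3 := h.int_inn hA hB hC h3
  have i4 := h.int_inn hA hB hC h4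
  have n1 := ori_ne (h.inn_ori i1)
  have n2 := ori_ne (h.inn_ori i2)
  have n3 := ori_ne (h.inn_ori i3)
  have n4 := ori_ne (h.inn_ori i4)
  have j1 := rot_innF h (rot_innF h i1)
  have d13 : p3 ≠ p1 := h.swap_ne i2 j1
  obtain ⟨R, hR⟩ := h.flip i2 j1 d13 hne
  have he : ∀ p q, (Ed (flipS S x p2 p3 p1) p q ↔ (Ed S p q ∧ ¬ (p = x ∧ q = p2) ∧ ¬ (p = p2 ∧ q = x)) ∨ (p = p1 ∧ q = p3) ∨ (p = p3 ∧ q = p1)) :=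
    fun p q => h.toCS.ed_flip h2 (innS j1) n1.2.2 n2.2.2 n2.2.1 n1.1 n1.2.1.symm
  have f1 : (x, p1, p3) ∈ flipS S x p2 p3 p1 := mem_flipS.2 (Or.inr (Or.inl (mem_rt.2 (by simp))))
  have f2 : (x, p3, p4) ∈ flipS S x p2 p3 p1 := by
    refine mem_flipS.2 (Or.inl ⟨h3, ?_, ?_⟩) <;> rw [mem_rt] <;> have := n2.2.1 <;> have := n2.1 <;> have := n2.2.2 <;> tauto
  have f3 : (x, p4, p1) ∈ flipS S x p2 p3 p1 := by
    refine mem_flipS.2 (Or.inl ⟨h4, ?_, ?_⟩) <;> rw [mem_rt] <;> have := n2.1 <;> have := n4.2.2 <;> have := n4.2.1 <;> have := n2.2.2 <;> have := n4.1 <;> tauto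
  have hR2 := hR.del3 hA hB hC f1 f2 f3
  have he2 : ∀ p q, Ed (delS (flipS S x p2 p3 p1) x p1 p3 p4) p q ↔ Ed (flipS S x p2 p3 p1) p q ∧ p ≠ x ∧ q ≠ x := by
    intro p q
    refine hR.toCS.ed_del f1 f2 f3 n1.1 n3.1 n4.1 ?_
    intro n hn
    rcases (he _ _).1 hn with q | q | q
    · rcases hall n q.1 with r | r | r | r
      · exact Or.inl r
      · exact absurd ⟨rfl, r⟩ q.2.1
      · exact Or.inr (Or.inl r)
      · exact Or.inr (Or.inr r)
    · exact absurd q.1 n1.1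
    · exact absurd q.1 n3.1
  have hne' : ¬ Ed S p3 p1 := fun q => hne (h.ed_symm q)
  refine ⟨_, R, hR2, ?_, ?_, ?_, ?_⟩
  · intro p q
    rw [he2, he]
    tauto
  · intro a b c hm ha hb hc
    have hm' : (a, b, c) ∈ delS (flipS S x p2 p3 p1) x p1 p3 p4 := by
      refine mem_delS.2 (Or.inl ⟨mem_flipS.2 (Or.inl ⟨innS hm, ?_, ?_⟩), ?_, ?_, ?_⟩) <;> rw [mem_rt] <;> tauto
    rw [hR2.inn_iff hm']
    exact (h.inn_iff (innS hm)).1 hm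
  · have hm' : (p2, p3, p1) ∈ delS (flipS S x p2 p3 p1) x p1 p3 p4 := by
      refine mem_delS.2 (Or.inl ⟨mem_flipS.2 (Or.inr (Or.inr (mem_rt.2 (by simp)))), ?_, ?_, ?_⟩) <;> rw [mem_rt] <;>
         have := n1.1 <;> have := n2.1 <;> have := n3.1 <;> tauto
    apply rot_innF hR2
    apply rot_innF hR2
    rw [hR2.inn_iff (hm')]
    intro q
    exact hne' ⟨_, h.rot _ _ _ (h.out_ed q)⟩
  · have hm' : (p1, p3, p4) ∈ delS (flipS S x p2 p3 p1) x p1 p3 p4 := by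
      refine mem_delS.2 (Or.inr (mem_rt.2 (by simp)))
    rw [hR2.inn_iff (hm')]
    intro q
    exact hne ⟨_, (h.out_ed q)⟩

/-- resolved dummy vertex -/
def Gd {W : Type} (S : Finset (W × W × W)) (P : W → ℝ × ℝ) (k : Finset W) : Prop :=
  ∃ p1 p2 p3 p4, k = {p1, p2, p3, p4} ∧ Ed S p1 p2 ∧ Ed S p2 p3 ∧ Ed S p3 p4 ∧ Ed S p4 p1 ∧ Ed S p1 p3 ∧
    (Ed S p2 p4 ∨ ((p1, p2, p3) ∈ innF S P ∧ (p1, p3, p4) ∈ innF S P))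

structure RD {W : Type} (S : Finset (W × W × W)) (A B C : W) (P : W → ℝ × ℝ) (V X Y : Finset W) (K : W → Finset W) (E0 : W → W → Prop) : Prop where
  real : RS S A B C P
  sp : ∀ v, Sp S v ↔ v ∈ V ∪ Y
  xk : ∀ x ∈ Y, ∀ k ∈ K x, Ed S x k
  dn : ∀ x ∈ Y, Dn S K x
  g0 : ∀ u v, E0 u v → Ed S u v ∨ ∃ x ∈ X, u ∈ K x ∧ v ∈ K x
  gd : ∀ x ∈ X, x ∉ Y → Gd S P (K x)

theorem RD.step {V Y : Finset W} (D : DAT X K E0) (hX : ∀ x ∈ X, x ≠ A ∧ x ≠ B ∧ x ≠ C ∧ x ∉ V) (hYX : Y ⊆ X)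
    (hKV : ∀ x ∈ X, K x ⊆ V) (hEV : ∀ u v, E0 u v → u ∈ V ∧ v ∈ V)
    (I : RD S A B C P V X Y K E0) {x : W} (hx : x ∈ Y) : ∃ S' P', RD S' A B C P' V X (Y.erase x) K E0 := by
  have h := I.real
  obtain ⟨hA, hB, hC, hxV⟩ := hX x (hYX hx)
  have hcard := D.kc x (hYX hx)
  obtain ⟨p1, hp1⟩ := Finset.card_pos.1 (by rw [hcard]; omega : 0 < (K x).card)
  obtain ⟨p2, h1⟩ := I.xk x hx p1 hp1
  obtain ⟨p3, e2, h2, -⟩ := h.next hA hB hC (h.ed_symm ⟨_, h.rot' h1⟩ : Ed S x p2)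
  replace e2 : Ed S x p2 := ⟨_, h2⟩
  obtain ⟨p4, e3, h3, -⟩ := h.next hA hB hC (h.ed_symm ⟨_, h.rot' h2⟩ : Ed S x p3)
  replace e3 : Ed S x p3 := ⟨_, h3⟩
  obtain ⟨p5, e4, h4, -⟩ := h.next hA hB hC (h.ed_symm ⟨_, h.rot' h3⟩ : Ed S x p4)
  have e5 := e4
  replace e4 : Ed S x p4 := ⟨_, h4⟩
  have i1 := h.int_inn hA hB hC h1
  have i2 := h.int_inn hA hB hC h2
  have i3 := h.int_inn hA hB hC h3
  have i4 := h.int_inn hA hB hC h4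
  have n1 := ori_ne (h.inn_ori i1)
  have n2 := ori_ne (h.inn_ori i2)
  have n3 := ori_ne (h.inn_ori i3)
  have n4 := ori_ne (h.inn_ori i4)
  have j1 := rot_innF h (rot_innF h i1)
  have j2 := rot_innF h (rot_innF h i2)
  have j3 := rot_innF h (rot_innF h i3)
  have d31 : p3 ≠ p1 := h.swap_ne i2 j1
  have d42 : p4 ≠ p2 := h.swap_ne i3 j2
  have d53 : p5 ≠ p3 := h.swap_ne i4 j3
  have d41 : p4 ≠ p1 := by
    rintro rfl
    have hsub : K x ⊆ {p4, p2, p3} := by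
      intro k hk
      refine h.closed_nbrs hA hB hC {p4, p2, p3} ⟨p4, by simp⟩ ?_ (I.xk x hx k hk)
      intro y hy
      simp only [Finset.mem_insert, Finset.mem_singleton] at hy
      rcases hy with rfl | rfl | rfl
      · exact ⟨p2, by simp, h1⟩
      · exact ⟨p3, by simp, h2⟩
      · exact ⟨p4, by simp, h3⟩
    have := Finset.card_le_card hsub
    have := Finset.card_le_three (a := p4) (b := p2) (c := p3)
    omega
  have k2 := I.dn x hx _ e2
  have k3 := I.dn x hx _ e3
  have k4 := I.dn x hx _ e4
  have k5 := I.dn x hx _ e5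
  have hK : K x = {p1, p2, p3, p4} := by
    symm
    apply Finset.eq_of_subset_of_card_le
    · intro y hy
      simp only [Finset.mem_insert, Finset.mem_singleton] at hy
      rcases hy with rfl | rfl | rfl | rfl <;> assumption
    · rw [hcard, Finset.card_insert_of_notMem, Finset.card_insert_of_notMem, Finset.card_pair] 
      · exact n3.2.1
      · simp only [Finset.mem_insert, Finset.mem_singleton, not_or]; exact ⟨n2.2.1, d42.symm⟩
      · simp only [Finset.mem_insert, Finset.mem_singleton, not_or]; exact ⟨n1.2.1, d31.symm, d41.symm⟩
  have d51 : p5 = p1 := by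
    rw [hK] at k5
    simp only [Finset.mem_insert, Finset.mem_singleton] at k5
    rcases k5 with q | q | q | q
    · exact q
    · exfalso; subst q
      exact d41 (h.uniq _ _ _ _ (h.rot' h4) (h.rot' h1))
    · exact absurd q d53
    · exact absurd q.symm n4.2.1
  rw [d51] at h4 i4 n4
  clear e5 k5 d53 d51
  have hall : ∀ n, Ed S x n → n = p1 ∨ n = p2 ∨ n = p3 ∨ n = p4 := by
    intro n hn
    have := I.dn x hx n hn
    rw [hK] at this
    simpa using this
  have hxK : ∀ y ∈ X, x ∉ K y := fun y hy q => hxV (hKV y hy q)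
  -- main
  have main : ∀ q1 q2 q3 q4 : W, K x = {q1, q2, q3, q4} → (x, q1, q2) ∈ S → (x, q2, q3) ∈ S → (x, q3, q4) ∈ S → (x, q4, q1) ∈ S →
     (∀ n, Ed S x n → n = q1 ∨ n = q2 ∨ n = q3 ∨ n = q4) → ¬ Ed S q1 q3 → q2 ≠ q4 → ∃ S' P', RD S' A B C P' V X (Y.erase x) K E0 := by
    intro q1 q2 q3 q4 hK h1 h2 h3 h4 hall hne d24
    obtain ⟨S', R, hR, he, hk, f1, f2⟩ := h.red hA hB hC h1 h2 h3 h4 hall hne d24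
    have m1 := ori_ne (h.inn_ori (h.int_inn hA hB hC h1))
    have m3 := ori_ne (h.inn_ori (h.int_inn hA hB hC h3))
    have eup : ∀ p q, Ed S p q → p ≠ x → q ≠ x → Ed S' p q := fun p q r r1 r2 => (he _ _).2 ⟨r1, r2, Or.inl r⟩
    have e12 := eup _ _ ⟨_, h.rot _ _ _ h1⟩ m1.1.symm m1.2.2.symm
    have e34 := eup _ _ ⟨_, h.rot _ _ _ h3⟩ m3.1.symm m3.2.2.symm
    have e23 := eup _ _ ⟨_, h.rot _ _ _ h2⟩ m1.2.2.symm m3.1.symm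
    have e41 := eup _ _ ⟨_, h.rot _ _ _ h4⟩ m3.2.2.symm m1.1.symm
    have e13 : Ed S' q1 q3 := ⟨_, innS f2⟩
    have hkv : ∀ k ∈ K x, k ∈ V := fun k hk => hKV x (hYX hx) hk
    refine ⟨S', R, hR, ?_, ?_, ?_, ?_, ?_⟩
    · intro v
      constructor
      · rintro ⟨u, hu⟩
        have := (he _ _).1 hu
        rcases this.2.2 with r | r | r
        · have r' := (I.sp v).1 ⟨u, r⟩
          simp only [Finset.mem_union, Finset.mem_erase] at r' ⊢
          tauto
        · rw [r.1]; exact Finset.mem_union_left _ (hkv _ (by rw [hK]; simp))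
        · rw [r.1]; exact Finset.mem_union_left _ (hkv _ (by rw [hK]; simp))
      · intro hv
        simp only [Finset.mem_union, Finset.mem_erase] at hv
        have hvx : v ≠ x := by
          rintro rfl
          rcases hv with r | r
          · exact hxV r
          · exact r.1 rfl
        obtain ⟨u, hu⟩ := (I.sp v).2 (by simp only [Finset.mem_union]; tauto)
        by_cases ux : u = x
        · subst ux
          rcases hall v (h.ed_symm hu) with r | r | r | r
          · rw [r]; exact ⟨_, e12⟩
          · rw [r]; exact ⟨_, e23⟩
          · rw [r]; exact ⟨_, e34⟩
          · rw [r]; exact ⟨_, e41⟩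
        · exact ⟨u, eup _ _ hu hvx ux⟩
    · intro y hy k hk
      rw [Finset.mem_erase] at hy
      exact eup _ _ (I.xk y hy.2 k hk) hy.1 (fun r => hxK y (hYX hy.2) (r ▸ hk))
    · intro y hy n hn
      rw [Finset.mem_erase] at hy
      have := (he _ _).1 hn
      have hyX := hYX hy.2
      rcases this.2.2 with r | r | r
      · exact I.dn y hy.2 n r
      · exfalso; apply D.kx x (hYX hx) y _ hyX; rw [hK, r.1]; simp
      · exfalso; apply D.kx x (hYX hx) y _ hyX; rw [hK, r.1]; simp
    · intro u v huv
      rcases I.g0 u v huv with r | r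
      · left
        have := hEV u v huv
        refine eup _ _ r ?_ ?_ 
        · rintro rfl; exact hxV this.1
        · rintro rfl; exact hxV this.2
      · exact Or.inr r
    · intro y hy hyY
      by_cases yx : y = x
      · subst yx
        exact ⟨q1, q2, q3, q4, hK, e12, e23, e34, e41, e13, Or.inr ⟨f1, f2⟩⟩
      · obtain ⟨r1, r2, r3, r4, g0, g1, g2, g3, g4, g5, g6⟩ := I.gd y hy (fun r => hyY (Finset.mem_erase.2 ⟨yx, r⟩))
        have x1 : r1 ≠ x := by rintro rfl; exact hxK y hy (by rw [g0]; simp)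
        have x2 : r2 ≠ x := by rintro rfl; exact hxK y hy (by rw [g0]; simp)
        have x3 : r3 ≠ x := by rintro rfl; exact hxK y hy (by rw [g0]; simp)
        have x4 : r4 ≠ x := by rintro rfl; exact hxK y hy (by rw [g0]; simp)
        refine ⟨r1, r2, r3, r4, g0, eup _ _ g1 x1 x2, eup _ _ g2 x2 x3, eup _ _ g3 x3 x4, eup _ _ g4 x4 x1, eup _ _ g5 x1 x3, ?_⟩
        rcases g6 with g6 | g6
        · exact Or.inl (eup _ _ g6 x2 x4)
        · exact Or.inr ⟨hk _ _ _ g6.1 x1 x2 x3, hk _ _ _ g6.2 x1 x3 x4⟩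
  by_cases e13 : Ed S p1 p3
  · refine main p2 p3 p4 p1 ?_ h2 h3 h4 h1 ?_ ?_ d31
    · rw [hK]; ext v; simp only [Finset.mem_insert, Finset.mem_singleton]; tauto
    · intro n hn; have := hall n hn; tauto
    · intro e24
      exact h.n1 i1 i2 e4 d41 d42 n3.2.1.symm e13 e24
  · exact main p1 p2 p3 p4 hK h1 h2 h3 h4 hall e13 d42.symm

theorem RD.all {V : Finset W} (D : DAT X K E0) (hX : ∀ x ∈ X, x ≠ A ∧ x ≠ B ∧ x ≠ C ∧ x ∉ V)
    (hKV : ∀ x ∈ X, K x ⊆ V) (hEV : ∀ u v, E0 u v → u ∈ V ∧ v ∈ V) : ∀ (m : ℕ) (Y : Finset W), Y.card = m → Y ⊆ X → 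
    ∀ S P, RD S A B C P V X Y K E0 → ∃ S' P', RD S' A B C P' V X ∅ K E0 := by
  intro m
  induction m with
  | zero =>
    intro Y hY _ S P I
    rw [Finset.card_eq_zero] at hY
    subst hY
    exact ⟨S, P, I⟩
  | succ m ih =>
    intro Y hY hYX S P I
    obtain ⟨x, hx⟩ := Finset.card_pos.1 (by rw [hY]; omega : 0 < Y.card)
    obtain ⟨S', P', I'⟩ := RD.step D hX hYX hKV hEV I hx
    exact ih (Y.erase x) (by rw [Finset.card_erase_of_mem hx, hY]; rfl) ((Finset.erase_subset _ _).trans hYX) S' P' I'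

theorem INV.core {V T : Finset W} (D : DAT X K E0) (hV : 3 ≤ V.card) (hKV : ∀ x ∈ X, K x ⊆ V)
   (hEV : ∀ u v, E0 u v → u ∈ V ∧ v ∈ V) (hT : V ∪ X ⊆ T) (hT2 : ∀ t ∈ T, t ∈ V ∪ X ∨ t = A ∨ t = B ∨ t = C) 
   (hX : ∀ x ∈ X, x ≠ A ∧ x ≠ B ∧ x ≠ C ∧ x ∉ V) (hVO : ∀ v ∈ V, v ≠ A ∧ v ≠ B ∧ v ≠ C)
   (I : INV S A B C T X K E0) : ∃ S' A' B' C' P', RS S' A' B' C' P' ∧ (∀ v, Sp S' v ↔ v ∈ V) ∧ 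
     (∀ u v, E0 u v → Ed S' u v ∨ ∃ x ∈ X, u ∈ K x ∧ v ∈ K x) ∧ ∀ x ∈ X, Gd S' P' (K x) := by
  obtain ⟨S1, I1, d1⟩ := INV.link D (fun x hx => ⟨(hX x hx).1, (hX x hx).2.1, (hX x hx).2.2.1⟩) (fun x hx k hk => hVO k (hKV x hx hk)) I
  obtain ⟨S2, A', B', C', I2, d2, hX2⟩ := INV.outAll D hV hKV hEV _ T rfl S1 A B C hT hT2 hX I1 d1
  obtain ⟨P, hP⟩ := I2.real
  obtain ⟨S3, P3, I3⟩ := RD.all D hX2 hKV hEV _ X rfl (fun _ q => q) S2 P ⟨hP, I2.sp, I2.xk, d2, I2.g0, fun x hx q => absurd hx q⟩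
  refine ⟨S3, A', B', C', P3, I3.real, ?_, I3.g0, fun x hx => I3.gd x hx (by simp)⟩
  intro v
  rw [I3.sp v]; simp
end ICP

end

set_option linter.all false
noncomputable section
set_option maxHeartbeats 1000000
open Classical Filter Topology
namespace ICP

abbrev Pt := ℝ × ℝ

/-- maximal plane straight-line graphs on a point set -/
structure PL (F : Finset Pt) (H : Pt → Pt → Prop) : Prop where
  sym : ∀ a b, H a b → H b a
  mem : ∀ a b, H a b → a ∈ F
  ne : ∀ a b, H a b → a ≠ b
  nov : ∀ a b x, H a b → x ∈ F → ¬ OnSeg x a b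
  npl : ∀ a b c d p, H a b → H c d → OnSeg p a b → OnSeg p c d → (a = c ∧ b = d) ∨ (a = d ∧ b = c)

structure MP (F : Finset Pt) (H : Pt → Pt → Prop) : Prop extends PL F H where
  max : ∀ a b, a ∈ F → b ∈ F → a ≠ b → ¬ H a b → (∃ x ∈ F, OnSeg x a b) ∨ ∃ c d p, H c d ∧ OnSeg p a b ∧ OnSeg p c d

theorem PL.exists_max {F : Finset Pt} {H0 : Pt → Pt → Prop} (h0 : PL F H0) :
    ∃ H, MP F H ∧ ∀ a b, H0 a b → H a b := by
  let Cd : Finset (Finset (Pt × Pt)) := (F ×ˢ F).powerset.filter (fun E => PL F (fun a b => (a, b) ∈ E) ∧ ∀ a b, H0 a b → (a, b) ∈ E)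
  have hne : Cd.Nonempty := by
    refine ⟨(F ×ˢ F).filter (fun t => H0 t.1 t.2), ?_⟩
    have hm : ∀ a b, (a, b) ∈ (F ×ˢ F).filter (fun t => H0 t.1 t.2) ↔ H0 a b := by
      intro a b
      simp only [Finset.mem_filter, Finset.mem_product]
      exact ⟨fun q => q.2, fun q => ⟨⟨h0.mem _ _ q, h0.mem _ _ (h0.sym _ _ q)⟩, q⟩⟩
    refine Finset.mem_filter.2 ⟨Finset.mem_powerset.2 (Finset.filter_subset _ _), ?_, fun a b q => (hm a b).2 q⟩
    have e : (fun a b => (a, b) ∈ (F ×ˢ F).filter (fun t => H0 t.1 t.2)) = H0 := by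
      funext a b; exact propext (hm a b)
    exact e.symm ▸ h0
  obtain ⟨E, hE, hmax⟩ := Cd.exists_max_image Finset.card hne
  simp only [Cd, Finset.mem_filter, Finset.mem_powerset] at hE
  obtain ⟨hE1, hp, hE0⟩ := hE
  refine ⟨fun a b => (a, b) ∈ E, { toPL := hp, max := ?_ }, hE0⟩
  intro a b ha hb hab hn
  by_contra hcon
  push Not at hcon
  obtain ⟨c1, c2⟩ := hcon
  have hm : ∀ p q, (p, q) ∈ insert (a, b) (insert (b, a) E) ↔ (p = a ∧ q = b) ∨ (p = b ∧ q = a) ∨ (p, q) ∈ E := by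
    intro p q; simp [Finset.mem_insert]
  have hin : insert (a, b) (insert (b, a) E) ∈ Cd := by
    simp only [Cd, Finset.mem_filter, Finset.mem_powerset]
    refine ⟨?_, ⟨?_, ?_, ?_, ?_, ?_⟩, ?_⟩
    · intro t ht
      obtain ⟨p, q⟩ := t
      rcases (hm _ _).1 ht with ⟨rfl, rfl⟩ | ⟨rfl, rfl⟩ | r
      · simp [ha, hb]
      · simp [ha, hb]
      · exact hE1 r
    · intro p q; rw [hm, hm]
      rintro (r | r | r)
      · exact Or.inr (Or.inl r.symm)
      · exact Or.inl r.symm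
      · exact Or.inr (Or.inr (hp.sym _ _ r))
    · intro p q; rw [hm]
      rintro (r | r | r)
      · rw [r.1]; exact ha
      · rw [r.1]; exact hb
      · exact hp.mem _ _ r
    · intro p q; rw [hm]
      rintro (r | r | r)
      · rw [r.1, r.2]; exact hab
      · rw [r.1, r.2]; exact hab.symm
      · exact hp.ne _ _ r
    · intro p q x; rw [hm]
      rintro (r | r | r) hx
      · rw [r.1, r.2]; exact c1 x hx
      · rw [r.1, r.2]; exact fun r => c1 x hx r.symm
      · exact hp.nov _ _ _ r hx
    · intro p q p' q' x; rw [hm, hm]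
      rintro (⟨rfl, rfl⟩ | ⟨rfl, rfl⟩ | r) (⟨rfl, rfl⟩ | ⟨rfl, rfl⟩ | r') s1 s2
      · simp
      · simp
      · exact absurd s2 (c2 _ _ _ r' s1)
      · simp
      · simp
      · exact absurd s2 (c2 _ _ _ r' s1.symm)
      · exact absurd s1 (c2 _ _ _ r s2)
      · exact absurd s1 (c2 _ _ _ r s2.symm)
      · exact hp.npl _ _ _ _ _ r r' s1 s2
    · intro p q r
      exact (hm _ _).2 (Or.inr (Or.inr (hE0 _ _ r)))
  have := hmax _ hin
  have h1 : E ⊂ insert (a, b) (insert (b, a) E) := by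
    rw [Finset.ssubset_iff_of_subset]
    · exact ⟨(a, b), by simp, hn⟩
    · intro t ht; simp [ht]
  have := Finset.card_lt_card h1
  omega

theorem lerp_eq_iff {a b : Pt} (hab : a ≠ b) {s t : ℝ} (h : lerp a b s = lerp a b t) : s = t := by
  unfold lerp at h
  simp only [Prod.mk.injEq] at h
  by_contra hne
  apply hab
  have hst : s - t ≠ 0 := sub_ne_zero.2 hne
  apply Prod.ext
  · have : (s - t) * (b.1 - a.1) = 0 := by linarith [h.1]
    have := (mul_eq_zero.1 this).resolve_left hst
    linarith
  · have : (s - t) * (b.2 - a.2) = 0 := by linarith [h.2]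
    have := (mul_eq_zero.1 this).resolve_left hst
    linarith

theorem lerp_zero (a b : Pt) : lerp a b 0 = a := by unfold lerp; apply Prod.ext <;> simp
theorem lerp_one (a b : Pt) : lerp a b 1 = b := by unfold lerp; apply Prod.ext <;> simp

theorem lerp_lerp (a b : Pt) (s t r : ℝ) : lerp (lerp a b s) (lerp a b t) r = lerp a b (s + r * (t - s)) := by
  unfold lerp; apply Prod.ext <;> simp <;> ring

theorem exists_lerp {a b x : Pt} (hab : a ≠ b) (h : ori a b x = 0) : ∃ t, x = lerp a b t := by
  have hd : b - a ≠ 0 := sub_ne_zero.2 hab.symm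
  have hsq := sq_pos_of_ne hd
  simp only [Prod.fst_sub, Prod.snd_sub] at hsq
  refine ⟨((b.1 - a.1) * (x.1 - a.1) + (b.2 - a.2) * (x.2 - a.2)) / ((b.1 - a.1) ^ 2 + (b.2 - a.2) ^ 2), ?_⟩
  unfold ori at h
  unfold lerp
  apply Prod.ext
  · simp only
    field_simp
    linear_combination (-(b.2 - a.2)) * h
  · simp only
    field_simp
    linear_combination ((b.1 - a.1)) * h

theorem OnSeg.ne {p a b : Pt} (h : OnSeg p a b) (hab : a ≠ b) : p ≠ a ∧ p ≠ b := by
  obtain ⟨s, h0, h1, rfl⟩ := h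
  constructor
  · intro q; have := lerp_eq_iff hab (q.trans (lerp_zero a b).symm); linarith
  · intro q; have := lerp_eq_iff hab (q.trans (lerp_one a b).symm); linarith

/-- collinear overlapping segments -/
theorem collinear_aux {F : Finset Pt} {v w c d p : Pt} (hv : v ∈ F) (hw : w ∈ F) (hc : c ∈ F) (hd : d ∈ F)
    (hvw : v ≠ w) (hcd : c ≠ d) (nv : ∀ x ∈ F, ¬ OnSeg x v w) (nc : ∀ x ∈ F, ¬ OnSeg x c d)
    (h1 : OnSeg p v w) (h2 : OnSeg p c d) (o1 : ori c d v = 0) (o2 : ori c d w = 0) :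
    (v = c ∧ w = d) ∨ (v = d ∧ w = c) := by
  obtain ⟨s, s0, s1, hs⟩ := h2
  obtain ⟨a, ha⟩ := exists_lerp hcd o1
  obtain ⟨b, hb⟩ := exists_lerp hcd o2
  have na := nc v hv
  have nb := nc w hw
  have Na : a ≤ 0 ∨ 1 ≤ a := by
    by_contra q; push Not at q; exact na ⟨a, q.1, q.2, ha⟩
  have Nb : b ≤ 0 ∨ 1 ≤ b := by
    by_contra q; push Not at q; exact nb ⟨b, q.1, q.2, hb⟩
  have hab : a ≠ b := by rintro rfl; exact hvw (ha.trans hb.symm)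
  obtain ⟨r, r0, r1, hr⟩ := h1
  rw [ha, hb, lerp_lerp, hs] at hr
  have hr := lerp_eq_iff hcd hr
  have key : ∀ t x, x ∈ F → x = lerp c d t → ¬ ((a < t ∧ t < b) ∨ (b < t ∧ t < a)) := by
    rintro t x hx rfl q
    apply nv _ hx
    refine ⟨(t - a) / (b - a), ?_, ?_, ?_⟩
    · rcases q with q | q
      · apply div_pos <;> linarith
      · apply div_pos_of_neg_of_neg <;> linarith
    · rcases q with q | q
      · rw [div_lt_one (by linarith)]; linarith
      · rw [div_lt_one_of_neg (by linarith)]; linarith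
    · rw [ha, hb, lerp_lerp]
      congr 1
      have : b - a ≠ 0 := sub_ne_zero.2 hab.symm
      field_simp; ring
  have k0 := key 0 c hc (lerp_zero c d).symm
  have k1 := key 1 d hd (lerp_one c d).symm
  rcases Na with Na | Na <;> rcases Nb with Nb | Nb
  · nlinarith
  · left
    have : a = 0 := by by_contra q; exact k0 (Or.inl ⟨lt_of_le_of_ne Na q, by linarith⟩)
    have : b = 1 := by by_contra q; exact k1 (Or.inl ⟨by linarith, lt_of_le_of_ne Nb (Ne.symm q)⟩)
    subst a; subst b
    rw [ha, hb, lerp_zero, lerp_one]; exact ⟨rfl, rfl⟩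
  · right
    have : b = 0 := by by_contra q; exact k0 (Or.inr ⟨lt_of_le_of_ne Nb q, by linarith⟩)
    have : a = 1 := by by_contra q; exact k1 (Or.inr ⟨by linarith, lt_of_le_of_ne Na (Ne.symm q)⟩)
    subst a; subst b
    rw [ha, hb, lerp_zero, lerp_one]; exact ⟨rfl, rfl⟩
  · nlinarith

/-- nearest point on a ray -/
theorem nearest {F : Finset Pt} {v q : Pt} (hq : q ∈ F) (hvq : v ≠ q) :
    ∃ w ∈ F, (w = q ∨ OnSeg w v q) ∧ ∀ x ∈ F, ¬ OnSeg x v w := by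
  obtain ⟨w, hw, hmin⟩ := (F.filter (fun w => w = q ∨ OnSeg w v q)).exists_min_image (fun w => |w.1 - v.1| + |w.2 - v.2|) ⟨q, by simp [hq]⟩
  rw [Finset.mem_filter] at hw
  refine ⟨w, hw.1, hw.2, ?_⟩
  intro x hx hs
  have hwv : v ≠ w := by
    rcases hw.2 with r | r
    · rw [r]; exact hvq
    · exact (r.ne hvq).1.symm
  have hx2 : OnSeg x v q := by
    rcases hw.2 with r | ⟨t, t0, t1, r⟩
    · rw [← r]; exact hs
    · obtain ⟨s, s0, s1, e⟩ := hs
      refine ⟨s * t, by positivity, by nlinarith, ?_⟩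
      rw [e, r]
      unfold lerp; apply Prod.ext <;> simp <;> ring
  have := hmin x (by simp [hx, hx2])
  obtain ⟨s, s0, s1, e⟩ := hs
  have e1 : x.1 - v.1 = s * (w.1 - v.1) := by rw [e]; unfold lerp; simp
  have e2 : x.2 - v.2 = s * (w.2 - v.2) := by rw [e]; unfold lerp; simp
  rw [e1, e2, abs_mul, abs_mul, abs_of_pos s0] at this
  have p1 := abs_nonneg (w.1 - v.1)
  have p2 := abs_nonneg (w.2 - v.2)
  have : |w.1 - v.1| + |w.2 - v.2| ≤ 0 := by nlinarith
  have z1 : |w.1 - v.1| = 0 := by linarith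
  have z2 : |w.2 - v.2| = 0 := by linarith
  rw [abs_eq_zero] at z1 z2
  apply hwv
  apply Prod.ext <;> linarith

variable {F : Finset Pt} {H : Pt → Pt → Prop}

theorem OnSeg.side {p a b x y : Pt} (h : OnSeg p a b) (h0 : ori x y p = 0) :
    (ori x y a = 0 ∧ ori x y b = 0) ∨ (ori x y a < 0 ∧ 0 < ori x y b) ∨ (0 < ori x y a ∧ ori x y b < 0) := by
  obtain ⟨s, s0, s1, rfl⟩ := h
  rw [ori_lerp] at h0
  rcases lt_trichotomy (ori x y a) 0 with q | q | q
  · right; left; refine ⟨q, ?_⟩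
    by_contra r; push Not at r
    nlinarith [mul_pos (sub_pos.2 s1) (neg_pos.2 q), mul_nonneg s0.le (neg_nonneg.2 r)]
  · left; refine ⟨q, ?_⟩
    rw [q] at h0
    simpa [s0.ne'] using h0
  · right; right; refine ⟨q, ?_⟩
    by_contra r; push Not at r
    nlinarith [mul_pos (sub_pos.2 s1) q, mul_nonneg s0.le r]

theorem OnSeg.ori0 {p a b : Pt} (h : OnSeg p a b) : ori a b p = 0 := by
  obtain ⟨s, s0, s1, rfl⟩ := h
  rw [ori_lerp, ori_self1, ori_self2]; ring

theorem col_swap {a b c d : Pt} (hab : a ≠ b) (h1 : ori a b c = 0) (h2 : ori a b d = 0) : ori c d a = 0 ∧ ori c d b = 0 := by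
  obtain ⟨s, rfl⟩ := exists_lerp hab h1
  obtain ⟨t, rfl⟩ := exists_lerp hab h2
  constructor <;> unfold lerp ori <;> simp <;> ring

/-- a blocked non-edge is crossed transversally -/
theorem MP.block (h : MP F H) {v w : Pt} (hv : v ∈ F) (hw : w ∈ F) (hvw : v ≠ w) (nv : ∀ x ∈ F, ¬ OnSeg x v w)
    (hn : ¬ H v w) : ∃ c d p, H c d ∧ OnSeg p v w ∧ OnSeg p c d ∧ ori v w c < 0 ∧ 0 < ori v w d := by
  rcases h.max v w hv hw hvw hn with ⟨x, hx, q⟩ | ⟨c, d, p, hcd, h1, h2⟩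
  · exact absurd q (nv x hx)
  · rcases h2.side h1.ori0 with q | q | q
    · have hc := h.mem _ _ hcd
      have hd := h.mem _ _ (h.sym _ _ hcd)
      have o := col_swap hvw q.1 q.2
      rcases collinear_aux hv hw hc hd hvw (h.ne _ _ hcd) nv (fun x hx => h.nov _ _ x hcd hx) h1 h2 o.1 o.2 with ⟨rfl, rfl⟩ | ⟨rfl, rfl⟩
      · exact absurd hcd hn
      · exact absurd (h.sym _ _ hcd) hn
    · exact ⟨c, d, p, hcd, h1, h2, q⟩
    · exact ⟨d, c, p, h.sym _ _ hcd, h1, h2.symm, q.2, q.1⟩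
end ICP

end

set_option linter.all false
noncomputable section
set_option maxHeartbeats 1000000
open Classical Filter Topology
namespace ICP
variable {F : Finset Pt} {H : Pt → Pt → Prop}

/-- ori along a segment starting at the apex -/
theorem OnSeg.ori_apex {x v q y : Pt} (h : OnSeg x v q) : ∃ s, 0 < s ∧ s < 1 ∧ (∀ y, ori v x y = s * ori v q y) ∧
    (∀ y, ori v y x = s * ori v y q) ∧ (∀ y, ori y v x = s * ori y v q) ∧ ∀ y z, ori y z x = (1 - s) * ori y z v + s * ori y z q := by
  obtain ⟨s, s0, s1, rfl⟩ := h
  refine ⟨s, s0, s1, ?_, ?_, ?_, ?_⟩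
  · intro y; unfold ori lerp; ring
  · intro y; unfold ori lerp; ring
  · intro y; unfold ori lerp; ring
  · intro y z; rw [ori_lerp]

theorem minang {M : Finset Pt} {v u : Pt} (hne : M.Nonempty) (hM : ∀ q ∈ M, 0 < ori v u q) :
    ∃ w ∈ M, (∀ q ∈ M, 0 ≤ ori v w q) ∧ ∀ x ∈ M, ¬ OnSeg x v w := by
  obtain ⟨w, hw, hmax⟩ := M.exists_max_image (fun q => ((u.1 - v.1) * (q.1 - v.1) + (u.2 - v.2) * (q.2 - v.2)) / ori v u q) hne
  have key : ∀ q ∈ M, 0 ≤ ori v w q := by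
    intro q hq
    have h1 := hmax q hq
    rw [div_le_div_iff₀ (hM q hq) (hM w hw)] at h1
    have id : ((u.1 - v.1)^2 + (u.2 - v.2)^2) * ori v w q =
      ((u.1 - v.1) * (w.1 - v.1) + (u.2 - v.2) * (w.2 - v.2)) * ori v u q -
      ((u.1 - v.1) * (q.1 - v.1) + (u.2 - v.2) * (q.2 - v.2)) * ori v u w := by unfold ori; ring
    have pos : 0 < (u.1 - v.1)^2 + (u.2 - v.2)^2 := by
      have h2 := hM w hw
      by_contra hc
      have e1 : u.1 - v.1 = 0 := by nlinarith [sq_nonneg (u.1 - v.1), sq_nonneg (u.2 - v.2)]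
      have e2 : u.2 - v.2 = 0 := by nlinarith [sq_nonneg (u.1 - v.1), sq_nonneg (u.2 - v.2)]
      unfold ori at h2; rw [e1, e2] at h2; simp at h2
    by_contra hc
    push Not at hc
    nlinarith [mul_neg_of_pos_of_neg pos hc]
  have hvw : v ≠ w := by
    rintro rfl; have := hM _ hw; rw [ori_self1] at this; exact lt_irrefl _ this
  obtain ⟨w', hw', h1, h2⟩ := nearest hw hvw
  refine ⟨w', hw', ?_, h2⟩
  rcases h1 with rfl | h1
  · exact key
  · obtain ⟨s, s0, s1, e, -⟩ := h1.ori_apex (y := v)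
    intro q hq; rw [e]; exact mul_nonneg s0.le (key q hq)

theorem OnSeg.trans {x i r e : Pt} (h : OnSeg i r e) (hx : OnSeg x i e) : OnSeg x r e := by
  obtain ⟨s, s0, s1, rfl⟩ := h
  obtain ⟨t, t0, t1, rfl⟩ := hx
  refine ⟨s + t * (1 - s), by nlinarith, by nlinarith, ?_⟩
  unfold lerp; apply Prod.ext <;> (simp only; ring)

theorem OnSeg.trans' {x i r e : Pt} (h : OnSeg i r e) (hx : OnSeg x r i) : OnSeg x r e :=
  (h.symm.trans hx.symm).symm

theorem OnSeg.ori_zero_of {p c d r : Pt} (h : OnSeg p c d) (hr : ori c d r = 0) : ori p d r = 0 := by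
  obtain ⟨s, s0, s1, rfl⟩ := h
  have : ori (lerp c d s) d r = (1 - s) * ori c d r := by unfold ori lerp; ring
  rw [this, hr, mul_zero]

/-- the crossing closest to v on the segment vw -/
theorem MP.closest (h : MP F H) {v w : Pt} (hv : v ∈ F) (hw : w ∈ F) (hvw : v ≠ w) (nv : ∀ x ∈ F, ¬ OnSeg x v w)
    (hn : ¬ H v w) : ∃ c d p, H c d ∧ OnSeg p v w ∧ OnSeg p c d ∧ ori v w c < 0 ∧ 0 < ori v w d ∧
      ∀ e f x, H e f → OnSeg x v p → OnSeg x e f → ori v w e ≠ 0 → False := by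
  let B : Finset (Pt × Pt) := (F ×ˢ F).filter (fun t => H t.1 t.2 ∧ (∃ p, OnSeg p v w ∧ OnSeg p t.1 t.2) ∧ ori v w t.1 < 0 ∧ 0 < ori v w t.2)
  have mB : ∀ c d p, H c d → OnSeg p v w → OnSeg p c d → ori v w c < 0 → 0 < ori v w d → (c, d) ∈ B := fun c d p a1 a2 a3 a4 a5 =>
    Finset.mem_filter.2 ⟨Finset.mem_product.2 ⟨h.mem _ _ a1, h.mem _ _ (h.sym _ _ a1)⟩, a1, ⟨p, a2, a3⟩, a4, a5⟩
  obtain ⟨c0, d0, p0, b1, b2, b3, b4, b5⟩ := h.block hv hw hvw nv hn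
  obtain ⟨⟨c, d⟩, hB, hmin⟩ := B.exists_min_image (fun t => ori t.1 t.2 v / (ori t.1 t.2 v - ori t.1 t.2 w)) ⟨_, mB _ _ _ b1 b2 b3 b4 b5⟩
  have form : ∀ c d t, OnSeg (lerp v w t) c d → ori v w c ≠ 0 → t = ori c d v / (ori c d v - ori c d w) := by
    intro c d t h1 h2
    have h3 := h1.ori0
    rw [ori_lerp] at h3
    have hne : ori c d v - ori c d w ≠ 0 := by
      intro h4
      have e1 : ori c d v = 0 := by linear_combination h3 + t * h4
      have e2 : ori c d w = 0 := by linarith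
      have hcd : c ≠ d := by
        rintro rfl
        obtain ⟨s, -, -, e⟩ := h1
        have : ori v w (lerp v w t) = ori v w (lerp c c s) := by rw [e]
        rw [ori_lerp, ori_lerp, ori_self1, ori_self2] at this
        apply h2; linarith
      exact h2 (col_swap hcd e1 e2).1
    rw [eq_div_iff hne]; linarith
  obtain ⟨-, c1, ⟨p, c2, c3⟩, c4, c5⟩ := Finset.mem_filter.1 hB
  refine ⟨c, d, p, c1, c2, c3, c4, c5, ?_⟩
  intro e f x k1 k2 k3 k4
  have k5 := c2.trans' k2
  have main : ∀ e f, H e f → OnSeg x e f → ori v w e < 0 → 0 < ori v w f → False := by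
    intro e f k1 k3 k6 k7
    have k8 := hmin _ (mB _ _ _ k1 k5 k3 k6 k7)
    simp only at k8
    obtain ⟨t, t0, t1, rfl⟩ := c2
    rw [← form _ _ _ c3 c4.ne] at k8
    obtain ⟨s, s0, s1, rfl⟩ := k2
    have : lerp v (lerp v w t) s = lerp v w (s * t) := by unfold lerp; apply Prod.ext <;> (simp only; ring)
    rw [this] at k3
    rw [← form _ _ _ k3 k6.ne] at k8
    nlinarith
  rcases k3.side k5.ori0 with ⟨a, b⟩ | ⟨a, b⟩ | ⟨a, b⟩
  · exact k4 a
  · exact main e f k1 k3 a b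
  · exact main f e (h.sym _ _ k1) k3.symm b a

theorem MP.lem1 (h : MP F H) {v u w0 : Pt} (hv : v ∈ F) (hw0 : w0 ∈ F) (h0 : 0 < ori v u w0) :
    ∃ q, H v q ∧ 0 < ori v u q := by
  obtain ⟨w, hw, hmin, hnear⟩ := minang (M := F.filter (fun q => 0 < ori v u q)) (v := v) (u := u)
    ⟨w0, Finset.mem_filter.2 ⟨hw0, h0⟩⟩ (fun q hq => (Finset.mem_filter.1 hq).2)
  obtain ⟨hwF, hwl⟩ := Finset.mem_filter.1 hw
  have left : ∀ x q, 0 < ori v u q → OnSeg x v q → 0 < ori v u x := by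
    intro x q hq hx
    obtain ⟨s, s0, s1, -, e, -⟩ := hx.ori_apex (y := v)
    rw [e]; exact mul_pos s0 hq
  have nv : ∀ x ∈ F, ¬ OnSeg x v w := fun x hx ho => hnear x (Finset.mem_filter.2 ⟨hx, left x w hwl ho⟩) ho
  have hvw : v ≠ w := by rintro rfl; rw [ori_self1] at hwl; exact lt_irrefl _ hwl
  by_cases hH : H v w
  · exact ⟨w, hH, hwl⟩
  obtain ⟨c, d, p, k1, k2, k3, k4, k5, k6⟩ := h.closest hv hwF hvw nv hH
  have hcF := h.mem _ _ k1
  have hdF := h.mem _ _ (h.sym _ _ k1)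
  have pl := left p w hwl k2
  have cl : ori v u c ≤ 0 := by
    by_contra hc
    have := hmin c (Finset.mem_filter.2 ⟨hcF, not_le.1 hc⟩)
    linarith
  have dl : 0 < ori v u d := by
    obtain ⟨s, s0, s1, e⟩ := k3
    rw [e, ori_lerp] at pl
    by_contra hc
    push Not at hc
    nlinarith [mul_nonneg s0.le (sub_nonneg.2 hc)]
  obtain ⟨τ, τ0, τ1, τe, -⟩ := k2.ori_apex (y := v)
  have D : 0 < ori v p d := by rw [τe]; exact mul_pos τ0 k5
  have D2 : 0 < ori p d v := by rw [ori_rot]; exact D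
  have D3 : 0 < ori d v p := by rw [ori_rot']; exact D
  have pF : p ∉ F := fun hp => nv p hp k2
  let M := F.filter (fun q => clT q v p d ∧ q ≠ v)
  have hdv : d ≠ v := by rintro rfl; rw [ori_self1] at dl; exact lt_irrefl _ dl
  have dM : d ∈ M := Finset.mem_filter.2 ⟨hdF, ⟨D.le, by rw [ori_self2], by rw [ori_self1]⟩, hdv⟩
  have ML : ∀ q ∈ M, 0 < ori v u q := by
    intro q hq
    obtain ⟨hqF, ⟨q1, q2, q3⟩, qv⟩ := Finset.mem_filter.1 hq
    have id := ori_comb v p d q v u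
    rw [ori_self1] at id
    have hsum : 0 < ori d v q * ori v u p + ori v p q * ori v u d := by
      rcases q3.lt_or_eq with q3 | q3
      · exact add_pos_of_pos_of_nonneg (mul_pos q3 pl) (mul_nonneg q1 dl.le)
      rcases q1.lt_or_eq with q1 | q1
      · exact add_pos_of_nonneg_of_pos (mul_nonneg q3.le pl.le) (mul_pos q1 dl)
      exfalso
      rcases closed_side D q1.symm q2 q3.le with e | e | e
      · exact qv e
      · rw [e] at hqF; exact pF hqF
      · obtain ⟨s, s0, s1, -, -, e, -⟩ := e.ori_apex (y := v)
        rw [e] at q3; have := mul_pos s0 D3; linarith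
    by_contra hc
    push Not at hc
    nlinarith [mul_nonneg D.le (sub_nonneg.2 hc)]
  obtain ⟨q, hq, qmin, qnear⟩ := minang ⟨d, dM⟩ ML
  have hql := ML q hq
  obtain ⟨hqF, ⟨q1, q2, q3⟩, qv⟩ := Finset.mem_filter.1 hq
  refine ⟨q, ?_, hql⟩
  by_contra hnq
  have segcl : ∀ x, OnSeg x v q → clT x v p d ∧ 0 < ori p d x := by
    intro x hx
    obtain ⟨s, s0, s1, -, e1, e2, e3⟩ := hx.ori_apex (y := v)
    have : 0 < ori p d x := by
      rw [e3]; have := mul_pos (sub_pos.2 s1) D2; have := mul_nonneg s0.le q2; linarith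
    exact ⟨⟨by rw [e1]; exact mul_nonneg s0.le q1, this.le, by rw [e2]; exact mul_nonneg s0.le q3⟩, this⟩
  have nq : ∀ x ∈ F, ¬ OnSeg x v q := by
    intro x hx ho
    exact qnear x (Finset.mem_filter.2 ⟨hx, (segcl x ho).1, (ho.ne qv.symm).1⟩) ho
  obtain ⟨e, f, r, r1, r2, r3, r4, r5⟩ := h.block hv hqF qv.symm nq hnq
  have heF := h.mem _ _ r1
  have q1' : 0 < ori v p q := by
    rcases q1.lt_or_eq with q1 | q1
    · exact q1
    exfalso
    rcases closed_side D q1.symm q2 q3 with e | e | e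
    · exact qv e
    · rw [e] at hqF; exact pF hqF
    · exact nv q hqF (k2.trans' e)
  have hr0 := r2.ori0
  obtain ⟨rc, rp⟩ := segcl r r2
  have rvp : 0 < ori v p r := by
    obtain ⟨s, s0, s1, -, e1, -⟩ := r2.ori_apex (y := v)
    rw [e1]; exact mul_pos s0 q1'
  have rdv : 0 < ori d v r ∨ (ori d v r = 0 ∧ 0 < ori d v e) := by
    rcases rc.2.2.lt_or_eq with z | z
    · exact Or.inl z
    right
    refine ⟨z.symm, ?_⟩
    obtain ⟨s, s0, s1, -, -, e2, -⟩ := r2.ori_apex (y := v)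
    rw [e2] at z
    have z' : ori v d q = 0 := by
      have : ori d v q = 0 := by
        rcases mul_eq_zero.1 z.symm with z | z
        · linarith
        · exact z
      rw [ori_swap, this, neg_zero]
    obtain ⟨t, ht⟩ := exists_lerp hdv.symm z'
    have e3 : ori v u q = t * ori v u d := by rw [ht, ori_lerp, ori_self1]; ring
    have t0 : 0 < t := by
      by_contra hc; push Not at hc
      nlinarith [mul_nonneg (neg_nonneg.2 hc) dl.le]
    have e4 : ori v q e = - (t * ori d v e) := by rw [ht]; unfold ori lerp; ring
    rw [e4] at r4
    by_contra hc; push Not at hc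
    nlinarith [mul_nonneg t0.le (neg_nonneg.2 hc)]
  have henc : ¬ clT e v p d := by
    intro hc
    have hev : e ≠ v := by rintro rfl; rw [ori_self1] at r4; exact lt_irrefl _ r4
    have := qmin e (Finset.mem_filter.2 ⟨heF, hc, hev⟩)
    linarith
  obtain ⟨ε, ⟨ε0, ε1⟩, ε2, ε3, ε4⟩ := ((ev_small 1 one_pos).and ((ev_pos (y := ori v p e - ori v p r) rvp).and
    ((ev_pos (y := ori p d e - ori p d r) rp).and (show ∀ᶠ ε in 𝓝[>] (0:ℝ), 0 < ε → 0 < ori d v r + ε * (ori d v e - ori d v r) from by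
      rcases rdv with z | ⟨z, z'⟩
      · exact (ev_pos z).mono (fun _ a _ => a)
      · refine Filter.Eventually.of_forall (fun ε hε => ?_)
        rw [z]; have := mul_pos hε z'; linarith)))).exists
  have hi : OnSeg (lerp r e ε) r e := ⟨ε, ε0, ε1, rfl⟩
  have ii : inT (lerp r e ε) v p d := by
    have ε4' := ε4 ε0
    refine ⟨?_, ?_, ?_⟩ <;> rw [ori_lerp] <;> linarith
  obtain ⟨x, x1, x2⟩ := exit_tri D ii henc
  have x3 := hi.trans x1
  have x4 : OnSeg x e f := r3.trans' x3.symm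
  have x5 : ori v q x < 0 := by
    obtain ⟨s, s0, s1, rfl⟩ := x3
    rw [ori_lerp, hr0]; nlinarith
  have fin : OnSeg x c d → False := by
    intro hx
    have : ori c d r = 0 := by
      have z := r3.ori0
      rcases h.npl _ _ _ _ _ k1 r1 hx x4 with ⟨rfl, rfl⟩ | ⟨rfl, rfl⟩
      · exact z
      · rw [ori_swap, z, neg_zero]
    have := k3.ori_zero_of this
    linarith
  rcases x2 with rfl | rfl | rfl | x2 | x2 | x2
  · rw [ori_self1] at x5; exact lt_irrefl _ x5
  · exact fin k3
  · have := qmin _ dM; linarith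
  · refine k6 e f x r1 x2 x4 ?_
    intro z
    have hx0 : ori v w x = 0 := (k2.trans' x2).ori0
    have hf0 : ori v w f = 0 := by
      rcases x4.side hx0 with a | a | a
      · exact a.2
      · linarith [a.1]
      · linarith [a.1]
    have hr : ori v w r = 0 := by
      obtain ⟨s, s0, s1, rfl⟩ := r3
      rw [ori_lerp, z, hf0]; ring
    rw [τe, hr] at rvp; linarith
  · exact fin (k3.trans x2)
  · have := qmin _ dM
    obtain ⟨s, s0, s1, -, -, -, e3⟩ := x2.ori_apex (y := v)
    rw [e3, ori_self1] at x5
    have := mul_nonneg (sub_pos.2 s1).le this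
    linarith

theorem MP.face (h : MP F H) {a b w0 : Pt} (hab : H a b) (hw0 : w0 ∈ F) (h0 : 0 < ori a b w0) :
    ∃ w, H a w ∧ H b w ∧ 0 < ori a b w ∧ ∀ x ∈ F, clT x a b w → x = a ∨ x = b ∨ x = w := by
  have ha := h.mem _ _ hab
  have hb := h.mem _ _ (h.sym _ _ hab)
  obtain ⟨q0, q1, q2⟩ := h.lem1 ha hw0 h0
  let N := F.filter (fun q => H a q ∧ 0 < ori a b q)
  have mN : ∀ q, H a q → 0 < ori a b q → q ∈ N := fun q z1 z2 => Finset.mem_filter.2 ⟨h.mem _ _ (h.sym _ _ z1), z1, z2⟩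
  obtain ⟨w, hw, hmin, -⟩ := minang ⟨q0, mN _ q1 q2⟩ (fun q hq => (Finset.mem_filter.1 hq).2.2)
  obtain ⟨wF, Haw, D⟩ := Finset.mem_filter.1 hw
  have D2 : 0 < ori b w a := by rw [ori_rot]; exact D
  have D3 : 0 < ori w a b := by rw [ori_rot']; exact D
  have nocone : ∀ q, H a q → 0 < ori a b q → 0 < ori w a q → False := by
    intro q z1 z2 z3
    have := hmin q (mN q z1 z2)
    rw [ori_swap] at z3; linarith
  have emp : ∀ x ∈ F, clT x a b w → x = a ∨ x = b ∨ x = w := by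
    by_contra hcon
    push Not at hcon
    obtain ⟨x0, y1, y2, y3, y4, y5⟩ := hcon
    let M := F.filter (fun q => clT q a b w ∧ q ≠ a ∧ q ≠ b ∧ q ≠ w)
    obtain ⟨q, hq, qmax⟩ := M.exists_max_image (fun q => ori b w q) ⟨x0, Finset.mem_filter.2 ⟨y1, y2, y3, y4, y5⟩⟩
    obtain ⟨qF, ⟨p1, p2, p3⟩, na, nb, nw⟩ := Finset.mem_filter.1 hq
    have p1' : 0 < ori a b q := by
      rcases p1.lt_or_eq with z | z
      · exact z
      rcases closed_side D z.symm p2 p3 with e | e | e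
      · exact absurd e na
      · exact absurd e nb
      · exact absurd e (h.nov _ _ _ hab qF)
    have p3' : 0 < ori w a q := by
      rcases p3.lt_or_eq with z | z
      · exact z
      rcases closed_side D3 z.symm p1 p2 with e | e | e
      · exact absurd e nw
      · exact absurd e na
      · exact absurd e (h.nov _ _ _ (h.sym _ _ Haw) qF)
    have hlt : ori b w q < ori b w a := by
      have := ori_add a b w q
      rw [← ori_rot a b w] at this; linarith
    have seg : ∀ x, OnSeg x a q → 0 < ori a b x ∧ 0 < ori w a x ∧ ori b w q < ori b w x := by
      intro x hx
      obtain ⟨s, s0, s1, -, e1, e2, e3⟩ := hx.ori_apex (y := a)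
      refine ⟨by rw [e1]; exact mul_pos s0 p1', by rw [e2]; exact mul_pos s0 p3', ?_⟩
      rw [e3]; nlinarith
    have nq : ∀ x ∈ F, ¬ OnSeg x a q := by
      intro x hx ho
      obtain ⟨s1, s2, s3⟩ := seg x ho
      have : x ∈ M := by
        refine Finset.mem_filter.2 ⟨hx, ⟨s1.le, by linarith, s2.le⟩, (ho.ne na.symm).1, ?_, ?_⟩
        · rintro rfl; rw [ori_self2] at s1; exact lt_irrefl _ s1
        · rintro rfl; rw [ori_self1] at s2; exact lt_irrefl _ s2
      have := qmax x this
      linarith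
    by_cases hH : H a q
    · exact nocone q hH p1' p3'
    obtain ⟨e0, f0, r, t1, t2, t3, t4, t5⟩ := h.block ha qF na.symm nq hH
    obtain ⟨s1, s2, s3⟩ := seg r t2
    have main : ∀ g f, H g f → OnSeg r g f → ori b w r ≤ ori b w g → False := by
      intro g f u1 u2 u3
      have gF := h.mem _ _ u1
      have rin : inT r a b w := ⟨s1, by linarith, s2⟩
      by_cases gc : clT g a b w
      · by_cases ga : g = a
        · subst ga
          obtain ⟨s, s0, _, -, e1, e2, -⟩ := u2.ori_apex (y := g)
          refine nocone f u1 ?_ ?_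
          · rw [e1] at s1; exact (pos_iff_pos_of_mul_pos s1).1 s0
          · rw [e2] at s2; exact (pos_iff_pos_of_mul_pos s2).1 s0
        · have : g ∈ M := by
            refine Finset.mem_filter.2 ⟨gF, gc, ga, ?_, ?_⟩
            · rintro rfl; rw [ori_self1] at u3; linarith
            · rintro rfl; rw [ori_self2] at u3; linarith
          have := qmax g this
          linarith
      · obtain ⟨x, x1, x2⟩ := exit_tri D rin gc
        have xp : 0 < ori b w x := by
          obtain ⟨s, s0, s1, rfl⟩ := x1
          rw [ori_lerp]; nlinarith
        have xs : OnSeg x g f := u2.trans' x1.symm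
        rcases x2 with rfl | rfl | rfl | x2 | x2 | x2
        · exact h.nov _ _ _ u1 ha xs
        · rw [ori_self1] at xp; exact lt_irrefl _ xp
        · rw [ori_self2] at xp; exact lt_irrefl _ xp
        · have z := u2.ori0
          rcases h.npl _ _ _ _ _ hab u1 x2 xs with ⟨rfl, rfl⟩ | ⟨rfl, rfl⟩
          · linarith
          · rw [ori_swap] at z; linarith
        · rw [x2.ori0] at xp; exact lt_irrefl _ xp
        · have z := u2.ori0
          rcases h.npl _ _ _ _ _ (h.sym _ _ Haw) u1 x2 xs with ⟨rfl, rfl⟩ | ⟨rfl, rfl⟩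
          · linarith
          · rw [ori_swap] at z; linarith
    by_cases hh : ori b w r ≤ ori b w e0
    · exact main e0 f0 t1 t3 hh
    · refine main f0 e0 (h.sym _ _ t1) t3.symm ?_
      push Not at hh
      obtain ⟨s, s0, s1, e⟩ := t3
      rw [e, ori_lerp] at hh ⊢
      by_contra hc
      push Not at hc
      nlinarith
  refine ⟨w, Haw, ?_, D, emp⟩
  have wb : b ≠ w := by rintro rfl; rw [ori_self2] at D; exact lt_irrefl _ D
  have seg : ∀ p, OnSeg p b w → 0 < ori a b p ∧ 0 < ori w a p ∧ ori b w p = 0 := by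
    intro p hp
    obtain ⟨z1, z2, z3⟩ := hp.edge D2
    exact ⟨z3, z2, z1⟩
  have nbw : ∀ x ∈ F, ¬ OnSeg x b w := by
    intro x hx ho
    obtain ⟨z1, z2, z3⟩ := seg x ho
    rcases emp x hx ⟨z1.le, z3.ge, z2.le⟩ with rfl | rfl | rfl
    · rw [ori_self1] at z1; exact lt_irrefl _ z1
    · rw [ori_self2] at z1; exact lt_irrefl _ z1
    · rw [ori_self1] at z2; exact lt_irrefl _ z2
  by_contra hH
  obtain ⟨c, d, p, k1, k2, k3, k4, k5⟩ := h.block hb wF wb nbw hH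
  obtain ⟨z1, z2, z3⟩ := seg p k2
  by_cases dc : clT d a b w
  · rcases emp d (h.mem _ _ (h.sym _ _ k1)) dc with rfl | rfl | rfl
    · obtain ⟨s, s0, _, -, e1, e2, -⟩ := k3.symm.ori_apex (y := d)
      refine nocone c (h.sym _ _ k1) ?_ ?_
      · rw [e1] at z1; exact (pos_iff_pos_of_mul_pos z1).1 s0
      · rw [e2] at z2; exact (pos_iff_pos_of_mul_pos z2).1 s0
    · rw [ori_self1] at k5; exact lt_irrefl _ k5
    · rw [ori_self2] at k5; exact lt_irrefl _ k5
  obtain ⟨ε, ⟨ε0, ε1⟩, ε2, ε3⟩ := ((ev_small 1 one_pos).and ((ev_pos (y := ori a b d - ori a b p) z1).and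
    (ev_pos (y := ori w a d - ori w a p) z2))).exists
  have hi : OnSeg (lerp p d ε) p d := ⟨ε, ε0, ε1, rfl⟩
  have ii : inT (lerp p d ε) a b w := by
    refine ⟨?_, ?_, ?_⟩ <;> rw [ori_lerp]
    · linarith
    · rw [z3]; have := mul_pos ε0 k5; linarith
    · linarith
  obtain ⟨x, x1, x2⟩ := exit_tri D ii dc
  have x3 := hi.trans x1
  have xs : OnSeg x c d := (k3.symm.trans' x3.symm).symm
  have xp : 0 < ori b w x := by
    obtain ⟨s, s0, s1, rfl⟩ := x3
    rw [ori_lerp, z3]; have := mul_pos s0 k5; linarith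
  have z := k3.ori0
  rcases x2 with rfl | rfl | rfl | x2 | x2 | x2
  · exact h.nov _ _ _ k1 ha xs
  · rw [ori_self1] at xp; exact lt_irrefl _ xp
  · rw [ori_self2] at xp; exact lt_irrefl _ xp
  · rcases h.npl _ _ _ _ _ hab k1 x2 xs with ⟨rfl, rfl⟩ | ⟨rfl, rfl⟩
    · linarith
    · rw [ori_swap] at z; linarith
  · rw [x2.ori0] at xp; exact lt_irrefl _ xp
  · rcases h.npl _ _ _ _ _ (h.sym _ _ Haw) k1 x2 xs with ⟨rfl, rfl⟩ | ⟨rfl, rfl⟩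
    · linarith
    · rw [ori_swap] at z; linarith

end ICP

end

set_option linter.all false
noncomputable section
set_option maxHeartbeats 1000000
open Classical Filter Topology
namespace ICP
variable {F : Finset Pt} {H : Pt → Pt → Prop}

def Tri (F : Finset Pt) (H : Pt → Pt → Prop) (a b c : Pt) : Prop :=
  H a b ∧ H b c ∧ H c a ∧ 0 < ori a b c ∧ ∀ x ∈ F, clT x a b c → x = a ∨ x = b ∨ x = c

theorem Tri.rot {a b c : Pt} (h : Tri F H a b c) : Tri F H b c a := by
  obtain ⟨h1, h2, h3, h4, h5⟩ := h
  refine ⟨h2, h3, h1, by rw [ori_rot]; exact h4, ?_⟩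
  intro x hx hc
  rcases h5 x hx (clT_rot (clT_rot hc)) with r | r | r
  · exact Or.inr (Or.inr r)
  · exact Or.inl r
  · exact Or.inr (Or.inl r)

theorem Tri.uniq (h : MP F H) {a b c c' : Pt} (h1 : Tri F H a b c) (h2 : Tri F H a b c') : c = c' := by
  by_contra hne
  obtain ⟨a1, a2, a3, a4, a5⟩ := h1
  obtain ⟨b1, b2, b3, b4, b5⟩ := h2
  have cF := h.mem _ _ a3
  have cF' := h.mem _ _ b3
  have n1 : ori b c c' < 0 ∨ ori c a c' < 0 := by
    by_contra hc; push Not at hc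
    rcases a5 c' cF' ⟨b4.le, hc.1, hc.2⟩ with r | r | r
    · exact h.ne _ _ b3 r
    · exact h.ne _ _ b2 r.symm
    · exact hne r.symm
  have n2 : 0 < ori b c c' ∨ 0 < ori c a c' := by
    by_contra hc; push Not at hc
    have e1 : ori b c' c = - ori b c c' := by unfold ori; ring
    have e2 : ori c' a c = - ori c a c' := by unfold ori; ring
    rcases b5 c cF ⟨a4.le, by linarith, by linarith⟩ with r | r | r
    · exact h.ne _ _ a3 r
    · exact h.ne _ _ a2 r.symm
    · exact hne r
  have hca : c ≠ a := h.ne _ _ a3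
  have hab : a ≠ b := h.ne _ _ a1
  have hbc : b ≠ c := h.ne _ _ a2
  have q1 : 0 < ori b c a := by rw [ori_rot]; exact a4
  have q2 : 0 < ori c a b := by rw [ori_rot']; exact a4
  rcases n1 with u | w
  · have w : 0 < ori c a c' := by
      rcases n2 with r | r
      · linarith
      · exact r
    obtain ⟨p, p1, p2⟩ := seg_cross (a := b) (b := c) (c := a) (d := c') q1 u
      (by rw [ori_rot]; exact w) (by rw [ori_swap']; linarith)
    rcases h.npl _ _ _ _ _ a2 (h.sym _ _ b3) p1 p2 with r | r
    · exact hab r.1.symm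
    · exact hca r.2
  · have u : 0 < ori b c c' := by
      rcases n2 with r | r
      · exact r
      · linarith
    obtain ⟨p, p1, p2⟩ := seg_cross (a := c) (b := a) (c := b) (d := c') q2 w
      (by rw [ori_rot]; exact b4) (by rw [ori_swap']; linarith)
    rcases h.npl _ _ _ _ _ a3 b2 p1 p2 with r | r
    · exact hbc r.1.symm
    · exact hab r.2

theorem MP.toRS (h : MP F H) {A B C : Pt} (D : 0 < ori A B C) (hAB : H A B) (hBC : H B C) (hCA : H C A)
    (hF : ∀ v ∈ F, v = A ∨ v = B ∨ v = C ∨ inT v A B C) :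
    ∃ S : Finset (Pt × Pt × Pt), RS S A B C id ∧ (∀ v, Sp S v ↔ v ∈ F) ∧ ∀ a b, H a b → Ed S a b := by
  have AF := h.mem _ _ hAB
  have BF := h.mem _ _ hBC
  have CF := h.mem _ _ hCA
  have D2 : 0 < ori B C A := by rw [ori_rot]; exact D
  have D3 : 0 < ori C A B := by rw [ori_rot']; exact D
  have nAB := h.ne _ _ hAB
  have nBC := h.ne _ _ hBC
  have nCA := h.ne _ _ hCA
  have hcl : ∀ v ∈ F, clT v A B C := by
    intro v hv
    rcases hF v hv with rfl | rfl | rfl | r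
    · exact ⟨by rw [ori_self1], D2.le, by rw [ori_self2]⟩
    · exact ⟨by rw [ori_self2], by rw [ori_self1], D3.le⟩
    · exact ⟨D.le, by rw [ori_self2], by rw [ori_self1]⟩
    · exact r.cl
  let OT : Pt × Pt × Pt → Prop := fun t => t = (C, B, A) ∨ t = (B, A, C) ∨ t = (A, C, B)
  let S : Finset (Pt × Pt × Pt) := (F ×ˢ F ×ˢ F).filter (fun t => Tri F H t.1 t.2.1 t.2.2 ∨ OT t)
  have mS : ∀ a b c, (a, b, c) ∈ S ↔ Tri F H a b c ∨ OT (a, b, c) := by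
    intro a b c
    constructor
    · intro r; exact (Finset.mem_filter.1 r).2
    · intro r
      refine Finset.mem_filter.2 ⟨?_, r⟩
      rcases r with r | r | r | r
      · exact Finset.mem_product.2 ⟨h.mem _ _ r.1, Finset.mem_product.2 ⟨h.mem _ _ r.2.1, h.mem _ _ r.2.2.1⟩⟩
      all_goals
        rw [r]; exact Finset.mem_product.2 ⟨by assumption, Finset.mem_product.2 ⟨by assumption, by assumption⟩⟩
  have hSH : ∀ a b c, (a, b, c) ∈ S → H a b := by
    intro a b c r
    rcases (mS _ _ _).1 r with r | r | r | r
    · exact r.1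
    · simp only [Prod.mk.injEq] at r; obtain ⟨rfl, rfl, rfl⟩ := r; exact h.sym _ _ hBC
    · simp only [Prod.mk.injEq] at r; obtain ⟨rfl, rfl, rfl⟩ := r; exact h.sym _ _ hAB
    · simp only [Prod.mk.injEq] at r; obtain ⟨rfl, rfl, rfl⟩ := r; exact h.sym _ _ hCA
  have hHS : ∀ a b, H a b → ∃ c, (a, b, c) ∈ S := by
    intro a b hab
    have aF := h.mem _ _ hab
    have bF := h.mem _ _ (h.sym _ _ hab)
    by_cases hw : ∃ w ∈ F, 0 < ori a b w
    · obtain ⟨w0, k1, k2⟩ := hw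
      obtain ⟨w, c1, c2, c3, c4⟩ := h.face hab k1 k2
      exact ⟨w, (mS _ _ _).2 (Or.inl ⟨hab, c2, h.sym _ _ c1, c3, c4⟩)⟩
    push Not at hw
    have hA := hw A AF
    have hB := hw B BF
    have hC := hw C CF
    have hIntr : ∀ p, inT p A B C → ori a b p = 0 → False := by
      intro p hp h0
      have id := ori_comb A B C p a b
      rw [h0, mul_zero] at id
      obtain ⟨p1, p2, p3⟩ := hp
      have z1 := mul_nonpos_of_nonneg_of_nonpos p2.le hA
      have z2 := mul_nonpos_of_nonneg_of_nonpos p3.le hB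
      have z3 := mul_nonpos_of_nonneg_of_nonpos p1.le hC
      have y1 : ori a b A = 0 := by
        rcases mul_eq_zero.1 (by linarith : ori B C p * ori a b A = 0) with r | r
        · linarith
        · exact r
      have y2 : ori a b B = 0 := by
        rcases mul_eq_zero.1 (by linarith : ori C A p * ori a b B = 0) with r | r
        · linarith
        · exact r
      have y3 : ori a b C = 0 := by
        rcases mul_eq_zero.1 (by linarith : ori A B p * ori a b C = 0) with r | r
        · linarith
        · exact r
      have x := ori_comb a b A A B C
      have w1 := col_swap (h.ne _ _ hab) y1 y2
      obtain ⟨t, ht⟩ := exists_lerp (h.ne _ _ hab) y3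
      rw [ht, ori_lerp, w1.1, w1.2] at D
      linarith
    rcases hF a aF with rfl | rfl | rfl | r
    · rcases hF b bF with rfl | rfl | rfl | r'
      · exact absurd rfl (h.ne _ _ hab)
      · linarith
      · exact ⟨_, (mS _ _ _).2 (Or.inr (Or.inr (Or.inr rfl)))⟩
      · exact absurd (ori_self2 _ _) (fun z => hIntr _ r' z)
    · rcases hF b bF with rfl | rfl | rfl | r'
      · exact ⟨_, (mS _ _ _).2 (Or.inr (Or.inr (Or.inl rfl)))⟩
      · exact absurd rfl (h.ne _ _ hab)
      · linarith
      · exact absurd (ori_self2 _ _) (fun z => hIntr _ r' z)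
    · rcases hF b bF with rfl | rfl | rfl | r'
      · linarith
      · exact ⟨_, (mS _ _ _).2 (Or.inr (Or.inl rfl))⟩
      · exact absurd rfl (h.ne _ _ hab)
      · exact absurd (ori_self2 _ _) (fun z => hIntr _ r' z)
    · exact absurd (ori_self1 _ _) (fun z => hIntr _ r z)
  have hmix : ∀ a b c c', Tri F H a b c → OT (a, b, c') → False := by
    intro a b c c' r r'
    have := hcl c (h.mem _ _ r.2.2.1)
    obtain ⟨y1, y2, y3⟩ := this
    have x := r.2.2.2.1
    rcases r' with r' | r' | r' <;> simp only [Prod.mk.injEq] at r' <;> obtain ⟨rfl, rfl, rfl⟩ := r' <;>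
      (rw [ori_swap] at x; linarith)
  refine ⟨S, { rot := ?_, uniq := ?_, adj := ?_, out := ?_, pos := D, inn := ?_ }, ?_, hHS⟩
  · intro a b c r
    rw [mS] at r ⊢
    rcases r with r | r | r | r
    · exact Or.inl r.rot
    all_goals
      simp only [Prod.mk.injEq] at r; obtain ⟨rfl, rfl, rfl⟩ := r
      right; simp [OT]
  · intro a b c c' r r'
    rw [mS] at r r'
    rcases r with r | r <;> rcases r' with r' | r'
    · exact r.uniq h r'
    · exact (hmix _ _ _ _ r r').elim
    · exact (hmix _ _ _ _ r' r).elim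
    · rcases r with r | r | r <;> rcases r' with r' | r' | r' <;> simp only [Prod.mk.injEq] at r r' <;>
        obtain ⟨r1, r2, r3⟩ := r <;> obtain ⟨r1', r2', r3'⟩ := r' <;> grind
  · intro a b c r
    exact hHS _ _ (h.sym _ _ (hSH _ _ _ r))
  · exact (mS _ _ _).2 (Or.inr (Or.inl rfl))
  · intro a b c r
    rcases (mS _ _ _).1 r with r | r
    · exact Or.inl r.2.2.2.1
    · exact Or.inr r
  · intro v
    constructor
    · rintro ⟨b, c, r⟩; exact h.mem _ _ (hSH _ _ _ r)
    · intro hv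
      have : ∃ q, H v q := by
        rcases hF v hv with rfl | rfl | rfl | r
        · exact ⟨_, hAB⟩
        · exact ⟨_, hBC⟩
        · exact ⟨_, hCA⟩
        · obtain ⟨q, hq, -⟩ := h.lem1 (u := A) hv BF (by rw [ori_rot']; exact r.1)
          exact ⟨q, hq⟩
      obtain ⟨q, hq⟩ := this
      obtain ⟨c, hc⟩ := hHS _ _ hq
      exact ⟨q, c, hc⟩

end ICP

end

set_option linter.all false
noncomputable section
set_option maxHeartbeats 1000000
open Classical Filter Topology
namespace ICP
variable {F : Finset Pt} {H : Pt → Pt → Prop}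

theorem big_tri (F : Finset Pt) : ∃ A B C : Pt, 0 < ori A B C ∧ ∀ p ∈ F, inT p A B C := by
  obtain ⟨M, hM⟩ : ∃ M : ℝ, ∀ p ∈ F, |p.1| + |p.2| ≤ M := by
    refine ⟨∑ p ∈ F, (|p.1| + |p.2|), fun p hp => ?_⟩
    exact Finset.single_le_sum (f := fun p : Pt => |p.1| + |p.2|) (fun i _ => by positivity) hp
  obtain ⟨N, hN0, hN⟩ : ∃ N : ℝ, 0 < N ∧ M < N := ⟨|M| + 1, by positivity, by linarith [le_abs_self M]⟩
  refine ⟨(-4 * N, -2 * N), (4 * N, -2 * N), (0, 4 * N), ?_, ?_⟩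
  · unfold ori; simp only; nlinarith [mul_pos hN0 hN0]
  · intro p hp
    have h1 := hM p hp
    have a1 := le_abs_self p.1
    have a2 := neg_le_abs p.1
    have a3 := le_abs_self p.2
    have a4 := neg_le_abs p.2
    have a5 := abs_nonneg p.1
    have a6 := abs_nonneg p.2
    refine ⟨?_, ?_, ?_⟩
    · have : 0 < N * (8 * (p.2 + 2 * N)) := mul_pos hN0 (by linarith)
      unfold ori; simp only; linarith
    · have : 0 < N * (16 * N - 4 * p.2 - 6 * p.1) := mul_pos hN0 (by linarith)
      unfold ori; simp only; linarith
    · have : 0 < N * (16 * N - 4 * p.2 + 6 * p.1) := mul_pos hN0 (by linarith)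
      unfold ori; simp only; linarith

theorem PL.withOuter (h : PL F H) : ∃ A B C : Pt, 0 < ori A B C ∧ (∀ p ∈ F, inT p A B C) ∧
    ∃ H' : Pt → Pt → Prop, PL (insert A (insert B (insert C F))) H' ∧ (∀ a b, H a b → H' a b) ∧
      H' A B ∧ H' B C ∧ H' C A := by
  obtain ⟨A, B, C, D, hT⟩ := big_tri F
  refine ⟨A, B, C, D, hT, ?_⟩
  have D2 : 0 < ori B C A := by rw [ori_rot]; exact D
  have D3 : 0 < ori C A B := by rw [ori_rot']; exact D
  have nAB : A ≠ B := by rintro rfl; rw [ori_self3] at D; exact lt_irrefl _ D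
  have nBC : B ≠ C := by rintro rfl; rw [ori_self2] at D; exact lt_irrefl _ D
  have nCA : C ≠ A := by rintro rfl; rw [ori_self1] at D; exact lt_irrefl _ D
  let U : Pt → Pt → Pt → Pt → Prop := fun x y a b => (a = x ∧ b = y) ∨ (a = y ∧ b = x)
  let O : Pt → Pt → Prop := fun a b => U A B a b ∨ U B C a b ∨ U C A a b
  have Useg : ∀ x y a b p, U x y a b → OnSeg p a b → OnSeg p x y := by
    rintro x y a b p (⟨rfl, rfl⟩ | ⟨rfl, rfl⟩) r
    · exact r
    · exact r.symm
  have key : ∀ a b p, O a b → OnSeg p a b →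
      (U A B a b ∧ ori A B p = 0 ∧ 0 < ori B C p ∧ 0 < ori C A p) ∨
      (U B C a b ∧ ori B C p = 0 ∧ 0 < ori A B p ∧ 0 < ori C A p) ∨
      (U C A a b ∧ ori C A p = 0 ∧ 0 < ori A B p ∧ 0 < ori B C p) := by
    intro a b p r q
    rcases r with r | r | r
    · obtain ⟨z1, z2, z3⟩ := (Useg _ _ _ _ _ r q).edge D
      exact Or.inl ⟨r, z1, z2, z3⟩
    · obtain ⟨z1, z2, z3⟩ := (Useg _ _ _ _ _ r q).edge D2
      exact Or.inr (Or.inl ⟨r, z1, z3, z2⟩)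
    · obtain ⟨z1, z2, z3⟩ := (Useg _ _ _ _ _ r q).edge D3
      exact Or.inr (Or.inr ⟨r, z1, z2, z3⟩)
  have inn : ∀ a b p, H a b → OnSeg p a b → inT p A B C := by
    intro a b p r q
    have ha := hT _ (h.mem _ _ r)
    have hb := hT _ (h.mem _ _ (h.sym _ _ r))
    exact ⟨q.pos ha.1 hb.1.le, q.pos ha.2.1 hb.2.1.le, q.pos ha.2.2 hb.2.2.le⟩
  have cont : ∀ a b p, O a b → OnSeg p a b → inT p A B C → False := by
    intro a b p r q ⟨i1, i2, i3⟩
    rcases key _ _ _ r q with ⟨-, r, -⟩ | ⟨-, r, -⟩ | ⟨-, r, -⟩ <;> linarith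
  have Ucomb : ∀ x y a b c d, U x y a b → U x y c d → (a = c ∧ b = d) ∨ (a = d ∧ b = c) := by
    rintro x y a b c d (⟨rfl, rfl⟩ | ⟨rfl, rfl⟩) (⟨rfl, rfl⟩ | ⟨rfl, rfl⟩) <;> simp
  refine ⟨fun a b => H a b ∨ O a b, ⟨?_, ?_, ?_, ?_, ?_⟩, fun a b r => Or.inl r, Or.inr (Or.inl (Or.inl ⟨rfl, rfl⟩)),
    Or.inr (Or.inr (Or.inl (Or.inl ⟨rfl, rfl⟩))), Or.inr (Or.inr (Or.inr (Or.inl ⟨rfl, rfl⟩)))⟩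
  · intro a b r
    rcases r with r | r
    · exact Or.inl (h.sym _ _ r)
    · right
      simp only [O, U] at r ⊢; tauto
  · intro a b r
    rcases r with r | r
    · simp [h.mem _ _ r]
    · simp only [O, U] at r; simp only [Finset.mem_insert]; tauto
  · intro a b r
    rcases r with r | r
    · exact h.ne _ _ r
    · rcases r with (⟨rfl, rfl⟩ | ⟨rfl, rfl⟩) | (⟨rfl, rfl⟩ | ⟨rfl, rfl⟩) | (⟨rfl, rfl⟩ | ⟨rfl, rfl⟩)
      · exact nAB
      · exact nAB.symm
      · exact nBC
      · exact nBC.symm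
      · exact nCA
      · exact nCA.symm
  · intro a b x r hx ho
    rcases r with r | r
    · have i := inn _ _ _ r ho
      simp only [Finset.mem_insert] at hx
      rcases hx with rfl | rfl | rfl | hx
      · have := i.1; rw [ori_self1] at this; exact lt_irrefl _ this
      · have := i.1; rw [ori_self2] at this; exact lt_irrefl _ this
      · have := i.2.1; rw [ori_self2] at this; exact lt_irrefl _ this
      · exact h.nov _ _ _ r hx ho
    · simp only [Finset.mem_insert] at hx
      rcases hx with rfl | rfl | rfl | hx
      · have z1 := ori_self1 x B
        have z2 := ori_self2 C x
        rcases key _ _ _ r ho with ⟨-, r1, r2, r3⟩ | ⟨-, r1, r2, r3⟩ | ⟨-, r1, r2, r3⟩ <;> linarith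
      · have z1 := ori_self2 A x
        have z2 := ori_self1 x C
        rcases key _ _ _ r ho with ⟨-, r1, r2, r3⟩ | ⟨-, r1, r2, r3⟩ | ⟨-, r1, r2, r3⟩ <;> linarith
      · have z1 := ori_self2 B x
        have z2 := ori_self1 x A
        rcases key _ _ _ r ho with ⟨-, r1, r2, r3⟩ | ⟨-, r1, r2, r3⟩ | ⟨-, r1, r2, r3⟩ <;> linarith
      · exact cont _ _ _ r ho (hT _ hx)
  · intro a b c d p r r' o o'
    rcases r with r | r <;> rcases r' with r' | r'
    · exact h.npl _ _ _ _ _ r r' o o'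
    · exact (cont _ _ _ r' o' (inn _ _ _ r o)).elim
    · exact (cont _ _ _ r o (inn _ _ _ r' o')).elim
    · rcases key _ _ _ r o with ⟨u, r1, r2, r3⟩ | ⟨u, r1, r2, r3⟩ | ⟨u, r1, r2, r3⟩ <;>
        rcases key _ _ _ r' o' with ⟨u', r1', r2', r3'⟩ | ⟨u', r1', r2', r3'⟩ | ⟨u', r1', r2', r3'⟩ <;>
        first
          | exact Ucomb _ _ _ _ _ _ u u'
          | (exfalso; linarith)

theorem pointMain {V X : Finset Pt} {K : Pt → Finset Pt} {J E0 : Pt → Pt → Prop}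
    (hJ : PL (V ∪ X) J) (D : DAT X K E0) (hV : 3 ≤ V.card) (hKV : ∀ x ∈ X, K x ⊆ V)
    (hEV : ∀ u v, E0 u v → u ∈ V ∧ v ∈ V) (hX : ∀ x ∈ X, x ∉ V) (hk : ∀ x ∈ X, ∀ k ∈ K x, J x k)
    (hE : ∀ u v, E0 u v → J u v ∨ ∃ x ∈ X, u ∈ K x ∧ v ∈ K x) :
    ∃ S A B C P, RS S A B C P ∧ (∀ v, Sp S v ↔ v ∈ V) ∧
      (∀ u v, E0 u v → Ed S u v ∨ ∃ x ∈ X, u ∈ K x ∧ v ∈ K x) ∧ ∀ x ∈ X, Gd S P (K x) := by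
  obtain ⟨A, B, C, hD, hT, H', h1, h2, h3, h4, h5⟩ := hJ.withOuter
  obtain ⟨H, hM, h6⟩ := h1.exists_max
  obtain ⟨S, hR, hS, hE'⟩ := hM.toRS hD (h6 _ _ h3) (h6 _ _ h4) (h6 _ _ h5) (by
    intro v hv
    simp only [Finset.mem_insert] at hv
    rcases hv with r | r | r | r
    · exact Or.inl r
    · exact Or.inr (Or.inl r)
    · exact Or.inr (Or.inr (Or.inl r))
    · exact Or.inr (Or.inr (Or.inr (hT _ r))))
  have nABC : ∀ v ∈ V ∪ X, v ≠ A ∧ v ≠ B ∧ v ≠ C := by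
    intro v hv
    obtain ⟨i1, i2, i3⟩ := hT v hv
    refine ⟨?_, ?_, ?_⟩ <;> rintro rfl
    · rw [ori_self1] at i1; exact lt_irrefl _ i1
    · rw [ori_self2] at i1; exact lt_irrefl _ i1
    · rw [ori_self2] at i2; exact lt_irrefl _ i2
  have I : INV S A B C (insert A (insert B (insert C (V ∪ X)))) X K E0 :=
    { real := ⟨_, hR⟩
      sp := hS
      xk := fun x hx k hkk => hE' _ _ (h6 _ _ (h2 _ _ (hk x hx k hkk)))
      g0 := fun u v e => (hE u v e).imp (fun r => hE' _ _ (h6 _ _ (h2 _ _ r))) id }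
  obtain ⟨S', A', B', C', P', r1, r2, r3, r4⟩ := INV.core (V := V) D hV hKV hEV
    (fun t ht => by simp only [Finset.mem_insert, Finset.mem_union] at ht ⊢; tauto)
    (fun t ht => by simp only [Finset.mem_insert, Finset.mem_union] at ht ⊢; tauto)
    (fun x hx => by
      obtain ⟨a, b, c⟩ := nABC x (Finset.mem_union_right _ hx)
      exact ⟨a, b, c, hX x hx⟩)
    (fun v hv => nABC v (Finset.mem_union_left _ hv)) I
  exact ⟨S', A', B', C', P', r1, r2, r3, r4⟩

end ICP

end

set_option linter.all false
noncomputable section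
set_option maxHeartbeats 1000000
open Classical Filter Topology
namespace ICP

universe u
variable {V : Type u} {G : SimpleGraph V} {ρ : V → ℝ × ℝ}

theorem onSeg_iff {p a b : Pt} : OnSeg p a b ↔ p ∈ openSegment ℝ a b := by
  rw [openSegment_eq_image]
  constructor
  · rintro ⟨s, s0, s1, rfl⟩
    refine ⟨s, ⟨s0, s1⟩, ?_⟩
    unfold lerp; apply Prod.ext <;> (simp; ring)
  · rintro ⟨s, ⟨s0, s1⟩, rfl⟩
    refine ⟨s, s0, s1, ?_⟩
    unfold lerp; apply Prod.ext <;> (simp; ring)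

theorem edgeSeg_mem {p : Pt} {a b : V} : p ∈ edgeSeg ρ s(a, b) ↔ OnSeg p (ρ a) (ρ b) := by
  rw [onSeg_iff]; rfl

def Crs (G : SimpleGraph V) (ρ : V → ℝ × ℝ) (a b c d : V) (p : Pt) : Prop :=
  G.Adj a b ∧ G.Adj c d ∧ a ≠ c ∧ a ≠ d ∧ b ≠ c ∧ b ≠ d ∧ OnSeg p (ρ a) (ρ b) ∧ OnSeg p (ρ c) (ρ d)

theorem Crs.swap {a b c d : V} {p : Pt} (h : Crs G ρ a b c d p) : Crs G ρ b a c d p := by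
  obtain ⟨h1, h2, h3, h4, h5, h6, h7, h8⟩ := h
  exact ⟨h1.symm, h2, h5, h6, h3, h4, h7.symm, h8⟩

theorem Crs.symm {a b c d : V} {p : Pt} (h : Crs G ρ a b c d p) : Crs G ρ c d a b p := by
  obtain ⟨h1, h2, h3, h4, h5, h6, h7, h8⟩ := h
  exact ⟨h2, h1, h3.symm, h5.symm, h4.symm, h6.symm, h8, h7⟩

theorem crosses_iff {a b c d : V} : Crosses ρ s(a, b) s(c, d) ↔
    (a ≠ c ∧ a ≠ d ∧ b ≠ c ∧ b ≠ d) ∧ ∃ p, OnSeg p (ρ a) (ρ b) ∧ OnSeg p (ρ c) (ρ d) := by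
  unfold Crosses
  constructor
  · rintro ⟨h1, p, h2, h3⟩
    have ha := h1 a (Sym2.mem_mk_left a b)
    have hb := h1 b (Sym2.mem_mk_right a b)
    simp only [Sym2.mem_iff, not_or] at ha hb
    exact ⟨⟨ha.1, ha.2, hb.1, hb.2⟩, p, edgeSeg_mem.1 h2, edgeSeg_mem.1 h3⟩
  · rintro ⟨⟨h1, h2, h3, h4⟩, p, h5, h6⟩
    refine ⟨?_, p, edgeSeg_mem.2 h5, edgeSeg_mem.2 h6⟩
    intro v hv
    simp only [Sym2.mem_iff, not_or] at hv ⊢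
    rcases hv with rfl | rfl
    · exact ⟨h1, h2⟩
    · exact ⟨h3, h4⟩

theorem Crs.crosses {a b c d : V} {p : Pt} (h : Crs G ρ a b c d p) : Crosses ρ s(a, b) s(c, d) := by
  obtain ⟨h1, h2, h3, h4, h5, h6, h7, h8⟩ := h
  exact crosses_iff.2 ⟨⟨h3, h4, h5, h6⟩, p, h7, h8⟩

structure Drw (G : SimpleGraph V) (ρ : V → ℝ × ℝ) : Prop where
  inj : Function.Injective ρ
  nov : ∀ a b u, G.Adj a b → ¬ OnSeg (ρ u) (ρ a) (ρ b)
  upt : ∀ a b c d p q, Crs G ρ a b c d p → Crs G ρ a b c d q → p = q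
  one : ∀ a b c d c' d' p q, Crs G ρ a b c d p → Crs G ρ a b c' d' q → (c = c' ∧ d = d') ∨ (c = d' ∧ d = c')
  mat : ∀ a b c d b' c' d' p q, Crs G ρ a b c d p → Crs G ρ a b' c' d' q → b = b'

theorem drw_of (h : IsICPlanarDrawing G ρ) : Drw G ρ := by
  obtain ⟨h1, h2, h3⟩ := h
  refine ⟨h1.inj, ?_, ?_, ?_, ?_⟩
  · intro a b u hab ho
    have hne : ρ a ≠ ρ b := fun e => hab.ne (h1.inj e)
    have := ho.ne hne
    refine h1.no_vertex_on_edge s(a, b) hab u ?_ (edgeSeg_mem.2 ho)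
    rw [Sym2.mem_iff]
    rintro (rfl | rfl)
    · exact this.1 rfl
    · exact this.2 rfl
  · intro a b c d p q k k'
    exact h1.meet_at_most_once s(a, b) k.1 s(c, d) k.2.1 k.crosses.1
      ⟨edgeSeg_mem.2 k.2.2.2.2.2.2.1, edgeSeg_mem.2 k.2.2.2.2.2.2.2⟩
      ⟨edgeSeg_mem.2 k'.2.2.2.2.2.2.1, edgeSeg_mem.2 k'.2.2.2.2.2.2.2⟩
  · intro a b c d c' d' p q k k'
    have := h2 s(a, b) k.1 s(c, d) k.2.1 s(c', d') k'.2.1 k.crosses k'.crosses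
    simpa using this
  · intro a b c d b' c' d' p q k k'
    by_contra hne
    refine h3 s(a, b) k.1 s(a, b') k'.1 ⟨_, k.2.1, k.crosses⟩ ⟨_, k'.2.1, k'.crosses⟩ ?_ a (Sym2.mem_mk_left _ _) (Sym2.mem_mk_left _ _)
    intro e
    rw [Sym2.eq_iff] at e
    rcases e with e | e
    · exact hne e.2
    · exact k.1.ne e.2.symm

theorem same_ray {p a b c : Pt} (h1 : OnSeg p a b) (h2 : OnSeg p a c) : b = c ∨ OnSeg b a c ∨ OnSeg c a b := by
  obtain ⟨s, s0, s1, rfl⟩ := h1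
  obtain ⟨t, t0, t1, e⟩ := h2
  have e1 : s * (b.1 - a.1) = t * (c.1 - a.1) := by
    have := congrArg Prod.fst e; simp only [lerp] at this; linarith
  have e2 : s * (b.2 - a.2) = t * (c.2 - a.2) := by
    have := congrArg Prod.snd e; simp only [lerp] at this; linarith
  rcases lt_trichotomy s t with r | r | r
  · right; right
    refine ⟨s / t, by positivity, (div_lt_one t0).2 r, ?_⟩
    unfold lerp; apply Prod.ext <;> (simp only; field_simp; linarith)
  · left
    subst r
    apply Prod.ext
    · have := mul_left_cancel₀ s0.ne' e1; linarith
    · have := mul_left_cancel₀ s0.ne' e2; linarith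
  · right; left
    refine ⟨t / s, by positivity, (div_lt_one s0).2 r, ?_⟩
    unfold lerp; apply Prod.ext <;> (simp only; field_simp; linarith)

theorem Drw.share (h : Drw G ρ) {a b c : V} {p : Pt} (h1 : G.Adj a b) (h2 : G.Adj a c)
    (o1 : OnSeg p (ρ a) (ρ b)) (o2 : OnSeg p (ρ a) (ρ c)) : b = c := by
  rcases same_ray o1 o2 with r | r | r
  · exact h.inj r
  · exact (h.nov _ _ _ h2 r).elim
  · exact (h.nov _ _ _ h1 r).elim

theorem Drw.meet (h : Drw G ρ) {a b c d : V} {p : Pt} (h1 : G.Adj a b) (h2 : G.Adj c d)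
    (o1 : OnSeg p (ρ a) (ρ b)) (o2 : OnSeg p (ρ c) (ρ d)) : (a = c ∧ b = d) ∨ (a = d ∧ b = c) ∨ Crs G ρ a b c d p := by
  by_cases k1 : a = c
  · subst k1; exact Or.inl ⟨rfl, h.share h1 h2 o1 o2⟩
  by_cases k2 : a = d
  · subst k2; exact Or.inr (Or.inl ⟨rfl, h.share h1 h2.symm o1 o2.symm⟩)
  by_cases k3 : b = c
  · subst k3; exact Or.inr (Or.inl ⟨h.share h1.symm h2 o1.symm o2, rfl⟩)
  by_cases k4 : b = d
  · subst k4; exact Or.inl ⟨h.share h1.symm h2.symm o1.symm o2.symm, rfl⟩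
  exact Or.inr (Or.inr ⟨h1, h2, k1, k2, k3, k4, o1, o2⟩)

/-- two crossings at the same edge are at the same point -/
theorem Drw.upt' (h : Drw G ρ) {a b c d c' d' : V} {p q : Pt} (h1 : Crs G ρ a b c d p) (h2 : Crs G ρ a b c' d' q) : p = q := by
  rcases h.one _ _ _ _ _ _ _ _ h1 h2 with ⟨rfl, rfl⟩ | ⟨rfl, rfl⟩
  · exact h.upt _ _ _ _ _ _ h1 h2
  · exact h.upt _ _ _ _ _ _ h1 h2.symm.swap.symm

def IsX (G : SimpleGraph V) (ρ : V → ℝ × ℝ) (x : Pt) : Prop := ∃ a b c d, Crs G ρ a b c d x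

/-- a crossing point on a crossed edge is its crossing -/
theorem Drw.xu (h : Drw G ρ) {a b c d : V} {x y : Pt} (h1 : Crs G ρ a b c d x) (hy : IsX G ρ y)
    (ho : OnSeg y (ρ a) (ρ b)) : x = y := by
  obtain ⟨a', b', c', d', k⟩ := hy
  rcases h.meet h1.1 k.1 ho k.2.2.2.2.2.2.1 with ⟨rfl, rfl⟩ | ⟨rfl, rfl⟩ | r
  · exact h.upt' h1 k
  · exact h.upt' h1 k.swap
  · exact h.upt' h1 r

theorem Drw.finX [Finite V] (h : Drw G ρ) : {x | IsX G ρ x}.Finite := by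
  have : {x | IsX G ρ x} = ⋃ a : V, ⋃ b : V, ⋃ c : V, ⋃ d : V, {x | Crs G ρ a b c d x} := by
    ext x; simp [IsX]
  rw [this]
  refine Set.finite_iUnion fun a => Set.finite_iUnion fun b => Set.finite_iUnion fun c => Set.finite_iUnion fun d => ?_
  apply Set.Subsingleton.finite
  intro p hp q hq
  exact h.upt _ _ _ _ _ _ hp hq

variable [Fintype V]
def Kx (G : SimpleGraph V) (ρ : V → ℝ × ℝ) (x : Pt) : Finset Pt :=
  (Finset.univ.filter (fun v => ∃ w c d, Crs G ρ v w c d x)).image ρ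

theorem mem_Kx {x k : Pt} : k ∈ Kx G ρ x ↔ ∃ v w c d, Crs G ρ v w c d x ∧ k = ρ v := by
  unfold Kx
  simp only [Finset.mem_image, Finset.mem_filter, Finset.mem_univ, true_and]
  constructor
  · rintro ⟨v, ⟨w, c, d, r⟩, rfl⟩; exact ⟨v, w, c, d, r, rfl⟩
  · rintro ⟨v, w, c, d, r, rfl⟩; exact ⟨v, ⟨w, c, d, r⟩, rfl⟩

theorem Drw.Kx_eq (h : Drw G ρ) {a b c d : V} {x : Pt} (k : Crs G ρ a b c d x) : Kx G ρ x = {ρ a, ρ b, ρ c, ρ d} := by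
  ext z
  rw [mem_Kx]
  simp only [Finset.mem_insert, Finset.mem_singleton]
  constructor
  · rintro ⟨v, w, c', d', r, rfl⟩
    rcases h.meet k.1 r.1 k.2.2.2.2.2.2.1 r.2.2.2.2.2.2.1 with ⟨rfl, rfl⟩ | ⟨rfl, rfl⟩ | q
    · simp
    · simp
    · rcases h.one _ _ _ _ _ _ _ _ k q with ⟨rfl, rfl⟩ | ⟨rfl, rfl⟩ <;> simp
  · rintro (rfl | rfl | rfl | rfl)
    · exact ⟨_, _, _, _, k, rfl⟩
    · exact ⟨_, _, _, _, k.swap, rfl⟩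
    · exact ⟨_, _, _, _, k.symm, rfl⟩
    · exact ⟨_, _, _, _, k.symm.swap, rfl⟩

theorem Drw.not_vtx (h : Drw G ρ) {x : Pt} (hx : IsX G ρ x) (u : V) : x ≠ ρ u := by
  rintro rfl
  obtain ⟨a, b, c, d, k⟩ := hx
  exact h.nov _ _ _ k.1 k.2.2.2.2.2.2.1

theorem opp {x v w p : Pt} (hvw : v ≠ w) (hx : OnSeg x v w) (h1 : OnSeg p x v) (h2 : OnSeg p x w) : False := by
  obtain ⟨s, s0, s1, rfl⟩ := hx
  obtain ⟨t, t0, t1, rfl⟩ := h1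
  obtain ⟨r, r0, r1, e⟩ := h2
  have e1 : lerp (lerp v w s) v t = lerp v w (s + t * (0 - s)) := by
    have := lerp_lerp v w s 0 t; rwa [lerp_zero] at this
  have e2 : lerp (lerp v w s) w r = lerp v w (s + r * (1 - s)) := by
    have := lerp_lerp v w s 1 r; rwa [lerp_one] at this
  rw [e1, e2] at e
  have := lerp_eq_iff hvw e
  nlinarith [mul_pos t0 s0, mul_pos r0 (sub_pos.2 s1)]

/-- oriented plane pieces: uncrossed edges and spokes -/
def J0 (G : SimpleGraph V) (ρ : V → ℝ × ℝ) (u v : Pt) : Prop :=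
  (∃ a b, G.Adj a b ∧ (∀ c d p, ¬ Crs G ρ a b c d p) ∧ u = ρ a ∧ v = ρ b) ∨ (∃ a b c d, Crs G ρ a b c d u ∧ v = ρ a)

/-- supporting edge -/
theorem J0.sup {u v p : Pt} (h : J0 G ρ u v) (hp : OnSeg p u v) : ∃ a b, G.Adj a b ∧ OnSeg p (ρ a) (ρ b) ∧ 
    ((∀ c d p, ¬ Crs G ρ a b c d p) ∧ u = ρ a ∧ v = ρ b ∨ (∃ c d, Crs G ρ a b c d u) ∧ v = ρ a) := by
  rcases h with ⟨a, b, h1, h2, rfl, rfl⟩ | ⟨a, b, c, d, h1, rfl⟩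
  · exact ⟨a, b, h1, hp, Or.inl ⟨h2, rfl, rfl⟩⟩
  · exact ⟨a, b, h1.1, h1.2.2.2.2.2.2.1.trans' hp.symm, Or.inr ⟨⟨c, d, h1⟩, rfl⟩⟩

theorem Drw.J0ne (h : Drw G ρ) {u v : Pt} (k : J0 G ρ u v) : u ≠ v := by
  rcases k with ⟨a, b, h1, h2, rfl, rfl⟩ | ⟨a, b, c, d, h1, rfl⟩
  · exact fun e => h1.ne (h.inj e)
  · exact h.not_vtx ⟨_, _, _, _, h1⟩ a

theorem Drw.J0nov (h : Drw G ρ) {u v x : Pt} (k : J0 G ρ u v) (hx : IsX G ρ x ∨ ∃ a, x = ρ a) : ¬ OnSeg x u v := by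
  intro ho
  obtain ⟨a, b, h1, h2, h3⟩ := k.sup ho
  rcases hx with hx | ⟨w, rfl⟩
  · rcases h3 with ⟨h4, rfl, rfl⟩ | ⟨⟨c, d, h4⟩, rfl⟩
    · obtain ⟨a', b', c', d', k'⟩ := hx
      rcases h.meet h1 k'.1 ho k'.2.2.2.2.2.2.1 with ⟨rfl, rfl⟩ | ⟨rfl, rfl⟩ | r
      · exact h4 _ _ _ k'
      · exact h4 _ _ _ k'.swap
      · exact h4 _ _ _ r
    · exact (ho.ne (h.J0ne k)).1 (h.xu h4 hx h2).symm
  · exact h.nov _ _ _ h1 h2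

theorem Drw.J0npl (h : Drw G ρ) {u v u' v' p : Pt} (k : J0 G ρ u v) (k' : J0 G ρ u' v') (o : OnSeg p u v) (o' : OnSeg p u' v') :
    (u = u' ∧ v = v') ∨ (u = v' ∧ v = u') := by
  obtain ⟨a, b, h1, h2, h3⟩ := k.sup o
  obtain ⟨a', b', h1', h2', h3'⟩ := k'.sup o'
  have on := (o.ne (h.J0ne k)).1
  rcases h.meet h1 h1' h2 h2' with ⟨rfl, rfl⟩ | ⟨rfl, rfl⟩ | r
  · rcases h3 with ⟨h4, rfl, rfl⟩ | ⟨⟨c, d, h4⟩, rfl⟩ <;> rcases h3' with ⟨h4', rfl, rfl⟩ | ⟨⟨c', d', h4'⟩, rfl⟩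
    · simp
    · exact (h4 _ _ _ h4').elim
    · exact (h4' _ _ _ h4).elim
    · exact Or.inl ⟨h.upt' h4 h4', rfl⟩
  · rcases h3 with ⟨h4, rfl, rfl⟩ | ⟨⟨c, d, h4⟩, rfl⟩ <;> rcases h3' with ⟨h4', rfl, rfl⟩ | ⟨⟨c', d', h4'⟩, rfl⟩
    · simp
    · exact (h4 _ _ _ h4'.swap).elim
    · exact (h4' _ _ _ h4.swap).elim
    · exfalso
      have e := h.upt' h4 h4'.swap
      subst e
      exact opp (fun e => h1.ne (h.inj e)) h4.2.2.2.2.2.2.1 o o'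
  · exfalso
    rcases h3 with ⟨h4, rfl, rfl⟩ | ⟨⟨c, d, h4⟩, rfl⟩
    · exact h4 _ _ _ r
    · exact on (h.upt' h4 r).symm

theorem Drw.main (h : Drw G ρ) (hn : 3 ≤ Fintype.card V) : ∃ (X : Finset Pt) (K : Pt → Finset Pt) (S : Finset (Pt × Pt × Pt))
    (A B C : Pt) (P : Pt → Pt), RS S A B C P ∧ (∀ v, Sp S v ↔ ∃ a, v = ρ a) ∧
    (∀ x ∈ X, ∀ y ∈ X, ∀ k, k ∈ K x → k ∈ K y → x = y) ∧ (∀ x ∈ X, (K x).card = 4) ∧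
      (∀ a b, G.Adj a b → Ed S (ρ a) (ρ b) ∨ ∃ x ∈ X, ρ a ∈ K x ∧ ρ b ∈ K x) ∧ ∀ x ∈ X, Gd S P (K x) := by
  let X := h.finX.toFinset
  have mX : ∀ x, x ∈ X ↔ IsX G ρ x := by intro x; simp [X]
  let V' : Finset Pt := Finset.univ.image ρ
  have mV : ∀ v, v ∈ V' ↔ ∃ a, v = ρ a := by
    intro v; simp only [V', Finset.mem_image, Finset.mem_univ, true_and]
    exact ⟨fun ⟨a, e⟩ => ⟨a, e.symm⟩, fun ⟨a, e⟩ => ⟨a, e.symm⟩⟩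
  have mJ : ∀ u v, J0 G ρ u v → u ∈ V' ∪ X ∧ v ∈ V' ∪ X := by
    intro u v k
    simp only [Finset.mem_union, mX, mV]
    rcases k with ⟨a, b, h1, h2, rfl, rfl⟩ | ⟨a, b, c, d, h1, rfl⟩
    · exact ⟨Or.inl ⟨_, rfl⟩, Or.inl ⟨_, rfl⟩⟩
    · exact ⟨Or.inr ⟨_, _, _, _, h1⟩, Or.inl ⟨_, rfl⟩⟩
  have hJ : PL (V' ∪ X) (fun u v => J0 G ρ u v ∨ J0 G ρ v u) := by
    refine ⟨fun a b => Or.symm, ?_, ?_, ?_, ?_⟩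
    · intro a b r
      rcases r with r | r
      · exact (mJ _ _ r).1
      · exact (mJ _ _ r).2
    · intro a b r
      rcases r with r | r
      · exact h.J0ne r
      · exact (h.J0ne r).symm
    · intro a b x r hx ho
      simp only [Finset.mem_union, mX, mV] at hx
      rcases r with r | r
      · exact h.J0nov r hx.symm ho
      · exact h.J0nov r hx.symm ho.symm
    · intro a b c d p r r' o o'
      rcases r with r | r <;> rcases r' with r' | r'
      · exact h.J0npl r r' o o'
      · have := h.J0npl r r' o o'.symm; tauto
      · have := h.J0npl r r' o.symm o'; tauto
      · have := h.J0npl r r' o.symm o'.symm; tauto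
  have kd : ∀ x ∈ X, ∀ y ∈ X, ∀ k, k ∈ Kx G ρ x → k ∈ Kx G ρ y → x = y := by
    intro x hx y hy k k1 k2
    obtain ⟨v, w, c, d, r, rfl⟩ := mem_Kx.1 k1
    obtain ⟨v', w', c', d', r', e⟩ := mem_Kx.1 k2
    have e := h.inj e
    subst e
    have := h.mat _ _ _ _ _ _ _ _ _ r r'
    subst this
    exact h.upt' r r'
  have kc : ∀ x ∈ X, (Kx G ρ x).card = 4 := by
    intro x hx
    obtain ⟨a, b, c, d, k⟩ := (mX x).1 hx
    rw [h.Kx_eq k]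
    obtain ⟨h1, h2, h3, h4, h5, h6, -⟩ := k
    have i : ∀ {a b : V}, a ≠ b → ρ a ≠ ρ b := fun n e => n (h.inj e)
    rw [Finset.card_insert_of_notMem, Finset.card_insert_of_notMem, Finset.card_insert_of_notMem, Finset.card_singleton]
    · simp [i h2.ne]
    · simp [i h5, i h6]
    · simp [i h1.ne, i h3, i h4]
  have Dd : DAT X (Kx G ρ) (fun u v => ∃ a b, G.Adj a b ∧ u = ρ a ∧ v = ρ b) := by
    refine ⟨?_, kd, kc, ?_⟩
    · intro x hx k hk hkX
      obtain ⟨v, w, c, d, r, rfl⟩ := mem_Kx.1 hk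
      exact h.not_vtx ((mX _).1 hkX) v rfl
    · rintro u v ⟨a, b, r, rfl, rfl⟩
      exact ⟨fun e => h.not_vtx ((mX _).1 e) _ rfl, fun e => h.not_vtx ((mX _).1 e) _ rfl⟩
  have hV3 : 3 ≤ V'.card := by
    rw [Finset.card_image_of_injective _ h.inj]; simpa using hn
  obtain ⟨S, A, B, C, P, r1, r2, r3, r4⟩ := pointMain hJ Dd hV3
    (by
      intro x hx k hk
      obtain ⟨v, w, c, d, r, rfl⟩ := mem_Kx.1 hk
      exact (mV _).2 ⟨_, rfl⟩)
    (by rintro u v ⟨a, b, r, rfl, rfl⟩; exact ⟨(mV _).2 ⟨_, rfl⟩, (mV _).2 ⟨_, rfl⟩⟩)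
    (by
      intro x hx hv
      obtain ⟨a, e⟩ := (mV _).1 hv
      exact h.not_vtx ((mX _).1 hx) a e)
    (by
      intro x hx k hk
      obtain ⟨v, w, c, d, r, rfl⟩ := mem_Kx.1 hk
      exact Or.inl (Or.inr ⟨_, _, _, _, r, rfl⟩))
    (by
      rintro u v ⟨a, b, r, rfl, rfl⟩
      by_cases hc : ∃ c d p, Crs G ρ a b c d p
      · obtain ⟨c, d, p, k⟩ := hc
        exact Or.inr ⟨p, (mX _).2 ⟨_, _, _, _, k⟩, mem_Kx.2 ⟨_, _, _, _, k, rfl⟩, mem_Kx.2 ⟨_, _, _, _, k.swap, rfl⟩⟩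
      · push Not at hc
        exact Or.inl (Or.inl (Or.inl ⟨a, b, r, hc, rfl, rfl⟩)))
  exact ⟨X, Kx G ρ, S, A, B, C, P, r1, fun v => (r2 v).trans (mV v), kd, kc, fun a b k => r3 _ _ ⟨a, b, k, rfl, rfl⟩, r4⟩

end ICP

end

set_option linter.all false
noncomputable section
set_option maxHeartbeats 1000000
open Classical Filter Topology
namespace ICP

section quads
variable {W : Type} {S : Finset (W × W × W)} {A B C : W} {P R : W → ℝ × ℝ} {Q : W → W → W → W → Prop}

/-- positions of points of the second diagonal -/
theorem RS.dpos (h : RS S A B C R) (hq : QOK S R Q) (hc : ∀ a b c d, Q a b c d → 0 < ori (R a) (R b) (R d))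
    {a b c d : W} (q : Q a b c d) {p : Pt} (hp : OnSeg p (R b) (R d)) :
    inT p (R a) (R b) (R c) ∨ inT p (R a) (R c) (R d) ∨ OnSeg p (R a) (R c) := by
  have c1 := hc _ _ _ _ q
  have c2 := hc _ _ _ _ (hq.sym _ _ _ _ q)
  have t1 := (mem_innF.1 (hq.t1 _ _ _ _ q)).2
  have t2 := (mem_innF.1 (hq.t2 _ _ _ _ q)).2
  have p1 : 0 < ori (R a) (R b) p := hp.symm.pos c1 (by rw [ori_self2])
  have p2 : 0 < ori (R b) (R c) p := hp.symm.pos (by rw [← ori_rot'] at c2; exact c2) (by rw [ori_self1])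
  have p3 : 0 < ori (R c) (R d) p := hp.pos c2 (by rw [ori_self2])
  have p4 : 0 < ori (R d) (R a) p := hp.pos (by rw [← ori_rot'] at c1; exact c1) (by rw [ori_self1])
  rcases lt_trichotomy (ori (R a) (R c) p) 0 with z | z | z
  · left; exact ⟨p1, p2, by rw [ori_swap]; linarith⟩
  · right; right
    exact onSeg_of_zero t2 z p3 p4
  · right; left; exact ⟨z, p3, p4⟩

theorem RS.dE (h : RS S A B C R) (hq : QOK S R Q) (hc : ∀ a b c d, Q a b c d → 0 < ori (R a) (R b) (R d))
    {a b c d e f : W} (q : Q a b c d) {p : Pt} (hp : OnSeg p (R b) (R d)) (he : Ed S e f) (hp' : OnSeg p (R e) (R f)) :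
    (e = a ∧ f = c) ∨ (e = c ∧ f = a) := by
  rcases h.dpos hq hc q hp with r | r | r
  · exact (h.p2c (hq.t1 _ _ _ _ q) he r hp').elim
  · exact (h.p2c (hq.t2 _ _ _ _ q) he r hp').elim
  · exact h.p2b he ⟨_, (mem_innF.1 (hq.t2 _ _ _ _ q)).1⟩ hp' r

theorem RS.dV (h : RS S A B C R) (hq : QOK S R Q) (hc : ∀ a b c d, Q a b c d → 0 < ori (R a) (R b) (R d))
    {a b c d v : W} (q : Q a b c d) (hv : Sp S v) (hp : OnSeg (R v) (R b) (R d)) : False := by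
  have aux : ∀ a b c, (a, b, c) ∈ innF S R → inT (R v) (R a) (R b) (R c) → False := by
    intro a b c m i
    obtain ⟨i1, i2, i3⟩ := i
    rcases h.p2a hv m ⟨i1.le, i2.le, i3.le⟩ with rfl | rfl | rfl
    · rw [ori_self1] at i1; exact lt_irrefl _ i1
    · rw [ori_self2] at i1; exact lt_irrefl _ i1
    · rw [ori_self2] at i2; exact lt_irrefl _ i2
  rcases h.dpos hq hc q hp with r | r | r
  · exact aux _ _ _ (hq.t1 _ _ _ _ q) r
  · exact aux _ _ _ (hq.t2 _ _ _ _ q) r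
  · exact h.no_vertex hv ⟨_, (mem_innF.1 (hq.t2 _ _ _ _ q)).1⟩ r

theorem Rot3.mem {a b c a' b' c' : W} (h : Rot3 a b c a' b' c') : a' = a ∨ a' = b ∨ a' = c := by
  rcases h with h | h | h <;> simp only [Prod.mk.injEq] at h <;> tauto

theorem RS.dD (h : RS S A B C R) (hq : QOK S R Q) (hc : ∀ a b c d, Q a b c d → 0 < ori (R a) (R b) (R d))
    {a b c d a' b' c' d' : W} (q : Q a b c d) (q' : Q a' b' c' d') {p : Pt} (hp : OnSeg p (R b) (R d))
    (hp' : OnSeg p (R b') (R d')) :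
    (b' = b ∧ d' = d) ∨ (b' = d ∧ d' = b) := by
  have key : a' = a ∨ a' = b ∨ a' = c ∨ a' = d := by
    rcases h.dpos hq hc q' hp' with r' | r' | r'
    · rcases h.dpos hq hc q hp with r | r | r
      · have := (h.uniqT (hq.t1 _ _ _ _ q) (hq.t1 _ _ _ _ q') r r').mem; tauto
      · have := (h.uniqT (hq.t2 _ _ _ _ q) (hq.t1 _ _ _ _ q') r r').mem; tauto
      · have := h.dE hq hc q' hp' ⟨_, (mem_innF.1 (hq.t2 _ _ _ _ q)).1⟩ r
        rcases this with ⟨rfl, rfl⟩ | ⟨rfl, rfl⟩ <;> simp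
    · rcases h.dpos hq hc q hp with r | r | r
      · have := (h.uniqT (hq.t1 _ _ _ _ q) (hq.t2 _ _ _ _ q') r r').mem; tauto
      · have := (h.uniqT (hq.t2 _ _ _ _ q) (hq.t2 _ _ _ _ q') r r').mem; tauto
      · have := h.dE hq hc q' hp' ⟨_, (mem_innF.1 (hq.t2 _ _ _ _ q)).1⟩ r
        rcases this with ⟨rfl, rfl⟩ | ⟨rfl, rfl⟩ <;> simp
    · have := h.dE hq hc q hp ⟨_, (mem_innF.1 (hq.t2 _ _ _ _ q')).1⟩ r'
      rcases this with ⟨rfl, rfl⟩ | ⟨rfl, rfl⟩ <;> simp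
  rcases hq.dis _ _ _ _ _ _ _ _ a' q q' key (Or.inl rfl) with ⟨-, e1, -, e2⟩ | ⟨-, e1, -, e2⟩
  · exact Or.inl ⟨e1, e2⟩
  · exact Or.inr ⟨e1, e2⟩

theorem conv_ori (x y : Pt) : Convex ℝ {p : Pt | 0 ≤ ori x y p} := by
  intro p hp q hq s t hs ht hst
  simp only [Set.mem_setOf_eq] at hp hq ⊢
  have : ori x y (s • p + t • q) = s * ori x y p + t * ori x y q := by
    have e : t = 1 - s := by linarith
    subst e
    unfold ori; simp; ring
  rw [this]; positivity

theorem RS.dHull (h : RS S A B C R) (hq : QOK S R Q) (hc : ∀ a b c d, Q a b c d → 0 < ori (R a) (R b) (R d))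
    {a b c d v : W} (q : Q a b c d) (hv : Sp S v) (hp : R v ∈ convexHull ℝ ({R a, R b, R c, R d} : Set Pt)) :
    v = a ∨ v = b ∨ v = c ∨ v = d := by
  have c1 := hc _ _ _ _ q
  have c2 := hc _ _ _ _ (hq.sym _ _ _ _ q)
  have t1 := (mem_innF.1 (hq.t1 _ _ _ _ q)).2
  have t2 := (mem_innF.1 (hq.t2 _ _ _ _ q)).2
  have hs : ∀ x y, 0 ≤ ori x y (R a) → 0 ≤ ori x y (R b) → 0 ≤ ori x y (R c) → 0 ≤ ori x y (R d) → 0 ≤ ori x y (R v) := by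
    intro x y h1 h2 h3 h4
    refine convexHull_min (t := {p : Pt | 0 ≤ ori x y p}) ?_ (conv_ori x y) hp
    rintro z (rfl | rfl | rfl | rfl) <;> assumption
  have z1 := ori_rot (R a) (R b) (R c)
  have z1' := ori_rot' (R a) (R b) (R c)
  have z2 := ori_rot (R a) (R c) (R d)
  have z2' := ori_rot' (R a) (R c) (R d)
  have z3 := ori_rot (R a) (R b) (R d)
  have z3' := ori_rot' (R a) (R b) (R d)
  have z4 := ori_rot (R c) (R d) (R b)
  have z4' := ori_rot' (R c) (R d) (R b)
  have s1 := hs (R a) (R b) (by rw [ori_self1]) (by rw [ori_self2]) t1.le c1.le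
  have s2 := hs (R b) (R c) (by linarith) (by rw [ori_self1]) (by rw [ori_self2]) (by linarith)
  have s3 := hs (R c) (R d) (by linarith) (by linarith) (by rw [ori_self1]) (by rw [ori_self2])
  have s4 := hs (R d) (R a) (by rw [ori_self2]) (by linarith) (by linarith) (by rw [ori_self1])
  rcases le_total 0 (ori (R a) (R c) (R v)) with z | z
  · have := h.p2a hv (hq.t2 _ _ _ _ q) ⟨z, s3, s4⟩; tauto
  · have := h.p2a hv (hq.t1 _ _ _ _ q) ⟨s1, s2, by rw [ori_swap]; linarith⟩; tauto

theorem clT_hull {p a b c : Pt} (D : 0 < ori a b c) (h : clT p a b c) : p ∈ convexHull ℝ ({a, b, c} : Set Pt) := by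
  obtain ⟨h1, h2, h3⟩ := h
  have hadd := ori_add a b c p
  have e : p = (ori b c p / ori a b c) • a + (ori c a p / ori a b c) • b + (ori a b p / ori a b c) • c := by
    apply Prod.ext
    · have := ori_bary a b c p Prod.fst (Or.inl rfl)
      simp only [Prod.fst_add, Prod.smul_fst, smul_eq_mul]
      field_simp
      linear_combination -this - p.1 * hadd
    · have := ori_bary a b c p Prod.snd (Or.inr rfl)
      simp only [Prod.snd_add, Prod.smul_snd, smul_eq_mul]
      field_simp
      linear_combination -this - p.2 * hadd
  have hcx := convex_convexHull ℝ ({a, b, c} : Set Pt)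
  have ma : a ∈ convexHull ℝ ({a, b, c} : Set Pt) := subset_convexHull ℝ _ (by simp)
  have mb : b ∈ convexHull ℝ ({a, b, c} : Set Pt) := subset_convexHull ℝ _ (by simp)
  have mc : c ∈ convexHull ℝ ({a, b, c} : Set Pt) := subset_convexHull ℝ _ (by simp)
  have := hcx.sum_mem (t := Finset.univ) (w := ![ori b c p / ori a b c, ori c a p / ori a b c, ori a b p / ori a b c]) (z := ![a, b, c])
    (by
      intro i _
      fin_cases i <;> simp <;> positivity)
    (by
      simp [Fin.sum_univ_three]
      field_simp; linarith)
    (by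
      intro i _
      fin_cases i <;> simp [ma, mb, mc])
  rw [e]
  simpa [Fin.sum_univ_three] using this
end quads

end ICP

end

set_option linter.all false
noncomputable section
set_option maxHeartbeats 1000000
open Classical Filter Topology
namespace ICP

universe u
variable {V : Type u} {G : SimpleGraph V} {ρ : V → ℝ × ℝ}

/-- the final configuration -/
structure FIN [Fintype V] (G : SimpleGraph V) (r : V → ℝ × ℝ) (E : V → V → Prop) (Q : V → V → V → V → Prop) : Prop where
  inj : Function.Injective r
  es : ∀ x y, E x y → E y x
  ei : ∀ x, ¬ E x x
  qs : ∀ a b c d, Q a b c d → Q c d a b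
  qe : ∀ a b c d, Q a b c d → E a b ∧ E b c ∧ E c d ∧ E d a ∧ E a c ∧ ¬ E b d ∧ b ≠ d
  dis : ∀ a b c d a' b' c' d' x, Q a b c d → Q a' b' c' d' → (x = a ∨ x = b ∨ x = c ∨ x = d) →
    (x = a' ∨ x = b' ∨ x = c' ∨ x = d') → (a' = a ∧ b' = b ∧ c' = c ∧ d' = d) ∨
      (a' = c ∧ b' = d ∧ c' = a ∧ d' = b)
  ee : ∀ a b c d p, E a b → E c d → OnSeg p (r a) (r b) → OnSeg p (r c) (r d) → (a = c ∧ b = d) ∨ (a = d ∧ b = c)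
  de : ∀ a b c d e f p, Q a b c d → E e f → OnSeg p (r b) (r d) → OnSeg p (r e) (r f) → (e = a ∧ f = c) ∨ (e = c ∧ f = a)
  dd : ∀ a b c d a' b' c' d' p, Q a b c d → Q a' b' c' d' → OnSeg p (r b) (r d) → OnSeg p (r b') (r d') →
    (b' = b ∧ d' = d) ∨ (b' = d ∧ d' = b)
  ve : ∀ a b v, E a b → ¬ OnSeg (r v) (r a) (r b)
  vd : ∀ a b c d v, Q a b c d → ¬ OnSeg (r v) (r b) (r d)
  dx : ∀ a b c d, Q a b c d → ∃ p, OnSeg p (r a) (r c) ∧ OnSeg p (r b) (r d)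
  np : ∀ a b c d, Q a b c d → 0 < ori (r a) (r c) (r d)
  emp : ∀ a b c d v, Q a b c d → r v ∈ convexHull ℝ ({r a, r b, r c, r d} : Set (ℝ × ℝ)) → v = a ∨ v = b ∨ v = c ∨ v = d
  count : (Finset.univ.filter (fun p : V × V => E p.1 p.2)).card + 12 = 6 * Fintype.card V
  out : ∃ x y z, (E x y ∧ E y z ∧ E z x) ∧ (∀ u v, ¬ Q x u y v ∧ ¬ Q y u z v ∧ ¬ Q z u x v) ∧
    ∀ v, r v ∈ convexHull ℝ ({r x, r y, r z} : Set (ℝ × ℝ))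
  gle : ∀ a b, G.Adj a b → E a b ∨ ∃ c d, Q c a d b

section
variable {W : Type} {S : Finset (W × W × W)} {A B C : W} {P R : W → ℝ × ℝ} {Q : W → W → W → W → Prop}

theorem RS.outQ (h : RS S A B C R) (hq : QOK S R Q) {u v : W} (q : Q A u B v) : False := by
  have t := mem_innF.1 (hq.t1 _ _ _ _ q)
  have e := h.uniq _ _ _ _ (h.rot _ _ _ (h.rot _ _ _ t.1)) (h.rot _ _ _ h.out)
  subst e
  have := h.pos
  have e : ori (R A) (R u) (R B) = - ori (R A) (R B) (R u) := by unfold ori; ring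
  linarith [t.2]

set_option maxHeartbeats 800000 in
theorem gd_quads (h : RS S A B C P) {X : Finset W} {K : W → Finset W}
    (hK : ∀ x ∈ X, ∀ y ∈ X, ∀ k, k ∈ K x → k ∈ K y → x = y) (h4 : ∀ x ∈ X, (K x).card = 4)
    (hg : ∀ x ∈ X, Gd S P (K x)) : ∃ Q, QOK S P Q ∧
      ∀ x ∈ X, ∀ a ∈ K x, ∀ b ∈ K x, a ≠ b → Ed S a b ∨ ∃ c d, Q c a d b := by
  choose p1 p2 p3 p4 hk e12 e23 e34 e41 e13 hd using hg
  refine ⟨fun a b c d => ∃ x, ∃ hx : x ∈ X, ((a = p1 x hx ∧ b = p2 x hx ∧ c = p3 x hx ∧ d = p4 x hx) ∨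
    (a = p3 x hx ∧ b = p4 x hx ∧ c = p1 x hx ∧ d = p2 x hx)) ∧ ¬ Ed S (p2 x hx) (p4 x hx), ⟨?_, ?_, ?_, ?_, ?_⟩, ?_⟩
  · rintro a b c d ⟨x, hx, q, n⟩
    exact ⟨x, hx, q.elim (fun k => Or.inr ⟨k.2.2.1, k.2.2.2, k.1, k.2.1⟩) (fun k => Or.inl ⟨k.2.2.1, k.2.2.2, k.1, k.2.1⟩), n⟩
  · rintro a b c d ⟨x, hx, q, n⟩
    have := (hd x hx).resolve_left n
    rcases q with ⟨rfl, rfl, rfl, rfl⟩ | ⟨rfl, rfl, rfl, rfl⟩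
    · exact this.1
    · exact rot_innF h this.2
  · rintro a b c d ⟨x, hx, q, n⟩
    have := (hd x hx).resolve_left n
    rcases q with ⟨rfl, rfl, rfl, rfl⟩ | ⟨rfl, rfl, rfl, rfl⟩
    · exact this.2
    · exact rot_innF h (rot_innF h this.1)
  · rintro a b c d ⟨x, hx, q, n⟩
    rcases q with ⟨rfl, rfl, rfl, rfl⟩ | ⟨rfl, rfl, rfl, rfl⟩
    · exact n
    · exact fun k => n (h.ed_symm k)
  · rintro a b c d a' b' c' d' z ⟨x, hx, q, n⟩ ⟨y, hy, q', n'⟩ hz hz'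
    have z1 : z ∈ K x := by
      rw [hk x hx]; simp only [Finset.mem_insert, Finset.mem_singleton]
      rcases q with ⟨rfl, rfl, rfl, rfl⟩ | ⟨rfl, rfl, rfl, rfl⟩
      · exact hz
      · rcases hz with k | k | k | k
        exacts [Or.inr (Or.inr (Or.inl k)), Or.inr (Or.inr (Or.inr k)), Or.inl k, Or.inr (Or.inl k)]
    have z2 : z ∈ K y := by
      rw [hk y hy]; simp only [Finset.mem_insert, Finset.mem_singleton]
      rcases q' with ⟨rfl, rfl, rfl, rfl⟩ | ⟨rfl, rfl, rfl, rfl⟩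
      · exact hz'
      · rcases hz' with k | k | k | k
        exacts [Or.inr (Or.inr (Or.inl k)), Or.inr (Or.inr (Or.inr k)), Or.inl k, Or.inr (Or.inl k)]
    have := hK x hx y hy z z1 z2
    subst this
    rcases q with ⟨rfl, rfl, rfl, rfl⟩ | ⟨rfl, rfl, rfl, rfl⟩ <;> rcases q' with ⟨rfl, rfl, rfl, rfl⟩ | ⟨rfl, rfl, rfl, rfl⟩ <;> first | exact Or.inl ⟨rfl, rfl, rfl, rfl⟩ | exact Or.inr ⟨rfl, rfl, rfl, rfl⟩
  · intro x hx a ha b hb hab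
    rw [hk x hx] at ha hb
    simp only [Finset.mem_insert, Finset.mem_singleton] at ha hb
    have f12 := e12 x hx
    have f23 := e23 x hx
    have f34 := e34 x hx
    have f41 := e41 x hx
    have f13 := e13 x hx
    by_cases n : Ed S (p2 x hx) (p4 x hx)
    · left
      rcases ha with rfl | rfl | rfl | rfl <;> rcases hb with rfl | rfl | rfl | rfl <;>
        first | exact absurd rfl hab | assumption | (apply h.ed_symm; assumption)
    · rcases ha with rfl | rfl | rfl | rfl <;> rcases hb with rfl | rfl | rfl | rfl <;>
        first
        | exact absurd rfl hab
        | (left; assumption)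
        | (left; apply h.ed_symm; assumption)
        | exact Or.inr ⟨_, _, x, hx, Or.inl ⟨rfl, rfl, rfl, rfl⟩, n⟩
        | exact Or.inr ⟨_, _, x, hx, Or.inr ⟨rfl, rfl, rfl, rfl⟩, n⟩
end

theorem Drw.fin [Fintype V] (h : Drw G ρ) (hn : 3 ≤ Fintype.card V) : ∃ r E Q, FIN G r E Q := by
  obtain ⟨X, K, S, A, B, C, P, hP, hs, hK, h4, hG, hg⟩ := h.main hn
  obtain ⟨Q, hq0, hQ⟩ := gd_quads hP hK h4 hg
  obtain ⟨R, hR, hc⟩ := hP.convexify hq0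
  have hq := hq0.of_innF (hP.innF_eq hR)
  have sp : ∀ a, Sp S (ρ a) := fun a => (hs _).2 ⟨a, rfl⟩
  have inj := h.inj
  refine ⟨fun v => R (ρ v), fun x y => Ed S (ρ x) (ρ y), fun a b c d => Q (ρ a) (ρ b) (ρ c) (ρ d), ?_⟩
  constructor
  · intro a b e; exact inj (hR.inj (sp _) (sp _) e)
  · exact fun x y e => hR.ed_symm e
  · exact fun x e => hR.ed_ne e rfl
  · exact fun a b c d q => hq.sym _ _ _ _ q
  · intro a b c d q
    obtain ⟨⟨s1, _⟩, ⟨s2, _⟩, ⟨s3, _⟩, ⟨s4, _⟩⟩ := hq.es hR.toCS q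
    refine ⟨s1, s2, s3, s4, ⟨_, innS (hq.t2 _ _ _ _ q)⟩, hq.nd _ _ _ _ q, ?_⟩
    intro e; exact (hq.ne q).2.2.2.2.2 (by rw [e])
  · intro a b c d a' b' c' d' x q q' hx hx'
    have := hq.dis _ _ _ _ _ _ _ _ (ρ x) q q' (by rcases hx with rfl | rfl | rfl | rfl <;> tauto) (by rcases hx' with rfl | rfl | rfl | rfl <;> tauto)
    simpa only [inj.eq_iff] using this
  · intro a b c d p e f h1 h2
    have := hR.p2b e f h1 h2
    simpa only [inj.eq_iff] using this
  · intro a b c d e f p q he h1 h2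
    have := hR.dE hq hc q h1 he h2
    simpa only [inj.eq_iff] using this
  · intro a b c d a' b' c' d' p q q' h1 h2
    have := hR.dD hq hc q q' h1 h2
    simpa only [inj.eq_iff] using this
  · intro a b v e o; exact hR.no_vertex (sp _) e o
  · intro a b c d v q o; exact hR.dV hq hc q (sp _) o
  · intro a b c d q
    have c1 := hc _ _ _ _ q
    have c2 := hc _ _ _ _ (hq.sym _ _ _ _ q)
    have t1 := (mem_innF.1 (hq.t1 _ _ _ _ q)).2
    have t2 := (mem_innF.1 (hq.t2 _ _ _ _ q)).2
    obtain ⟨p, o1, o2⟩ := seg_cross (a := R (ρ a)) (b := R (ρ c)) (c := R (ρ d)) (d := R (ρ b)) t2 (by rw [ori_swap']; linarith)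
      (by rw [ori_rot'] at c2; unfold ori at *; linarith) (by unfold ori at *; linarith)
    exact ⟨p, o1, o2.symm⟩
  · intro a b c d q; exact (mem_innF.1 (hq.t2 _ _ _ _ q)).2
  · intro a b c d v q hv
    have := hR.dHull hq hc q (sp _) hv
    simpa only [inj.eq_iff] using this
  · have hT : (Finset.univ.image ρ).card = Fintype.card V := by
      rw [Finset.card_image_of_injective _ inj]; rfl
    have := hR.count (T := Finset.univ.image ρ) (by rw [hT]; exact hn) (by intro v; rw [hs]; simp [eq_comm])
    rw [hT] at this
    rw [← this]
    congr 1
    apply Finset.card_bij (fun p _ => (ρ p.1, ρ p.2))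
    · rintro ⟨a, b⟩ hm
      simp only [Finset.mem_filter, Finset.mem_univ, true_and] at hm
      exact mem_edS.2 hm
    · rintro ⟨a, b⟩ _ ⟨a', b'⟩ _ e
      simp only [Prod.mk.injEq, inj.eq_iff] at e ⊢
      exact e
    · rintro ⟨a, b⟩ hm
      rw [mem_edS] at hm
      obtain ⟨a', rfl⟩ := (hs _).1 (hR.sp_l hm)
      obtain ⟨b', rfl⟩ := (hs _).1 (hR.sp_r hm)
      exact ⟨(a', b'), by simpa using hm, rfl⟩
  · have o1 := hR.out
    have o2 := hR.rot _ _ _ o1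
    have o3 := hR.rot _ _ _ o2
    obtain ⟨x, rfl⟩ := (hs A).1 ⟨_, _, o3⟩
    obtain ⟨y, rfl⟩ := (hs B).1 ⟨_, _, o2⟩
    obtain ⟨z, rfl⟩ := (hs C).1 ⟨_, _, o1⟩
    refine ⟨x, y, z, ⟨hR.ed_symm ⟨_, o2⟩, hR.ed_symm ⟨_, o1⟩, hR.ed_symm ⟨_, o3⟩⟩, ?_, ?_⟩
    · intro u v
      exact ⟨hR.outQ hq, hR.rotO.outQ hq, hR.rotO.rotO.outQ hq⟩
    · intro v; exact clT_hull hR.pos (hR.hull (sp v))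
  · intro a b hab
    rcases hG a b hab with e | ⟨x, hx, m1, m2⟩
    · exact Or.inl e
    · rcases hQ x hx _ m1 _ m2 (fun e => hab.ne (inj e)) with e | ⟨c, d, q⟩
      · exact Or.inl e
      · have t := innS (hq.t2 _ _ _ _ q)
        have t' := innS (hq.t1 _ _ _ _ q)
        obtain ⟨c', rfl⟩ := (hs _).1 ⟨_, _, t⟩
        obtain ⟨d', rfl⟩ := (hs _).1 ⟨_, _, hR.rot _ _ _ t⟩
        exact Or.inr ⟨c', d', q⟩

end ICP

end

set_option linter.all false
noncomputable section
set_option maxHeartbeats 1000000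
open Classical Filter Topology
namespace ICP

universe u
variable {V : Type u} [Fintype V] {G : SimpleGraph V} {r : V → ℝ × ℝ} {E : V → V → Prop} {Q : V → V → V → V → Prop}

/-- crossing pattern -/
def Cr (Q : V → V → V → V → Prop) (x y z w : V) : Prop := Q z x w y ∨ Q w x z y ∨ Q x z y w ∨ Q y z x w

theorem FIN.ne (h : FIN G r E Q) {a b c d : V} (q : Q a b c d) : a ≠ b ∧ a ≠ c ∧ a ≠ d ∧ b ≠ c ∧ b ≠ d ∧ c ≠ d := by
  obtain ⟨e1, e2, e3, e4, e5, e6, e7⟩ := h.qe _ _ _ _ q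
  have := h.ei
  refine ⟨?_, ?_, ?_, ?_, e7, ?_⟩ <;> rintro rfl <;> first | exact this _ e1 | exact this _ e2 | exact this _ e3 | exact this _ e4 | exact this _ e5

theorem FIN.cr_symm (h : FIN G r E Q) {x y z w : V} (c : Cr Q x y z w) : Cr Q z w x y := by
  rcases c with c | c | c | c
  · exact Or.inr (Or.inr (Or.inl c))
  · exact Or.inr (Or.inr (Or.inr c))
  · exact Or.inl c
  · exact Or.inr (Or.inl c)

theorem FIN.cr_swap (h : FIN G r E Q) {x y z w : V} (c : Cr Q x y z w) : Cr Q y x z w := by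
  have := h.qs
  unfold Cr at *
  grind

/-- the augmented graph -/
def Gpl (h : FIN G r E Q) : SimpleGraph V where
  Adj x y := E x y ∨ ∃ a c, Q a x c y
  symm := ⟨by
    rintro x y (e | ⟨a, c, q⟩)
    · exact Or.inl (h.es _ _ e)
    · exact Or.inr ⟨c, a, h.qs _ _ _ _ q⟩⟩
  loopless := ⟨by
    rintro x (e | ⟨a, c, q⟩)
    · exact h.ei _ e
    · exact (h.ne q).2.2.2.2.1 rfl⟩

theorem FIN.cr_of (h : FIN G r E Q) {x y z w : V} (h1 : (Gpl h).Adj x y) (h2 : (Gpl h).Adj z w)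
    (hc : Crosses r s(x, y) s(z, w)) : Cr Q x y z w := by
  obtain ⟨⟨n1, n2, n3, n4⟩, p, o1, o2⟩ := crosses_iff.1 hc
  rcases h1 with e | ⟨a, c, q⟩ <;> rcases h2 with e' | ⟨a', c', q'⟩
  · have := h.ee _ _ _ _ _ e e' o1 o2; tauto
  · rcases h.de _ _ _ _ _ _ _ q' e o2 o1 with ⟨rfl, rfl⟩ | ⟨rfl, rfl⟩
    · exact Or.inr (Or.inr (Or.inl q'))
    · exact Or.inr (Or.inr (Or.inr q'))
  · rcases h.de _ _ _ _ _ _ _ q e' o1 o2 with ⟨rfl, rfl⟩ | ⟨rfl, rfl⟩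
    · exact Or.inl q
    · exact Or.inr (Or.inl q)
  · have := h.dd _ _ _ _ _ _ _ _ _ q q' o1 o2
    rcases this with ⟨rfl, rfl⟩ | ⟨rfl, rfl⟩ <;> tauto

theorem FIN.crosses_q (h : FIN G r E Q) {a b c d : V} (q : Q a b c d) : Crosses r s(a, c) s(b, d) := by
  have := h.ne q
  exact crosses_iff.2 ⟨by grind, h.dx _ _ _ _ q⟩

theorem FIN.cr_uniq (h : FIN G r E Q) {x y z w z' w' : V} (c : Cr Q x y z w) (c' : Cr Q x y z' w') :
    (z = z' ∧ w = w') ∨ (z = w' ∧ w = z') := by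
  rcases c with c | c | c | c <;> rcases c' with c' | c' | c' | c' <;>
    (have n := h.ne c; have n' := h.ne c'; have d := h.dis _ _ _ _ _ _ _ _ x c c' (by simp) (by simp); clear h c c'; grind)

theorem FIN.cr_mat (h : FIN G r E Q) {x y z w y' z' w' : V} (c : Cr Q x y z w) (c' : Cr Q x y' z' w') :
    y = y' := by
  rcases c with c | c | c | c <;> rcases c' with c' | c' | c' | c' <;>
    (have n := h.ne c; have n' := h.ne c'; have d := h.dis _ _ _ _ _ _ _ _ x c c' (by simp) (by simp); clear h c c'; grind)

theorem FIN.cr_side (h : FIN G r E Q) {x y z w : V} (c : Cr Q x y z w) {u v : V} (c' : Cr Q x z u v) : False := by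
  have n : y ≠ z := by
    rcases c with c | c | c | c <;> have n := h.ne c <;> grind
  exact n (h.cr_mat c c')

theorem FIN.cr_adj (h : FIN G r E Q) {x y z w : V} (c : Cr Q x y z w) :
    E x z ∧ E z y ∧ E y w ∧ E w x ∧ (Gpl h).Adj x y ∧ (Gpl h).Adj z w := by
  have es := h.es
  have qs := h.qs
  have : (E x z ∧ E z y ∧ E y w ∧ E w x) ∧ ((E x y ∧ ∃ a c, Q a z c w) ∨ (E z w ∧ ∃ a c, Q a x c y)) := by
    rcases c with c | c | c | c <;> obtain ⟨e1, e2, e3, e4, e5, e6, e7⟩ := h.qe _ _ _ _ c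
    · exact ⟨⟨es _ _ e1, es _ _ e4, es _ _ e3, es _ _ e2⟩, Or.inr ⟨e5, _, _, c⟩⟩
    · exact ⟨⟨e2, e3, e4, e1⟩, Or.inr ⟨es _ _ e5, _, _, c⟩⟩
    · exact ⟨⟨e1, e2, e3, e4⟩, Or.inl ⟨e5, _, _, c⟩⟩
    · exact ⟨⟨es _ _ e2, es _ _ e1, es _ _ e4, es _ _ e3⟩, Or.inl ⟨es _ _ e5, _, _, c⟩⟩
  obtain ⟨⟨e1, e2, e3, e4⟩, k | k⟩ := this
  · exact ⟨e1, e2, e3, e4, Or.inl k.1, Or.inr k.2⟩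
  · exact ⟨e1, e2, e3, e4, Or.inr k.2, Or.inl k.1⟩

theorem OnSeg.zero {p a c : ℝ × ℝ} (h : OnSeg p a c) : ori a c p = 0 := by
  obtain ⟨s, _, _, rfl⟩ := h
  unfold ori lerp; ring

theorem FIN.one_pt (h : FIN G r E Q) {a b c d : V} (k : Q a b c d) {p q : ℝ × ℝ} (p1 : OnSeg p (r a) (r c))
    (q1 : OnSeg q (r a) (r c)) (p2 : OnSeg p (r b) (r d)) (q2 : OnSeg q (r b) (r d)) : p = q := by
  have n := h.np _ _ _ _ k
  have z1 := p1.zero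
  have z2 := q1.zero
  obtain ⟨s, s0, s1, rfl⟩ := p2
  obtain ⟨t, t0, t1, rfl⟩ := q2
  rw [ori_lerp] at z1 z2
  have e : (s - t) * ori (r a) (r c) (r d) = 0 := by linear_combination (1 - t) * z1 - (1 - s) * z2
  rcases mul_eq_zero.1 e with e | e
  · rw [sub_eq_zero.1 e]
  · exact absurd e n.ne'

theorem FIN.ic (h : FIN G r E Q) : IsICPlanarDrawing (Gpl h) r := by
  refine ⟨⟨h.inj, ?_, ?_⟩, ?_, ?_⟩
  · intro e
    induction e using Sym2.ind with | _ a b =>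
    rintro (e | ⟨x, y, q⟩) v hv hm
    · exact h.ve _ _ v e (edgeSeg_mem.1 hm)
    · exact h.vd _ _ _ _ v q (edgeSeg_mem.1 hm)
  · intro e he f hf hd p ⟨p1, p2⟩ q ⟨q1, q2⟩
    induction e using Sym2.ind with | _ a b =>
    induction f using Sym2.ind with | _ c d =>
    have c1 : Crosses r s(a, b) s(c, d) := ⟨hd, p, p1, p2⟩
    have k : Cr Q a b c d := h.cr_of he hf c1
    rw [edgeSeg_mem] at p1 p2 q1 q2
    rcases k with k | k | k | k
    · exact h.one_pt k p2 q2 p1 q1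
    · exact h.one_pt k p2.symm q2.symm p1 q1
    · exact h.one_pt k p1 q1 p2 q2
    · exact h.one_pt k p1.symm q1.symm p2 q2
  · intro e he f hf g hg c1 c2
    induction e using Sym2.ind with | _ a b =>
    induction f using Sym2.ind with | _ c d =>
    induction g using Sym2.ind with | _ c' d' =>
    rw [Sym2.eq_iff]
    exact h.cr_uniq (h.cr_of he hf c1) (h.cr_of he hg c2)
  · intro e he f hf ⟨e', he', c1⟩ ⟨f', hf', c2⟩ hne v h1 h2
    obtain ⟨b, rfl⟩ := Sym2.mem_iff_exists.1 h1
    obtain ⟨d, rfl⟩ := Sym2.mem_iff_exists.1 h2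
    induction e' using Sym2.ind with | _ x y =>
    induction f' using Sym2.ind with | _ z w =>
    have k : b = d := h.cr_mat (h.cr_of he he' c1) (h.cr_of hf hf' c2)
    exact hne (by rw [k])

theorem FIN.cr_emp (h : FIN G r E Q) {a b c d v : V} (k : Cr Q a d b c)
    (hv : r v ∈ convexHull ℝ ({r a, r b, r c, r d} : Set (ℝ × ℝ))) : v = a ∨ v = b ∨ v = c ∨ v = d := by
  rcases k with k | k | k | k <;> have := h.emp _ _ _ _ v k (by convert hv using 2; ext; simp; tauto) <;> tauto

theorem FIN.c12 (h : FIN G r E Q) (a d b c : V) (h1 : s(a, d) ∈ (Gpl h).edgeSet) (h2 : s(b, c) ∈ (Gpl h).edgeSet)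
    (hc : Crosses r s(a, d) s(b, c)) :
        ((Gpl h).Adj a b ∧ (Gpl h).Adj b d ∧ (Gpl h).Adj d c ∧ (Gpl h).Adj c a ∧ (Gpl h).Adj a d ∧ (Gpl h).Adj b c) ∧
        (∀ f ∈ (Gpl h).edgeSet, ¬ Crosses r s(a, b) f ∧ ¬ Crosses r s(b, d) f ∧
          ¬ Crosses r s(d, c) f ∧ ¬ Crosses r s(c, a) f) ∧
        (∀ f ∈ (Gpl h).edgeSet, Crosses r s(a, d) f → f = s(b, c)) ∧
        (∀ f ∈ (Gpl h).edgeSet, Crosses r s(b, c) f → f = s(a, d)) ∧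
        (∀ v : V, r v ∈ convexHull ℝ ({r a, r b, r c, r d} : Set (ℝ × ℝ)) →
          v = a ∨ v = b ∨ v = c ∨ v = d) := by
  have k := h.cr_of h1 h2 hc
  have ks := h.cr_symm k
  obtain ⟨e1, e2, e3, e4, e5, e6⟩ := h.cr_adj k
  have a1 : (Gpl h).Adj a b := Or.inl e1
  have a2 : (Gpl h).Adj b d := Or.inl e2
  have a3 : (Gpl h).Adj d c := Or.inl e3
  have a4 : (Gpl h).Adj c a := Or.inl e4
  refine ⟨⟨a1, a2, a3, a4, e5, e6⟩, ?_, ?_, ?_, ?_⟩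
  · intro f hf
    induction f using Sym2.ind with | _ u v =>
    have t1 := fun m => h.cr_side k (h.cr_of a1 hf m)
    have t2 := fun m => h.cr_side (h.cr_swap k) (h.cr_swap (h.cr_of a2 hf m))
    have t3 := fun m => h.cr_side (h.cr_symm (h.cr_swap ks)) (u := u) (v := v)  m
    refine ⟨t1, t2, ?_, ?_⟩
    · intro m
      exact h.cr_side (h.cr_symm (h.cr_swap (h.cr_symm (h.cr_swap k)))) (h.cr_of a3 hf m)
    · intro m
      exact h.cr_side (h.cr_swap ks) (h.cr_of a4 hf m)
  · intro f hf m
    induction f using Sym2.ind with | _ u v =>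
    rw [eq_comm, Sym2.eq_iff]
    exact h.cr_uniq k (h.cr_of e5 hf m)
  · intro f hf m
    induction f using Sym2.ind with | _ u v =>
    rw [eq_comm, Sym2.eq_iff]
    exact h.cr_uniq ks (h.cr_of e6 hf m)
  · intro v hv
    exact h.cr_emp k hv

def Cst (Q : V → V → V → V → Prop) : Set (Sym2 V) := {e | ∃ a b c d, e = s(b, d) ∧ Q a b c d}

theorem FIN.mem_cst (h : FIN G r E Q) {b d : V} : s(b, d) ∈ Cst Q ↔ ∃ a c, Q a b c d := by
  constructor
  · rintro ⟨a, b', c, d', e, q⟩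
    rcases Sym2.eq_iff.1 e with ⟨rfl, rfl⟩ | ⟨rfl, rfl⟩
    · exact ⟨_, _, q⟩
    · exact ⟨_, _, h.qs _ _ _ _ q⟩
  · rintro ⟨a, c, q⟩; exact ⟨_, _, _, _, rfl, q⟩

/-- the triangulation -/
def Gtr (h : FIN G r E Q) : SimpleGraph V where
  Adj := E
  symm := ⟨h.es⟩
  loopless := ⟨h.ei⟩

theorem FIN.tr_card (h : FIN G r E Q) : (Gtr h).edgeSet.ncard = 3 * Fintype.card V - 6 := by
  have h1 := (Gtr h).dart_card_eq_twice_card_edges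
  have h2 : Fintype.card (Gtr h).Dart = (Finset.univ.filter (fun p : V × V => E p.1 p.2)).card := by
    rw [← Finset.card_univ]
    apply Finset.card_bij (fun d _ => d.toProd)
    · intro d _; simp only [Finset.mem_filter, Finset.mem_univ, true_and]; exact d.adj
    · intro d _ d' _ e; exact SimpleGraph.Dart.ext _ _ e
    · intro p hp
      simp only [Finset.mem_filter, Finset.mem_univ, true_and] at hp
      exact ⟨⟨p, hp⟩, Finset.mem_univ _, rfl⟩
  have h3 := h.count
  have h4 : (Gtr h).edgeSet.ncard = (Gtr h).edgeFinset.card := by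
    rw [← Set.ncard_coe_finset, SimpleGraph.coe_edgeFinset]
  omega

theorem FIN.diff (h : FIN G r E Q) : (Gpl h).edgeSet \ Cst Q = (Gtr h).edgeSet := by
  ext e
  induction e using Sym2.ind with | _ a b =>
  rw [Set.mem_diff, h.mem_cst, SimpleGraph.mem_edgeSet, SimpleGraph.mem_edgeSet]
  constructor
  · rintro ⟨e | q, n⟩
    · exact e
    · exact absurd q n
  · intro e
    exact ⟨Or.inl e, fun ⟨_, _, q⟩ => (h.qe _ _ _ _ q).2.2.2.2.2.1 e⟩

theorem FIN.c3 (h : FIN G r E Q) : ∃ Cstar : Set (Sym2 V), Cstar ⊆ (Gpl h).edgeSet ∧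
        (∀ e ∈ Cstar, ∃ f ∈ (Gpl h).edgeSet, Crosses r e f) ∧
        (∀ e ∈ (Gpl h).edgeSet, ∀ f ∈ (Gpl h).edgeSet, Crosses r e f → (e ∈ Cstar ↔ f ∉ Cstar)) ∧
        (∀ e ∈ (Gpl h).edgeSet \ Cstar, ∀ f ∈ (Gpl h).edgeSet \ Cstar, ¬ Crosses r e f) ∧
        ((Gpl h).edgeSet \ Cstar).ncard = 3 * Fintype.card V - 6 := by
  refine ⟨Cst Q, ?_, ?_, ?_, ?_, ?_⟩
  · rintro e ⟨a, b, c, d, rfl, q⟩; exact Or.inr ⟨_, _, q⟩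
  · rintro e ⟨a, b, c, d, rfl, q⟩
    refine ⟨s(a, c), Or.inl (h.qe _ _ _ _ q).2.2.2.2.1, ?_⟩
    have n := h.ne q
    obtain ⟨p, o1, o2⟩ := h.dx _ _ _ _ q
    exact crosses_iff.2 ⟨by grind, p, o2, o1⟩
  · intro e he f hf m
    induction e using Sym2.ind with | _ x y =>
    induction f using Sym2.ind with | _ z w =>
    have k : Cr Q x y z w := h.cr_of he hf m
    rw [h.mem_cst, h.mem_cst]
    have aux : ∀ a b c d, Q a b c d → (∃ x y, Q x b y d) ∧ ¬ (∃ x y, Q x a y c) := by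
      intro a b c d q
      refine ⟨⟨_, _, q⟩, ?_⟩
      rintro ⟨x, y, q'⟩
      exact (h.qe _ _ _ _ q').2.2.2.2.2.1 (h.qe _ _ _ _ q).2.2.2.2.1
    rcases k with k | k | k | k
    · have t := aux _ _ _ _ k
      exact ⟨fun _ => t.2, fun _ => t.1⟩
    · have t := aux _ _ _ _ (h.qs _ _ _ _ k)
      have t' := aux _ _ _ _ k
      exact ⟨fun _ => t.2, fun _ => t'.1⟩
    · have t := aux _ _ _ _ k
      exact ⟨fun t' => absurd t' t.2, fun t' => absurd t.1 t'⟩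
    · have t := aux _ _ _ _ k
      have t2 := aux _ _ _ _ (h.qs _ _ _ _ k)
      exact ⟨fun t' => absurd t' t2.2, fun t' => absurd t.1 t'⟩
  · rw [h.diff]
    intro e he f hf m
    induction e using Sym2.ind with | _ x y =>
    induction f using Sym2.ind with | _ z w =>
    obtain ⟨⟨n1, n2, n3, n4⟩, p, o1, o2⟩ := crosses_iff.1 m
    have := h.ee _ _ _ _ _ he hf o1 o2
    tauto
  · rw [h.diff]; exact h.tr_card

theorem FIN.c4 (h : FIN G r E Q) : ∃ x y z : V, (Gpl h).Adj x y ∧ (Gpl h).Adj y z ∧ (Gpl h).Adj z x ∧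
        (∀ f ∈ (Gpl h).edgeSet, ¬ Crosses r s(x, y) f ∧ ¬ Crosses r s(y, z) f ∧
          ¬ Crosses r s(z, x) f) ∧
        (∀ v : V, r v ∈ convexHull ℝ ({r x, r y, r z} : Set (ℝ × ℝ))) := by
  obtain ⟨x, y, z, ⟨e1, e2, e3⟩, n, hv⟩ := h.out
  refine ⟨x, y, z, Or.inl e1, Or.inl e2, Or.inl e3, ?_, hv⟩
  intro f hf
  induction f using Sym2.ind with | _ a b =>
  have aux : ∀ x y, E x y → (∀ u v, ¬ Q x u y v) → ¬ Crosses r s(x, y) s(a, b) := by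
    intro x y e n m
    rcases h.cr_of (Or.inl e) hf m with k | k | k | k
    · exact (h.qe _ _ _ _ k).2.2.2.2.2.1 e
    · exact (h.qe _ _ _ _ k).2.2.2.2.2.1 e
    · exact n _ _ k
    · exact n _ _ (h.qs _ _ _ _ k)
  exact ⟨aux _ _ e1 (fun u v => (n u v).1), aux _ _ e2 (fun u v => (n u v).2.1), aux _ _ e3 (fun u v => (n u v).2.2)⟩

end ICP

end

/-- straight-line form of Lemma 1. Every graph with `n ≥ 3` vertices
admitting an IC-planar straight-line drawing can be augmented to a plane-maximal
IC-plane graph `G⁺` with an IC-planar straight-line drawing `ρ` in which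
(c1) the endpoints of every pair of crossing edges induce a kite,
(c2) each kite is empty,
(c3) removing one edge of each crossing pair leaves a crossing-free triangulated
planar graph with `3n - 6` edges, and
(c4) there is an uncrossed 3-cycle whose triangle contains the whole drawing. -/
theorem icplanar_plane_maximal_augmentation {V : Type*} [Fintype V] (G : SimpleGraph V)
    (hn : 3 ≤ Fintype.card V)
    (h : ∃ ρ : V → ℝ × ℝ, IsICPlanarDrawing G ρ) :
    ∃ (Gp : SimpleGraph V) (ρ : V → ℝ × ℝ), G ≤ Gp ∧ IsICPlanarDrawing Gp ρ ∧
      -- (c1) and (c2)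
      (∀ a d b c : V, s(a, d) ∈ Gp.edgeSet → s(b, c) ∈ Gp.edgeSet →
        Crosses ρ s(a, d) s(b, c) →
        (Gp.Adj a b ∧ Gp.Adj b d ∧ Gp.Adj d c ∧ Gp.Adj c a ∧ Gp.Adj a d ∧ Gp.Adj b c) ∧
        (∀ f ∈ Gp.edgeSet, ¬ Crosses ρ s(a, b) f ∧ ¬ Crosses ρ s(b, d) f ∧
          ¬ Crosses ρ s(d, c) f ∧ ¬ Crosses ρ s(c, a) f) ∧
        (∀ f ∈ Gp.edgeSet, Crosses ρ s(a, d) f → f = s(b, c)) ∧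
        (∀ f ∈ Gp.edgeSet, Crosses ρ s(b, c) f → f = s(a, d)) ∧
        (∀ v : V, ρ v ∈ convexHull ℝ ({ρ a, ρ b, ρ c, ρ d} : Set (ℝ × ℝ)) →
          v = a ∨ v = b ∨ v = c ∨ v = d)) ∧
      -- (c3)
      (∃ Cstar : Set (Sym2 V), Cstar ⊆ Gp.edgeSet ∧
        (∀ e ∈ Cstar, ∃ f ∈ Gp.edgeSet, Crosses ρ e f) ∧
        (∀ e ∈ Gp.edgeSet, ∀ f ∈ Gp.edgeSet, Crosses ρ e f → (e ∈ Cstar ↔ f ∉ Cstar)) ∧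
        (∀ e ∈ Gp.edgeSet \ Cstar, ∀ f ∈ Gp.edgeSet \ Cstar, ¬ Crosses ρ e f) ∧
        (Gp.edgeSet \ Cstar).ncard = 3 * Fintype.card V - 6) ∧
      -- (c4)
      (∃ x y z : V, Gp.Adj x y ∧ Gp.Adj y z ∧ Gp.Adj z x ∧
        (∀ f ∈ Gp.edgeSet, ¬ Crosses ρ s(x, y) f ∧ ¬ Crosses ρ s(y, z) f ∧
          ¬ Crosses ρ s(z, x) f) ∧
        (∀ v : V, ρ v ∈ convexHull ℝ ({ρ x, ρ y, ρ z} : Set (ℝ × ℝ)))) := by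
  obtain ⟨ρ, h⟩ := h
  obtain ⟨r, E, Q, f⟩ := (ICP.drw_of h).fin hn
  exact ⟨ICP.Gpl f, r, fun a b hab => f.gle a b hab, f.ic, f.c12, f.c3, f.c4⟩
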